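/- Let N and m be positive integers satisfying Condition (**). Then lim_{X→∞} (1/#N⁻(X,m,N)) Σ_{Δ ∈ N⁻(X,m,N)} h₃(Δ) = 2. -/

import Mathlib

open Filter IntermediateField

/-- A square root of the integer `m` in `ℂ`. -/
noncomputable def sqrtC (m : ℤ) : ℂ := (m : ℂ) ^ (2⁻¹ : ℂ)

/-- The quadratic field `ℚ(√m)`, realized as a subfield of `ℂ`. -/
noncomputable def quadField (m : ℤ) : IntermediateField ℚ ℂ := ℚ⟮sqrtC m⟯

/-- `h₃(Δ)`: the number of elements of order dividing `3` in the ideal class group of the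
quadratic field `ℚ(√Δ)` (for a fundamental discriminant `Δ`, this is the quadratic field
of discriminant `Δ`). -/
noncomputable def h3 (Δ : ℤ) : ℕ :=
  Nat.card {x : ClassGroup (NumberField.RingOfIntegers (quadField Δ)) // x ^ 3 = 1}

/-- An integer is a fundamental discriminant if it is the discriminant of a quadratic
number field: `Δ ≠ 1` and either `Δ` is square-free with `Δ ≡ 1 (mod 4)`, or `Δ = 4·m'`
with `m'` square-free and `m' ≡ 2` or `3 (mod 4)`. -/
def IsFundamentalDiscriminant (Δ : ℤ) : Prop :=
  Δ ≠ 1 ∧ ((Squarefree Δ ∧ Δ % 4 = 1) ∨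
    ∃ m' : ℤ, Δ = 4 * m' ∧ Squarefree m' ∧ (m' % 4 = 2 ∨ m' % 4 = 3))

/-- `Nminus X m N` is the set of fundamental discriminants `Δ` with `-X < Δ < 0` and
`Δ ≡ m (mod N)`. -/
def Nminus (X : ℝ) (m N : ℕ) : Set ℤ :=
  {Δ : ℤ | -X < (Δ : ℝ) ∧ Δ < 0 ∧ IsFundamentalDiscriminant Δ ∧ Δ ≡ (m : ℤ) [ZMOD (N : ℤ)]}

/-- Condition (**) on the positive integers `m` and `N`: every odd prime dividing both
`m` and `N` has `p² ∣ N` and `p² ∤ m`; and if `N` is even then either `4 ∣ N` and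
`m ≡ 1 (mod 4)`, or `16 ∣ N` and `m ≡ 8` or `12 (mod 16)`. -/
def CondStarStar (m N : ℕ) : Prop :=
  (∀ p : ℕ, p.Prime → Odd p → p ∣ m → p ∣ N → p ^ 2 ∣ N ∧ ¬ p ^ 2 ∣ m) ∧
    (2 ∣ N → (4 ∣ N ∧ m % 4 = 1) ∨ (16 ∣ N ∧ (m % 16 = 8 ∨ m % 16 = 12)))

namespace NH

/-! ### Quadratic field basics -/

lemma sqrtC_sq (Δ : ℤ) : sqrtC Δ ^ 2 = (Δ : ℂ) := by
  unfold sqrtC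
  have := Complex.cpow_nat_inv_pow (Δ : ℂ) (n := 2) (by norm_num)
  simpa using this

lemma sqrtC_re {Δ : ℤ} (h : Δ < 0) : (sqrtC Δ).re = 0 := by
  have h2 := sqrtC_sq Δ
  have hr := congrArg Complex.re h2
  have hi := congrArg Complex.im h2
  simp [sq] at hr hi
  by_contra hne
  have him : (sqrtC Δ).im = 0 := by
    rcases (by nlinarith : (sqrtC Δ).re * (sqrtC Δ).im = 0) |> mul_eq_zero.1 with h | h
    · exact absurd h hne
    · exact h
  rw [him] at hr
  have : (Δ : ℝ) < 0 := by exact_mod_cast h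
  nlinarith [mul_self_nonneg (sqrtC Δ).re]

lemma sqrtC_im_ne {Δ : ℤ} (h : Δ < 0) : (sqrtC Δ).im ≠ 0 := by
  intro h0
  have hr := congrArg Complex.re (sqrtC_sq Δ)
  simp [sq, h0, sqrtC_re h] at hr
  exact absurd hr.symm (by exact_mod_cast h.ne)

lemma conj_sqrtC {Δ : ℤ} (h : Δ < 0) : (starRingEnd ℂ) (sqrtC Δ) = - sqrtC Δ := by
  apply Complex.ext <;> simp [sqrtC_re h]

/-- The generator `ω = (Δ + √Δ)/2`. -/
noncomputable def om (Δ : ℤ) : ℂ := ((Δ : ℂ) + sqrtC Δ) / 2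

lemma quad_repr {Δ : ℤ} (x : ℂ) (hx : x ∈ quadField Δ) :
    ∃ r q : ℚ, x = (r : ℂ) + (q : ℂ) * sqrtC Δ := by
  have hIntg : IsIntegral ℚ (sqrtC Δ) := by
    refine ⟨Polynomial.X ^ 2 - Polynomial.C (Δ : ℚ), Polynomial.monic_X_pow_sub_C _ (by norm_num), ?_⟩
    simp only [Polynomial.eval₂_sub, Polynomial.eval₂_pow, Polynomial.eval₂_X, Polynomial.eval₂_C, sqrtC_sq]
    simp
  have h1 : x ∈ (quadField Δ).toSubalgebra := hx
  unfold quadField at h1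
  rw [IntermediateField.adjoin_simple_toSubalgebra_of_isAlgebraic hIntg.isAlgebraic] at h1
  clear hx
  induction h1 using Algebra.adjoin_induction with
  | mem x hx =>
    rw [Set.mem_singleton_iff.1 hx]
    exact ⟨0, 1, by simp⟩
  | algebraMap r => exact ⟨r, 0, by simp⟩
  | add x y hx hy h1 h2 =>
    obtain ⟨r, q, h1⟩ := h1
    obtain ⟨r', q', h2⟩ := h2
    exact ⟨r + r', q + q', by rw [h1, h2]; push_cast; ring⟩
  | mul x y hx hy h1 h2 =>
    obtain ⟨r, q, h1⟩ := h1
    obtain ⟨r', q', h2⟩ := h2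
    refine ⟨r * r' + q * q' * Δ, r * q' + q * r', ?_⟩
    rw [h1, h2]; push_cast
    linear_combination (q * q' : ℂ) * sqrtC_sq Δ

lemma rat_int_of_sq_mul {v : ℚ} {m k : ℤ} (hm : Squarefree m) (h : v ^ 2 * m = k) :
    ∃ n : ℤ, v = n := by
  have hd : (v.den : ℤ) ^ 2 ∣ m := by
    have hv : (v.num : ℚ) / v.den = v := Rat.num_div_den v
    have hden : (v.den : ℚ) ≠ 0 := by exact_mod_cast v.den_ne_zero
    have h1 : (v.num ^ 2 * m : ℤ) = k * (v.den : ℤ) ^ 2 := by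
      have : (v.num : ℚ) ^ 2 * m = k * (v.den : ℚ) ^ 2 := by
        rw [← h]
        have h3 : (v.num : ℚ) = v * v.den := by field_simp [← hv]; exact (div_mul_cancel₀ _ hden).symm.trans (by rw [hv])
        rw [h3]; ring
      exact_mod_cast this
    have hc : IsCoprime ((v.den : ℤ) ^ 2) (v.num ^ 2) := by
      apply IsCoprime.pow
      have := v.reduced
      rw [Int.isCoprime_iff_gcd_eq_one, Int.gcd_comm]
      simpa [Int.gcd, Nat.Coprime] using this
    exact hc.dvd_of_dvd_mul_left ⟨k, by rw [h1]; ring⟩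
  have hu : IsUnit (v.den : ℤ) := hm _ (by rw [← sq]; exact hd)
  have : v.den = 1 := by
    have := Int.isUnit_iff.1 hu
    omega
  exact ⟨v.num, by rw [← Rat.num_div_den v, this]; simp⟩

lemma fund_repr {Δ : ℤ} (hf : IsFundamentalDiscriminant Δ) {u n : ℤ} {v : ℚ}
    (h : (u : ℚ) ^ 2 - 4 * n = v ^ 2 * Δ) : ∃ w : ℤ, v = w ∧ (2 : ℤ) ∣ u - w * Δ := by
  obtain ⟨-, ⟨hs, h4⟩ | ⟨m', hm, hs, h4⟩⟩ := hf
  · obtain ⟨w, rfl⟩ := rat_int_of_sq_mul (k := u ^ 2 - 4 * n) hs (by rw [← h]; push_cast; ring)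
    refine ⟨w, rfl, ?_⟩
    have h' : u ^ 2 - 4 * n = w ^ 2 * Δ := by exact_mod_cast h
    have hmod : (u ^ 2 - w^2 * Δ) % 2 = 0 := by rw [← h']; ring_nf; omega
    have hΔ : Δ % 2 = 1 := by omega
    rcases Int.emod_two_eq_zero_or_one u with hu | hu <;>
    rcases Int.emod_two_eq_zero_or_one w with hw | hw <;>
    simp [Int.dvd_iff_emod_eq_zero, sq, Int.sub_emod, Int.mul_emod, hu, hw, hΔ] at hmod ⊢
  · obtain ⟨w, hw⟩ := rat_int_of_sq_mul (v := 2 * v) (k := u ^ 2 - 4 * n) hs (by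
      push_cast; rw [h, hm]; push_cast; ring)
    have h' : u ^ 2 - 4 * n = w ^ 2 * m' := by
      have : (u : ℚ) ^ 2 - 4 * n = (w : ℚ) ^ 2 * m' := by rw [← hw, h, hm]; push_cast; ring
      exact_mod_cast this
    have hmod : (u ^ 2 - w^2 * m') % 4 = 0 := by rw [← h']; ring_nf; omega
    have key : u % 2 = 0 ∧ w % 2 = 0 := by
      have h1 : u % 4 = 0 ∨ u % 4 = 1 ∨ u % 4 = 2 ∨ u % 4 = 3 := by omega
      have h2 : w % 4 = 0 ∨ w % 4 = 1 ∨ w % 4 = 2 ∨ w % 4 = 3 := by omega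
      rcases h1 with h1 | h1 | h1 | h1 <;> rcases h2 with h2 | h2 | h2 | h2 <;>
      rcases h4 with h4 | h4 <;>
      simp [sq, Int.sub_emod, Int.mul_emod, h1, h2, h4] at hmod <;> omega
    obtain ⟨w', hw'⟩ : ∃ w', w = 2 * w' := ⟨w / 2, by omega⟩
    refine ⟨w', ?_, ?_⟩
    · have : (2 : ℚ) * v = 2 * w' := by rw [hw, hw']; push_cast; ring
      linarith
    · rw [hm]; obtain ⟨u', hu'⟩ : ∃ w', u = 2 * w' := ⟨u / 2, by omega⟩
      exact ⟨u' - 2 * w' * m', by rw [hu']; ring⟩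

/-- The embedding of the ring of integers in `ℂ`. -/
noncomputable def io (Δ : ℤ) : NumberField.RingOfIntegers (quadField Δ) →+* ℂ :=
  (algebraMap (quadField Δ) ℂ).comp (algebraMap _ (quadField Δ))

lemma io_inj (Δ : ℤ) : Function.Injective (io Δ) := by
  intro x y h
  have : algebraMap _ (quadField Δ) x = algebraMap _ (quadField Δ) y :=
    (algebraMap (quadField Δ) ℂ).injective h
  exact NumberField.RingOfIntegers.ext this

lemma rat_isIntegral {r : ℚ} (h : IsIntegral ℤ ((r : ℚ) : ℂ)) : ∃ n : ℤ, r = n := by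
  have h1 : IsIntegral ℤ r := by
    have : IsIntegral ℤ (algebraMap ℚ ℂ r) := by simpa using h
    exact (isIntegral_algebraMap_iff (algebraMap ℚ ℂ).injective).1 this
  obtain ⟨n, hn⟩ := IsIntegrallyClosed.isIntegral_iff.1 h1
  exact ⟨n, by simpa using hn.symm⟩

lemma io_repr {Δ : ℤ} (hΔ : Δ < 0) (hf : IsFundamentalDiscriminant Δ)
    (x : NumberField.RingOfIntegers (quadField Δ)) :
    ∃ p q : ℤ, io Δ x = p + q * om Δ := by
  have hIntg : IsIntegral ℤ (io Δ x) := by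
    have := (NumberField.RingOfIntegers.isIntegral_coe x)
    exact IsIntegral.map (((algebraMap (quadField Δ) ℂ)).toIntAlgHom) this
  obtain ⟨r, q, hrq⟩ := quad_repr (Δ := Δ) (io Δ x) (by
    show ((x : quadField Δ) : ℂ) ∈ quadField Δ
    exact SetLike.coe_mem _)
  have hc : (starRingEnd ℂ) (io Δ x) = r - q * sqrtC Δ := by
    rw [hrq]; simp [conj_sqrtC hΔ]; ring
  have hcIntg : IsIntegral ℤ ((starRingEnd ℂ) (io Δ x)) :=
    IsIntegral.map ((starRingEnd ℂ).toIntAlgHom) hIntg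
  obtain ⟨u, hu⟩ := rat_isIntegral (r := 2 * r) (by
    have := hIntg.add hcIntg
    rw [hc, hrq] at this
    have e : ((2 * r : ℚ) : ℂ) = (r + q * sqrtC Δ) + (r - q * sqrtC Δ) := by push_cast; ring
    rw [e]; exact this)
  obtain ⟨n, hn⟩ := rat_isIntegral (r := r ^ 2 - q ^ 2 * Δ) (by
    have := hIntg.mul hcIntg
    rw [hc, hrq] at this
    have e : ((r ^ 2 - q ^ 2 * Δ : ℚ) : ℂ) = (r + q * sqrtC Δ) * (r - q * sqrtC Δ) := by
      push_cast; linear_combination (q ^ 2 : ℂ) * sqrtC_sq Δ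
    rw [e]; exact this)
  obtain ⟨w, hw, k, hk⟩ := fund_repr hf (u := u) (n := n) (v := 2 * q) (by rw [← hu, ← hn]; ring)
  refine ⟨k, w, ?_⟩
  have hr : r = (u : ℚ) / 2 := by linarith
  have hq : q = (w : ℚ) / 2 := by linarith
  have hu' : u = w * Δ + 2 * k := by linarith
  rw [hrq, hr, hq, hu', om]; push_cast; ring

lemma fund_mod {Δ : ℤ} (hf : IsFundamentalDiscriminant Δ) : ∃ e : ℤ, Δ ^ 2 - Δ = 4 * e := by
  obtain ⟨-, ⟨hs, h4⟩ | ⟨m', hm, hs, h4⟩⟩ := hf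
  · obtain ⟨k, hk⟩ : ∃ k, Δ = 4 * k + 1 := ⟨Δ / 4, by omega⟩
    exact ⟨(4 * k + 1) * k, by rw [hk]; ring⟩
  · exact ⟨4 * m' ^ 2 - m', by rw [hm]; ring⟩

lemma sqrtC_mem (Δ : ℤ) : sqrtC Δ ∈ quadField Δ := IntermediateField.mem_adjoin_simple_self ℚ _

lemma om_sq {Δ e : ℤ} (he : Δ ^ 2 - Δ = 4 * e) : om Δ ^ 2 = Δ * om Δ - e := by
  have : ((Δ : ℂ)) ^ 2 - Δ = 4 * e := by exact_mod_cast he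
  rw [om]; linear_combination (1 / 4 : ℂ) * sqrtC_sq Δ - (1/4 : ℂ) * this

lemma exists_io {Δ : ℤ} (hf : IsFundamentalDiscriminant Δ) (p q : ℤ) :
    ∃ x, io Δ x = p + q * om Δ := by
  obtain ⟨e, he⟩ := fund_mod hf
  have hmem : om Δ ∈ quadField Δ := by
    unfold om
    exact div_mem (add_mem (intCast_mem _ _) (sqrtC_mem Δ)) (ofNat_mem _ 2)
  have hIntg : IsIntegral ℤ (⟨om Δ, hmem⟩ : quadField Δ) := by
    refine ⟨Polynomial.X ^ 2 + Polynomial.C (-Δ) * Polynomial.X + Polynomial.C e, ?_, ?_⟩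
    · monicity!
    · simp only [Polynomial.eval₂_add, Polynomial.eval₂_mul, Polynomial.eval₂_pow, Polynomial.eval₂_X, Polynomial.eval₂_C]
      apply Subtype.ext
      have := om_sq he
      simp
      linear_combination this
  refine ⟨p + q * ⟨⟨om Δ, hmem⟩, hIntg⟩, ?_⟩
  simp only [map_add, map_mul, map_intCast]
  rfl

lemma om_im {Δ : ℤ} : (om Δ).im = (sqrtC Δ).im / 2 := by
  simp [om]

lemma int_om_inj {Δ : ℤ} (hΔ : Δ < 0) {p q p' q' : ℤ}
    (h : (p : ℂ) + q * om Δ = p' + q' * om Δ) : p = p' ∧ q = q' := by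
  have hi := congrArg Complex.im h
  simp [om_im] at hi
  have hq : q = q' := by
    rcases hi with h | h
    · exact h
    · exact absurd h (sqrtC_im_ne hΔ)
  subst hq
  refine ⟨?_, rfl⟩
  have : (p : ℂ) = p' := by linear_combination h
  exact_mod_cast this

end NH

namespace NH

/-! ### Binary cubic forms `a x³ + 3 b x² y + 3 c x y² + d y³` and their Hessians -/

section forms
variable {R : Type*} [CommRing R]

/-- Leading coefficient of the Hessian. -/
def qA (F : R × R × R × R) : R := F.2.1 ^ 2 - F.1 * F.2.2.1
/-- Middle coefficient of the Hessian. -/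
def qB (F : R × R × R × R) : R := F.2.1 * F.2.2.1 - F.1 * F.2.2.2
/-- Last coefficient of the Hessian. -/
def qC (F : R × R × R × R) : R := F.2.2.1 ^ 2 - F.2.1 * F.2.2.2
/-- Minus the discriminant of the Hessian. -/
def qD (F : R × R × R × R) : R := 4 * qA F * qC F - qB F ^ 2
end forms

/-- strictly reduced -/
def SRed (F : ℤ × ℤ × ℤ × ℤ) : Prop := |qB F| < qA F ∧ qA F < qC F
/-- reduced -/
def Red (F : ℤ × ℤ × ℤ × ℤ) : Prop := |qB F| ≤ qA F ∧ qA F ≤ qC F ∧ 0 < qD F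

lemma fund_prim {Δ g E : ℤ} (hf : IsFundamentalDiscriminant Δ) (hE : E % 4 = 0 ∨ E % 4 = 1)
    (h : Δ = g ^ 2 * E) : g = 1 ∨ g = -1 := by
  obtain ⟨-, ⟨hs, h4⟩ | ⟨m', hm, hs, h4⟩⟩ := hf
  · exact Int.isUnit_iff.1 (hs g ⟨E, by rw [h]; ring⟩)
  · rcases Int.emod_two_eq_zero_or_one g with hg | hg
    · exfalso
      obtain ⟨k, rfl⟩ : ∃ k, g = 2 * k := ⟨g / 2, by omega⟩
      have h1 : m' = k ^ 2 * E := by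
        have : 4 * m' = 4 * (k ^ 2 * E) := by rw [← hm, h]; ring
        linarith
      have hk := Int.isUnit_iff.1 (hs k ⟨E, by rw [h1]; ring⟩)
      have : k ^ 2 = 1 := by rcases hk with rfl | rfl <;> norm_num
      rw [this] at h1
      omega
    · have hc : IsCoprime (g ^ 2) (4 : ℤ) := by
        obtain ⟨k, rfl⟩ : ∃ k, g = 2 * k + 1 := ⟨g / 2, by omega⟩
        exact ⟨1, -(k ^ 2 + k), by ring⟩
      have : g ^ 2 ∣ m' := hc.dvd_of_dvd_mul_left ⟨E, by rw [← hm, h]⟩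
      exact Int.isUnit_iff.1 (hs g (by rw [← sq]; exact this))

lemma fund_bezout {Δ A B C : ℤ} (hf : IsFundamentalDiscriminant Δ) (h : B ^ 2 - 4 * A * C = Δ) :
    ∃ x y z : ℤ, x * A + y * B + z * C = 1 := by
  have hg : ((Int.gcd A (Int.gcd B C) : ℕ) : ℤ) = 1 := by
    obtain ⟨A', hA⟩ := Int.gcd_dvd_left A (Int.gcd B C : ℤ)
    have h2 := Int.gcd_dvd_right A (Int.gcd B C : ℤ)
    obtain ⟨B', hB⟩ := h2.trans (Int.gcd_dvd_left B C)
    obtain ⟨C', hC⟩ := h2.trans (Int.gcd_dvd_right B C)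
    set g : ℤ := ((Int.gcd A (Int.gcd B C) : ℕ) : ℤ)
    have := fund_prim (Δ := Δ) (g := g) (E := B' ^ 2 - 4 * A' * C') hf (by
      rcases Int.emod_two_eq_zero_or_one B' with hb | hb
      · obtain ⟨k, rfl⟩ : ∃ k, B' = 2 * k := ⟨B' / 2, by omega⟩
        left; ring_nf; omega
      · obtain ⟨k, rfl⟩ : ∃ k, B' = 2 * k + 1 := ⟨B' / 2, by omega⟩
        right; ring_nf; omega) (by
        rw [← h]
        calc B ^ 2 - 4 * A * C = (g * B') ^ 2 - 4 * (g * A') * (g * C') := by rw [← hA, ← hB, ← hC]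
          _ = _ := by ring)
    rcases this with h | h
    · exact h
    · have : (0:ℤ) ≤ g := by positivity
      omega
  have h1 := Int.gcd_eq_gcd_ab A (Int.gcd B C)
  have h2 := Int.gcd_eq_gcd_ab B C
  rw [hg] at h1
  generalize Int.gcdA A _ = u at h1
  generalize Int.gcdB A _ = v at h1
  rw [h2] at h1
  exact ⟨u, B.gcdA C * v, B.gcdB C * v, by linear_combination -h1⟩

/-- `θ = (B+√Δ)/2` -/
noncomputable def th (Δ B : ℤ) : ℂ := ((B : ℂ) + sqrtC Δ) / 2

section quad
variable {Δ A B C : ℤ}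

lemma disc_parity (h : B ^ 2 - 4 * A * C = Δ) : ∃ k : ℤ, Δ = B + 2 * k := by
  rcases Int.emod_two_eq_zero_or_one B with hb | hb
  · obtain ⟨k, rfl⟩ : ∃ k, B = 2 * k := ⟨B / 2, by omega⟩
    exact ⟨2 * k ^ 2 - 2 * A * C - k, by rw [← h]; ring⟩
  · obtain ⟨k, rfl⟩ : ∃ k, B = 2 * k + 1 := ⟨B / 2, by omega⟩
    exact ⟨2 * k ^ 2 + k - 2 * A * C, by rw [← h]; ring⟩

lemma om_eq_th {k : ℤ} (hk : Δ = B + 2 * k) : om Δ = th Δ B + k := by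
  have : (Δ : ℂ) = B + 2 * k := by exact_mod_cast hk
  rw [om, th, this]; ring

lemma exists_io_half (hf : IsFundamentalDiscriminant Δ) {U a : ℤ} (h : (2 : ℤ) ∣ U - a * Δ) :
    ∃ x, io Δ x = ((U : ℂ) + a * sqrtC Δ) / 2 := by
  obtain ⟨k, hk⟩ := h
  obtain ⟨x, hx⟩ := exists_io hf k a
  refine ⟨x, ?_⟩
  have : (U : ℂ) = 2 * k + a * Δ := by
    have : U = 2 * k + a * Δ := by linarith
    exact_mod_cast this
  rw [hx, this, om]; ring

lemma half_inj (hΔ : Δ < 0) {p q p' q' : ℝ}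
    (h : (p : ℂ) + q * sqrtC Δ = p' + q' * sqrtC Δ) : p = p' ∧ q = q' := by
  have hi := congrArg Complex.im h
  have hr := congrArg Complex.re h
  simp [sqrtC_re hΔ, sqrtC_im_ne hΔ] at hi hr
  exact ⟨hr, hi⟩

lemma normSq_half (hΔ : Δ < 0) (p q : ℝ) :
    Complex.normSq ((p : ℂ) + q * sqrtC Δ) = p ^ 2 - q ^ 2 * Δ := by
  have h2 := congrArg Complex.re (sqrtC_sq Δ)
  simp [sq, sqrtC_re hΔ] at h2
  simp [Complex.normSq_apply, sqrtC_re hΔ]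
  linear_combination (-q ^ 2) * h2

lemma normSq_lat (hΔ : Δ < 0) (h : B ^ 2 - 4 * A * C = Δ) (x y : ℤ) :
    Complex.normSq ((x : ℂ) * A + y * th Δ B) =
      ((A * (A * x ^ 2 + B * x * y + C * y ^ 2) : ℤ) : ℝ) := by
  have e : (x : ℂ) * A + y * th Δ B =
      ((x * A + y * B / 2 : ℝ) : ℂ) + ((y / 2 : ℝ) : ℂ) * sqrtC Δ := by
    push_cast; rw [th]; ring
  have h' : (Δ : ℝ) = B ^ 2 - 4 * A * C := by rw [← h]; push_cast; ring
  rw [e, normSq_half hΔ, h']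
  push_cast; ring

lemma red_min (hB : |B| ≤ A) (hAC : A ≤ C) (hA : 0 < A) {x y : ℤ} (h : ¬ (x = 0 ∧ y = 0)) :
    A ≤ A * x ^ 2 + B * x * y + C * y ^ 2 := by
  obtain ⟨h1, h2⟩ := abs_le.1 hB
  have hxy : 1 ≤ x ^ 2 - |x * y| + y ^ 2 := by
    have e1 : x ^ 2 = |x| ^ 2 := (sq_abs x).symm
    have e2 : y ^ 2 = |y| ^ 2 := (sq_abs y).symm
    have : 0 < |x| ∨ 0 < |y| := by
      by_contra hh
      push Not at hh
      exact h ⟨abs_nonpos_iff.1 hh.1, abs_nonpos_iff.1 hh.2⟩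
    have h0 := abs_nonneg x
    have h0' := abs_nonneg y
    rw [abs_mul, e1, e2]
    rcases this with h | h
    · nlinarith [sq_nonneg (|x| - 2 * |y|), sq_nonneg (|x|-|y|)]
    · nlinarith [sq_nonneg (|y| - 2 * |x|), sq_nonneg (|x|-|y|)]
  have h3 : -(A * |x * y|) ≤ B * x * y := by
    have : |B * (x * y)| ≤ A * |x * y| := by rw [abs_mul]; gcongr
    have := (abs_le.1 this).1
    linarith [mul_assoc B x y]
  nlinarith [sq_nonneg y]

lemma sred_min (hB : |B| < A) (hAC : A < C) {x y : ℤ}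
    (h : A * x ^ 2 + B * x * y + C * y ^ 2 = A) : (x = 1 ∨ x = -1) ∧ y = 0 := by
  have hA : 0 < A := lt_of_le_of_lt (abs_nonneg B) hB
  have hy : y = 0 := by
    by_contra hy
    have hy1 : 1 ≤ |y| := Int.one_le_abs hy
    have h3 : -(|B| * |x * y|) ≤ B * x * y := by
      have : |B * (x * y)| ≤ |B| * |x * y| := by rw [abs_mul]
      have := (abs_le.1 this).1
      linarith [mul_assoc B x y]
    rw [abs_mul] at h3
    have e1 : x ^ 2 = |x| ^ 2 := (sq_abs x).symm
    have e2 : y ^ 2 = |y| ^ 2 := (sq_abs y).symm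
    rw [e1, e2] at h
    have h0 := abs_nonneg x
    have hh : A * |x| ^ 2 - |B| * (|x| * |y|) + C * |y| ^ 2 ≤ A := by linarith
    have hB0 := abs_nonneg B
    rcases eq_or_lt_of_le h0 with hx | hx
    · rw [← hx] at hh
      have h5 : (1:ℤ) ≤ |y| ^ 2 := one_le_pow₀ hy1
      have h6 : C * |y| ^ 2 ≤ A := by linarith
      nlinarith
    · have : |x| ^ 2 + |y| ^ 2 - |x| * |y| ≥ 1 := by nlinarith [sq_nonneg (|x| - |y|)]
      nlinarith [mul_pos hx (lt_of_lt_of_le zero_lt_one hy1)]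
  subst hy
  refine ⟨?_, rfl⟩
  have : x ^ 2 = 1 := by
    have : A * x ^ 2 = A * 1 := by linarith
    exact mul_left_cancel₀ hA.ne' this
  have h7 : (x - 1) * (x + 1) = 0 := by linear_combination this
  rcases mul_eq_zero.1 h7 with h | h
  · left; linarith
  · right; linarith

end quad
end NH

namespace NH

noncomputable instance nf_inst (Δ : ℤ) : NumberField (quadField Δ) where
  to_charZero := inferInstance
  to_finiteDimensional := by
    unfold quadField
    apply IntermediateField.adjoin.finiteDimensional
    refine ⟨Polynomial.X ^ 2 - Polynomial.C (Δ : ℚ), Polynomial.monic_X_pow_sub_C _ (by norm_num), ?_⟩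
    simp only [Polynomial.eval₂_sub, Polynomial.eval₂_pow, Polynomial.eval₂_X, Polynomial.eval₂_C, sqrtC_sq]
    simp

/-- ring of integers -/
abbrev OO (Δ : ℤ) : Type := NumberField.RingOfIntegers (quadField Δ)

section
variable {Δ A B C : ℤ}

lemma th_sq (h : B ^ 2 - 4 * A * C = Δ) : th Δ B ^ 2 = B * th Δ B - A * C := by
  have h' : (Δ : ℂ) = B ^ 2 - 4 * A * C := by rw [← h]; push_cast; ring
  rw [th]; linear_combination (1 / 4 : ℂ) * sqrtC_sq Δ + (1 / 4 : ℂ) * h'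

lemma exists_theta (hf : IsFundamentalDiscriminant Δ) (h : B ^ 2 - 4 * A * C = Δ) :
    ∃ x, io Δ x = th Δ B := by
  obtain ⟨k, hk⟩ := disc_parity h
  obtain ⟨x, hx⟩ := exists_io hf (-k) 1
  exact ⟨x, by rw [hx, om_eq_th hk]; push_cast; ring⟩

lemma io_repr_th (hΔ : Δ < 0) (hf : IsFundamentalDiscriminant Δ) (h : B ^ 2 - 4 * A * C = Δ)
    (x : OO Δ) : ∃ p q : ℤ, io Δ x = p + q * th Δ B := by
  obtain ⟨k, hk⟩ := disc_parity h
  obtain ⟨p, q, hx⟩ := io_repr hΔ hf x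
  exact ⟨p + q * k, q, by rw [hx, om_eq_th hk]; push_cast; ring⟩

lemma mem_lat (hΔ : Δ < 0) (hf : IsFundamentalDiscriminant Δ) (h : B ^ 2 - 4 * A * C = Δ)
    {t z : OO Δ} (ht : io Δ t = th Δ B) (hz : z ∈ Ideal.span {(A : OO Δ), t}) :
    ∃ p q : ℤ, io Δ z = p * A + q * th Δ B := by
  obtain ⟨r, s, rfl⟩ := Ideal.mem_span_pair.1 hz
  obtain ⟨p, q, hr⟩ := io_repr_th hΔ hf h r
  obtain ⟨p', q', hs⟩ := io_repr_th hΔ hf h s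
  refine ⟨p - q' * C, q * A + p' + q' * B, ?_⟩
  simp only [map_add, map_mul, map_intCast, ht, hr, hs]
  push_cast
  linear_combination (q' : ℂ) * th_sq h

lemma lat_mul_conj (hf : IsFundamentalDiscriminant Δ) (h : B ^ 2 - 4 * A * C = Δ)
    {t : OO Δ} (ht : io Δ t = th Δ B) :
    Ideal.span {(A : OO Δ), t} * Ideal.span {(A : OO Δ), (B : OO Δ) - t} = Ideal.span {(A : OO Δ)} := by
  have ht2 : t * ((B : OO Δ) - t) = A * C := by
    apply io_inj Δ
    simp only [map_sub, map_mul, map_intCast, ht]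
    linear_combination -th_sq h
  rw [Ideal.span_pair_mul_span_pair]
  apply le_antisymm
  · rw [Ideal.span_le]
    rintro x (rfl | rfl | rfl | rfl)
    · exact Ideal.mem_span_singleton.2 ⟨_, rfl⟩
    · exact Ideal.mem_span_singleton.2 ⟨_, rfl⟩
    · exact Ideal.mem_span_singleton.2 ⟨_, mul_comm _ _⟩
    · exact Ideal.mem_span_singleton.2 ⟨C, ht2⟩
  · obtain ⟨x, y, z, hxyz⟩ := fund_bezout hf h
    have hxyz' : (x : OO Δ) * A + y * B + z * C = 1 := by
      have := congrArg (Int.cast (R := OO Δ)) hxyz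
      push_cast at this; exact this
    rw [Ideal.span_singleton_le_iff_mem]
    have e : (A : OO Δ) = x * (A * A) + y * (A * (B - t)) + y * (t * A) + z * (t * (B - t)) := by
      rw [ht2]; linear_combination -(A : OO Δ) * hxyz'
    suffices key : ∀ w : OO Δ, w = x * (A * A) + y * (A * (B - t)) + y * (t * A) + z * (t * (B - t)) →
        w ∈ Ideal.span {(A : OO Δ) * A, (A : OO Δ) * (B - t), t * A, t * (B - t)} from key _ e
    rintro w rfl
    refine Ideal.add_mem _ (Ideal.add_mem _ (Ideal.add_mem _ ?_ ?_) ?_) ?_ <;>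
      apply Ideal.mul_mem_left <;> apply Ideal.subset_span <;> simp

lemma cube_le {A' t δ t0 t1 t2 t3 : OO Δ}
    (h0 : A' ^ 3 = δ * t0) (h1 : A' ^ 2 * t = δ * t1) (h2 : A' * t ^ 2 = δ * t2)
    (h3 : t ^ 3 = δ * t3) : Ideal.span {A', t} ^ 3 ≤ Ideal.span {δ} := by
  rw [pow_succ, pow_two, Ideal.span_pair_mul_span_pair, Ideal.span_mul_span', Ideal.span_le]
  rintro _ ⟨x, hx, y, hy, rfl⟩
  simp only [Set.mem_insert_iff, Set.mem_singleton_iff] at hx hy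
  show x * y ∈ Ideal.span {δ}
  rw [Ideal.mem_span_singleton]
  rcases hx with rfl | rfl | rfl | rfl <;> rcases hy with rfl | rfl
  · exact ⟨t0, by rw [← h0]; ring⟩
  · exact ⟨t1, by rw [← h1]; ring⟩
  · exact ⟨t1, by rw [← h1]; ring⟩
  · exact ⟨t2, by rw [← h2]; ring⟩
  · exact ⟨t1, by rw [← h1]; ring⟩
  · exact ⟨t2, by rw [← h2]; ring⟩
  · exact ⟨t2, by rw [← h2]; ring⟩
  · exact ⟨t3, by rw [← h3]; ring⟩

lemma cube_eq {I J : Ideal (OO Δ)} {x y a : OO Δ} (hI : I ^ 3 ≤ Ideal.span {x})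
    (hJ : J ^ 3 ≤ Ideal.span {y}) (hIJ : I * J = Ideal.span {a}) (ha : a ^ 3 = x * y) (ha0 : a ≠ 0) :
    I ^ 3 = Ideal.span {x} := by
  obtain ⟨K, hK⟩ := Ideal.dvd_iff_le.2 hI
  obtain ⟨L, hL⟩ := Ideal.dvd_iff_le.2 hJ
  have hx : x ≠ 0 := by
    rintro rfl
    exact ha0 (eq_zero_of_pow_eq_zero (n := 3) (by rw [ha]; ring))
  have hy : y ≠ 0 := by
    rintro rfl
    exact ha0 (eq_zero_of_pow_eq_zero (n := 3) (by rw [ha]; ring))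
  have h1 : (Ideal.span {x} * Ideal.span {y}) * (K * L) = (Ideal.span {x} * Ideal.span {y}) * 1 := by
    calc _ = (Ideal.span {x} * K) * (Ideal.span {y} * L) := by ring
      _ = (I * J) ^ 3 := by rw [← hK, ← hL]; ring
      _ = _ := by rw [hIJ, Ideal.span_singleton_pow, ha, mul_one, Ideal.span_singleton_mul_span_singleton]
  have h2 := mul_left_cancel₀ (by
    rw [Ideal.span_singleton_mul_span_singleton]
    simp only [ne_eq, Submodule.zero_eq_bot, Ideal.span_singleton_eq_bot]
    exact mul_ne_zero hx hy) h1
  have h3 : K = 1 := by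
    have := IsUnit.of_mul_eq_one L h2
    simpa using this
  rw [hK, h3, mul_one]
end
end NH

namespace NH

section
variable {Δ A B C A' B' C' : ℤ}

lemma lat_ne_zero {t : OO Δ} (hA : 0 < A) : Ideal.span {(A : OO Δ), t} ≠ 0 := by
  intro h
  have : (A : OO Δ) ∈ Ideal.span {(A : OO Δ), t} := Ideal.subset_span (by simp)
  rw [h] at this
  have h2 : (A : OO Δ) = 0 := by simpa using this
  have h3 : io Δ (A : OO Δ) = 0 := by rw [h2, map_zero]
  rw [map_intCast] at h3
  have : A = 0 := by exact_mod_cast h3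
  omega

lemma lat_im (hΔ : Δ < 0) {p q p' q' : ℝ} (h : (p : ℂ) + q * th Δ B = p' + q' * th Δ B') :
    q = q' ∧ 2 * p + q * B = 2 * p' + q' * B' := by
  have h1 : ((p + q * B / 2 : ℝ) : ℂ) + ((q / 2 : ℝ) : ℂ) * sqrtC Δ =
      ((p' + q' * B' / 2 : ℝ) : ℂ) + ((q' / 2 : ℝ) : ℂ) * sqrtC Δ := by
    rw [th, th] at h; push_cast; linear_combination h
  obtain ⟨h2, h3⟩ := half_inj hΔ h1
  constructor <;> linarith

lemma class_step (hΔ : Δ < 0) (hf : IsFundamentalDiscriminant Δ) (h : B ^ 2 - 4 * A * C = Δ)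
    (h' : B' ^ 2 - 4 * A' * C' = Δ) {t t' x y : OO Δ} (ht : io Δ t = th Δ B) (ht' : io Δ t' = th Δ B')
    (he : Ideal.span {x} * Ideal.span {(A : OO Δ), t} = Ideal.span {y} * Ideal.span {(A' : OO Δ), t'})
    {z : OO Δ} (hz : z ∈ Ideal.span {(A : OO Δ), t}) :
    ∃ p q : ℤ, io Δ x * io Δ z = io Δ y * (p * A' + q * th Δ B') := by
  have : x * z ∈ Ideal.span {y} * Ideal.span {(A' : OO Δ), t'} := by
    rw [← he]; exact Ideal.mul_mem_mul (Ideal.mem_span_singleton_self x) hz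
  obtain ⟨w, hw, hxw⟩ := Ideal.mem_span_singleton_mul.1 this
  obtain ⟨p, q, hpq⟩ := mem_lat hΔ hf h' ht' hw
  exact ⟨p, q, by rw [← map_mul, ← hxw, map_mul, hpq]⟩

lemma class_norm (hΔ : Δ < 0) (hf : IsFundamentalDiscriminant Δ) (h : B ^ 2 - 4 * A * C = Δ)
    (h' : B' ^ 2 - 4 * A' * C' = Δ) (hA : 0 < A)
    (hr' : |B'| < A' ∧ A' < C')
    {t t' x y : OO Δ} (ht : io Δ t = th Δ B) (ht' : io Δ t' = th Δ B') (hx : x ≠ 0)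
    (he : Ideal.span {x} * Ideal.span {(A : OO Δ), t} = Ideal.span {y} * Ideal.span {(A' : OO Δ), t'}) :
    ∃ p q : ℤ, io Δ x * A = io Δ y * (p * A' + q * th Δ B') ∧
      Complex.normSq (io Δ x) * (A : ℝ) ^ 2 = Complex.normSq (io Δ y) *
        ((A' : ℝ) * ((A' * p ^ 2 + B' * p * q + C' * q ^ 2 : ℤ) : ℝ)) ∧
      Complex.normSq (io Δ y) * (A' : ℝ) ^ 2 ≤ Complex.normSq (io Δ x) * (A : ℝ) ^ 2 := by
  obtain ⟨p, q, hpq⟩ := class_step hΔ hf h h' ht ht' he (z := A) (Ideal.subset_span (by simp))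
  rw [map_intCast] at hpq
  have hA' : 0 < A' := lt_of_le_of_lt (abs_nonneg _) hr'.1
  have hn := congrArg Complex.normSq hpq
  rw [map_mul, map_mul, normSq_lat hΔ h', Complex.normSq_intCast] at hn
  have hn' : Complex.normSq (io Δ x) * (A : ℝ) ^ 2 = Complex.normSq (io Δ y) *
        ((A' : ℝ) * ((A' * p ^ 2 + B' * p * q + C' * q ^ 2 : ℤ) : ℝ)) := by
    rw [Int.cast_mul] at hn; rw [sq]; exact hn
  refine ⟨p, q, hpq, hn', ?_⟩
  have hne : ¬ (p = 0 ∧ q = 0) := by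
    rintro ⟨rfl, rfl⟩
    have h0 : io Δ x = 0 := by
      simp at hpq
      rcases hpq with h | h
      · rw [h]
      · omega
    exact hx ((io_inj Δ) (by rw [h0, map_zero]))
  have := red_min hr'.1.le hr'.2.le hA' hne
  have h2 : (A' : ℝ) ≤ ((A' * p ^ 2 + B' * p * q + C' * q ^ 2 : ℤ) : ℝ) := by exact_mod_cast this
  have hA'r : (0 : ℝ) < A' := by exact_mod_cast hA'
  rw [hn', sq]
  gcongr
  exact Complex.normSq_nonneg _

lemma class_dvd (hΔ : Δ < 0) (hf : IsFundamentalDiscriminant Δ) (h : B ^ 2 - 4 * A * C = Δ)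
    (h' : B' ^ 2 - 4 * A' * C' = Δ) (hr : |B| < A ∧ A < C) (hr' : |B'| < A' ∧ A' < C')
    {t t' x y : OO Δ} (ht : io Δ t = th Δ B) (ht' : io Δ t' = th Δ B') (hx : x ≠ 0) (hy : y ≠ 0)
    (he : Ideal.span {x} * Ideal.span {(A : OO Δ), t} = Ideal.span {y} * Ideal.span {(A' : OO Δ), t'}) :
    ∃ s k : ℤ, (s = 1 ∨ s = -1) ∧ A * k = s * A' ∧ ∃ l : ℤ, s * A' * B = 2 * l * A * A' + k * A * B' := by
  have hA : 0 < A := lt_of_le_of_lt (abs_nonneg _) hr.1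
  have hA' : 0 < A' := lt_of_le_of_lt (abs_nonneg _) hr'.1
  obtain ⟨p, q, h1, h2, h3⟩ := class_norm hΔ hf h h' hA hr' ht ht' hx he
  obtain ⟨-, -, -, -, h4⟩ := class_norm hΔ hf h' h hA' hr ht' ht hy he.symm
  have h5 : Complex.normSq (io Δ x) * (A : ℝ) ^ 2 = Complex.normSq (io Δ y) * (A' : ℝ) ^ 2 :=
    le_antisymm h4 h3
  have hY : io Δ y ≠ 0 := fun h0 => hy (io_inj Δ (by rw [h0, map_zero]))
  have hA'r : (0 : ℝ) < A' := by exact_mod_cast hA'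
  have h6 : A' * p ^ 2 + B' * p * q + C' * q ^ 2 = A' := by
    rw [h2] at h5
    have := mul_left_cancel₀ (Complex.normSq_eq_zero.not.2 hY) h5
    rw [sq (A' : ℝ)] at this
    have := mul_left_cancel₀ hA'r.ne' this
    exact_mod_cast this
  obtain ⟨hp, hq⟩ := sred_min hr'.1 hr'.2 h6
  subst hq
  obtain ⟨l, k, h7⟩ := class_step hΔ hf h h' ht ht' he (z := t) (Ideal.subset_span (by simp))
  rw [ht] at h7
  have h8 : (p : ℂ) * A' * th Δ B = A * (l * A' + k * th Δ B') := by
    apply mul_left_cancel₀ hY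
    simp only [Int.cast_zero, zero_mul, add_zero] at h1
    linear_combination (A : ℂ) * h7 - th Δ B * h1
  have h9 := lat_im hΔ (p := 0) (q := p * A') (B := B) (B' := B') (p' := A * l * A') (q' := A * k)
    (by push_cast; linear_combination h8)
  obtain ⟨h10, h11⟩ := h9
  refine ⟨p, k, hp, ?_, l, ?_⟩
  · exact_mod_cast h10.symm
  · have : ((p * A' * B : ℤ) : ℝ) = ((2 * l * A * A' + k * A * B' : ℤ) : ℝ) := by
      push_cast; linear_combination h11
    exact_mod_cast this

lemma class_eq (hΔ : Δ < 0) (hf : IsFundamentalDiscriminant Δ) (h : B ^ 2 - 4 * A * C = Δ)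
    (h' : B' ^ 2 - 4 * A' * C' = Δ) (hr : |B| < A ∧ A < C) (hr' : |B'| < A' ∧ A' < C')
    {t t' x y : OO Δ} (ht : io Δ t = th Δ B) (ht' : io Δ t' = th Δ B') (hx : x ≠ 0) (hy : y ≠ 0)
    (he : Ideal.span {x} * Ideal.span {(A : OO Δ), t} = Ideal.span {y} * Ideal.span {(A' : OO Δ), t'}) :
    A = A' ∧ B = B' ∧ C = C' := by
  have hA : 0 < A := lt_of_le_of_lt (abs_nonneg _) hr.1
  have hA' : 0 < A' := lt_of_le_of_lt (abs_nonneg _) hr'.1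
  obtain ⟨s, k, hs, h1, l, h2⟩ := class_dvd hΔ hf h h' hr hr' ht ht' hx hy he
  obtain ⟨s', k', hs', h1', -⟩ := class_dvd hΔ hf h' h hr' hr ht' ht hy hx he.symm
  have d1 : A ∣ A' := by
    rcases hs with rfl | rfl
    · exact ⟨k, by linarith⟩
    · exact ⟨-k, by linarith⟩
  have d2 : A' ∣ A := by
    rcases hs' with rfl | rfl
    · exact ⟨k', by linarith⟩
    · exact ⟨-k', by linarith⟩
  have hAA : A = A' := Int.dvd_antisymm hA.le hA'.le d1 d2
  subst hAA
  have hk : k = s := by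
    have : A * k = A * s := by linarith
    exact mul_left_cancel₀ hA.ne' this
  subst hk
  have h3 : k * B = 2 * l * A + k * B' := by
    apply mul_left_cancel₀ hA.ne'; linear_combination h2
  have hB : B = B' := by
    have e1 := abs_lt.1 hr.1
    have e2 := abs_lt.1 hr'.1
    have hl : l = 0 := by
      rcases hs with rfl | rfl
      · by_contra hl
        rcases lt_or_gt_of_ne hl with hl | hl <;> nlinarith
      · by_contra hl
        rcases lt_or_gt_of_ne hl with hl | hl <;> nlinarith
    subst hl
    rcases hs with rfl | rfl <;> linarith
  subst hB
  refine ⟨rfl, rfl, ?_⟩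
  have : 4 * A * C = 4 * A * C' := by linarith
  exact mul_left_cancel₀ (by omega) this

lemma io_norm_ge (hΔ : Δ < 0) (hf : IsFundamentalDiscriminant Δ) {r : OO Δ} (hr : r ≠ 0) :
    1 ≤ Complex.normSq (io Δ r) := by
  obtain ⟨e, he⟩ := fund_mod hf
  obtain ⟨p, q, hpq⟩ := io_repr hΔ hf r
  have h1 : Complex.normSq (io Δ r) = ((p ^ 2 + p * q * Δ + q ^ 2 * e : ℤ) : ℝ) := by
    have h2 : io Δ r = ((p + q * Δ / 2 : ℝ) : ℂ) + ((q / 2 : ℝ) : ℂ) * sqrtC Δ := by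
      rw [hpq, om]; push_cast; ring
    have he' : (Δ : ℝ) ^ 2 - Δ = 4 * e := by exact_mod_cast he
    rw [h2, normSq_half hΔ]; push_cast; linear_combination (q^2/4 : ℝ) * he'
  have h3 : 0 < Complex.normSq (io Δ r) := by
    rw [Complex.normSq_pos]
    intro h0; exact hr (io_inj Δ (by rw [h0, map_zero]))
  rw [h1] at h3 ⊢
  exact_mod_cast h3

lemma class_triv (hΔ : Δ < 0) (hf : IsFundamentalDiscriminant Δ) (h : B ^ 2 - 4 * A * C = Δ)
    (hr : |B| < A ∧ A < C) {t γ : OO Δ} (ht : io Δ t = th Δ B)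
    (he : Ideal.span {(A : OO Δ), t} = Ideal.span {γ}) : A = 1 := by
  have hA : 0 < A := lt_of_le_of_lt (abs_nonneg _) hr.1
  have hAr : (0 : ℝ) < A := by exact_mod_cast hA
  have hγ : γ ∈ Ideal.span {(A : OO Δ), t} := by rw [he]; exact Ideal.mem_span_singleton_self _
  obtain ⟨p, q, hpq⟩ := mem_lat hΔ hf h ht hγ
  have h1 : (A : OO Δ) ∈ Ideal.span {γ} := by rw [← he]; exact Ideal.subset_span (by simp)
  obtain ⟨r, hr1⟩ := Ideal.mem_span_singleton.1 h1
  have h2 : t ∈ Ideal.span {γ} := by rw [← he]; exact Ideal.subset_span (by simp)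
  obtain ⟨s, hs⟩ := Ideal.mem_span_singleton.1 h2
  have hA0 : io Δ (A : OO Δ) ≠ 0 := by rw [map_intCast]; exact_mod_cast hA.ne'
  have hr0 : r ≠ 0 := by rintro rfl; rw [hr1] at hA0; simp at hA0
  have hγ0 : io Δ γ ≠ 0 := by
    intro h0; rw [hr1, map_mul, h0] at hA0; simp at hA0
  have hn := io_norm_ge hΔ hf hr0
  have e1 := congrArg Complex.normSq (congrArg (io Δ) hr1)
  rw [map_intCast, Complex.normSq_intCast, map_mul, map_mul] at e1
  have e2 : Complex.normSq (io Δ γ) = (A : ℝ) * ((A * p ^ 2 + B * p * q + C * q ^ 2 : ℤ) : ℝ) := by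
    rw [hpq, normSq_lat hΔ h, Int.cast_mul]
  have hne : ¬ (p = 0 ∧ q = 0) := by
    rintro ⟨rfl, rfl⟩
    simp at hpq; exact hγ0 hpq
  have e3 := red_min hr.1.le hr.2.le hA hne
  have e4 : A * p ^ 2 + B * p * q + C * q ^ 2 = A := by
    apply le_antisymm _ e3
    have : (A : ℝ) * ((A * p ^ 2 + B * p * q + C * q ^ 2 : ℤ) : ℝ) ≤ A * A := by
      rw [e1, ← e2]
      exact le_mul_of_one_le_right (Complex.normSq_nonneg _) hn
    have := le_of_mul_le_mul_left this hAr
    exact_mod_cast this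
  obtain ⟨hp, rfl⟩ := sred_min hr.1 hr.2 e4
  obtain ⟨u, v, huv⟩ := io_repr_th hΔ hf h s
  have e5 := congrArg (io Δ) hs
  rw [ht, map_mul, hpq, huv] at e5
  have e6 := lat_im hΔ (B := B) (B' := B) (p := 0) (q := 1) (p' := p * A * u) (q' := p * A * v) (by
    simp only [Int.cast_zero, zero_mul, add_zero] at e5
    push_cast; linear_combination e5)
  have e7 : A * (p * v) = 1 := by
    have := e6.1
    have h8 : (1 : ℤ) = p * A * v := by exact_mod_cast this
    linarith
  exact Int.eq_one_of_mul_eq_one_right hA.le e7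

lemma unit_small (hΔ : Δ < -4) (hf : IsFundamentalDiscriminant Δ) {u : OO Δ}
    (hu : Complex.normSq (io Δ u) = 1) : io Δ u = 1 ∨ io Δ u = -1 := by
  obtain ⟨p, q, hpq⟩ := io_repr (by omega) hf u
  have h2 : io Δ u = ((p + q * Δ / 2 : ℝ) : ℂ) + ((q / 2 : ℝ) : ℂ) * sqrtC Δ := by
    rw [hpq, om]; push_cast; ring
  have h3 := hu
  rw [h2, normSq_half (by omega)] at h3
  have h4 : (2 * p + q * Δ) ^ 2 - q ^ 2 * Δ = 4 := by
    have : ((2 * p + q * Δ : ℝ)) ^ 2 - q ^ 2 * Δ = 4 := by linear_combination 4 * h3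
    exact_mod_cast this
  have hq : q = 0 := by
    by_contra hq
    have : 0 < q ^ 2 := by positivity
    nlinarith [sq_nonneg (2 * p + q * Δ)]
  subst hq
  have : (p - 1) * (p + 1) = 0 := by linarith
  rcases mul_eq_zero.1 this with h | h
  · left; rw [hpq]; have : p = 1 := by linarith
    simp [this]
  · right; rw [hpq]; have : p = -1 := by linarith
    simp [this]
end
end NH

namespace NH

section
variable {Δ : ℤ}

/-- leading covariant coefficient -/
def qU (F : ℤ × ℤ × ℤ × ℤ) : ℤ := 2 * F.2.1 * qA F - F.1 * qB F

lemma qU_sq (F : ℤ × ℤ × ℤ × ℤ) : qU F ^ 2 + qD F * F.1 ^ 2 = 4 * qA F ^ 3 := by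
  unfold qU qD qC qB qA; ring

lemma cubic_ids {a b c d s A B C : ℂ} (hA : A = b ^ 2 - a * c) (hB : B = b * c - a * d)
    (hC : C = c ^ 2 - b * d) (hs : s ^ 2 = B ^ 2 - 4 * A * C) :
    A ^ 3 = ((2 * b * A - a * B + -a * s) / 2) * ((2 * b * A - a * B + a * s) / 2) ∧
    A ^ 2 * ((B + s) / 2) = ((2 * b * A - a * B + -a * s) / 2) * ((b * B - 2 * a * C + b * s) / 2) ∧
    A * ((B + s) / 2) ^ 2 = ((2 * b * A - a * B + -a * s) / 2) * ((B * c - 2 * b * C + c * s) / 2) ∧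
    ((B + s) / 2) ^ 3 = ((2 * b * A - a * B + -a * s) / 2) * ((B * d - 2 * c * C + d * s) / 2) := by
  subst hA hB hC
  refine ⟨?_, ?_, ?_, ?_⟩
  · linear_combination (a ^ 2 / 4) * hs
  · linear_combination (a * b / 4) * hs
  · linear_combination ((b ^ 2 - a * c + a * c) / 4) * hs
  · linear_combination (3 * (b * c - a * d) / 8 + s / 8 + a * d / 4) * hs

lemma form_ideal (hf : IsFundamentalDiscriminant Δ) {F : ℤ × ℤ × ℤ × ℤ}
    (hD : qD F = -Δ) (hA : 0 < qA F) {t : OO Δ} (ht : io Δ t = th Δ (qB F)) :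
    ∃ δ : OO Δ, io Δ δ = ((qU F : ℂ) - F.1 * sqrtC Δ) / 2 ∧
      Ideal.span {((qA F : ℤ) : OO Δ), t} ^ 3 = Ideal.span {δ} := by
  obtain ⟨a, b, c, d⟩ := F
  set A := qA (a, b, c, d) with hAdef
  set B := qB (a, b, c, d) with hBdef
  set C := qC (a, b, c, d) with hCdef
  have hdisc : B ^ 2 - 4 * A * C = Δ := by
    rw [hAdef, hBdef, hCdef]; unfold qD at hD; linarith
  obtain ⟨k, hk⟩ := disc_parity hdisc
  have e3 : c ^ 2 - b * d = C := by simp only [hCdef, qC]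
  have e4 : b * c - a * d = B := by simp only [hBdef, qB]
  have e0 : b ^ 2 - a * c = A := by simp only [hAdef, qA]
  have hU : qU (a, b, c, d) = 2 * b * A - a * B := rfl
  rw [hU]
  obtain ⟨δ, hδ⟩ := exists_io_half hf (U := 2 * b * A - a * B) (a := -a) ⟨b * A + a * k, by rw [hk]; ring⟩
  obtain ⟨δ', hδ'⟩ := exists_io_half hf (U := 2 * b * A - a * B) (a := a) ⟨b * A - a * B - a * k, by rw [hk]; ring⟩
  obtain ⟨t1, ht1⟩ := exists_io_half hf (U := b * B - 2 * a * C) (a := b) ⟨- a * C - b * k, by rw [hk]; ring⟩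
  obtain ⟨t1', ht1'⟩ := exists_io_half hf (U := b * B - 2 * a * C) (a := -b) ⟨- a * C + b * B + b * k, by rw [hk]; ring⟩
  obtain ⟨t2, ht2⟩ := exists_io_half hf (U := B * c - 2 * b * C) (a := c) ⟨- b * C - c * k, by rw [hk]; ring⟩
  obtain ⟨t2', ht2'⟩ := exists_io_half hf (U := B * c - 2 * b * C) (a := -c) ⟨- b * C + c * B + c * k, by rw [hk]; ring⟩
  obtain ⟨t3, ht3⟩ := exists_io_half hf (U := B * d - 2 * c * C) (a := d) ⟨- c * C - d * k, by rw [hk]; ring⟩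
  obtain ⟨t3', ht3'⟩ := exists_io_half hf (U := B * d - 2 * c * C) (a := -d) ⟨- c * C + d * B + d * k, by rw [hk]; ring⟩
  have hs : sqrtC Δ ^ 2 = (B : ℂ) ^ 2 - 4 * A * C := by rw [sqrtC_sq, ← hdisc]; push_cast; ring
  have c0 : (A : ℂ) = b ^ 2 - a * c := by rw [← e0]; push_cast; ring
  have c3 : (C : ℂ) = c ^ 2 - b * d := by rw [← e3]; push_cast; ring
  have c4 : (B : ℂ) = b * c - a * d := by rw [← e4]; push_cast; ring
  refine ⟨δ, by rw [hδ]; push_cast; ring, ?_⟩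
  obtain ⟨i0, i1, i2, i3⟩ := cubic_ids c0 c4 c3 hs
  obtain ⟨j0, j1, j2, j3⟩ := cubic_ids (s := - sqrtC Δ) c0 c4 c3 (by rw [neg_sq]; exact hs)
  have k0 : (A : OO Δ) ^ 3 = δ * δ' := by
    apply io_inj Δ
    simp only [map_mul, map_pow, map_intCast, hδ, hδ']
    push_cast; exact i0
  refine cube_eq (y := δ') (a := (A : OO Δ)) (J := Ideal.span {(A : OO Δ), (B : OO Δ) - t})
    (cube_le (t0 := δ') (t1 := t1) (t2 := t2) (t3 := t3) k0 ?_ ?_ ?_)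
    (cube_le (t0 := δ) (t1 := t1') (t2 := t2') (t3 := t3') (by rw [k0, mul_comm]) ?_ ?_ ?_)
    (lat_mul_conj hf hdisc ht) k0 ?_
  · apply io_inj Δ
    simp only [map_mul, map_pow, map_intCast, hδ, ht1, ht, th]
    push_cast; linear_combination i1
  · apply io_inj Δ
    simp only [map_mul, map_pow, map_intCast, hδ, ht2, ht, th]
    push_cast; linear_combination i2
  · apply io_inj Δ
    simp only [map_mul, map_pow, hδ, ht3, ht, th]
    push_cast; linear_combination i3
  · apply io_inj Δ
    simp only [map_mul, map_pow, map_sub, map_intCast, hδ', ht1', ht, th]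
    push_cast; linear_combination j1
  · apply io_inj Δ
    simp only [map_mul, map_pow, map_sub, map_intCast, hδ', ht2', ht, th]
    push_cast; linear_combination j2
  · apply io_inj Δ
    simp only [map_mul, map_pow, map_sub, map_intCast, hδ', ht3', ht, th]
    push_cast; linear_combination j3
  · intro h0
    have := congrArg (io Δ) h0
    rw [map_intCast, map_zero] at this
    have h1 : A = 0 := by exact_mod_cast this
    omega

lemma form_ext (hΔ : Δ < -4) (hf : IsFundamentalDiscriminant Δ) {F G : ℤ × ℤ × ℤ × ℤ}
    (hF : 0 < F.1) (hG : 0 < G.1) (hDF : qD F = -Δ) (hDG : qD G = -Δ)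
    (hA : qA F = qA G) (hB : qB F = qB G) (hA0 : 0 < qA F) : F = G := by
  have hdisc : (qB F) ^ 2 - 4 * qA F * qC F = Δ := by unfold qD at hDF; linarith
  obtain ⟨t, ht⟩ := exists_theta hf hdisc
  obtain ⟨δ, hδ, h1⟩ := form_ideal hf hDF hA0 ht
  obtain ⟨δ', hδ', h2⟩ := form_ideal hf hDG (hA ▸ hA0) (hB ▸ ht)
  rw [← hA, h1] at h2
  obtain ⟨u, hu⟩ := Ideal.span_singleton_eq_span_singleton.1 h2
  have n1 : ∀ H : ℤ × ℤ × ℤ × ℤ, qD H = -Δ → Complex.normSq (((qU H : ℂ) - H.1 * sqrtC Δ) / 2) = ((qA H : ℤ) : ℝ) ^ 3 := by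
    intro H hH
    have := normSq_half (Δ := Δ) (by omega) ((qU H : ℝ) / 2) (-(H.1 : ℝ) / 2)
    have e : (((qU H : ℂ) - H.1 * sqrtC Δ) / 2) = (((qU H : ℝ) / 2 : ℝ) : ℂ) + ((-(H.1 : ℝ) / 2 : ℝ) : ℂ) * sqrtC Δ := by
      push_cast; ring
    rw [e, this]
    have h := qU_sq H
    rw [hH] at h
    have h' : ((qU H : ℝ)) ^ 2 + -Δ * (H.1 : ℝ) ^ 2 = 4 * ((qA H : ℤ) : ℝ) ^ 3 := by exact_mod_cast h
    linear_combination (1/4 : ℝ) * h'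
  have hA0r : (0 : ℝ) < ((qA F : ℤ) : ℝ) ^ 3 := by
    have : (0:ℝ) < ((qA F : ℤ) : ℝ) := by exact_mod_cast hA0
    positivity
  have hun : Complex.normSq (io Δ u) = 1 := by
    have := congrArg Complex.normSq (congrArg (io Δ) hu)
    rw [map_mul, map_mul, hδ, hδ', n1 F hDF, n1 G hDG, ← hA] at this
    exact mul_left_cancel₀ hA0r.ne' (by rw [this, mul_one])
  have hu2 := congrArg (io Δ) hu
  rw [map_mul, hδ, hδ'] at hu2
  have key : ∀ s : ℝ, (io Δ u = s) → s * (qU F : ℝ) = qU G ∧ s * (F.1 : ℝ) = G.1 := by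
    intro s hs
    rw [hs] at hu2
    have := half_inj (Δ := Δ) (by omega) (p := s * qU F) (q := - (s * F.1)) (p' := qU G) (q' := -G.1) (by
      push_cast; linear_combination 2 * hu2)
    exact ⟨this.1, by linarith [this.2]⟩
  have fin : F.1 = G.1 ∧ qU F = qU G := by
    rcases unit_small hΔ hf hun with h | h
    · obtain ⟨k1, k2⟩ := key 1 (by rw [h]; simp)
      rw [one_mul] at k1 k2
      exact ⟨by exact_mod_cast k2, by exact_mod_cast k1⟩
    · obtain ⟨k1, k2⟩ := key (-1) (by rw [h]; simp)
      have : -1 * F.1 = G.1 := by exact_mod_cast k2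
      omega
  obtain ⟨a, b, c, d⟩ := F
  obtain ⟨a', b', c', d'⟩ := G
  obtain ⟨fa, fu⟩ := fin
  simp only at fa hF hG
  subst fa
  have hb : b = b' := by
    unfold qU at fu
    rw [← hA, ← hB] at fu
    have : (2 * qA (a, b, c, d)) * b = (2 * qA (a, b, c, d)) * b' := by simp only at fu; linarith
    exact mul_left_cancel₀ (by omega) this
  subst hb
  have hc : c = c' := by
    unfold qA at hA
    have : a * c = a * c' := by simp only at hA; linarith
    exact mul_left_cancel₀ (by omega) this
  subst hc
  have hd : d = d' := by
    unfold qB at hB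
    have : a * d = a * d' := by simp only at hB; linarith
    exact mul_left_cancel₀ (by omega) this
  rw [hd]

/-- **DOWN** -/
theorem h3_ge (hΔ : Δ < -4) (hf : IsFundamentalDiscriminant Δ) :
    {F : ℤ × ℤ × ℤ × ℤ | SRed F ∧ 0 < F.1 ∧ qD F = -Δ}.ncard + 1 ≤ h3 Δ := by
  set S := {F : ℤ × ℤ × ℤ × ℤ | SRed F ∧ 0 < F.1 ∧ qD F = -Δ} with hS
  have hdisc : ∀ F : S, (qB F.1) ^ 2 - 4 * qA F.1 * qC F.1 = Δ := by
    intro F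
    have := F.2.2.2
    unfold qD at this; linarith
  have hA : ∀ F : S, 0 < qA F.1 := fun F => lt_of_le_of_lt (abs_nonneg _) F.2.1.1
  choose t ht using fun F : S => exists_theta hf (hdisc F)
  have hne : ∀ F : S, Ideal.span {((qA F.1 : ℤ) : OO Δ), t F} ∈ nonZeroDivisors (Ideal (OO Δ)) :=
    fun F => mem_nonZeroDivisors_of_ne_zero (lat_ne_zero (hA F))
  have hcube : ∀ F : S, (ClassGroup.mk0 ⟨_, hne F⟩) ^ 3 = 1 := by
    intro F
    rw [← map_pow, ClassGroup.mk0_eq_one_iff]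
    obtain ⟨δ, -, hδ⟩ := form_ideal hf F.2.2.2 (hA F) (ht F)
    rw [SubmonoidClass.coe_pow, hδ]
    exact ⟨⟨δ, rfl⟩⟩
  let f : Option S → {x : ClassGroup (OO Δ) // x ^ 3 = 1} := fun o => match o with
    | none => ⟨1, one_pow 3⟩
    | some F => ⟨ClassGroup.mk0 ⟨_, hne F⟩, hcube F⟩
  have hone : ∀ F : S, ClassGroup.mk0 ⟨_, hne F⟩ ≠ 1 := by
    intro F h1
    rw [ClassGroup.mk0_eq_one_iff] at h1
    obtain ⟨γ, hγ⟩ := h1.principal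
    have hA1 := class_triv (by omega) hf (hdisc F) F.2.1 (ht F) hγ
    have h2 := qU_sq F.1
    rw [hA1, F.2.2.2] at h2
    have h3 : 0 < F.1.1 := F.2.2.1
    nlinarith [sq_nonneg (qU F.1)]
  have hinj : Function.Injective f := by
    rintro (_ | F) (_ | G) h
    · rfl
    · exact absurd (congrArg Subtype.val h).symm (hone G)
    · exact absurd (congrArg Subtype.val h) (hone F)
    · have h1 : ClassGroup.mk0 ⟨_, hne F⟩ = ClassGroup.mk0 ⟨_, hne G⟩ := congrArg Subtype.val h
      rw [ClassGroup.mk0_eq_mk0_iff] at h1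
      obtain ⟨x, y, hx, hy, he⟩ := h1
      obtain ⟨e1, e2, -⟩ := class_eq (by omega) hf (hdisc F) (hdisc G) F.2.1 G.2.1 (ht F) (ht G) hx hy he
      rw [Subtype.ext (form_ext hΔ hf F.2.2.1 G.2.2.1 F.2.2.2 G.2.2.2 e1 e2 (hA F))]
  have hfin : Finite (Option S) := Finite.of_injective f hinj
  have hfin2 : Finite S := Finite.of_injective (some : S → Option S) (Option.some_injective _)
  have := Nat.card_le_card_of_injective f hinj
  rw [Finite.card_option] at this
  exact this
end
end NH

namespace NH

section
variable {Δ : ℤ}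

lemma exists_conj (hΔ : Δ < 0) (hf : IsFundamentalDiscriminant Δ) (x : OO Δ) :
    ∃ y : OO Δ, io Δ y = (starRingEnd ℂ) (io Δ x) := by
  obtain ⟨p, q, h⟩ := io_repr hΔ hf x
  obtain ⟨y, hy⟩ := exists_io hf (p + q * Δ) (-q)
  refine ⟨y, ?_⟩
  rw [hy, h]
  simp [om, conj_sqrtC hΔ, map_ofNat]; ring

lemma exists_cj (hΔ : Δ < 0) (hf : IsFundamentalDiscriminant Δ) :
    ∃ σ : OO Δ →+* OO Δ, ∀ x, io Δ (σ x) = (starRingEnd ℂ) (io Δ x) := by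
  choose f hf using exists_conj hΔ hf
  exact ⟨{ toFun := f
           map_one' := io_inj Δ (by simp [hf])
           map_zero' := io_inj Δ (by simp [hf])
           map_mul' := fun x y => io_inj Δ (by simp [hf])
           map_add' := fun x y => io_inj Δ (by simp [hf]) }, hf⟩

/-- complex conjugation on the ring of integers -/
noncomputable def cj (hΔ : Δ < 0) (hf : IsFundamentalDiscriminant Δ) : OO Δ →+* OO Δ :=
  (exists_cj hΔ hf).choose

lemma io_cj (hΔ : Δ < 0) (hf : IsFundamentalDiscriminant Δ) (x : OO Δ) :
    io Δ (cj hΔ hf x) = (starRingEnd ℂ) (io Δ x) := (exists_cj hΔ hf).choose_spec x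

lemma conj_th (hΔ : Δ < 0) (B : ℤ) : (starRingEnd ℂ) (th Δ B) = B - th Δ B := by
  simp [th, conj_sqrtC hΔ, map_ofNat]; ring

/-- every nonzero ideal is an integer multiple of a standard lattice ideal -/
lemma ideal_std (hΔ : Δ < 0) (hf : IsFundamentalDiscriminant Δ) (I : Ideal (OO Δ)) (hI : I ≠ ⊥) :
    ∃ (A B C q : ℤ) (t : OO Δ), 0 < A ∧ 0 < q ∧ B ^ 2 - 4 * A * C = Δ ∧ io Δ t = th Δ B ∧
      I = Ideal.span {(q : OO Δ)} * Ideal.span {(A : OO Δ), t} := by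
  classical
  obtain ⟨e, he⟩ := fund_mod hf
  obtain ⟨W, hW⟩ := exists_io hf 0 1
  have hW' : io Δ W = om Δ := by rw [hW]; simp
  have hW2 : W * W = Δ * W - e := by
    apply io_inj Δ; simp only [map_mul, map_sub, map_intCast, hW']; rw [← sq, om_sq he]
  have rep : ∀ z : OO Δ, ∃ p q : ℤ, z = p + q * W := by
    intro z
    obtain ⟨p, q, h⟩ := io_repr hΔ hf z
    exact ⟨p, q, io_inj Δ (by rw [h]; simp [hW'])⟩
  -- an integer in the ideal
  obtain ⟨z, hz, hz0⟩ := Submodule.exists_mem_ne_zero_of_ne_bot hI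
  have hn0 : ∃ n : ℕ, 0 < n ∧ ((n : ℤ) : OO Δ) ∈ I := by
    obtain ⟨p, q, h⟩ := io_repr hΔ hf z
    have h1 : z * cj hΔ hf z = ((p ^ 2 + p * q * Δ + q ^ 2 * e : ℤ) : OO Δ) := by
      apply io_inj Δ
      rw [map_mul, io_cj, map_intCast, h]
      have : (starRingEnd ℂ) (om Δ) = Δ - om Δ := by simp [om, conj_sqrtC hΔ, map_ofNat]; ring
      simp only [map_add, map_mul, map_intCast, this]
      push_cast
      linear_combination -(q : ℂ) ^ 2 * om_sq he
    have h2 : (p ^ 2 + p * q * Δ + q ^ 2 * e : ℤ) ≠ 0 := by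
      intro h0
      rw [h0] at h1
      have h3 := congrArg (io Δ) h1
      rw [map_mul, io_cj, Complex.mul_conj] at h3
      simp at h3
      exact hz0 (io_inj Δ (by rw [h3, map_zero]))
    have h3 : ((p ^ 2 + p * q * Δ + q ^ 2 * e : ℤ) : OO Δ) ∈ I := by rw [← h1]; exact I.mul_mem_right _ hz
    refine ⟨(p ^ 2 + p * q * Δ + q ^ 2 * e : ℤ).natAbs, Int.natAbs_pos.2 h2, ?_⟩
    rcases Int.natAbs_eq (p ^ 2 + p * q * Δ + q ^ 2 * e : ℤ) with h4 | h4
    · rw [← h4]; exact h3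
    · have : ((((p ^ 2 + p * q * Δ + q ^ 2 * e : ℤ).natAbs : ℕ) : ℤ)) = - (p ^ 2 + p * q * Δ + q ^ 2 * e : ℤ) := by omega
      rw [this, Int.cast_neg]; exact I.neg_mem h3
  have hq0 : ∃ n : ℕ, 0 < n ∧ ∃ p : ℤ, (p : OO Δ) + ((n : ℤ) : OO Δ) * W ∈ I := by
    obtain ⟨n, hn, h⟩ := hn0
    exact ⟨n, hn, 0, by simpa using I.mul_mem_right W h⟩
  obtain ⟨n, hn, hnI, hnmin⟩ : ∃ n : ℤ, 0 < n ∧ (n : OO Δ) ∈ I ∧ ∀ k : ℤ, (k : OO Δ) ∈ I → n ∣ k := by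
    refine ⟨Nat.find hn0, by exact_mod_cast (Nat.find_spec hn0).1, (Nat.find_spec hn0).2, ?_⟩
    intro k hk
    set n : ℤ := (Nat.find hn0 : ℤ) with hndef
    have hnp : 0 < n := by rw [hndef]; exact_mod_cast (Nat.find_spec hn0).1
    by_contra hd
    have h1 : 0 < k % n := lt_of_le_of_ne (Int.emod_nonneg _ hnp.ne') (fun h => hd (Int.dvd_of_emod_eq_zero h.symm))
    have h2 : k % n < n := Int.emod_lt_of_pos _ hnp
    have h3 : ((k % n : ℤ) : OO Δ) ∈ I := by
      have : ((k % n : ℤ) : OO Δ) = k - (k / n : ℤ) * (n : OO Δ) := by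
        rw [← Int.cast_mul, ← Int.cast_sub]; congr 1
        have := Int.emod_add_mul_ediv k n; linarith
      rw [this]; exact I.sub_mem hk (I.mul_mem_left _ (Nat.find_spec hn0).2)
    have h4 := Nat.find_min' hn0 (m := (k % n).toNat) ⟨by omega, by rw [Int.toNat_of_nonneg h1.le]; exact h3⟩
    omega
  obtain ⟨q, hq, ⟨p, hpI⟩, hqmin⟩ : ∃ q : ℤ, 0 < q ∧ (∃ p : ℤ, (p : OO Δ) + q * W ∈ I) ∧
      ∀ k l : ℤ, (l : OO Δ) + k * W ∈ I → q ∣ k := by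
    refine ⟨Nat.find hq0, by exact_mod_cast (Nat.find_spec hq0).1, (Nat.find_spec hq0).2, ?_⟩
    intro k l hk
    set n : ℤ := (Nat.find hq0 : ℤ) with hndef
    obtain ⟨p, hp⟩ := (Nat.find_spec hq0).2
    have hnp : 0 < n := by rw [hndef]; exact_mod_cast (Nat.find_spec hq0).1
    by_contra hd
    have h1 : 0 < k % n := lt_of_le_of_ne (Int.emod_nonneg _ hnp.ne') (fun h => hd (Int.dvd_of_emod_eq_zero h.symm))
    have h2 : k % n < n := Int.emod_lt_of_pos _ hnp
    have h3 : ((l - (k / n) * p : ℤ) : OO Δ) + ((k % n : ℤ) : OO Δ) * W ∈ I := by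
      have h5 : ((k % n : ℤ) : OO Δ) = k - (k / n : ℤ) * (n : OO Δ) := by
        rw [← Int.cast_mul, ← Int.cast_sub]; congr 1
        have := Int.emod_add_mul_ediv k n; linarith
      have : ((l - (k / n) * p : ℤ) : OO Δ) + ((k % n : ℤ) : OO Δ) * W =
        (l + k * W) - (k / n : ℤ) * ((p : OO Δ) + (n : ℤ) * W) := by
        rw [h5]; push_cast; ring
      rw [this]; exact I.sub_mem hk (I.mul_mem_left _ hp)
    have h4 := Nat.find_min' hq0 (m := (k % n).toNat) ⟨by omega, _, by rw [Int.toNat_of_nonneg h1.le]; exact h3⟩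
    omega
  obtain ⟨A, hA⟩ : q ∣ n := hqmin n 0 (by simpa using I.mul_mem_right W hnI)
  obtain ⟨p', hp'⟩ : q ∣ p := by
    have h1 := hqmin (p + q * Δ) (- q * e) (by
      have : ((- q * e : ℤ) : OO Δ) + ((p + q * Δ : ℤ) : OO Δ) * W = (p + q * W) * W := by
        push_cast; linear_combination -(q : OO Δ) * hW2
      rw [this]; exact I.mul_mem_right _ hpI)
    exact (Int.dvd_add_left ⟨Δ, rfl⟩).1 h1
  have hA0 : 0 < A := by
    rw [hA] at hn; exact (mul_pos_iff_of_pos_left hq).1 hn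
  have hpI' : (q : OO Δ) * (p' + W) ∈ I := by
    have : (q : OO Δ) * (p' + W) = p + q * W := by rw [hp']; push_cast; ring
    rw [this]; exact hpI
  have hnI' : (q : OO Δ) * A ∈ I := by rw [← Int.cast_mul, ← hA]; exact hnI
  obtain ⟨C, hC⟩ : A ∣ p' ^ 2 + p' * Δ + e := by
    have h1 : ((q * (p' ^ 2 + p' * Δ + e) : ℤ) : OO Δ) ∈ I := by
      have : ((q * (p' ^ 2 + p' * Δ + e) : ℤ) : OO Δ) = q * (p' + W) * (p' + (Δ - W)) := by
        push_cast; linear_combination (q : OO Δ) * hW2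
      rw [this]; exact I.mul_mem_right _ hpI'
    have h2 := hnmin _ h1
    rw [hA] at h2
    exact Int.dvd_of_mul_dvd_mul_left hq.ne' h2
  refine ⟨A, Δ + 2 * p', C, q, p' + W, hA0, hq, ?_, ?_, ?_⟩
  · linear_combination he + 4 * hC
  · rw [map_add, map_intCast, hW', th, om]; push_cast; ring
  · apply le_antisymm
    · intro z hz
      obtain ⟨l, k, rfl⟩ := rep z
      obtain ⟨k', hk⟩ := hqmin k l hz
      have h1 : ((l - k' * p : ℤ) : OO Δ) ∈ I := by
        have : ((l - k' * p : ℤ) : OO Δ) = (l + k * W) - k' * ((q : OO Δ) * (p' + W)) := by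
          rw [hk, hp']; push_cast; ring
        rw [this]; exact I.sub_mem hz (I.mul_mem_left _ hpI')
      obtain ⟨r, hr⟩ := hnmin _ h1
      rw [Ideal.mem_span_singleton_mul]
      refine ⟨r * A + k' * (p' + W), Ideal.mem_span_pair.2 ⟨r, k', rfl⟩, ?_⟩
      have hl : l = q * A * r + k' * (q * p') := by rw [← hA, ← hp']; linarith
      rw [hl, hk]; push_cast; ring
    · rw [Ideal.span_singleton_mul_le_iff]
      intro z hz
      obtain ⟨r, s, rfl⟩ := Ideal.mem_span_pair.1 hz
      have : (q : OO Δ) * (r * A + s * (p' + W)) = r * (q * A) + s * (q * (p' + W)) := by ring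
      rw [this]; exact I.add_mem (I.mul_mem_left _ hnI') (I.mul_mem_left _ hpI')

end
end NH

namespace NH

section
variable {Δ : ℤ}

/-- `x` is the class of the standard lattice ideal attached to `(A,B,C)`. -/
def IsCls (Δ : ℤ) (x : ClassGroup (OO Δ)) (A B : ℤ) : Prop :=
  ∃ (t : OO Δ) (h : Ideal.span {(A : OO Δ), t} ∈ nonZeroDivisors (Ideal (OO Δ))),
    io Δ t = th Δ B ∧ ClassGroup.mk0 ⟨_, h⟩ = x

lemma cls_unique {x y : ClassGroup (OO Δ)} {A B : ℤ} (hx : IsCls Δ x A B) (hy : IsCls Δ y A B) :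
    x = y := by
  obtain ⟨t, h, ht, rfl⟩ := hx
  obtain ⟨t', h', ht', rfl⟩ := hy
  have : t = t' := io_inj Δ (by rw [ht, ht'])
  subst this; rfl

lemma int_ne_zero {q : ℤ} (hq : q ≠ 0) : (q : OO Δ) ≠ 0 := by
  intro h0
  have := congrArg (io Δ) h0
  rw [map_intCast, map_zero] at this
  exact hq (by exact_mod_cast this)

lemma exists_cls (hΔ : Δ < 0) (hf : IsFundamentalDiscriminant Δ) (x : ClassGroup (OO Δ)) :
    ∃ A B C : ℤ, 0 < A ∧ B ^ 2 - 4 * A * C = Δ ∧ IsCls Δ x A B := by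
  obtain ⟨I, rfl⟩ := ClassGroup.mk0_surjective x
  obtain ⟨A, B, C, q, t, hA, hq, hd, ht, hI⟩ := ideal_std hΔ hf I.1 (nonZeroDivisors.coe_ne_zero I)
  refine ⟨A, B, C, hA, hd, t, mem_nonZeroDivisors_of_ne_zero (lat_ne_zero hA), ht, ?_⟩
  rw [ClassGroup.mk0_eq_mk0_iff]
  refine ⟨q, 1, int_ne_zero hq.ne', one_ne_zero, ?_⟩
  show Ideal.span {(q : OO Δ)} * Ideal.span {(A : OO Δ), t} = _
  rw [← hI]; simp

lemma cls_translate {x : ClassGroup (OO Δ)} {A B : ℤ} (h : IsCls Δ x A B) (k : ℤ) :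
    IsCls Δ x A (B + 2 * k * A) := by
  obtain ⟨t, h, ht, rfl⟩ := h
  have e : Ideal.span {(A : OO Δ), t + k * A} = Ideal.span {(A : OO Δ), t} := by
    apply le_antisymm <;> rw [Ideal.span_le]
    · rintro z (rfl | rfl)
      · exact Ideal.subset_span (by simp)
      · exact Ideal.mem_span_pair.2 ⟨k, 1, by ring⟩
    · rintro z (rfl | rfl)
      · exact Ideal.subset_span (by simp)
      · exact Ideal.mem_span_pair.2 ⟨-k, 1, by ring⟩
  refine ⟨t + k * A, by rw [e]; exact h, ?_, ?_⟩
  · simp only [map_add, map_mul, map_intCast, ht, th]; push_cast; ring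
  · congr 1; exact Subtype.ext e

lemma cls_swap (hΔ : Δ < 0) {x : ClassGroup (OO Δ)} {A B C : ℤ} (h : IsCls Δ x A B)
    (hd : B ^ 2 - 4 * A * C = Δ) (hA : 0 < A) : 0 < C ∧ IsCls Δ x C (-B) := by
  have hC : 0 < C := by nlinarith [sq_nonneg B]
  refine ⟨hC, ?_⟩
  obtain ⟨t, h, ht, rfl⟩ := h
  have ht2 : t * t = B * t - A * C := by
    apply io_inj Δ; simp only [map_mul, map_sub, map_intCast, ht]; rw [← sq, th_sq hd]
  have ht0 : (B : OO Δ) - t ≠ 0 := by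
    intro h0
    have h1 : ((A * C : ℤ) : OO Δ) = 0 := by push_cast; linear_combination ht2 + t * h0
    exact int_ne_zero (mul_pos hA hC).ne' h1
  refine ⟨t - B, mem_nonZeroDivisors_of_ne_zero (lat_ne_zero hC), ?_, ?_⟩
  · simp only [map_sub, map_intCast, ht, th]; push_cast; ring
  · rw [ClassGroup.mk0_eq_mk0_iff]
    refine ⟨A, B - t, int_ne_zero hA.ne', ht0, ?_⟩
    show Ideal.span {(A : OO Δ)} * Ideal.span {(C : OO Δ), t - B} =
      Ideal.span {(B : OO Δ) - t} * Ideal.span {(A : OO Δ), t}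
    apply le_antisymm
    · rw [Ideal.span_singleton_mul_le_iff]
      intro z hz
      obtain ⟨r, s, rfl⟩ := Ideal.mem_span_pair.1 hz
      rw [Ideal.mem_span_singleton_mul]
      exact ⟨-s * A + r * t, Ideal.mem_span_pair.2 ⟨_, _, rfl⟩, by linear_combination -r * ht2⟩
    · rw [Ideal.span_singleton_mul_le_iff]
      intro z hz
      obtain ⟨r, s, rfl⟩ := Ideal.mem_span_pair.1 hz
      rw [Ideal.mem_span_singleton_mul]
      exact ⟨s * C + -r * (t - B), Ideal.mem_span_pair.2 ⟨_, _, rfl⟩, by linear_combination s * ht2⟩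

lemma exists_cls_red (hΔ : Δ < 0) (hf : IsFundamentalDiscriminant Δ) (x : ClassGroup (OO Δ)) :
    ∃ A B C : ℤ, 0 < A ∧ B ^ 2 - 4 * A * C = Δ ∧ IsCls Δ x A B ∧ |B| ≤ A ∧ A ≤ C := by
  classical
  have hex : ∃ n : ℕ, ∃ A B C : ℤ, A = n ∧ 0 < A ∧ B ^ 2 - 4 * A * C = Δ ∧ IsCls Δ x A B := by
    obtain ⟨A, B, C, h1, h2, h3⟩ := exists_cls hΔ hf x
    exact ⟨A.toNat, A, B, C, by omega, h1, h2, h3⟩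
  obtain ⟨A, B, C, hn, hA, hd, hc⟩ := Nat.find_spec hex
  -- translate
  obtain ⟨k, hk⟩ : ∃ k : ℤ, |B + 2 * k * A| ≤ A := by
    refine ⟨-((B + A) / (2 * A)), ?_⟩
    have h1 := Int.emod_add_mul_ediv (B + A) (2 * A)
    have h2 := Int.emod_nonneg (B + A) (b := 2 * A) (by omega)
    have h3 := Int.emod_lt_of_pos (B + A) (b := 2 * A) (by omega)
    rw [abs_le]
    constructor <;> nlinarith
  refine ⟨A, B + 2 * k * A, C + B * k + k ^ 2 * A, hA, by linear_combination hd, cls_translate hc k, hk, ?_⟩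
  have hd' : (B + 2 * k * A) ^ 2 - 4 * A * (C + B * k + k ^ 2 * A) = Δ := by linear_combination hd
  obtain ⟨h1, h2⟩ := cls_swap hΔ (cls_translate hc k) hd' hA
  have := Nat.find_min' hex (m := (C + B * k + k ^ 2 * A).toNat) ⟨_, _, A, by omega, h1, by linear_combination hd, h2⟩
  omega

lemma exists_form (hΔ : Δ < 0) (hf : IsFundamentalDiscriminant Δ) {A B C : ℤ} {t : OO Δ}
    (hA : 0 < A) (hd : B ^ 2 - 4 * A * C = Δ) (ht : io Δ t = th Δ B) (hA1 : A ≠ 1)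
    {δ : OO Δ} (hδ : Ideal.span {(A : OO Δ), t} ^ 3 = Ideal.span {δ}) :
    ∃ F : ℤ × ℤ × ℤ × ℤ, 0 < F.1 ∧ qA F = A ∧ qB F = B ∧ qC F = C := by
  have hct : cj hΔ hf t = B - t := by
    apply io_inj Δ; rw [io_cj, ht, conj_th hΔ, map_sub, map_intCast, ht]
  have hconj : Ideal.span {(A : OO Δ), (B : OO Δ) - t} ^ 3 = Ideal.span {cj hΔ hf δ} := by
    have := congrArg (Ideal.map (cj hΔ hf)) hδ
    rw [Ideal.map_pow, Ideal.map_span, Ideal.map_span, Set.image_pair, Set.image_singleton, hct, map_intCast] at this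
    exact this
  have hprod : Ideal.span {(A : OO Δ) ^ 3} = Ideal.span {δ * cj hΔ hf δ} := by
    rw [← Ideal.span_singleton_pow, ← lat_mul_conj hf hd ht, mul_pow, hδ, hconj,
      Ideal.span_singleton_mul_span_singleton]
  obtain ⟨u, hu⟩ := Ideal.span_singleton_eq_span_singleton.1 hprod
  have hAr : (0:ℝ) < A := by exact_mod_cast hA
  have hnorm : Complex.normSq (io Δ δ) = (A : ℝ) ^ 3 := by
    have h1 := congrArg Complex.normSq (congrArg (io Δ) hu)
    have h2 : Complex.normSq (io Δ u) = 1 := by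
      have hu1 := io_norm_ge hΔ hf (r := (u : OO Δ)) u.ne_zero
      have hu2 := io_norm_ge hΔ hf (r := ((u⁻¹ : (OO Δ)ˣ) : OO Δ)) (u⁻¹).ne_zero
      have h3 : Complex.normSq (io Δ u) * Complex.normSq (io Δ (u⁻¹ : (OO Δ)ˣ)) = 1 := by
        rw [← map_mul, ← map_mul, Units.mul_inv]; simp
      nlinarith
    simp only [map_mul, map_pow, map_intCast, h2, io_cj, Complex.normSq_conj, Complex.normSq_intCast, mul_one] at h1
    have h4 : ((A : ℝ) ^ 3) ^ 2 = (Complex.normSq (io Δ δ)) ^ 2 := by rw [sq (Complex.normSq _), ← h1]; ring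
    exact ((sq_eq_sq₀ (by positivity) (Complex.normSq_nonneg _)).1 h4).symm
  have hconjδ : io Δ δ * (starRingEnd ℂ) (io Δ δ) = (A : ℂ) ^ 3 := by
    rw [Complex.mul_conj, hnorm]; push_cast; rfl
  have hδ0 : io Δ δ ≠ 0 := by
    intro h0; rw [h0, map_zero] at hnorm
    have : (0:ℝ) < (A : ℝ) ^ 3 := by positivity
    linarith
  have mem : ∀ x y z : OO Δ, x ∈ Ideal.span {(A : OO Δ), t} → y ∈ Ideal.span {(A : OO Δ), t} →
      z ∈ Ideal.span {(A : OO Δ), t} → ∃ w, x * y * z = δ * w := by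
    intro x y z hx hy hz
    have : x * y * z ∈ Ideal.span {δ} := by
      rw [← hδ, pow_succ, pow_two]; exact Ideal.mul_mem_mul (Ideal.mul_mem_mul hx hy) hz
    exact Ideal.mem_span_singleton.1 this
  have mA : (A : OO Δ) ∈ Ideal.span {(A : OO Δ), t} := Ideal.subset_span (by simp)
  have mt : t ∈ Ideal.span {(A : OO Δ), t} := Ideal.subset_span (by simp)
  obtain ⟨t0, ht0⟩ := mem _ _ _ mA mA mA
  obtain ⟨t1, ht1⟩ := mem _ _ _ mA mA mt
  obtain ⟨t2, ht2⟩ := mem _ _ _ mA mt mt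
  obtain ⟨t3, ht3⟩ := mem _ _ _ mt mt mt
  have half : ∀ z : OO Δ, ∃ V a : ℤ, io Δ z = ((V / 2 : ℝ) : ℂ) + ((a / 2 : ℝ) : ℂ) * sqrtC Δ := by
    intro z
    obtain ⟨p, q, h⟩ := io_repr hΔ hf z
    exact ⟨2 * p + q * Δ, q, by rw [h, om]; push_cast; ring⟩
  obtain ⟨V0, a, k0⟩ := half t0
  obtain ⟨V1, b, k1⟩ := half t1
  obtain ⟨V2, c, k2⟩ := half t2
  obtain ⟨V3, d, k3⟩ := half t3
  have rel : ∀ z w : OO Δ, ∀ V a W b : ℤ, A * w = t * z → io Δ z = ((V / 2 : ℝ) : ℂ) + ((a / 2 : ℝ) : ℂ) * sqrtC Δ →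
      io Δ w = ((W / 2 : ℝ) : ℂ) + ((b / 2 : ℝ) : ℂ) * sqrtC Δ → 2 * A * W = B * V + a * Δ ∧ 2 * A * b = V + a * B := by
    intro z w V a W b h hz hw
    have h1 := congrArg (io Δ) h
    rw [map_mul, map_mul, map_intCast, ht, hz, hw, th] at h1
    have h2 := half_inj hΔ (p := 2 * A * W) (q := 2 * A * b) (p' := B * V + a * Δ) (q' := V + a * B) (by
      push_cast at h1 ⊢; linear_combination 4 * h1 + (a : ℂ) * sqrtC_sq Δ)
    exact ⟨by exact_mod_cast h2.1, by exact_mod_cast h2.2⟩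
  have hδO : δ ≠ 0 := fun h => hδ0 (by rw [h, map_zero])
  obtain ⟨r1, r1'⟩ := rel t0 t1 V0 a V1 b (mul_left_cancel₀ hδO (by linear_combination t * ht0 - A * ht1)) k0 k1
  obtain ⟨r2, r2'⟩ := rel t1 t2 V1 b V2 c (mul_left_cancel₀ hδO (by linear_combination t * ht1 - A * ht2)) k1 k2
  obtain ⟨r3, r3'⟩ := rel t2 t3 V2 c V3 d (mul_left_cancel₀ hδO (by linear_combination t * ht2 - A * ht3)) k2 k3
  have hV : V0 ^ 2 - a ^ 2 * Δ = 4 * A ^ 3 := by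
    have h1 : io Δ t0 = (starRingEnd ℂ) (io Δ δ) := by
      apply mul_left_cancel₀ hδ0
      rw [hconjδ, ← map_mul, ← ht0]; simp only [map_mul, map_intCast]; ring
    have h2 := congrArg Complex.normSq h1
    rw [Complex.normSq_conj, hnorm, k0, normSq_half hΔ] at h2
    have : (V0 : ℝ) ^ 2 - a ^ 2 * Δ = 4 * A ^ 3 := by linear_combination 4 * h2
    exact_mod_cast this
  have hA2 : (2 * A) ≠ 0 := by omega
  have hA0 : A ≠ 0 := hA.ne'
  have v0 : V0 = 2 * A * b - a * B := by linarith
  have v1 : V1 = B * b - 2 * a * C := by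
    apply mul_left_cancel₀ hA2; rw [r1, v0, ← hd]; ring
  have e1 : B * b - a * C = A * c := by linarith
  have v2 : V2 = B * c - 2 * b * C := by
    apply mul_left_cancel₀ hA2; rw [r2, ← hd]; linear_combination B * v1 + (2 * B) * e1
  have e2 : B * c - b * C = A * d := by linarith
  have qa : b ^ 2 - a * c = A := by
    apply mul_left_cancel₀ (mul_ne_zero (mul_ne_zero (by norm_num : (4:ℤ) ≠ 0) hA0) hA0)
    rw [v0, ← hd] at hV
    linear_combination hV + 4 * A * a * e1
  have qb : b * c - a * d = B := by
    apply mul_left_cancel₀ hA0; linear_combination -b * e1 + a * e2 + B * qa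
  have qc : c ^ 2 - b * d = C := by
    apply mul_left_cancel₀ hA0; linear_combination -c * e1 + b * e2 + C * qa
  have ha : a ≠ 0 := by
    rintro rfl
    have hb : b = 1 ∨ b = -1 := by
      refine fund_prim (Δ := Δ) (E := 4 * (b * d) - 3 * c ^ 2) hf ?_ ?_
      · rcases Int.emod_two_eq_zero_or_one c with hb | hb
        · obtain ⟨k, rfl⟩ : ∃ k, c = 2 * k := ⟨c / 2, by omega⟩
          left; ring_nf; omega
        · obtain ⟨k, rfl⟩ : ∃ k, c = 2 * k + 1 := ⟨c / 2, by omega⟩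
          right; ring_nf; omega
      · rw [← hd, ← qa, ← qb, ← qc]; ring
    apply hA1; rw [← qa]; rcases hb with rfl | rfl <;> norm_num
  rcases lt_or_gt_of_ne ha with h | h
  · refine ⟨(-a, -b, -c, -d), by simpa using h, ?_, ?_, ?_⟩
    · rw [← qa]; simp [qA]
    · rw [← qb]; simp [qB]
    · rw [← qc]; simp [qC]
  · exact ⟨(a, b, c, d), h, qa, qb, qc⟩

end
end NH

namespace NH

section
variable {R : Type*} [CommRing R] [LinearOrder R] [IsStrictOrderedRing R]

lemma red_bounds (F : R × R × R × R) (hB : |qB F| ≤ qA F) (hAC : qA F ≤ qC F) :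
    F.1 ^ 2 * qC F + F.2.1 ^ 2 * qA F ≤ 2 * qA F ^ 2 ∧
    F.2.2.2 ^ 2 * qA F + F.2.2.1 ^ 2 * qC F ≤ 2 * qC F ^ 2 ∧ 3 * (qA F * qC F) ≤ qD F := by
  obtain ⟨a, b, c, d⟩ := F
  set A := qA (a, b, c, d) with hA
  set B := qB (a, b, c, d) with hBd
  set C := qC (a, b, c, d) with hC
  have i1 : a ^ 2 * C + b ^ 2 * A = A ^ 2 + a * b * B := by
    rw [hA, hBd, hC]; simp only [qA, qB, qC]; ring
  have i2 : d ^ 2 * A + c ^ 2 * C = C ^ 2 + c * d * B := by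
    rw [hA, hBd, hC]; simp only [qA, qB, qC]; ring
  obtain ⟨b1, b2⟩ := abs_le.1 hB
  have hA0 : 0 ≤ A := le_trans (abs_nonneg _) hB
  have key : ∀ x y : R, 2 * (x * y * B) ≤ (x ^ 2 + y ^ 2) * A := by
    intro x y
    rcases le_total 0 (x * y) with h | h
    · nlinarith [mul_nonneg hA0 (sq_nonneg (x - y))]
    · nlinarith [mul_nonneg hA0 (sq_nonneg (x + y))]
  refine ⟨?_, ?_, ?_⟩
  · show a ^ 2 * C + b ^ 2 * A ≤ 2 * A ^ 2
    nlinarith [key a b, mul_le_mul_of_nonneg_left hAC (sq_nonneg a)]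
  · show d ^ 2 * A + c ^ 2 * C ≤ 2 * C ^ 2
    nlinarith [key c d, mul_le_mul_of_nonneg_left hAC (sq_nonneg c)]
  · show 3 * (A * C) ≤ 4 * A * C - B ^ 2
    nlinarith [mul_le_mul_of_nonneg_left hAC hA0]
end

lemma red_pos {F : ℤ × ℤ × ℤ × ℤ} (h : Red F) : 0 < qA F := by
  have h0 := h.2.2
  rcases (le_trans (abs_nonneg _) h.1).eq_or_lt with h1 | h1
  · have : |qB F| ≤ 0 := by rw [h1]; exact h.1
    have : qB F = 0 := abs_nonpos_iff.1 this
    unfold qD at h0; rw [this, ← h1] at h0; simp at h0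
  · exact h1

lemma SRed.red {F : ℤ × ℤ × ℤ × ℤ} (h : SRed F) : Red F := by
  refine ⟨h.1.le, h.2.le, ?_⟩
  have hA : 0 < qA F := lt_of_le_of_lt (abs_nonneg _) h.1
  have := (red_bounds F h.1.le h.2.le).2.2
  have := h.2
  nlinarith

lemma red_finite (Y : ℤ) : {F : ℤ × ℤ × ℤ × ℤ | Red F ∧ qD F ≤ Y}.Finite := by
  have hI := Set.finite_Icc (-(2 * Y)) (2 * Y)
  refine (hI.prod (hI.prod (hI.prod hI))).subset ?_
  rintro F ⟨hr, hY⟩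
  have hA := red_pos hr
  obtain ⟨h1, h2, h3⟩ := red_bounds F hr.1 hr.2.1
  have hAC := hr.2.1
  have hC : 0 < qC F := lt_of_lt_of_le hA hAC
  have hCY : qC F ≤ Y := by nlinarith
  have hY0 : 0 < Y := by linarith
  have key : ∀ x : ℤ, x ^ 2 ≤ 2 * qC F ^ 2 → x ∈ Set.Icc (-(2 * Y)) (2 * Y) := by
    intro x hx
    rw [Set.mem_Icc, ← abs_le]
    apply abs_le_of_sq_le_sq _ (by omega)
    nlinarith
  refine ⟨key _ ?_, key _ ?_, key _ ?_, key _ ?_⟩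
  · nlinarith [sq_nonneg F.1, sq_nonneg F.2.1, mul_nonneg (sq_nonneg F.2.1) hA.le]
  · nlinarith [sq_nonneg F.1, sq_nonneg F.2.1, mul_nonneg (sq_nonneg F.1) hC.le, mul_nonneg (sq_nonneg F.2.1) hA.le]
  · nlinarith [sq_nonneg F.2.2.1, sq_nonneg F.2.2.2, mul_nonneg (sq_nonneg F.2.2.1) hC.le, mul_nonneg (sq_nonneg F.2.2.2) hA.le]
  · nlinarith [sq_nonneg F.2.2.1, sq_nonneg F.2.2.2, mul_nonneg (sq_nonneg F.2.2.1) hC.le, mul_nonneg (sq_nonneg F.2.2.2) hA.le]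

/-- **UP** -/
theorem h3_le {Δ : ℤ} (hΔ : Δ < 0) (hf : IsFundamentalDiscriminant Δ) :
    h3 Δ ≤ {F : ℤ × ℤ × ℤ × ℤ | Red F ∧ 0 < F.1 ∧ qD F = -Δ}.ncard + 1 := by
  classical
  set S := {F : ℤ × ℤ × ℤ × ℤ | Red F ∧ 0 < F.1 ∧ qD F = -Δ} with hS
  have hfin : S.Finite := (red_finite (-Δ)).subset (fun F hF => ⟨hF.1, hF.2.2.le⟩)
  have hfS : Finite S := hfin
  have hex : ∀ x : {x : ClassGroup (OO Δ) // x ^ 3 = 1}, x.1 ≠ 1 → ∃ F : S, IsCls Δ x.1 (qA F.1) (qB F.1) := by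
    rintro ⟨x, hx⟩ hx1
    obtain ⟨A, B, C, hA, hd, hc, hB, hAC⟩ := exists_cls_red hΔ hf x
    obtain ⟨t, hne, ht, hx2⟩ := id hc
    have h3 : ∃ δ, Ideal.span {(A : OO Δ), t} ^ 3 = Ideal.span {δ} := by
      rw [← hx2, ← map_pow, ClassGroup.mk0_eq_one_iff] at hx
      obtain ⟨γ, hγ⟩ := hx.principal
      exact ⟨γ, hγ⟩
    obtain ⟨δ, hδ⟩ := h3
    have hA1 : A ≠ 1 := by
      rintro rfl
      apply hx1
      show x = 1
      rw [← hx2, ClassGroup.mk0_eq_one_iff]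
      have : Ideal.span {((1 : ℤ) : OO Δ), t} = Ideal.span {1} := by
        rw [Ideal.span_singleton_one, Ideal.eq_top_iff_one]
        exact Ideal.subset_span (by simp)
      exact ⟨⟨1, this⟩⟩
    obtain ⟨F, h0, qa, qb, qc⟩ := exists_form hΔ hf hA hd ht hA1 hδ
    have hD : qD F = -Δ := by unfold qD; rw [qa, qb, qc]; linarith
    refine ⟨⟨F, ⟨by rw [qa, qb]; exact hB, by rw [qa, qc]; exact hAC, by omega⟩, h0, hD⟩, ?_⟩
    show IsCls Δ x (qA F) (qB F)
    rw [qa, qb]; exact hc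
  choose g hg using hex
  have hcard : Nat.card {x : ClassGroup (OO Δ) // x ^ 3 = 1} ≤ Nat.card (Option S) := by
    refine Nat.card_le_card_of_injective
      (fun x => if h : x.1 = 1 then (none : Option S) else some (g x h)) ?_
    intro x y hxy
    simp only at hxy
    split_ifs at hxy with h1 h2 h2
    · exact Subtype.ext (h1.trans h2.symm)
    · have h4 := hg x h1
      rw [Option.some_inj.1 hxy] at h4
      exact Subtype.ext (cls_unique h4 (hg y h2))
  rw [Finite.card_option] at hcard
  exact hcard
end NH

namespace NH

section
variable {R : Type*} [CommRing R] [Fintype R] [DecidableEq R]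

/-- discriminant of the cubic form -/
def dsc {R : Type*} [CommRing R] (a b c d : R) : R :=
  a ^ 2 * d ^ 2 - 6 * a * b * c * d - 3 * b ^ 2 * c ^ 2 + 4 * b ^ 3 * d + 4 * a * c ^ 3

lemma dsc_eq {R : Type*} [CommRing R] (F : R × R × R × R) : dsc F.1 F.2.1 F.2.2.1 F.2.2.2 = - qD F := by
  unfold dsc qD qA qB qC; ring

lemma sum_uniq (f : R → R) (hf : Function.Injective f) (y : R) :
    ∑ d, (if f d = y then 1 else 0 : ℕ) = 1 := by
  obtain ⟨d0, rfl⟩ := (Finite.injective_iff_surjective.1 hf) y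
  simp [hf.eq_iff]

lemma sum_uniq_on (s : Finset R) (f : R → R) (hf : Set.InjOn f s) (hs : ∀ x ∈ s, f x ∈ s) {y : R}
    (hy : y ∈ s) : ∑ d ∈ s, (if f d = y then 1 else 0 : ℕ) = 1 := by
  have h := Finset.surjOn_of_injOn_of_card_le (s := s) (t := s) f hs hf le_rfl
  obtain ⟨d0, hd0, rfl⟩ := h hy
  rw [Finset.sum_eq_single_of_mem d0 hd0]
  · simp
  · intro b hb hne
    rw [if_neg]
    intro h; exact hne (hf hb hd0 h)

open scoped Classical in
/-- units as a finset -/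
noncomputable def UU (R : Type*) [CommRing R] [Fintype R] : Finset R := Finset.univ.filter (fun a => IsUnit a)
open scoped Classical in
/-- nonunits as a finset -/
noncomputable def MM (R : Type*) [CommRing R] [Fintype R] : Finset R := Finset.univ.filter (fun a => ¬ IsUnit a)

lemma sum_split (f : R → ℕ) : ∑ a, f a = ∑ a ∈ UU R, f a + ∑ a ∈ MM R, f a := by
  unfold UU MM
  rw [Finset.sum_filter, Finset.sum_filter, ← Finset.sum_add_distrib]
  refine Finset.sum_congr rfl fun a _ => ?_
  by_cases h : IsUnit a <;> simp [h]

lemma card_split : Fintype.card R = (UU R).card + (MM R).card := by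
  have := sum_split (R := R) (fun _ => 1)
  simpa using this

lemma shift_sum (u : Rˣ) (y : R) :
    ∑ b : R, ∑ c : R, ∑ d : R, (if dsc (u : R) b c d = y then 1 else 0 : ℕ) =
    Fintype.card R * ∑ c : R, ∑ e : R, (if e ^ 2 + 4 * u * c ^ 3 = y then 1 else 0 : ℕ) := by
  have h1 : ∀ b : R, ∑ c : R, ∑ d : R, (if dsc (u : R) b c d = y then 1 else 0 : ℕ) =
      ∑ c : R, ∑ e : R, (if e ^ 2 + 4 * u * c ^ 3 = y then 1 else 0 : ℕ) := by
    intro b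
    rw [← Equiv.sum_comp (Equiv.addRight ((u⁻¹ : Rˣ) * b ^ 2 : R))]
    refine Finset.sum_congr rfl fun c _ => ?_
    rw [← Equiv.sum_comp ((Units.mulLeft u⁻¹).trans (Equiv.addRight (3 * (u⁻¹ : Rˣ) * b * c + (u⁻¹ : Rˣ) ^ 2 * b ^ 3 : R)))]
    refine Finset.sum_congr rfl fun e _ => ?_
    have hu : (u : R) * (u⁻¹ : Rˣ) = 1 := Units.mul_inv u
    simp only [Equiv.trans_apply, Equiv.coe_addRight, Units.mulLeft_apply]
    generalize ((u⁻¹ : Rˣ) : R) = v at hu ⊢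
    have : dsc (u : R) b (c + v * b ^ 2) (v * e + (3 * v * b * c + v ^ 2 * b ^ 3)) = e ^ 2 + 4 * u * c ^ 3 := by
      generalize (u : R) = w at hu
      obtain ⟨β, rfl⟩ : ∃ β, b = w * β := ⟨v * b, by linear_combination (-b) * hu⟩
      have h1 : v * (w * β) ^ 2 = w * β ^ 2 := by linear_combination (w * β ^ 2) * hu
      have h2 : v * e + (3 * v * (w * β) * c + v ^ 2 * (w * β) ^ 3) = v * e + 3 * β * c + w * β ^ 3 := by
        linear_combination (3 * β * c + w * β ^ 3 * (v * w + 1)) * hu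
      rw [h1, h2]
      obtain ⟨ε, rfl⟩ : ∃ ε, e = w * ε := ⟨v * e, by linear_combination (-e) * hu⟩
      have h3 : v * (w * ε) = ε := by linear_combination ε * hu
      rw [h3]; unfold dsc; ring
    rw [this]
  rw [Finset.sum_congr rfl (fun b _ => h1 b), Finset.sum_const, smul_eq_mul, Finset.card_univ]

lemma mem_UU {x : R} : x ∈ UU R ↔ IsUnit x := by classical simp [UU]
lemma mem_MM {x : R} : x ∈ MM R ↔ ¬ IsUnit x := by classical simp [MM]

/-- number of square roots -/
def rt (y : R) : ℕ := ∑ e : R, (if e ^ 2 = y then 1 else 0 : ℕ)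

variable [IsLocalRing R]

lemma nu_add {x y : R} (hx : ¬ IsUnit x) (hy : ¬ IsUnit y) : ¬ IsUnit (x + y) :=
  IsLocalRing.nonunits_add hx hy
lemma nu_mul {x : R} (y : R) (hx : ¬ IsUnit x) : ¬ IsUnit (x * y) := fun h => hx (isUnit_of_mul_isUnit_left h)
lemma nu_mul' {x : R} (y : R) (hx : ¬ IsUnit x) : ¬ IsUnit (y * x) := fun h => hx (isUnit_of_mul_isUnit_right h)
lemma nu_neg {x : R} (hx : ¬ IsUnit x) : ¬ IsUnit (-x) := by simpa using hx
lemma un_add {x y : R} (hx : IsUnit x) (hy : ¬ IsUnit y) : IsUnit (x + y) := by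
  by_contra h
  exact nu_add h (nu_neg hy) (by simpa using hx)

lemma sqrt_one_add (h2 : IsUnit (2 : R)) {ν : R} (hν : ¬ IsUnit ν) : ∃ s : Rˣ, (s : R) ^ 2 = 1 + ν := by
  have h := Finset.surjOn_of_injOn_of_card_le (s := MM R) (t := MM R) (fun x => (2 + x) * x)
    (by
      intro x hx
      have hx' : ¬ IsUnit x := mem_MM.1 hx
      exact mem_MM.2 (nu_mul' _ hx'))
    (by
      intro x hx y hy hxy
      have hx' : ¬ IsUnit x := mem_MM.1 hx
      have hy' : ¬ IsUnit y := mem_MM.1 hy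
      have hu : IsUnit (2 + (x + y)) := un_add h2 (nu_add hx' hy')
      have : (2 + (x + y)) * (x - y) = 0 := by
        simp only at hxy
        linear_combination hxy
      have := hu.mul_right_eq_zero.1 this
      exact sub_eq_zero.1 this) le_rfl
  obtain ⟨x, hx, hxν⟩ := h (mem_MM.2 hν)
  simp only at hxν
  obtain ⟨s, hs⟩ := un_add (isUnit_one) (mem_MM.1 hx)
  exact ⟨s, by rw [hs, ← hxν]; ring⟩

lemma rt_const (h2 : IsUnit (2 : R)) {D μ : R} (hD : IsUnit D) (hμ : ¬ IsUnit μ) : rt (D + μ) = rt D := by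
  obtain ⟨D, rfl⟩ := hD
  obtain ⟨s, hs⟩ := sqrt_one_add h2 (nu_mul ((D⁻¹ : Rˣ) : R) hμ)
  unfold rt
  rw [← Equiv.sum_comp (Units.mulLeft s)]
  refine Finset.sum_congr rfl fun e _ => ?_
  congr 1
  rw [Units.mulLeft_apply, mul_pow, hs]
  have h1 : (D : R) + μ = (1 + μ * ((D⁻¹ : Rˣ) : R)) * D := by
    have := Units.inv_mul D
    linear_combination (-μ) * this
  rw [h1, ← hs]
  have hu : IsUnit ((s : R) ^ 2) := s.isUnit.pow 2
  exact propext hu.mul_right_inj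

open scoped Classical in
lemma sum_rt (D : R) : ∑ μ ∈ MM R, rt (D + μ) = ∑ e : R, (if ¬ IsUnit (D - e ^ 2) then 1 else 0 : ℕ) := by
  unfold rt
  rw [Finset.sum_comm]
  refine Finset.sum_congr rfl fun e _ => ?_
  by_cases h : ¬ IsUnit (D - e ^ 2)
  · rw [if_pos h]
    rw [Finset.sum_eq_single_of_mem (e ^ 2 - D) (mem_MM.2 (by simpa using nu_neg h))]
    · simp
    · intro b _ hb
      rw [if_neg]
      rintro h; exact hb (by rw [h]; ring)
  · rw [if_neg h]
    refine Finset.sum_eq_zero fun b hb => ?_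
    rw [if_neg]
    intro h'
    apply h
    rw [h']
    have := nu_neg (mem_MM.1 hb)
    simpa using this

open scoped Classical in
lemma unit_solve (h2 : IsUnit (2 : R)) {c : R} (hc : IsUnit c) (D e : R) :
    ∑ a ∈ UU R, (if e ^ 2 + 4 * a * c ^ 3 = D then 1 else 0 : ℕ) = if IsUnit (D - e ^ 2) then 1 else 0 := by
  have hu : IsUnit (4 * c ^ 3) := by
    have : (4 : R) = 2 * 2 := by norm_num
    rw [this]; exact (h2.mul h2).mul (hc.pow 3)
  by_cases h : IsUnit (D - e ^ 2)
  · rw [if_pos h]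
    refine Eq.trans ?_ (sum_uniq_on (UU R) (fun a => a * (4 * c ^ 3)) (fun x _ y _ h => hu.mul_left_inj.1 h)
      (fun x hx => mem_UU.2 ((mem_UU.1 hx).mul hu)) (mem_UU.2 h))
    refine Finset.sum_congr rfl fun a _ => ?_
    congr 1
    apply propext
    constructor
    · intro h; linear_combination h
    · intro h; linear_combination h
  · rw [if_neg h]
    refine Finset.sum_eq_zero fun a ha => ?_
    rw [if_neg]
    intro h'
    apply h
    rw [← h']
    have := (mem_UU.1 ha).mul hu
    convert this using 1
    ring

/-- count of (a,c,e), a unit -/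
noncomputable def WW (D : R) : ℕ := ∑ a ∈ UU R, ∑ c : R, ∑ e : R, (if e ^ 2 + 4 * a * c ^ 3 = D then 1 else 0 : ℕ)

open scoped Classical in
lemma WW_eq (h2 : IsUnit (2 : R)) (D : R) : WW D = (UU R).card * (∑ e : R, if IsUnit (D - e ^ 2) then 1 else 0) +
    ∑ a ∈ UU R, ∑ c ∈ MM R, rt (D - 4 * a * c ^ 3) := by
  unfold WW
  rw [Finset.sum_congr rfl (fun a _ => sum_split (fun c => ∑ e : R, (if e ^ 2 + 4 * a * c ^ 3 = D then 1 else 0 : ℕ)))]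
  rw [Finset.sum_add_distrib]
  congr 1
  · rw [Finset.sum_comm, ← smul_eq_mul, ← Finset.sum_const]
    refine Finset.sum_congr rfl fun c hc => ?_
    rw [Finset.sum_comm]
    refine Finset.sum_congr rfl fun e _ => ?_
    exact unit_solve h2 (mem_UU.1 hc) D e
  · refine Finset.sum_congr rfl fun a _ => Finset.sum_congr rfl fun c _ => ?_
    unfold rt
    refine Finset.sum_congr rfl fun e _ => ?_
    congr 1
    apply propext
    constructor
    · intro h; linear_combination h
    · intro h; linear_combination h

lemma WW_unit (h2 : IsUnit (2 : R)) {D : R} (hD : IsUnit D) : WW D = (UU R).card * Fintype.card R := by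
  classical
  rw [WW_eq h2]
  have h1 : ∀ a ∈ UU R, ∑ c ∈ MM R, rt (D - 4 * a * c ^ 3) = (MM R).card * rt D := by
    intro a _
    refine Finset.sum_const_nat fun c hc => ?_
    rw [sub_eq_add_neg]
    refine rt_const h2 hD (nu_neg (nu_mul' _ ?_))
    rw [pow_succ]; exact nu_mul' _ (mem_MM.1 hc)
  rw [Finset.sum_congr rfl h1, Finset.sum_const, smul_eq_mul, ← mul_add]
  congr 1
  have h3 := sum_rt D
  rw [Finset.sum_congr rfl (fun μ hμ => rt_const h2 hD (mem_MM.1 hμ)), Finset.sum_const, smul_eq_mul] at h3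
  rw [h3, ← Finset.sum_add_distrib, ← Finset.card_univ, Finset.card_eq_sum_ones]
  refine Finset.sum_congr rfl fun e _ => ?_
  by_cases h : IsUnit (D - e ^ 2) <;> simp [h]

lemma WW_nonunit (h2 : IsUnit (2 : R)) {D : R} (hD : ¬ IsUnit D) (hD2 : D ∉ (IsLocalRing.maximalIdeal R) ^ 2) :
    WW D = (UU R).card * (UU R).card := by
  classical
  rw [WW_eq h2]
  have h1 : ∀ a ∈ UU R, ∑ c ∈ MM R, rt (D - 4 * a * c ^ 3) = 0 := by
    intro a _
    refine Finset.sum_eq_zero fun c hc => ?_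
    refine Finset.sum_eq_zero fun e _ => ?_
    rw [if_neg]
    intro h
    apply hD2
    have hc' := mem_MM.1 hc
    have he : ¬ IsUnit e := by
      intro he
      have h3 := he.pow 2
      rw [h, sub_eq_add_neg] at h3
      refine nu_add hD (nu_neg (nu_mul' _ ?_)) h3
      rw [pow_succ]; exact nu_mul' _ hc'
    have : D = e * e + c * (c * (4 * a * c)) := by linear_combination -h
    rw [this, sq]
    exact Ideal.add_mem _ (Ideal.mul_mem_mul he he) (Ideal.mul_mem_mul hc' (Ideal.mul_mem_right _ _ hc'))
  rw [Finset.sum_congr rfl h1]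
  simp only [Finset.sum_const_zero, add_zero]
  congr 1
  have h4 : ∀ e : R, IsUnit (D - e ^ 2) ↔ IsUnit e := by
    intro e
    constructor
    · intro h
      by_contra he
      refine nu_add hD (nu_neg (x := e ^ 2) ?_) (by rwa [← sub_eq_add_neg])
      rw [sq]; exact nu_mul _ he
    · intro he
      have := un_add ((he.pow 2).neg) hD
      rwa [neg_add_eq_sub] at this
  simp only [h4]
  rw [Finset.card_eq_sum_ones]
  unfold UU
  rw [Finset.sum_filter]
  refine Finset.sum_congr rfl fun e _ => ?_
  congr 1

theorem local_count (h2 : IsUnit (2 : R)) {D : R} (hD2 : D ∉ (IsLocalRing.maximalIdeal R) ^ 2) :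
    ∑ a : R, ∑ b : R, ∑ c : R, ∑ d : R, (if dsc a b c d = D then 1 else 0 : ℕ) =
    Fintype.card R * (UU R).card * (Fintype.card R + (MM R).card) := by
  classical
  have h4u : IsUnit (4 : R) := by
    have : (4 : R) = 2 * 2 := by norm_num
    rw [this]; exact h2.mul h2
  rw [sum_split]
  have e1 : ∑ a ∈ UU R, ∑ b : R, ∑ c : R, ∑ d : R, (if dsc a b c d = D then 1 else 0 : ℕ) = Fintype.card R * WW D := by
    unfold WW
    rw [Finset.mul_sum]
    refine Finset.sum_congr rfl fun a ha => ?_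
    obtain ⟨u, rfl⟩ := mem_UU.1 ha
    exact shift_sum u D
  have e2 : ∀ a ∈ MM R, ∑ b ∈ UU R, ∑ c : R, ∑ d : R, (if dsc a b c d = D then 1 else 0 : ℕ) =
      (UU R).card * Fintype.card R := by
    intro a ha
    have ha' := mem_MM.1 ha
    rw [← smul_eq_mul, ← Finset.sum_const]
    refine Finset.sum_congr rfl fun b hb => ?_
    rw [← Finset.card_univ, Finset.card_eq_sum_ones]
    refine Finset.sum_congr rfl fun c _ => ?_
    refine sum_uniq (fun d => dsc a b c d) ?_ D
    intro x y hxy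
    simp only [dsc] at hxy
    have hu : IsUnit (4 * b ^ 3 + a * (a * (x + y) - 6 * b * c)) :=
      un_add (h4u.mul ((mem_UU.1 hb).pow 3)) (nu_mul _ ha')
    have : (4 * b ^ 3 + a * (a * (x + y) - 6 * b * c)) * (x - y) = 0 := by linear_combination hxy
    exact sub_eq_zero.1 (hu.mul_right_eq_zero.1 this)
  have hm : ∀ {a b : R}, ¬ IsUnit a → ¬ IsUnit b → ∀ c d, ¬ IsUnit (dsc a b c d) := by
    intro a b ha hb c d
    have : dsc a b c d = a * (a * d ^ 2 - 6 * b * c * d + 4 * c ^ 3) + b * (- 3 * b * c ^ 2 + 4 * b ^ 2 * d) := by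
      unfold dsc; ring
    rw [this]
    exact nu_add (nu_mul _ ha) (nu_mul _ hb)
  rw [e1, Finset.sum_congr rfl (fun a _ => sum_split (fun b => ∑ c : R, ∑ d : R, (if dsc a b c d = D then 1 else 0 : ℕ))),
    Finset.sum_add_distrib, Finset.sum_congr rfl e2, Finset.sum_const, smul_eq_mul]
  by_cases hD : IsUnit D
  · have e3 : ∑ a ∈ MM R, ∑ b ∈ MM R, ∑ c : R, ∑ d : R, (if dsc a b c d = D then 1 else 0 : ℕ) = 0 := by
      refine Finset.sum_eq_zero fun a ha => Finset.sum_eq_zero fun b hb => Finset.sum_eq_zero fun c _ =>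
        Finset.sum_eq_zero fun d _ => ?_
      rw [if_neg]
      intro h
      exact hm (mem_MM.1 ha) (mem_MM.1 hb) c d (h ▸ hD)
    rw [e3, WW_unit h2 hD]
    ring
  · have e3 : ∑ a ∈ MM R, ∑ b ∈ MM R, ∑ c : R, ∑ d : R, (if dsc a b c d = D then 1 else 0 : ℕ) =
        (MM R).card * ((UU R).card * Fintype.card R) := by
      rw [Finset.sum_comm, ← smul_eq_mul, ← Finset.sum_const]
      refine Finset.sum_congr rfl fun b hb => ?_
      have hb' := mem_MM.1 hb
      rw [Finset.sum_comm, sum_split]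
      have z : ∑ c ∈ MM R, ∑ a ∈ MM R, ∑ d : R, (if dsc a b c d = D then 1 else 0 : ℕ) = 0 := by
        refine Finset.sum_eq_zero fun c hc => Finset.sum_eq_zero fun a ha => Finset.sum_eq_zero fun d _ => ?_
        have ha' := mem_MM.1 ha
        have hc' := mem_MM.1 hc
        rw [if_neg]
        intro h
        apply hD2
        rw [← h, sq]
        have : dsc a b c d = a * (a * d ^ 2) + a * (b * (- 6 * c * d)) + b * (b * (- 3 * c ^ 2 + 4 * b * d)) +
          a * (c * (4 * c ^ 2)) := by unfold dsc; ring
        rw [this]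
        refine Ideal.add_mem _ (Ideal.add_mem _ (Ideal.add_mem _ ?_ ?_) ?_) ?_ <;>
          exact Ideal.mul_mem_mul (by assumption) (Ideal.mul_mem_right _ _ (by assumption))
      rw [z, add_zero, ← smul_eq_mul, ← Finset.sum_const]
      refine Finset.sum_congr rfl fun c hc => ?_
      have hc' := mem_UU.1 hc
      rw [Finset.sum_comm, ← Finset.card_univ, Finset.card_eq_sum_ones]
      refine Finset.sum_congr rfl fun d _ => ?_
      refine sum_uniq_on (MM R) (fun a => dsc a b c d) ?_ ?_ (mem_MM.2 hD)
      · intro x hx y hy hxy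
        simp only [dsc] at hxy
        have hu : IsUnit (4 * c ^ 3 + (b * (-6 * c * d) + (x + y) * d ^ 2)) :=
          un_add (h4u.mul (hc'.pow 3)) (nu_add (nu_mul _ hb') (nu_mul _ (nu_add (mem_MM.1 hx) (mem_MM.1 hy))))
        have : (4 * c ^ 3 + (b * (-6 * c * d) + (x + y) * d ^ 2)) * (x - y) = 0 := by linear_combination hxy
        exact sub_eq_zero.1 (hu.mul_right_eq_zero.1 this)
      · intro x hx
        exact mem_MM.2 (hm (mem_MM.1 hx) hb' c d)
    rw [e3, WW_nonunit h2 hD hD2]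
    have := card_split (R := R)
    rw [this]; ring
end
end NH

namespace NH

/-- number of forms mod `q` with given discriminant -/
noncomputable def cnt (q : ℕ) (D : ZMod q) : ℕ :=
  Nat.card {F : ZMod q × ZMod q × ZMod q × ZMod q // dsc F.1 F.2.1 F.2.2.1 F.2.2.2 = D}

lemma cnt_eq_sum (q : ℕ) [NeZero q] (D : ZMod q) :
    cnt q D = ∑ a : ZMod q, ∑ b : ZMod q, ∑ c : ZMod q, ∑ d : ZMod q, (if dsc a b c d = D then 1 else 0 : ℕ) := by
  unfold cnt
  rw [Nat.card_eq_fintype_card, Fintype.card_subtype, Finset.card_filter, Fintype.sum_prod_type]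
  refine Finset.sum_congr rfl fun a _ => ?_
  rw [Fintype.sum_prod_type]
  refine Finset.sum_congr rfl fun b _ => ?_
  rw [Fintype.sum_prod_type]

lemma zmod_unit_iff {p k : ℕ} (hp : p.Prime) (hk : 0 < k) (x : ZMod (p ^ k)) :
    IsUnit x ↔ ¬ p ∣ x.val := by
  haveI : NeZero (p ^ k) := ⟨(pow_pos hp.pos k).ne'⟩
  conv_lhs => rw [← ZMod.natCast_zmod_val x]
  rw [ZMod.isUnit_iff_coprime, Nat.coprime_pow_right_iff hk, Nat.coprime_comm, hp.coprime_iff_not_dvd]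

lemma zmod_nonunit {p k : ℕ} (hp : p.Prime) (hk : 0 < k) (x : ZMod (p ^ k)) :
    ¬ IsUnit x ↔ ∃ y, x = p * y := by
  haveI : NeZero (p ^ k) := ⟨(pow_pos hp.pos k).ne'⟩
  constructor
  · rw [zmod_unit_iff hp hk, not_not]
    rintro ⟨y, hy⟩
    refine ⟨y, ?_⟩
    rw [← ZMod.natCast_zmod_val x, hy]; push_cast; ring
  · rintro ⟨y, rfl⟩ h
    have := isUnit_of_mul_isUnit_left h
    rw [ZMod.isUnit_iff_coprime, Nat.coprime_pow_right_iff hk, Nat.coprime_self] at this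
    exact hp.one_lt.ne' this

lemma zmod_local {p k : ℕ} (hp : p.Prime) (hk : 0 < k) : IsLocalRing (ZMod (p ^ k)) := by
  haveI : Fact (1 < p ^ k) := ⟨Nat.one_lt_pow hk.ne' hp.one_lt⟩
  refine IsLocalRing.of_nonunits_add ?_
  intro a b ha hb
  rw [mem_nonunits_iff, zmod_nonunit hp hk] at *
  obtain ⟨x, rfl⟩ := ha
  obtain ⟨y, rfl⟩ := hb
  exact ⟨x + y, by ring⟩

lemma cnt_odd {p k : ℕ} (hp : p.Prime) (hp2 : p ≠ 2) (hk : 2 ≤ k) {D : ℤ} (hD : ¬ ((p : ℤ) ^ 2 ∣ D)) :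
    (cnt (p ^ k) (D : ZMod (p ^ k)) : ℝ) = ((p ^ k : ℕ) : ℝ) ^ 3 * (1 - 1 / (p : ℝ) ^ 2) := by
  haveI : NeZero (p ^ k) := ⟨(pow_pos hp.pos k).ne'⟩
  haveI := zmod_local hp (k := k) (by omega)
  have h2 : IsUnit (2 : ZMod (p ^ k)) := by
    have : ((2 : ℕ) : ZMod (p ^ k)) = 2 := by norm_num
    rw [← this, ZMod.isUnit_iff_coprime]
    apply Nat.Coprime.pow_right
    exact (Nat.coprime_primes Nat.prime_two hp).2 (Ne.symm hp2)
  have hD2 : (D : ZMod (p ^ k)) ∉ (IsLocalRing.maximalIdeal (ZMod (p ^ k))) ^ 2 := by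
    intro h
    have hle : IsLocalRing.maximalIdeal (ZMod (p ^ k)) ≤ Ideal.span {(p : ZMod (p ^ k))} := by
      intro x hx
      obtain ⟨y, rfl⟩ := (zmod_nonunit hp (by omega) x).1 hx
      exact Ideal.mul_mem_right _ _ (Ideal.mem_span_singleton_self _)
    have h' := (Ideal.pow_right_mono hle 2) h
    rw [Ideal.span_singleton_pow, Ideal.mem_span_singleton] at h'
    obtain ⟨y, hy⟩ := h'
    apply hD
    have h3 : ((D - p ^ 2 * (y.val : ℤ) : ℤ) : ZMod (p ^ k)) = 0 := by
      push_cast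
      rw [ZMod.natCast_zmod_val, hy, sub_self]
    rw [ZMod.intCast_zmod_eq_zero_iff_dvd] at h3
    have h4 : (p : ℤ) ^ 2 ∣ ((p ^ k : ℕ) : ℤ) := by
      push_cast; exact pow_dvd_pow _ hk
    have h5 := h4.trans h3
    exact (dvd_sub_left (Dvd.intro _ rfl)).1 h5
  rw [cnt_eq_sum, local_count h2 hD2, ZMod.card]
  have hU : (UU (ZMod (p ^ k))).card = p ^ (k - 1) * (p - 1) := by
    rw [← Nat.totient_prime_pow hp (by omega), ← ZMod.card_units_eq_totient, ← Fintype.card_coe]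
    refine Fintype.card_congr ?_
    exact { toFun := fun x => (mem_UU.1 x.2).unit
            invFun := fun u => ⟨u, mem_UU.2 u.isUnit⟩
            left_inv := fun x => by simp
            right_inv := fun u => by ext; simp }
  have hM := card_split (R := ZMod (p ^ k))
  rw [ZMod.card] at hM
  have hM' : ((MM (ZMod (p ^ k))).card : ℝ) = (p : ℝ) ^ k - (UU (ZMod (p ^ k))).card := by
    rw [eq_sub_iff_add_eq]; exact_mod_cast (by omega : (MM (ZMod (p ^ k))).card + (UU (ZMod (p ^ k))).card = p ^ k)
  have hp1 : 1 ≤ p := hp.one_lt.le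
  have hU' : ((UU (ZMod (p ^ k))).card : ℝ) = (p : ℝ) ^ k * (1 - 1 / p) := by
    rw [hU]
    push_cast [Nat.cast_sub hp1]
    obtain ⟨j, rfl⟩ : ∃ j, k = j + 1 := ⟨k - 1, by omega⟩
    have : (p : ℝ) ≠ 0 := by exact_mod_cast hp.ne_zero
    rw [Nat.add_sub_cancel, pow_succ]; field_simp
  push_cast
  rw [hM', hU']
  have : (p : ℝ) ≠ 0 := by exact_mod_cast hp.ne_zero
  field_simp; ring
end NH

namespace NH

/-- partial derivatives of the discriminant -/
def g1 (a b c d : ℤ) : ℤ := 2 * a * d ^ 2 - 6 * b * c * d + 4 * c ^ 3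
def g2 (a b c d : ℤ) : ℤ := -6 * a * c * d - 6 * b * c ^ 2 + 12 * b ^ 2 * d
def g3 (a b c d : ℤ) : ℤ := -6 * a * b * d - 6 * b ^ 2 * c + 12 * a * c ^ 2
def g4 (a b c d : ℤ) : ℤ := 2 * a ^ 2 * d - 6 * a * b * c + 4 * b ^ 3

lemma dsc_taylor (a b c d x y z w P : ℤ) : ∃ Q : ℤ, dsc (a + P * x) (b + P * y) (c + P * z) (d + P * w) =
    dsc a b c d + P * (g1 a b c d * x + g2 a b c d * y + g3 a b c d * z + g4 a b c d * w) + P ^ 2 * Q := by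
  refine ⟨(1)*a^2*w^2 + (4)*a*d*x*w + (2)*a*x*w^2*P + (1)*d^2*x^2 + (2)*d*x^2*w*P + (1)*x^2*w^2*P^2 + (-6)*a*b*z*w + (-6)*a*c*y*w + (-6)*a*d*y*z + (-6)*a*y*z*w*P + (-6)*b*c*x*w + (-6)*b*d*x*z + (-6)*b*x*z*w*P + (-6)*c*d*x*y + (-6)*c*x*y*w*P + (-6)*d*x*y*z*P + (-6)*x*y*z*w*P^2 + (-3)*b^2*z^2 + (-12)*b*c*y*z + (-6)*b*y*z^2*P + (-3)*c^2*y^2 + (-6)*c*y^2*z*P + (-3)*y^2*z^2*P^2 + (12)*b^2*y*w + (12)*b*d*y^2 + (12)*b*y^2*w*P + (4)*d*y^3*P + (4)*y^3*w*P^2 + (12)*a*c*z^2 + (4)*a*z^3*P + (12)*c^2*x*z + (12)*c*x*z^2*P + (4)*x*z^3*P^2, ?_⟩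
  unfold dsc g1 g2 g3 g4
  ring

/-- indicator of `2^t ∣ disc - D` -/
def ind (t : ℕ) (D : ℤ) (a b c d : ℕ) : ℕ := if (2 : ℤ) ^ t ∣ dsc (a : ℤ) b c d - D then 1 else 0

/-- all partials divisible by `2^s` -/
def Gd (s : ℕ) (a b c d : ℤ) : Prop :=
  (2 : ℤ) ^ s ∣ g1 a b c d ∧ (2 : ℤ) ^ s ∣ g2 a b c d ∧ (2 : ℤ) ^ s ∣ g3 a b c d ∧ (2 : ℤ) ^ s ∣ g4 a b c d

lemma dsc_shift {s j : ℕ} (hj : s ≤ j) {a b c d : ℤ} (h : Gd s a b c d) (x y z w : ℤ) :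
    (2 : ℤ) ^ (j + s) ∣ dsc (a + 2 ^ j * x) (b + 2 ^ j * y) (c + 2 ^ j * z) (d + 2 ^ j * w) - dsc a b c d := by
  obtain ⟨Q, hQ⟩ := dsc_taylor a b c d x y z w (2 ^ j)
  obtain ⟨⟨k1, h1⟩, ⟨k2, h2⟩, ⟨k3, h3⟩, ⟨k4, h4⟩⟩ := h
  obtain ⟨i, rfl⟩ : ∃ i, j = s + i := ⟨j - s, by omega⟩
  refine ⟨k1 * x + k2 * y + k3 * z + k4 * w + 2 ^ i * Q, ?_⟩
  rw [hQ, h1, h2, h3, h4]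
  rw [pow_add, pow_add]; ring

lemma dvd_congr {n x y D : ℤ} (h : n ∣ x - y) : n ∣ x - D ↔ n ∣ y - D := by
  have : x - D = (y - D) + (x - y) := by ring
  rw [this]
  exact dvd_add_left h

lemma parity_count : ∀ x l1 l2 l3 l4 : ZMod 2, ¬ (l1 = 0 ∧ l2 = 0 ∧ l3 = 0 ∧ l4 = 0) →
    ∑ p ∈ Finset.range 2, ∑ q ∈ Finset.range 2, ∑ r ∈ Finset.range 2, ∑ s ∈ Finset.range 2,
      (if x + l1 * (p : ℕ) + l2 * (q : ℕ) + l3 * (r : ℕ) + l4 * (s : ℕ) = 0 then 1 else 0 : ℕ) = 8 := by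
  decide +kernel

lemma hensel_step {s j : ℕ} (hj : s + 1 ≤ j) {a b c d : ℕ} (h : Gd s a b c d) (hn : ¬ Gd (s + 1) a b c d) (D : ℤ) :
    ∑ p ∈ Finset.range 2, ∑ q ∈ Finset.range 2, ∑ r ∈ Finset.range 2, ∑ w ∈ Finset.range 2,
      ind (j + s + 1) D (a + 2 ^ j * p) (b + 2 ^ j * q) (c + 2 ^ j * r) (d + 2 ^ j * w) = 8 * ind (j + s) D a b c d := by
  by_cases hD : (2 : ℤ) ^ (j + s) ∣ dsc (a : ℤ) b c d - D
  · obtain ⟨x, hx⟩ := hD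
    have e : ind (j + s) D a b c d = 1 := if_pos ⟨x, hx⟩
    rw [e]
    obtain ⟨⟨k1, h1⟩, ⟨k2, h2⟩, ⟨k3, h3⟩, ⟨k4, h4⟩⟩ := h
    have hk : ¬ ((k1 : ZMod 2) = 0 ∧ (k2 : ZMod 2) = 0 ∧ (k3 : ZMod 2) = 0 ∧ (k4 : ZMod 2) = 0) := by
      rintro ⟨e1, e2, e3, e4⟩
      rw [ZMod.intCast_zmod_eq_zero_iff_dvd] at e1 e2 e3 e4
      apply hn
      refine ⟨?_, ?_, ?_, ?_⟩
      · rw [h1, pow_succ]; exact mul_dvd_mul_left _ e1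
      · rw [h2, pow_succ]; exact mul_dvd_mul_left _ e2
      · rw [h3, pow_succ]; exact mul_dvd_mul_left _ e3
      · rw [h4, pow_succ]; exact mul_dvd_mul_left _ e4
    have := parity_count x k1 k2 k3 k4 hk
    rw [mul_one]
    rw [← this]
    refine Finset.sum_congr rfl fun p _ => Finset.sum_congr rfl fun q _ => Finset.sum_congr rfl fun r _ =>
      Finset.sum_congr rfl fun w _ => ?_
    unfold ind
    congr 1
    apply propext
    obtain ⟨Q, hQ⟩ := dsc_taylor a b c d p q r w (2 ^ j)
    have e5 : dsc ((a + 2 ^ j * p : ℕ) : ℤ) ((b + 2 ^ j * q : ℕ) : ℤ) ((c + 2 ^ j * r : ℕ) : ℤ) ((d + 2 ^ j * w : ℕ) : ℤ) - D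
       = 2 ^ (j + s) * (x + k1 * p + k2 * q + k3 * r + k4 * w + 2 * (2 ^ (j - s - 1) * Q)) := by
      push_cast
      rw [hQ, h1, h2, h3, h4]
      have : (2 : ℤ) ^ j = 2 ^ (s + (j - s - 1) + 1) := by congr 1; omega
      have e6 : ((2 : ℤ) ^ j) ^ 2 = 2 ^ (j + s) * 2 * 2 ^ (j - s - 1) := by
        rw [sq]; conv_lhs => rw [this]
        rw [← pow_add, ← pow_succ, ← pow_add]; congr 1; omega
      rw [e6, pow_add]
      rw [pow_add] at hx
      linear_combination hx
    rw [e5, pow_succ, mul_dvd_mul_iff_left (by positivity)]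
    have e7 : (x : ZMod 2) + k1 * (p : ℕ) + k2 * (q : ℕ) + k3 * (r : ℕ) + k4 * (w : ℕ) =
      ((x + k1 * p + k2 * q + k3 * r + k4 * w + 2 * (2 ^ (j - s - 1) * Q) : ℤ) : ZMod 2) := by
      have : (2 : ZMod 2) = 0 := rfl
      push_cast
      rw [this]; ring
    rw [e7, ZMod.intCast_zmod_eq_zero_iff_dvd]
    rfl
  · have e : ind (j + s) D a b c d = 0 := if_neg hD
    rw [e, mul_zero]
    refine Finset.sum_eq_zero fun p _ => Finset.sum_eq_zero fun q _ => Finset.sum_eq_zero fun r _ =>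
      Finset.sum_eq_zero fun w _ => if_neg ?_
    intro h'
    apply hD
    have h2 := dsc_shift (j := j) (by omega) h p q r w
    rw [← dvd_congr h2]
    refine dvd_trans (pow_dvd_pow 2 (Nat.le_succ _)) ?_
    push_cast at h'
    exact h'

/-- count over a box -/
def SS (j t : ℕ) (D : ℤ) : ℕ := ∑ a ∈ Finset.range (2 ^ j), ∑ b ∈ Finset.range (2 ^ j), ∑ c ∈ Finset.range (2 ^ j),
  ∑ d ∈ Finset.range (2 ^ j), ind t D a b c d

lemma sum_double (j : ℕ) (f : ℕ → ℕ) : ∑ a ∈ Finset.range (2 ^ (j + 1)), f a =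
    ∑ a ∈ Finset.range (2 ^ j), (f a + f (a + 2 ^ j)) := by
  rw [pow_succ, mul_two, Finset.sum_range_add, Finset.sum_add_distrib]
  simp only [add_comm]

lemma SS_succ (j t : ℕ) (D : ℤ) : SS (j + 1) t D = ∑ a ∈ Finset.range (2 ^ j), ∑ b ∈ Finset.range (2 ^ j),
    ∑ c ∈ Finset.range (2 ^ j), ∑ d ∈ Finset.range (2 ^ j),
    ∑ p ∈ Finset.range 2, ∑ q ∈ Finset.range 2, ∑ r ∈ Finset.range 2, ∑ w ∈ Finset.range 2,
      ind t D (a + 2 ^ j * p) (b + 2 ^ j * q) (c + 2 ^ j * r) (d + 2 ^ j * w) := by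
  unfold SS
  simp only [sum_double]
  simp only [← Finset.sum_add_distrib]
  refine Finset.sum_congr rfl fun a _ => Finset.sum_congr rfl fun b _ => Finset.sum_congr rfl fun c _ =>
      Finset.sum_congr rfl fun d _ => ?_
  simp only [Finset.sum_range_succ, Finset.sum_range_zero, mul_zero, mul_one, add_zero, zero_add]

lemma Gd_one (a b c d : ℤ) : Gd 1 a b c d := by
  unfold Gd g1 g2 g3 g4
  refine ⟨⟨a * d ^ 2 - 3 * b * c * d + 2 * c ^ 3, by ring⟩, ⟨-3 * a * c * d - 3 * b * c ^ 2 + 6 * b ^ 2 * d, by ring⟩,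
    ⟨-3 * a * b * d - 3 * b ^ 2 * c + 6 * a * c ^ 2, by ring⟩, ⟨a ^ 2 * d - 3 * a * b * c + 2 * b ^ 3, by ring⟩⟩

instance (s : ℕ) (a b c d : ℤ) : Decidable (Gd s a b c d) := by unfold Gd; infer_instance

lemma table4 : ∀ a ∈ Finset.range 4, ∀ b ∈ Finset.range 4, ∀ c ∈ Finset.range 4, ∀ d ∈ Finset.range 4,
    (dsc (a : ℤ) (b : ℤ) (c : ℤ) (d : ℤ) % 2 = 1 → ¬ Gd 2 (a : ℤ) (b : ℤ) (c : ℤ) (d : ℤ)) ∧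
    (dsc (a : ℤ) (b : ℤ) (c : ℤ) (d : ℤ) % 4 = 0 → Gd 2 (a : ℤ) (b : ℤ) (c : ℤ) (d : ℤ)) := by
  decide +kernel

lemma table8 : ∀ a ∈ Finset.range 8, ∀ b ∈ Finset.range 8, ∀ c ∈ Finset.range 8, ∀ d ∈ Finset.range 8,
    (dsc (a : ℤ) (b : ℤ) (c : ℤ) (d : ℤ) % 16 = 8 ∨ dsc (a : ℤ) (b : ℤ) (c : ℤ) (d : ℤ) % 16 = 12 →
       ¬ Gd 3 (a : ℤ) (b : ℤ) (c : ℤ) (d : ℤ)) := by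
  decide +kernel
lemma base1 : SS 2 3 1 = 48 ∧ SS 2 3 5 = 48 := by decide +kernel
lemma base2 : SS 3 5 8 = 192 ∧ SS 3 5 12 = 192 ∧ SS 3 5 24 = 192 ∧ SS 3 5 28 = 192 := by decide +kernel

lemma Gd_congr {s : ℕ} {a b c d a' b' c' d' : ℤ} (ha : a ≡ a' [ZMOD 2 ^ s]) (hb : b ≡ b' [ZMOD 2 ^ s])
    (hc : c ≡ c' [ZMOD 2 ^ s]) (hd : d ≡ d' [ZMOD 2 ^ s]) : Gd s a b c d ↔ Gd s a' b' c' d' := by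
  have e1 : g1 a b c d ≡ g1 a' b' c' d' [ZMOD 2 ^ s] := by unfold g1; gcongr
  have e2 : g2 a b c d ≡ g2 a' b' c' d' [ZMOD 2 ^ s] := by unfold g2; gcongr
  have e3 : g3 a b c d ≡ g3 a' b' c' d' [ZMOD 2 ^ s] := by unfold g3; gcongr
  have e4 : g4 a b c d ≡ g4 a' b' c' d' [ZMOD 2 ^ s] := by unfold g4; gcongr
  unfold Gd
  rw [e1.dvd_iff, e2.dvd_iff, e3.dvd_iff, e4.dvd_iff]

lemma nat_split (j a : ℕ) : (a : ℤ) = ((a % 2 ^ j : ℕ) : ℤ) + 2 ^ j * ((a / 2 ^ j : ℕ) : ℤ) := by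
  exact_mod_cast (Nat.mod_add_div a (2 ^ j)).symm

lemma nat_modEq (j a : ℕ) : (a : ℤ) ≡ ((a % 2 ^ j : ℕ) : ℤ) [ZMOD 2 ^ j] := by
  conv_lhs => rw [nat_split j a]
  simp [Int.ModEq]

lemma dsc_red (j : ℕ) (hj : 1 ≤ j) (a b c d : ℕ) :
    (2 : ℤ) ^ (j + 1) ∣ dsc (a : ℤ) b c d - dsc ((a % 2 ^ j : ℕ) : ℤ) ((b % 2 ^ j : ℕ) : ℤ) ((c % 2 ^ j : ℕ) : ℤ) ((d % 2 ^ j : ℕ) : ℤ) := by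
  conv_rhs => rw [nat_split j a, nat_split j b, nat_split j c, nat_split j d]
  simpa using dsc_shift hj (Gd_one ((a % 2 ^ j : ℕ) : ℤ) ((b % 2 ^ j : ℕ) : ℤ) ((c % 2 ^ j : ℕ) : ℤ) ((d % 2 ^ j : ℕ) : ℤ)) (a / 2 ^ j : ℕ) (b / 2 ^ j : ℕ) (c / 2 ^ j : ℕ) (d / 2 ^ j : ℕ)

lemma not_Gd_two {a b c d : ℕ} (h : dsc (a : ℤ) b c d % 2 = 1) : ¬ Gd 2 a b c d := by
  rw [Gd_congr (nat_modEq 2 a) (nat_modEq 2 b) (nat_modEq 2 c) (nat_modEq 2 d)]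
  refine (table4 _ (Finset.mem_range.2 (Nat.mod_lt _ (by norm_num))) _ (Finset.mem_range.2 (Nat.mod_lt _ (by norm_num))) _ (Finset.mem_range.2 (Nat.mod_lt _ (by norm_num))) _ (Finset.mem_range.2 (Nat.mod_lt _ (by norm_num)))).1 ?_
  have := dsc_red 2 (by norm_num) a b c d
  norm_num at this ⊢
  omega

lemma Gd_two {a b c d : ℕ} (h : dsc (a : ℤ) b c d % 4 = 0) : Gd 2 a b c d := by
  rw [Gd_congr (nat_modEq 2 a) (nat_modEq 2 b) (nat_modEq 2 c) (nat_modEq 2 d)]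
  refine (table4 _ (Finset.mem_range.2 (Nat.mod_lt _ (by norm_num))) _ (Finset.mem_range.2 (Nat.mod_lt _ (by norm_num))) _ (Finset.mem_range.2 (Nat.mod_lt _ (by norm_num))) _ (Finset.mem_range.2 (Nat.mod_lt _ (by norm_num)))).2 ?_
  have := dsc_red 2 (by norm_num) a b c d
  norm_num at this ⊢
  omega

lemma not_Gd_three {a b c d : ℕ} (h : dsc (a : ℤ) b c d % 16 = 8 ∨ dsc (a : ℤ) b c d % 16 = 12) : ¬ Gd 3 a b c d := by
  rw [Gd_congr (nat_modEq 3 a) (nat_modEq 3 b) (nat_modEq 3 c) (nat_modEq 3 d)]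
  refine (table8 _ (Finset.mem_range.2 (Nat.mod_lt _ (by norm_num))) _ (Finset.mem_range.2 (Nat.mod_lt _ (by norm_num))) _ (Finset.mem_range.2 (Nat.mod_lt _ (by norm_num))) _ (Finset.mem_range.2 (Nat.mod_lt _ (by norm_num)))) ?_
  have := dsc_red 3 (by norm_num) a b c d
  norm_num at this ⊢
  omega

/-- sum over `{0,1}^4` of an indicator vanishes when dsc is wrong mod `2^i` -/
lemma zero_sum {i j t : ℕ} (hj : 1 ≤ j) (hi : i ≤ j + 1) (hit : i ≤ t) {a b c d : ℕ} {D : ℤ}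
    (h : ¬ (2 : ℤ) ^ i ∣ dsc (a : ℤ) b c d - D) :
    ∑ p ∈ Finset.range 2, ∑ q ∈ Finset.range 2, ∑ r ∈ Finset.range 2, ∑ w ∈ Finset.range 2,
      ind t D (a + 2 ^ j * p) (b + 2 ^ j * q) (c + 2 ^ j * r) (d + 2 ^ j * w) = 0 := by
  refine Finset.sum_eq_zero fun p _ => Finset.sum_eq_zero fun q _ => Finset.sum_eq_zero fun r _ =>
      Finset.sum_eq_zero fun w _ => if_neg ?_
  intro h'
  apply h
  have h2 := (pow_dvd_pow (2 : ℤ) hi).trans (dsc_shift (j := j) hj (Gd_one a b c d) p q r w)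
  rw [← dvd_congr h2]
  refine dvd_trans (pow_dvd_pow 2 hit) ?_
  push_cast at h'
  exact h'

lemma ind_zero {i t : ℕ} (hit : i ≤ t) {a b c d : ℕ} {D : ℤ} (h : ¬ (2 : ℤ) ^ i ∣ dsc (a : ℤ) b c d - D) :
    ind t D a b c d = 0 := if_neg fun h' => h ((pow_dvd_pow 2 hit).trans h')

lemma SS_step1 {j : ℕ} (hj : 2 ≤ j) {D : ℤ} (hD : D % 4 = 1) : SS (j + 1) (j + 2) D = 8 * SS j (j + 1) D := by
  rw [SS_succ]
  unfold SS
  simp only [Finset.mul_sum]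
  refine Finset.sum_congr rfl fun a _ => Finset.sum_congr rfl fun b _ => Finset.sum_congr rfl fun c _ =>
      Finset.sum_congr rfl fun d _ => ?_
  by_cases h : (2 : ℤ) ^ 1 ∣ dsc (a : ℤ) b c d - D
  · exact hensel_step (s := 1) hj (Gd_one _ _ _ _) (not_Gd_two (by omega)) D
  · rw [zero_sum (by omega) (by omega) (by omega) h, ind_zero (by omega) h, mul_zero]

lemma SS_step2 {j : ℕ} (hj : 3 ≤ j) {D : ℤ} (hD : D % 16 = 8 ∨ D % 16 = 12) : SS (j + 1) (j + 3) D = 8 * SS j (j + 2) D := by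
  rw [SS_succ]
  unfold SS
  simp only [Finset.mul_sum]
  refine Finset.sum_congr rfl fun a _ => Finset.sum_congr rfl fun b _ => Finset.sum_congr rfl fun c _ =>
      Finset.sum_congr rfl fun d _ => ?_
  by_cases h : (2 : ℤ) ^ 4 ∣ dsc (a : ℤ) b c d - D
  · exact hensel_step (s := 2) hj (Gd_two (by omega)) (not_Gd_three (by omega)) D
  · rw [zero_sum (by omega) (by omega) (by omega) h, ind_zero (by omega) h, mul_zero]

lemma pad_aux {s j t : ℕ} (hj : s ≤ j) (ht : t ≤ j + s) {a b c d : ℕ} (h : Gd s a b c d) (D : ℤ) :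
    ∑ p ∈ Finset.range 2, ∑ q ∈ Finset.range 2, ∑ r ∈ Finset.range 2, ∑ w ∈ Finset.range 2,
      ind t D (a + 2 ^ j * p) (b + 2 ^ j * q) (c + 2 ^ j * r) (d + 2 ^ j * w) = 16 * ind t D a b c d := by
  have : ∀ p q r w : ℕ, ind t D (a + 2 ^ j * p) (b + 2 ^ j * q) (c + 2 ^ j * r) (d + 2 ^ j * w) = ind t D a b c d := by
    intro p q r w
    unfold ind
    congr 1
    apply propext
    have h2 := (pow_dvd_pow (2 : ℤ) ht).trans (dsc_shift (j := j) hj h p q r w)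
    push_cast
    exact dvd_congr h2
  simp only [this, Finset.sum_const, Finset.card_range, smul_eq_mul]
  ring

lemma SS_pad1 {j t : ℕ} (hj : 1 ≤ j) (ht : t ≤ j + 1) (D : ℤ) : SS (j + 1) t D = 16 * SS j t D := by
  rw [SS_succ]
  unfold SS
  simp only [Finset.mul_sum]
  refine Finset.sum_congr rfl fun a _ => Finset.sum_congr rfl fun b _ => Finset.sum_congr rfl fun c _ =>
      Finset.sum_congr rfl fun d _ => pad_aux hj ht (Gd_one _ _ _ _) D

lemma SS_pad2 {j : ℕ} (hj : 2 ≤ j) {D : ℤ} (hD : D % 4 = 0) : SS (j + 1) (j + 2) D = 16 * SS j (j + 2) D := by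
  rw [SS_succ]
  unfold SS
  simp only [Finset.mul_sum]
  refine Finset.sum_congr rfl fun a _ => Finset.sum_congr rfl fun b _ => Finset.sum_congr rfl fun c _ =>
      Finset.sum_congr rfl fun d _ => ?_
  by_cases h : (2 : ℤ) ^ 2 ∣ dsc (a : ℤ) b c d - D
  · exact pad_aux hj le_rfl (Gd_two (by omega)) D
  · rw [zero_sum (by omega) (by omega) (by omega) h, ind_zero (by omega) h, mul_zero]

lemma SS_congr {j t : ℕ} {D E : ℤ} (h : D % 2 ^ t = E) : SS j t D = SS j t E := by
  subst h
  unfold SS ind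
  have : ∀ x : ℤ, (2 : ℤ) ^ t ∣ x - D ↔ (2 : ℤ) ^ t ∣ x - D % 2 ^ t := by
    intro x
    have : x - D % 2 ^ t = (x - D) + 2 ^ t * (D / 2 ^ t) := by
      have := Int.emod_add_mul_ediv D (2 ^ t)
      linear_combination -this
    rw [this]
    exact (dvd_add_left (Dvd.intro _ rfl)).symm
  simp only [this]

lemma SS_odd (i : ℕ) {D : ℤ} (hD : D % 4 = 1) : SS (i + 2) (i + 3) D = 48 * 8 ^ i := by
  induction i with
  | zero =>
    have : D % 8 = 1 ∨ D % 8 = 5 := by omega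
    rcases this with h | h
    · rw [SS_congr (E := 1) (by simpa using h)]; simpa using base1.1
    · rw [SS_congr (E := 5) (by simpa using h)]; simpa using base1.2
  | succ i ih =>
    rw [show i + 1 + 2 = (i + 2) + 1 by ring, show i + 1 + 3 = (i + 2) + 2 by ring, SS_step1 (by omega) hD]
    rw [show i + 2 + 1 = i + 3 by ring, ih]; ring

lemma SS_even (i : ℕ) {D : ℤ} (hD : D % 16 = 8 ∨ D % 16 = 12) : SS (i + 3) (i + 5) D = 192 * 8 ^ i := by
  induction i with
  | zero =>
    have : D % 32 = 8 ∨ D % 32 = 12 ∨ D % 32 = 24 ∨ D % 32 = 28 := by omega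
    obtain ⟨b1, b2, b3, b4⟩ := base2
    rcases this with h | h | h | h
    · rw [SS_congr (E := 8) (by simpa using h)]; simpa using b1
    · rw [SS_congr (E := 12) (by simpa using h)]; simpa using b2
    · rw [SS_congr (E := 24) (by simpa using h)]; simpa using b3
    · rw [SS_congr (E := 28) (by simpa using h)]; simpa using b4
  | succ i ih =>
    rw [show i + 1 + 3 = (i + 3) + 1 by ring, show i + 1 + 5 = (i + 3) + 3 by ring, SS_step2 (by omega) hD]
    rw [show i + 3 + 2 = i + 5 by ring, ih]; ring

lemma SS_full (i : ℕ) {D : ℤ} (hD : D % 4 = 1 ∨ D % 16 = 8 ∨ D % 16 = 12) : 2 * SS (i + 5) (i + 5) D = 3 * (2 ^ (i + 5)) ^ 3 := by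
  rcases hD with hD | hD
  · rw [show i + 5 = (i + 4) + 1 by ring, SS_pad1 (by omega) (by omega), show i + 4 = (i + 2) + 2 by ring,
      show i + 2 + 2 + 1 = (i + 2) + 3 by ring, SS_odd _ hD]
    have h8 : (8 : ℕ) ^ i = (2 ^ i) ^ 3 := by rw [← pow_mul, mul_comm, pow_mul]; norm_num
    have h9 : (8 : ℕ) ^ (i + 2) = 8 ^ i * 64 := by rw [pow_add]; norm_num
    simp only [h9, h8]
    ring
  · rw [show SS (i + 5) (i + 5) D = SS ((i + 4) + 1) (i + 5) D from rfl, SS_pad1 (by omega) (by omega),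
      show SS (i + 4) (i + 5) D = SS ((i + 3) + 1) ((i + 3) + 2) D from rfl, SS_pad2 (by omega) (by omega),
      show SS (i + 3) (i + 3 + 2) D = SS (i + 3) (i + 5) D from rfl, SS_even _ hD]
    have h8 : (8 : ℕ) ^ i = (2 ^ i) ^ 3 := by rw [← pow_mul, mul_comm, pow_mul]; norm_num
    have h9 : (8 : ℕ) ^ (i + 2) = 8 ^ i * 64 := by rw [pow_add]; norm_num
    simp only [h9, h8]
    ring

lemma cnt_two {k : ℕ} (hk : 5 ≤ k) {D : ℤ} (hD : D % 4 = 1 ∨ D % 16 = 8 ∨ D % 16 = 12) :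
    (cnt (2 ^ k) (D : ZMod (2 ^ k)) : ℝ) = ((2 ^ k : ℕ) : ℝ) ^ 3 * (3 / 2) := by
  obtain ⟨i, rfl⟩ : ∃ i, k = i + 5 := ⟨k - 5, by omega⟩
  have key : ∀ f : ZMod (2 ^ (i + 5)) → ℕ, ∑ a, f a = ∑ a ∈ Finset.range (2 ^ (i + 5)), f (a : ZMod (2 ^ (i + 5))) := by
    intro f
    symm
    refine Finset.sum_bij (fun a _ => (a : ZMod (2 ^ (i + 5)))) (fun _ _ => Finset.mem_univ _) ?_ ?_ (fun _ _ => rfl)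
    · intro a ha b hb hab
      rw [ZMod.natCast_eq_natCast_iff] at hab
      exact Nat.ModEq.eq_of_lt_of_lt hab (Finset.mem_range.1 ha) (Finset.mem_range.1 hb)
    · intro b _
      exact ⟨b.val, Finset.mem_range.2 (ZMod.val_lt b), ZMod.natCast_zmod_val b⟩
  have h1 : cnt (2 ^ (i + 5)) (D : ZMod (2 ^ (i + 5))) = SS (i + 5) (i + 5) D := by
    rw [cnt_eq_sum]
    simp only [key]
    unfold SS ind
    refine Finset.sum_congr rfl fun a _ => Finset.sum_congr rfl fun b _ => Finset.sum_congr rfl fun c _ =>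
      Finset.sum_congr rfl fun d _ => ?_
    congr 1
    apply propext
    rw [← sub_eq_zero]
    have : dsc (a : ZMod (2 ^ (i + 5))) b c d - (D : ZMod (2 ^ (i + 5))) = ((dsc (a : ℤ) b c d - D : ℤ) : ZMod (2 ^ (i + 5))) := by
      unfold dsc; push_cast; ring
    rw [this, ZMod.intCast_zmod_eq_zero_iff_dvd]
    push_cast; rfl
  rw [h1]
  have h2 : (2 * SS (i + 5) (i + 5) D : ℝ) = 3 * (2 ^ (i + 5)) ^ 3 := by exact_mod_cast SS_full i hD
  push_cast
  linarith
end NH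

namespace NH

lemma dsc_map {R S : Type*} [CommRing R] [CommRing S] (f : R →+* S) (a b c d : R) :
    f (dsc a b c d) = dsc (f a) (f b) (f c) (f d) := by
  unfold dsc
  simp only [map_add, map_sub, map_mul, map_pow, map_ofNat]

lemma cnt_mul {m n : ℕ} (h : m.Coprime n) (D : ℤ) :
    cnt (m * n) (D : ZMod (m * n)) = cnt m (D : ZMod m) * cnt n (D : ZMod n) := by
  unfold cnt
  rw [← Nat.card_prod]
  obtain ⟨e⟩ : Nonempty (ZMod (m * n) ≃+* ZMod m × ZMod n) := ⟨ZMod.chineseRemainder h⟩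
  have h1 : ∀ x : ZMod (m * n) × ZMod (m * n) × ZMod (m * n) × ZMod (m * n),
      dsc x.1 x.2.1 x.2.2.1 x.2.2.2 = (D : ZMod (m * n)) ↔
      dsc (e x.1).1 (e x.2.1).1 (e x.2.2.1).1 (e x.2.2.2).1 = (D : ZMod m) ∧
      dsc (e x.1).2 (e x.2.1).2 (e x.2.2.1).2 (e x.2.2.2).2 = (D : ZMod n) := by
    intro x
    rw [← e.injective.eq_iff]
    have : e (dsc x.1 x.2.1 x.2.2.1 x.2.2.2) = dsc (e x.1) (e x.2.1) (e x.2.2.1) (e x.2.2.2) := dsc_map e.toRingHom _ _ _ _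
    rw [this, map_intCast, Prod.ext_iff]
    have e1 := dsc_map (RingHom.fst (ZMod m) (ZMod n)) (e x.1) (e x.2.1) (e x.2.2.1) (e x.2.2.2)
    have e2 := dsc_map (RingHom.snd (ZMod m) (ZMod n)) (e x.1) (e x.2.1) (e x.2.2.1) (e x.2.2.2)
    simp only [RingHom.coe_fst, RingHom.coe_snd] at e1 e2
    rw [e1, e2]
    rfl
  refine Nat.card_congr
    { toFun := fun x => (⟨((e x.1.1).1, (e x.1.2.1).1, (e x.1.2.2.1).1, (e x.1.2.2.2).1), ((h1 x.1).1 x.2).1⟩,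
        ⟨((e x.1.1).2, (e x.1.2.1).2, (e x.1.2.2.1).2, (e x.1.2.2.2).2), ((h1 x.1).1 x.2).2⟩)
      invFun := fun y => ⟨(e.symm (y.1.1.1, y.2.1.1), e.symm (y.1.1.2.1, y.2.1.2.1), e.symm (y.1.1.2.2.1, y.2.1.2.2.1),
        e.symm (y.1.1.2.2.2, y.2.1.2.2.2)), (h1 _).2 ?_⟩
      left_inv := ?_
      right_inv := ?_ }
  · simp only [RingEquiv.apply_symm_apply]
    exact ⟨y.1.2, y.2.2⟩
  · rintro ⟨⟨a, b, c, d⟩, hx⟩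
    simp
  · rintro ⟨⟨⟨a, b, c, d⟩, hx⟩, ⟨⟨a', b', c', d'⟩, hx'⟩⟩
    simp

/-- local density -/
noncomputable def wt (p : ℕ) : ℝ := if p = 2 then 3 / 2 else 1 - 1 / (p : ℝ) ^ 2

/-- locally fundamental at all primes dividing `q` -/
def LocF (q : ℕ) (D : ℤ) : Prop := ∀ p : ℕ, p.Prime → p ∣ q →
  (p ≠ 2 → p ^ 2 ∣ q ∧ ¬ (p : ℤ) ^ 2 ∣ D) ∧ (p = 2 → 32 ∣ q ∧ (D % 4 = 1 ∨ D % 16 = 8 ∨ D % 16 = 12))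

lemma LocF.left {m n : ℕ} {D : ℤ} (h : LocF (m * n) D) (hc : m.Coprime n) : LocF m D := by
  intro p hp hpm
  obtain ⟨h1, h2⟩ := h p hp (hpm.mul_right n)
  have hpn : p.Coprime n := Nat.Coprime.coprime_dvd_left hpm hc
  refine ⟨fun hp2 => ⟨?_, (h1 hp2).2⟩, fun hp2 => ⟨?_, (h2 hp2).2⟩⟩
  · exact (hpn.pow_left 2).dvd_of_dvd_mul_right (h1 hp2).1
  · subst hp2
    exact (hpn.pow_left 5).dvd_of_dvd_mul_right (h2 rfl).1

theorem cnt_eq {q : ℕ} (hq : 0 < q) {D : ℤ} (h : LocF q D) :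
    (cnt q (D : ZMod q) : ℝ) = (q : ℝ) ^ 3 * ∏ p ∈ q.primeFactors, wt p := by
  induction q using Nat.recOnPosPrimePosCoprime with
  | zero => omega
  | one =>
    have : cnt 1 (D : ZMod 1) = 1 := by
      unfold cnt
      rw [Nat.card_eq_one_iff_unique]
      constructor
      · constructor
        rintro ⟨x, _⟩ ⟨y, _⟩
        have : x = y := Subsingleton.elim _ _
        subst this; rfl
      · exact ⟨⟨(0, 0, 0, 0), Subsingleton.elim _ _⟩⟩
    rw [this]; simp
  | prime_pow p k hp hk =>
    rw [Nat.primeFactors_prime_pow hk.ne' hp, Finset.prod_singleton]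
    obtain ⟨h1, h2⟩ := h p hp (dvd_pow_self p hk.ne')
    by_cases hp2 : p = 2
    · subst hp2
      rw [cnt_two _ (h2 rfl).2, wt, if_pos rfl]
      have := (h2 rfl).1
      rw [show 32 = 2 ^ 5 by norm_num, Nat.pow_dvd_pow_iff_le_right (by norm_num)] at this
      exact this
    · rw [cnt_odd hp hp2 _ (h1 hp2).2, wt, if_neg hp2]
      have := (h1 hp2).1
      rwa [Nat.pow_dvd_pow_iff_le_right hp.one_lt] at this
  | coprime m n hm hn hc ihm ihn =>
    rw [cnt_mul hc]
    have hr : LocF (n * m) D := by rwa [mul_comm]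
    push_cast
    rw [ihm (by omega) (h.left hc), ihn (by omega) (hr.left hc.symm), hc.primeFactors_mul,
      Finset.prod_union hc.disjoint_primeFactors]
    ring
end NH

namespace NH
open MeasureTheory

abbrev Z4 := ℤ × ℤ × ℤ × ℤ
abbrev R4 := ℝ × ℝ × ℝ × ℝ

/-- scaling -/
noncomputable def scl (T : ℝ) (F : Z4) : R4 := (F.1 / T, F.2.1 / T, F.2.2.1 / T, F.2.2.2 / T)

/-- congruence mod q -/
def Cong (q : ℕ) (F G : Z4) : Prop := (q : ℤ) ∣ F.1 - G.1 ∧ (q : ℤ) ∣ F.2.1 - G.2.1 ∧ (q : ℤ) ∣ F.2.2.1 - G.2.2.1 ∧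
  (q : ℤ) ∣ F.2.2.2 - G.2.2.2

/-- box -/
def bx (K : ℝ) : Set R4 := Set.Icc (-K) K ×ˢ Set.Icc (-K) K ×ˢ Set.Icc (-K) K ×ˢ Set.Icc (-K) K

lemma box_finite {T K : ℝ} (hT : 0 < T) : {F : Z4 | scl T F ∈ bx K}.Finite := by
  have h1 : ∀ n : ℤ, (n : ℝ) / T ∈ Set.Icc (-K) K → n ∈ Set.Icc (-⌈K * T⌉) ⌈K * T⌉ := by
    intro n hn
    have h2 : (n : ℝ) ≤ K * T := (div_le_iff₀ hT).1 hn.2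
    have h3 : -K * T ≤ n := (le_div_iff₀ hT).1 hn.1
    constructor
    · have : (-⌈K * T⌉ : ℝ) ≤ n := by have := Int.le_ceil (K * T); linarith
      exact_mod_cast this
    · have : (n : ℝ) ≤ ⌈K * T⌉ := h2.trans (Int.le_ceil _)
      exact_mod_cast this
  refine Set.Finite.subset (s := Set.Icc (-⌈K * T⌉) ⌈K * T⌉ ×ˢ Set.Icc (-⌈K * T⌉) ⌈K * T⌉ ×ˢ Set.Icc (-⌈K * T⌉) ⌈K * T⌉ ×ˢ
    Set.Icc (-⌈K * T⌉) ⌈K * T⌉) ?_ ?_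
  · exact (Set.finite_Icc _ _).prod ((Set.finite_Icc _ _).prod ((Set.finite_Icc _ _).prod (Set.finite_Icc _ _)))
  · rintro F ⟨a, b, c, d⟩
    exact ⟨h1 _ a, h1 _ b, h1 _ c, h1 _ d⟩

/-- cell -/
def cell (q : ℕ) (T : ℝ) (F : Z4) : Set R4 :=
  Set.Ico ((F.1 : ℝ) / T) ((F.1 + q : ℝ) / T) ×ˢ Set.Ico ((F.2.1 : ℝ) / T) ((F.2.1 + q : ℝ) / T) ×ˢ
  Set.Ico ((F.2.2.1 : ℝ) / T) ((F.2.2.1 + q : ℝ) / T) ×ˢ Set.Ico ((F.2.2.2 : ℝ) / T) ((F.2.2.2 + q : ℝ) / T)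

lemma cell_meas (q : ℕ) (T : ℝ) (F : Z4) : MeasurableSet (cell q T F) :=
  measurableSet_Ico.prod (measurableSet_Ico.prod (measurableSet_Ico.prod measurableSet_Ico))

lemma cell_vol (q : ℕ) (T : ℝ) (F : Z4) : volume (cell q T F) = ENNReal.ofReal (q / T) ^ 4 := by
  have h : ∀ n : ℤ, volume (Set.Ico ((n : ℝ) / T) ((n + q : ℝ) / T)) = ENNReal.ofReal (q / T) := by
    intro n; rw [Real.volume_Ico]; congr 1; ring
  unfold cell
  rw [Measure.volume_eq_prod, Measure.prod_prod, Measure.volume_eq_prod, Measure.prod_prod, Measure.volume_eq_prod, Measure.prod_prod]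
  rw [h, h, h, h]; ring

lemma cell_uniq1 {q : ℕ} {T x : ℝ} (hT : 0 < T) (hq : 0 < q) {m n : ℤ} (h : (q : ℤ) ∣ m - n)
    (hm : x ∈ Set.Ico ((m : ℝ) / T) ((m + q : ℝ) / T)) (hn : x ∈ Set.Ico ((n : ℝ) / T) ((n + q : ℝ) / T)) : m = n := by
  obtain ⟨k, hk⟩ := h
  have h1 := (div_le_iff₀ hT).1 hm.1
  have h2 := (lt_div_iff₀ hT).1 hm.2
  have h3 := (div_le_iff₀ hT).1 hn.1
  have h4 := (lt_div_iff₀ hT).1 hn.2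
  have h5 : (m : ℝ) < n + q := by linarith
  have h6 : (n : ℝ) < m + q := by linarith
  have h5 : m < n + q := by exact_mod_cast h5
  have h6 : n < m + q := by exact_mod_cast h6
  have hq' : (0 : ℤ) < q := by exact_mod_cast hq
  have : k < 1 := by by_contra hh; nlinarith
  have : -1 < k := by by_contra hh; nlinarith
  have : k = 0 := by omega
  subst this; linarith

lemma cell_ex1 {q : ℕ} {T : ℝ} (hT : 0 < T) (hq : 0 < q) (x : ℝ) (n : ℤ) :
    ∃ m : ℤ, (q : ℤ) ∣ m - n ∧ x ∈ Set.Ico ((m : ℝ) / T) ((m + q : ℝ) / T) := by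
  refine ⟨n + q * ⌊(x * T - n) / q⌋, ⟨⌊(x * T - n) / q⌋, by ring⟩, ?_, ?_⟩
  · rw [div_le_iff₀ hT]
    have hq' : (0 : ℝ) < q := by exact_mod_cast hq
    have := Int.floor_le ((x * T - n) / q)
    rw [le_div_iff₀ hq'] at this
    push_cast
    linarith
  · rw [lt_div_iff₀ hT]
    have hq' : (0 : ℝ) < q := by exact_mod_cast hq
    have := Int.lt_floor_add_one ((x * T - n) / q)
    rw [div_lt_iff₀ hq'] at this
    push_cast
    linarith

lemma cell_uniq {q : ℕ} {T : ℝ} (hT : 0 < T) (hq : 0 < q) {F G : Z4} (h : Cong q F G) {x : R4}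
    (hF : x ∈ cell q T F) (hG : x ∈ cell q T G) : F = G := by
  obtain ⟨h1, h2, h3, h4⟩ := h
  obtain ⟨f1, f2, f3, f4⟩ := hF
  obtain ⟨k1, k2, k3, k4⟩ := hG
  refine Prod.ext (cell_uniq1 hT hq h1 f1 k1) (Prod.ext (cell_uniq1 hT hq h2 f2 k2) (Prod.ext (cell_uniq1 hT hq h3 f3 k3)
    (cell_uniq1 hT hq h4 f4 k4)))

lemma cell_ex {q : ℕ} {T : ℝ} (hT : 0 < T) (hq : 0 < q) (x : R4) (G : Z4) : ∃ F, Cong q F G ∧ x ∈ cell q T F := by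
  obtain ⟨a, h1, k1⟩ := cell_ex1 hT hq x.1 G.1
  obtain ⟨b, h2, k2⟩ := cell_ex1 hT hq x.2.1 G.2.1
  obtain ⟨c, h3, k3⟩ := cell_ex1 hT hq x.2.2.1 G.2.2.1
  obtain ⟨d, h4, k4⟩ := cell_ex1 hT hq x.2.2.2 G.2.2.2
  exact ⟨(a, b, c, d), ⟨h1, h2, h3, h4⟩, k1, k2, k3, k4⟩

lemma Cong.symm {q : ℕ} {F G : Z4} (h : Cong q F G) : Cong q G F := by
  obtain ⟨h1, h2, h3, h4⟩ := h
  exact ⟨(dvd_sub_comm).1 h1, (dvd_sub_comm).1 h2, (dvd_sub_comm).1 h3, (dvd_sub_comm).1 h4⟩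
lemma Cong.trans {q : ℕ} {F G H : Z4} (h : Cong q F G) (h' : Cong q G H) : Cong q F H := by
  obtain ⟨h1, h2, h3, h4⟩ := h
  obtain ⟨k1, k2, k3, k4⟩ := h'
  have key : ∀ {x y z : ℤ}, (q : ℤ) ∣ x - y → (q : ℤ) ∣ y - z → (q : ℤ) ∣ x - z := by
    intro x y z h h'
    have := dvd_add h h'
    rwa [sub_add_sub_cancel] at this
  exact ⟨key h1 k1, key h2 k2, key h3 k3, key h4 k4⟩
 
lemma cell_dist {q : ℕ} {T : ℝ} (hT : 0 < T) {F : Z4} {x : R4} (hx : x ∈ cell q T F) : dist (scl T F) x ≤ q / T := by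
  have h : ∀ {n : ℤ} {y : ℝ}, y ∈ Set.Ico ((n : ℝ) / T) ((n + q : ℝ) / T) → dist ((n : ℝ) / T) y ≤ q / T := by
    intro n y hy
    rw [dist_comm, Real.dist_eq, abs_of_nonneg (by linarith [hy.1])]
    have := hy.2
    rw [add_div] at this
    linarith
  obtain ⟨h1, h2, h3, h4⟩ := hx
  simp only [scl, Prod.dist_eq]
  exact max_le (h h1) (max_le (h h2) (max_le (h h3) (h h4)))

/-- lattice points -/
def Latt (q : ℕ) (G : Z4) (T : ℝ) (R : Set R4) : Set Z4 := {F | Cong q F G ∧ scl T F ∈ R}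

theorem lattice_count {q : ℕ} (hq : 0 < q) (G : Z4) {R : Set R4} {K : ℝ} (hR : R ⊆ bx K) (hm : MeasurableSet R)
    (hb : ∀ᵐ x : R4, ∀ᶠ y in nhds x, (y ∈ R ↔ x ∈ R)) :
    Tendsto (fun T : ℝ => ((Latt q G T R).ncard : ℝ) * (q / T) ^ 4) atTop (nhds (volume R).toReal) := by
  have hfin : ∀ T : ℝ, 0 < T → (Latt q G T R).Finite := fun T hT =>
    (box_finite (K := K) hT).subset fun F hF => hR hF.2
  have hK : ∀ x ∈ bx (K + 1), True := fun _ _ => trivial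
  let U : ℝ → Set R4 := fun T => if 0 < T then ⋃ F ∈ Latt q G T R, cell q T F else ∅
  have hU : ∀ T, 0 < T → U T = ⋃ F ∈ Latt q G T R, cell q T F := fun T hT => if_pos hT
  have hUm : ∀ T, MeasurableSet (U T) := by
    intro T
    by_cases hT : 0 < T
    · rw [hU T hT]
      exact (hfin T hT).measurableSet_biUnion fun F _ => cell_meas q T F
    · simp only [U, if_neg hT]; exact MeasurableSet.empty
  have hUv : ∀ T, 0 < T → (volume (U T)).toReal = ((Latt q G T R).ncard : ℝ) * (q / T) ^ 4 := by
    intro T hT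
    have hfin' := hfin T hT
    rw [hU T hT, measure_biUnion hfin'.countable]
    · simp only [cell_vol]
      rw [ENNReal.tsum_set_const, ENNReal.toReal_mul, ENNReal.toReal_pow, ENNReal.toReal_ofReal (by positivity)]
      congr 1
      rw [← hfin'.cast_ncard_eq]
      simp
    · intro F hF F' hF' hne
      rw [Function.onFun, Set.disjoint_left]
      intro x hx hx'
      exact hne (cell_uniq hT hq (hF.1.trans hF'.1.symm) hx hx')
    · intro F _; exact cell_meas q T F
  have hlim : Tendsto (fun T => volume (U T)) atTop (nhds (volume R)) := by
    refine tendsto_measure_of_ae_tendsto_indicator atTop hm hUm (B := bx (K + 1)) ?_ ?_ ?_ ?_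
    · exact measurableSet_Icc.prod (measurableSet_Icc.prod (measurableSet_Icc.prod measurableSet_Icc))
    · have : IsCompact (bx (K + 1)) := isCompact_Icc.prod (isCompact_Icc.prod (isCompact_Icc.prod isCompact_Icc))
      exact this.measure_lt_top.ne
    · filter_upwards [eventually_ge_atTop (max 1 (q : ℝ))] with T hT
      have hT1 : 0 < T := lt_of_lt_of_le one_pos ((le_max_left _ _).trans hT)
      rw [hU T hT1]
      refine Set.iUnion₂_subset fun F hF x hx => ?_
      have hd := cell_dist hT1 hx
      have h1 : (q : ℝ) / T ≤ 1 := (div_le_one hT1).2 ((le_max_right _ _).trans hT)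
      have hF2 := hR hF.2
      have key : ∀ {u v : ℝ}, dist u v ≤ 1 → u ∈ Set.Icc (-K) K → v ∈ Set.Icc (-(K + 1)) (K + 1) := by
        intro u v h hu
        rw [Real.dist_eq, abs_le] at h
        constructor <;> linarith [hu.1, hu.2, h.1, h.2]
      have hd := hd.trans h1
      simp only [scl, Prod.dist_eq, max_le_iff] at hd
      obtain ⟨k1, k2, k3, k4⟩ := hF2
      exact ⟨key hd.1 k1, key hd.2.1 k2, key hd.2.2.1 k3, key hd.2.2.2 k4⟩
    · filter_upwards [hb] with x hx
      obtain ⟨δ, hδ, hx⟩ := Metric.eventually_nhds_iff.1 hx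
      filter_upwards [eventually_gt_atTop (max 1 (q / δ : ℝ))] with T hT
      have hT1 : 0 < T := lt_trans one_pos (lt_of_le_of_lt (le_max_left _ _) hT)
      have hT2 : (q : ℝ) / T < δ := by
        rw [div_lt_iff₀ hT1]
        have := lt_of_le_of_lt (le_max_right _ _) hT
        rw [div_lt_iff₀ hδ] at this
        linarith
      obtain ⟨F, hF, hxF⟩ := cell_ex hT1 hq x G
      have h3 := hx (lt_of_le_of_lt (cell_dist hT1 hxF) hT2)
      rw [← h3, hU T hT1]
      constructor
      · intro h
        obtain ⟨F', hF', hx'⟩ := Set.mem_iUnion₂.1 h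
        have := cell_uniq hT1 hq (hF.trans hF'.1.symm) hxF hx'
        subst this
        exact hF'.2
      · intro h
        exact Set.mem_iUnion₂.2 ⟨F, ⟨hF, h⟩, hxF⟩
  have hfinR : volume R ≠ ⊤ := by
    have : IsCompact (bx K) := isCompact_Icc.prod (isCompact_Icc.prod (isCompact_Icc.prod isCompact_Icc))
    exact ((measure_mono hR).trans_lt this.measure_lt_top).ne
  have := (ENNReal.tendsto_toReal hfinR).comp hlim
  refine this.congr' ?_
  filter_upwards [eventually_gt_atTop (0 : ℝ)] with T hT
  exact hUv T hT

/-- reduction mod q -/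
def rdq (q : ℕ) (F : Z4) : ZMod q × ZMod q × ZMod q × ZMod q := (F.1, F.2.1, F.2.2.1, F.2.2.2)

lemma rdq_iff {q : ℕ} {F G : Z4} : rdq q F = rdq q G ↔ Cong q F G := by
  unfold rdq Cong
  simp only [Prod.mk.injEq]
  have : ∀ x y : ℤ, (x : ZMod q) = y ↔ (q : ℤ) ∣ x - y := by
    intro x y
    rw [← sub_eq_zero, ← Int.cast_sub, ZMod.intCast_zmod_eq_zero_iff_dvd]
  simp only [this]

lemma rdq_surj (q : ℕ) : Function.Surjective (rdq q) := by
  rintro ⟨a, b, c, d⟩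
  obtain ⟨a, rfl⟩ := ZMod.intCast_surjective a
  obtain ⟨b, rfl⟩ := ZMod.intCast_surjective b
  obtain ⟨c, rfl⟩ := ZMod.intCast_surjective c
  obtain ⟨d, rfl⟩ := ZMod.intCast_surjective d
  exact ⟨(a, b, c, d), rfl⟩

theorem lattice_count_set {q : ℕ} (hq : 0 < q) (S : Finset (ZMod q × ZMod q × ZMod q × ZMod q)) {R : Set R4} {K : ℝ}
    (hR : R ⊆ bx K) (hm : MeasurableSet R)
    (hb : ∀ᵐ x : R4, ∀ᶠ y in nhds x, (y ∈ R ↔ x ∈ R)) :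
    Tendsto (fun T : ℝ => ({F : Z4 | rdq q F ∈ S ∧ scl T F ∈ R}.ncard : ℝ) * (q / T) ^ 4) atTop
      (nhds (S.card * (volume R).toReal)) := by
  classical
  induction S using Finset.induction_on with
  | empty => simp
  | insert σ S hσ ih =>
    obtain ⟨G, rfl⟩ := rdq_surj q σ
    have h1 := (lattice_count hq G hR hm hb).add ih
    rw [Finset.card_insert_of_notMem hσ]
    have e : (((S.card + 1 : ℕ) : ℝ)) * (volume R).toReal = (volume R).toReal + S.card * (volume R).toReal := by
      push_cast; ring
    rw [e]
    refine h1.congr' ?_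
    filter_upwards [eventually_gt_atTop (0 : ℝ)] with T hT
    rw [← add_mul, ← Nat.cast_add, ← Set.ncard_union_eq (hs := (box_finite (K := K) hT).subset fun F hF => hR hF.2) (ht := (box_finite (K := K) hT).subset fun F hF => hR hF.2)]
    · congr 3
      ext F
      simp only [Latt, Set.mem_union, Set.mem_ofPred_eq, Finset.mem_insert, rdq_iff]
      tauto
    · rw [Set.disjoint_left]
      rintro F hF hF'
      apply hσ
      rw [← rdq_iff.2 hF.1]
      exact hF'.1
end NH

namespace NH
open MeasureTheory

lemma lint_affine {f g : ℝ → ENNReal} (hf : Measurable f) {k : ℝ} (hk : k ≠ 0) (m : ℝ)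
    (h : ∀ y, ENNReal.ofReal |k| * f (k * y + m) = g y) : ∫⁻ x, f x = ∫⁻ y, g y := by
  calc ∫⁻ x, f x = ∫⁻ x, f (x + m) := (lintegral_add_right_eq_self f m).symm
    _ = ∫⁻ x, f (x + m) ∂(ENNReal.ofReal |k| • Measure.map (k * ·) volume) := by
        rw [Real.smul_map_volume_mul_left hk]
    _ = ENNReal.ofReal |k| * ∫⁻ y, f (k * y + m) := by
        rw [lintegral_smul_measure, lintegral_map (show Measurable (fun x => f (x + m)) from hf.comp (measurable_id.add_const m)) (measurable_const_mul k)]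
        rfl
    _ = ∫⁻ y, ENNReal.ofReal |k| * f (k * y + m) := by
        rw [lintegral_const_mul]
        exact hf.comp ((measurable_const_mul k).add_const m)
    _ = ∫⁻ y, g y := lintegral_congr h

/-- iterated integral -/
noncomputable def I4 (f : ℝ → ℝ → ℝ → ℝ → ENNReal) : ENNReal := ∫⁻ a, ∫⁻ b, ∫⁻ c, ∫⁻ d, f a b c d

/-- uncurrying -/
def M4 (f : ℝ → ℝ → ℝ → ℝ → ENNReal) : Prop := Measurable (fun x : R4 => f x.1 x.2.1 x.2.2.1 x.2.2.2)

lemma I4_eq {f : ℝ → ℝ → ℝ → ℝ → ENNReal} (hf : M4 f) : I4 f = ∫⁻ x : R4, f x.1 x.2.1 x.2.2.1 x.2.2.2 := by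
  unfold M4 at hf
  unfold I4
  rw [Measure.volume_eq_prod, lintegral_prod _ hf.aemeasurable]
  refine lintegral_congr fun a => ?_
  have h2 : Measurable (fun x : ℝ × ℝ × ℝ => f a x.1 x.2.1 x.2.2) := hf.comp (measurable_const.prodMk measurable_id)
  rw [Measure.volume_eq_prod, lintegral_prod _ h2.aemeasurable]
  refine lintegral_congr fun b => ?_
  have h3 : Measurable (fun x : ℝ × ℝ => f a b x.1 x.2) := h2.comp (measurable_const.prodMk measurable_id)
  rw [Measure.volume_eq_prod, lintegral_prod _ h3.aemeasurable]

lemma I3_eq {f : ℝ → ℝ → ℝ → ENNReal} (hf : Measurable (fun x : ℝ × ℝ × ℝ => f x.1 x.2.1 x.2.2)) :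
    ∫⁻ a, ∫⁻ b, ∫⁻ c, f a b c = ∫⁻ x : ℝ × ℝ × ℝ, f x.1 x.2.1 x.2.2 := by
  rw [Measure.volume_eq_prod, lintegral_prod _ hf.aemeasurable]
  refine lintegral_congr fun a => ?_
  have h2 : Measurable (fun x : ℝ × ℝ => f a x.1 x.2) := hf.comp (measurable_const.prodMk measurable_id)
  rw [Measure.volume_eq_prod, lintegral_prod _ h2.aemeasurable]

lemma I4_rot {f : ℝ → ℝ → ℝ → ℝ → ENNReal} (hf : M4 f) : I4 f = I4 (fun b c d a => f a b c d) := by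
  unfold M4 at hf
  have h1 : I4 f = ∫⁻ a : ℝ, ∫⁻ x : ℝ × ℝ × ℝ, f a x.1 x.2.1 x.2.2 := by
    unfold I4
    refine lintegral_congr fun a => I3_eq (f := f a) (hf.comp (measurable_const.prodMk measurable_id))
  rw [h1, lintegral_lintegral_swap hf.aemeasurable]
  unfold I4
  have h2 : Measurable (fun x : ℝ × ℝ × ℝ => ∫⁻ a : ℝ, f a x.1 x.2.1 x.2.2) := by
    have : Measurable (fun y : ((ℝ × ℝ × ℝ) × ℝ) => f y.2 y.1.1 y.1.2.1 y.1.2.2) :=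
      hf.comp (measurable_snd.prodMk measurable_fst)
    exact this.lintegral_prod_right
  exact (I3_eq (f := fun b c d => ∫⁻ a : ℝ, f a b c d) h2).symm

lemma I4_sub {f g : ℝ → ℝ → ℝ → ℝ → ENNReal} (h : ∀ a b c, ∫⁻ d, f a b c d = ∫⁻ d, g a b c d) : I4 f = I4 g := by
  unfold I4
  exact lintegral_congr fun a => lintegral_congr fun b => lintegral_congr fun c => h a b c
end NH

namespace NH
open MeasureTheory Classical

/-- integrand -/
noncomputable def f0 (a b c d : ℝ) : ENNReal := if 0 < a ∧ |qB (a, b, c, d)| < qA (a, b, c, d) ∧ qA (a, b, c, d) < qC (a, b, c, d) ∧ qD (a, b, c, d) < 1 then 1 else 0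
/-- integrand -/
noncomputable def f1' (A t a b : ℝ) (w : ℝ) : ENNReal :=
  if 0 < a ∧ 0 < A ∧ |t| < 1 ∧ a ^ 2 < A - b ^ 2 + a * b * t ∧ A ^ 2 * (4 * (A - b ^ 2 + a * b * t) - a ^ 2 * t ^ 2) < a ^ 2
  then ENNReal.ofReal w else 0
/-- integrand -/
noncomputable def f1 (a b c t : ℝ) : ENNReal := f1' (b ^ 2 - a * c) t a b ((b ^ 2 - a * c) / a)
/-- integrand -/
noncomputable def f2 (t a b A : ℝ) : ENNReal := f1' A t a b (A / a ^ 2)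
/-- integrand -/
noncomputable def f3 (A t a u : ℝ) : ENNReal :=
  if 0 < a ∧ 0 < A ∧ |t| < 1 ∧ a ^ 2 * (4 - t ^ 2) < 4 * A * (1 - u ^ 2) ∧ 4 * A ^ 3 * (1 - u ^ 2) < a ^ 2
  then ENNReal.ofReal (A * √A / a ^ 2) else 0
/-- integrand -/
noncomputable def f4 (u A t α : ℝ) : ENNReal :=
  if 0 < α ∧ 0 < A ∧ |t| < 1 ∧ A ^ 2 * α ^ 2 * (4 - t ^ 2) < 1 - u ^ 2 ∧ 1 - u ^ 2 < α ^ 2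
  then ENNReal.ofReal (1 / (2 * α ^ 2)) else 0

lemma M4_f0 : M4 f0 := by
  unfold M4 f0 qD qA qB qC
  refine Measurable.ite ?_ measurable_const measurable_const
  measurability

lemma M4_f1 : M4 f1 := by
  unfold M4 f1 f1'
  refine Measurable.ite ?_ (by fun_prop) measurable_const
  measurability
lemma M4_f2 : M4 f2 := by
  unfold M4 f2 f1'
  refine Measurable.ite ?_ (by fun_prop) measurable_const
  measurability
lemma M4_f3 : M4 f3 := by
  unfold M4 f3
  refine Measurable.ite ?_ (by fun_prop) measurable_const
  measurability
lemma M4_f4 : M4 f4 := by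
  unfold M4 f4
  refine Measurable.ite ?_ (by fun_prop) measurable_const
  measurability

lemma I_f0 : I4 f0 = I4 f1 := by
  refine I4_sub fun a b c => ?_
  by_cases ha : 0 < a ∧ 0 < b ^ 2 - a * c
  · obtain ⟨ha, hA⟩ := ha
    have hk : -((b ^ 2 - a * c) / a) ≠ 0 := neg_ne_zero.2 (div_pos hA ha).ne'
    refine lint_affine (M4_f0.comp (f := fun d : ℝ => ((a, b, c, d) : R4)) (by fun_prop)) hk (b * c / a) fun t => ?_
    unfold f0 f1 f1'
    generalize hAA : b ^ 2 - a * c = A at *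
    have e1 : qA (a, b, c, -(A / a) * t + b * c / a) = A := by unfold qA; simp only; linarith
    have e2 : qB (a, b, c, -(A / a) * t + b * c / a) = A * t := by unfold qB; field_simp; ring
    have e3 : qC (a, b, c, -(A / a) * t + b * c / a) = A * (A - b ^ 2 + a * b * t) / a ^ 2 := by
      unfold qC; simp only; field_simp; rw [← hAA]; ring
    have e4 : qD (a, b, c, -(A / a) * t + b * c / a) = A ^ 2 * (4 * (A - b ^ 2 + a * b * t) - a ^ 2 * t ^ 2) / a ^ 2 := by
      unfold qD; rw [e1, e2, e3]; field_simp
    simp only [e1, e2, e3, e4, abs_mul, abs_of_pos hA, abs_neg, abs_of_pos (div_pos hA ha), div_lt_one (show 0 < a ^ 2 by positivity), lt_div_iff₀ (show 0 < a ^ 2 by positivity)]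
    have i1 : A * |t| < A ↔ |t| < 1 := by
      constructor
      · intro h; by_contra h'; nlinarith
      · intro h; nlinarith
    have i2 : A * a ^ 2 < A * (A - b ^ 2 + a * b * t) ↔ a ^ 2 < A - b ^ 2 + a * b * t := by
      rw [mul_lt_mul_iff_right₀ hA]
    simp only [i1, i2, hA, true_and]
    split_ifs <;> simp
  · rw [lintegral_congr (g := fun _ => 0), lintegral_congr (f := f1 a b c) (g := fun _ => 0)]
    · intro t
      unfold f1 f1'
      rw [if_neg]
      rintro ⟨h1, h2, -⟩
      exact ha ⟨h1, h2⟩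
    · intro d
      unfold f0
      rw [if_neg]
      rintro ⟨h1, h2, -⟩
      refine ha ⟨h1, ?_⟩
      have := (abs_nonneg _).trans_lt h2
      unfold qA at this
      simpa using this

lemma I4_rot' {f g : ℝ → ℝ → ℝ → ℝ → ENNReal} (hf : M4 g) (h : ∀ a b c d, f b c d a = g a b c d) : I4 f = I4 g := by
  rw [I4_rot hf]
  congr 1
  ext a b c d
  exact h d a b c

lemma I_f1 : I4 f1 = I4 f2 := by
  have hM : M4 (fun t a b c => f1 a b c t) := M4_f1.comp (f := fun x : R4 => ((x.2.1, x.2.2.1, x.2.2.2, x.1) : R4)) (by fun_prop)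
  rw [I4_rot' hM fun _ _ _ _ => rfl]
  refine I4_sub fun t a b => ?_
  by_cases ha : 0 < a
  · have hk : -(1 / a) ≠ 0 := neg_ne_zero.2 (one_div_pos.2 ha).ne'
    refine lint_affine (hM.comp (f := fun c : ℝ => ((t, a, b, c) : R4)) (by fun_prop)) hk (b ^ 2 / a) fun A => ?_
    unfold f1 f2
    have e : b ^ 2 - a * (-(1 / a) * A + b ^ 2 / a) = A := by field_simp; ring
    rw [e, abs_neg, abs_of_pos (one_div_pos.2 ha)]
    unfold f1'
    split_ifs
    · rw [← ENNReal.ofReal_mul (by positivity)]; congr 1; field_simp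
    · simp
  · rw [lintegral_congr (g := fun _ => 0), lintegral_congr (f := f2 t a b) (g := fun _ => 0)]
    · intro t
      unfold f2 f1'
      rw [if_neg]
      exact fun h => ha h.1
    · intro d
      unfold f1 f1'
      rw [if_neg]
      exact fun h => ha h.1

lemma I_f2 : I4 f2 = I4 f3 := by
  have hM : M4 (fun A t a b => f2 t a b A) := M4_f2.comp (f := fun x : R4 => ((x.2.1, x.2.2.1, x.2.2.2, x.1) : R4)) (by fun_prop)
  rw [I4_rot' hM fun _ _ _ _ => rfl]
  refine I4_sub fun A t a => ?_
  by_cases ha : 0 < A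
  · have hs := Real.sqrt_pos.2 ha
    have hss := Real.sq_sqrt ha.le
    refine lint_affine (hM.comp (f := fun c : ℝ => ((A, t, a, c) : R4)) (by fun_prop)) hs.ne' (a * t / 2) fun u => ?_
    unfold f2 f3 f1'
    have e : A - (√A * u + a * t / 2) ^ 2 + a * (√A * u + a * t / 2) * t = A * (1 - u ^ 2) + a ^ 2 * t ^ 2 / 4 := by
      linear_combination (-u ^ 2) * hss
    simp only [e, abs_of_pos hs]
    have i1 : a ^ 2 < A * (1 - u ^ 2) + a ^ 2 * t ^ 2 / 4 ↔ a ^ 2 * (4 - t ^ 2) < 4 * A * (1 - u ^ 2) := by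
      constructor <;> intro h <;> linarith
    have i2 : A ^ 2 * (4 * (A * (1 - u ^ 2) + a ^ 2 * t ^ 2 / 4) - a ^ 2 * t ^ 2) < a ^ 2 ↔ 4 * A ^ 3 * (1 - u ^ 2) < a ^ 2 := by
      constructor <;> intro h <;> linarith
    simp only [i1, i2]
    split_ifs
    · rw [← ENNReal.ofReal_mul (by positivity)]; congr 1; field_simp
    · simp
  · rw [lintegral_congr (g := fun _ => 0), lintegral_congr (f := f3 A t a) (g := fun _ => 0)]
    · intro t
      unfold f3
      rw [if_neg]
      exact fun h => ha h.2.1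
    · intro d
      unfold f2 f1'
      rw [if_neg]
      exact fun h => ha h.2.1

lemma I_f3 : I4 f3 = I4 f4 := by
  have hM : M4 (fun u A t a => f3 A t a u) := M4_f3.comp (f := fun x : R4 => ((x.2.1, x.2.2.1, x.2.2.2, x.1) : R4)) (by fun_prop)
  rw [I4_rot' hM fun _ _ _ _ => rfl]
  refine I4_sub fun u A t => ?_
  by_cases ha : 0 < A
  · have hs := Real.sqrt_pos.2 ha
    have hss := Real.sq_sqrt ha.le
    have hk : 0 < 2 * (A * √A) := by positivity
    refine lint_affine (hM.comp (f := fun c : ℝ => ((u, A, t, c) : R4)) (by fun_prop)) hk.ne' 0 fun α => ?_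
    unfold f3 f4
    have e : (2 * (A * √A) * α) ^ 2 = 4 * A ^ 3 * α ^ 2 := by
      linear_combination (4 * A ^ 2 * α ^ 2) * hss
    simp only [add_zero]
    simp only [e, abs_of_pos hk, mul_pos_iff_of_pos_left hk]
    have i1 : 4 * A ^ 3 * α ^ 2 * (4 - t ^ 2) < 4 * A * (1 - u ^ 2) ↔ A ^ 2 * α ^ 2 * (4 - t ^ 2) < 1 - u ^ 2 := by
      rw [show 4 * A ^ 3 * α ^ 2 * (4 - t ^ 2) = 4 * A * (A ^ 2 * α ^ 2 * (4 - t ^ 2)) by ring, mul_lt_mul_iff_right₀ (show 0 < 4 * A by positivity)]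
    have i2 : 4 * A ^ 3 * (1 - u ^ 2) < 4 * A ^ 3 * α ^ 2 ↔ (1 - u ^ 2) < α ^ 2 := by
      rw [mul_lt_mul_iff_right₀ (show 0 < 4 * A ^ 3 by positivity)]
    simp only [i1, i2]
    split_ifs with h
    · have := h.1
      rw [← ENNReal.ofReal_mul (by positivity)]; congr 1; field_simp
      linear_combination 4 * hss
    · simp
  · rw [lintegral_congr (g := fun _ => 0), lintegral_congr (f := f4 u A t) (g := fun _ => 0)]
    · intro t
      unfold f4
      rw [if_neg]
      exact fun h => ha h.2.1
    · intro d
      unfold f3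
      rw [if_neg]
      exact fun h => ha h.2.1
end NH

namespace NH
open MeasureTheory Classical

/-- integrand -/
noncomputable def f5 (t α u : ℝ) : ENNReal :=
  if 0 < α ∧ |t| < 1 ∧ 0 < 1 - u ^ 2 ∧ 1 - u ^ 2 < α ^ 2
  then ENNReal.ofReal (√(1 - u ^ 2) / (2 * α ^ 3 * √(4 - t ^ 2))) else 0

lemma I_f4 : I4 f4 = ∫⁻ t, ∫⁻ α, ∫⁻ u, f5 t α u := by
  have hM : M4 (fun A t α u => f4 u A t α) := M4_f4.comp (f := fun x : R4 => ((x.2.2.2, x.1, x.2.1, x.2.2.1) : R4)) (by fun_prop)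
  rw [I4_rot M4_f4, I4_rot hM]
  unfold I4
  refine lintegral_congr fun t => lintegral_congr fun α => lintegral_congr fun u => ?_
  by_cases h : 0 < α ∧ |t| < 1 ∧ 0 < 1 - u ^ 2 ∧ 1 - u ^ 2 < α ^ 2
  · obtain ⟨h1, h2, h3, h4⟩ := h
    have ht : 0 < 4 - t ^ 2 := by rw [abs_lt] at h2; nlinarith
    have hs := Real.sqrt_pos.2 ht
    have hs2 := Real.sqrt_pos.2 h3
    have key : ∀ A, f4 u A t α = (Set.Ioo 0 (√(1 - u ^ 2) / (α * √(4 - t ^ 2)))).indicator (fun _ => ENNReal.ofReal (1 / (2 * α ^ 2))) A := by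
      intro A
      rw [Set.indicator_apply]
      unfold f4
      refine if_congr ?_ rfl rfl
      rw [Set.mem_Ioo, lt_div_iff₀ (by positivity)]
      have : 0 < A → (A ^ 2 * α ^ 2 * (4 - t ^ 2) < 1 - u ^ 2 ↔ A * (α * √(4 - t ^ 2)) < √(1 - u ^ 2)) := by
        intro hA
        rw [Real.lt_sqrt (by positivity), mul_pow, mul_pow, Real.sq_sqrt ht.le, mul_assoc]
      constructor
      · rintro ⟨-, k, -, k', -⟩; exact ⟨k, (this k).1 k'⟩
      · rintro ⟨k, k'⟩; exact ⟨h1, k, h2, (this k).2 k', h4⟩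
    rw [lintegral_congr key, lintegral_indicator measurableSet_Ioo, setLIntegral_const, Real.volume_Ioo]
    unfold f5
    rw [if_pos ⟨h1, h2, h3, h4⟩, ← ENNReal.ofReal_mul (by positivity)]
    congr 1
    rw [sub_zero]
    field_simp
  · rw [lintegral_congr (g := fun _ => 0)]
    · unfold f5; rw [if_neg h]; simp
    · intro A
      unfold f4
      beta_reduce
      rw [if_neg]
      rintro ⟨k1, k2, k3, k4, k5⟩
      refine h ⟨k1, k3, lt_of_le_of_lt ?_ k4, k5⟩
      have ht : 0 < 4 - t ^ 2 := by rw [abs_lt] at k3; nlinarith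
      positivity

/-- integrand -/
noncomputable def gu (u : ℝ) : ENNReal := if |u| < 1 then ENNReal.ofReal (1 / √(1 - u ^ 2)) else 0
/-- integrand -/
noncomputable def gt (t : ℝ) : ENNReal := if |t| < 1 then ENNReal.ofReal (1 / √(4 - t ^ 2)) else 0

lemma abs_lt_one_iff_sq (u : ℝ) : |u| < 1 ↔ 0 < 1 - u ^ 2 := by
  rw [sub_pos, sq_lt_one_iff_abs_lt_one]

lemma int_cube {s : ℝ} (hs : 0 < s) : ∫⁻ α in Set.Ioi s, ENNReal.ofReal (1 / α ^ 3) = ENNReal.ofReal (1 / (2 * s ^ 2)) := by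
  have h1 := integral_Ioi_rpow_of_lt (show (-3 : ℝ) < -1 by norm_num) hs
  have h2 := integrableOn_Ioi_rpow_of_lt (show (-3 : ℝ) < -1 by norm_num) hs
  have e : ∀ α ∈ Set.Ioi s, ENNReal.ofReal (1 / α ^ 3) = ENNReal.ofReal (α ^ (-3 : ℝ)) := by
    intro α hα
    have : 0 < α := hs.trans hα
    rw [Real.rpow_neg this.le, one_div]
    norm_cast
  rw [setLIntegral_congr_fun measurableSet_Ioi e, ← ofReal_integral_eq_lintegral_ofReal h2, h1]
  · congr 1
    rw [show (-3 : ℝ) + 1 = -2 by norm_num, Real.rpow_neg hs.le, show s ^ (2 : ℝ) = s ^ 2 by norm_cast]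
    field_simp
  · filter_upwards [ae_restrict_mem measurableSet_Ioi] with x hx
    exact Real.rpow_nonneg (hs.trans hx).le _

lemma I_f5 : ∫⁻ t, ∫⁻ α, ∫⁻ u, f5 t α u = ENNReal.ofReal (1 / 4) * ((∫⁻ u, gu u) * ∫⁻ t, gt t) := by
  have hg1 : Measurable gu := by
    unfold gu
    refine Measurable.ite ?_ (by fun_prop) measurable_const
    measurability
  have hg2 : Measurable gt := by
    unfold gt
    refine Measurable.ite ?_ (by fun_prop) measurable_const
    measurability
  rw [← lintegral_const_mul _ (hg2), ← lintegral_const_mul _ (hg2.const_mul _)]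
  refine lintegral_congr fun t => ?_
  rw [lintegral_lintegral_swap]
  · rw [mul_comm (∫⁻ u, gu u), ← lintegral_const_mul _ hg1, ← lintegral_const_mul _ (hg1.const_mul _)]
    refine lintegral_congr fun u => ?_
    by_cases h : |t| < 1 ∧ |u| < 1
    · obtain ⟨h1, h2⟩ := h
      unfold gu gt
      rw [if_pos h1, if_pos h2]
      have h3 := (abs_lt_one_iff_sq u).1 h2
      have ht : 0 < 4 - t ^ 2 := by rw [abs_lt] at h1; nlinarith
      have hs := Real.sqrt_pos.2 ht
      have hs2 := Real.sqrt_pos.2 h3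
      have key : ∀ α, f5 t α u = (Set.Ioi (√(1 - u ^ 2))).indicator (fun α => ENNReal.ofReal (√(1 - u ^ 2) / (2 * √(4 - t ^ 2))) * ENNReal.ofReal (1 / α ^ 3)) α := by
        intro α
        rw [Set.indicator_apply]
        unfold f5
        rw [← ENNReal.ofReal_mul (by positivity)]
        refine if_congr ?_ ?_ rfl
        · rw [Set.mem_Ioi]
          constructor
          · rintro ⟨k1, -, -, k⟩
            rwa [Real.sqrt_lt' k1]
          · intro k
            have k1 := hs2.trans k
            exact ⟨k1, h1, h3, (Real.sqrt_lt' k1).1 k⟩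
        · congr 1
          ring
      rw [lintegral_congr key, lintegral_indicator measurableSet_Ioi, lintegral_const_mul _ (by fun_prop), int_cube hs2,
        ← ENNReal.ofReal_mul (by positivity), ← ENNReal.ofReal_mul (by positivity), ← ENNReal.ofReal_mul (by positivity)]
      congr 1
      field_simp
      norm_num
    · rw [lintegral_congr (g := fun _ => 0)]
      · unfold gu gt
        rw [not_and_or] at h
        rcases h with h | h <;> simp [h]
      · intro α
        unfold f5
        rw [if_neg]
        rintro ⟨-, k1, k2, -⟩
        exact h ⟨k1, (abs_lt_one_iff_sq u).2 k2⟩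
  · apply Measurable.aemeasurable
    unfold f5 Function.uncurry
    refine Measurable.ite ?_ (by fun_prop) measurable_const
    measurability

lemma arcs {r : ℝ} (hr : 1 ≤ r) : ∫⁻ t, (if |t| < 1 then ENNReal.ofReal (1 / √(r ^ 2 - t ^ 2)) else 0) = ENNReal.ofReal (2 * Real.arcsin (1 / r)) := by
  have hr0 : 0 < r := by linarith
  have hd : ∀ x ∈ Set.Ioo (-1 : ℝ) 1, HasDerivAt (fun x => Real.arcsin (x / r)) (1 / √(r ^ 2 - x ^ 2)) x := by
    intro x hx
    have h1 : x / r < 1 := by rw [div_lt_one hr0]; linarith [hx.2]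
    have h2 : -1 < x / r := by rw [lt_div_iff₀ hr0]; linarith [hx.1]
    have := (Real.hasDerivAt_arcsin h2.ne' h1.ne).comp x ((hasDerivAt_id x).div_const r)
    refine this.congr_deriv ?_
    have e : r ^ 2 - x ^ 2 = r ^ 2 * (1 - (x / r) ^ 2) := by field_simp
    rw [e, Real.sqrt_mul (by positivity), Real.sqrt_sq hr0.le]
    field_simp
  have hc : ContinuousOn (fun x => Real.arcsin (x / r)) (Set.Icc (-1) 1) :=
    (Real.continuous_arcsin.comp (continuous_id.div_const r)).continuousOn
  have hIntg := intervalIntegral.integrableOn_deriv_of_nonneg hc hd (fun x _ => by positivity)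
  have hIntg' : IntervalIntegrable (fun x => 1 / √(r ^ 2 - x ^ 2)) volume (-1) 1 := by
    rw [intervalIntegrable_iff_integrableOn_Ioc_of_le (by norm_num)]; exact hIntg
  have hI := intervalIntegral.integral_eq_sub_of_hasDerivAt_of_le (by norm_num) hc hd hIntg'
  rw [intervalIntegral.integral_of_le (by norm_num), integral_Ioc_eq_integral_Ioo] at hI
  have e : ∀ t : ℝ, (if |t| < 1 then ENNReal.ofReal (1 / √(r ^ 2 - t ^ 2)) else 0) = (Set.Ioo (-1 : ℝ) 1).indicator (fun t => ENNReal.ofReal (1 / √(r ^ 2 - t ^ 2))) t := by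
    intro t
    rw [Set.indicator_apply]
    exact if_congr (by rw [abs_lt, Set.mem_Ioo]) rfl rfl
  rw [lintegral_congr e, lintegral_indicator measurableSet_Ioo, ← ofReal_integral_eq_lintegral_ofReal, hI]
  · congr 1
    rw [neg_div, Real.arcsin_neg]; ring
  · exact hIntg.mono_set Set.Ioo_subset_Ioc_self
  · exact Eventually.of_forall fun x => by positivity

theorem vol_f0 : I4 f0 = ENNReal.ofReal (Real.pi ^ 2 / 12) := by
  rw [I_f0, I_f1, I_f2, I_f3, I_f4, I_f5]
  have h1 := arcs (r := 1) le_rfl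
  have h2 := arcs (r := 2) (by norm_num)
  have h3 : Real.arcsin (1 / 2) = Real.pi / 6 := by
    rw [← Real.sin_pi_div_six, Real.arcsin_sin] <;> linarith [Real.pi_pos]
  have e1 : ∫⁻ u, gu u = ENNReal.ofReal Real.pi := by
    rw [div_one, Real.arcsin_one] at h1
    rw [show Real.pi = 2 * (Real.pi / 2) by ring, ← h1]
    unfold gu
    simp
  have e2 : ∫⁻ u, gt u = ENNReal.ofReal (Real.pi / 3) := by
    rw [h3] at h2
    rw [show Real.pi / 3 = 2 * (Real.pi / 6) by ring, ← h2]
    unfold gt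
    norm_num
  have := Real.pi_pos
  rw [e1, e2, ← ENNReal.ofReal_mul (by positivity), ← ENNReal.ofReal_mul (by positivity)]
  congr 1
  ring
end NH

namespace NH
open MeasureTheory Classical

/-- open region -/
def RgO (ε : ℝ) : Set R4 := {x | ε < x.1 ∧ |qB x| < qA x ∧ qA x < qC x ∧ qD x < 1}
/-- closed region -/
def RgC (ε : ℝ) : Set R4 := {x | ε < x.1 ∧ |qB x| ≤ qA x ∧ qA x ≤ qC x ∧ 0 < qD x ∧ qD x < 1}

lemma qD_pos_of {x : R4} (h : |qB x| < qA x) (h' : qA x < qC x) : 0 < qD x := by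
  unfold qD
  have h1 := (abs_nonneg _).trans_lt h
  have h2 : (qB x) ^ 2 < (qA x) ^ 2 := sq_lt_sq.2 (by rwa [abs_of_pos h1])
  nlinarith

lemma RgO_sub (ε : ℝ) : RgO ε ⊆ RgC ε := fun _ h => ⟨h.1, h.2.1.le, h.2.2.1.le, qD_pos_of h.2.1 h.2.2.1, h.2.2.2⟩

lemma RgO_meas (ε : ℝ) : MeasurableSet (RgO ε) := by
  unfold RgO qD qA qB qC
  measurability
lemma RgC_meas (ε : ℝ) : MeasurableSet (RgC ε) := by
  unfold RgC qD qA qB qC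
  measurability

lemma Rg_bounds {ε : ℝ} (hε : 0 < ε) {x : R4} (hx : x ∈ RgC ε) : ε ^ 2 / 2 ≤ qA x ∧ qA x ≤ 1 ∧ qC x ≤ 2 / (3 * ε ^ 2) ∧
    x.1 ^ 2 ≤ 2 ∧ x.2.1 ^ 2 ≤ 2 ∧ x.2.2.1 ^ 2 ≤ 4 / (3 * ε ^ 2) ∧ x.2.2.2 ^ 2 ≤ 16 / (9 * ε ^ 6) := by
  obtain ⟨h1, h2, h3, h4, h5⟩ := hx
  obtain ⟨k1, k2, k3⟩ := red_bounds x h2 h3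
  have hA0 : 0 ≤ qA x := (abs_nonneg _).trans h2
  have hA1 : 0 < qA x := by
    rcases hA0.lt_or_eq with h | h
    · exact h
    · exfalso
      have hB : qB x = 0 := by rw [← h] at h2; exact abs_nonpos_iff.1 h2
      have : qD x = 0 := by unfold qD; rw [← h, hB]; ring
      linarith
  obtain ⟨a, b, c, d⟩ := x
  simp only at *
  generalize qA (a, b, c, d) = A at *
  generalize qC (a, b, c, d) = C at *
  have hC : 0 < C := hA1.trans_le h3
  have ha : ε ^ 2 < a ^ 2 := by nlinarith
  have e1 : a ^ 2 ≤ 2 * A := by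
    have : a ^ 2 * A ≤ 2 * A * A := by nlinarith [sq_nonneg a, sq_nonneg b, mul_nonneg (sq_nonneg b) hA0, mul_nonneg (sq_nonneg a) (sub_nonneg.2 h3)]
    exact le_of_mul_le_mul_right this hA1
  have e2 : b ^ 2 ≤ 2 * A := by
    have : b ^ 2 * A ≤ 2 * A * A := by nlinarith [mul_nonneg (sq_nonneg a) hC.le]
    exact le_of_mul_le_mul_right this hA1
  have e3 : c ^ 2 ≤ 2 * C := by
    have : c ^ 2 * C ≤ 2 * C * C := by nlinarith [mul_nonneg (sq_nonneg d) hA0]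
    exact le_of_mul_le_mul_right this hC
  have e4 : d ^ 2 * A ≤ 2 * C ^ 2 := by nlinarith [mul_nonneg (sq_nonneg c) hC.le]
  have hA2 : ε ^ 2 / 2 ≤ A := by linarith
  have hε2 : 0 < ε ^ 2 := by positivity
  have hA3 : A ≤ 1 := by nlinarith
  have hC2 : C * (3 * ε ^ 2) ≤ 2 := by nlinarith
  have hC3 : C ≤ 2 / (3 * ε ^ 2) := by rw [le_div_iff₀ (by positivity)]; linarith
  refine ⟨hA2, hA3, hC3, by linarith, by linarith, ?_, ?_⟩
  · refine e3.trans ?_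
    rw [le_div_iff₀ (by positivity)]; linarith
  · have h7 : C ^ 2 ≤ (2 / (3 * ε ^ 2)) ^ 2 := by gcongr
    have h8 : d ^ 2 * (ε ^ 2 / 2) ≤ 2 * (2 / (3 * ε ^ 2)) ^ 2 := by nlinarith [mul_nonneg (sq_nonneg d) (sub_nonneg.2 hA2)]
    rw [le_div_iff₀ (by positivity)]
    have h9 : 2 * (2 / (3 * ε ^ 2)) ^ 2 * (2 * (9 * ε ^ 4)) = 16 := by field_simp; norm_num
    have : d ^ 2 * (ε ^ 2 / 2) * (2 * (9 * ε ^ 4)) ≤ 16 := by rw [← h9]; gcongr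
    nlinarith

lemma RgC_bx {ε : ℝ} (hε : 0 < ε) (hε1 : ε ≤ 1) : RgC ε ⊆ bx (2 / ε ^ 3) := by
  intro x hx
  obtain ⟨-, -, -, h1, h2, h3, h4⟩ := Rg_bounds hε hx
  have e0 : (2 / ε ^ 3) ^ 2 = 4 / ε ^ 6 := by field_simp; norm_num
  have hε6 : ε ^ 6 ≤ 1 := pow_le_one₀ hε.le hε1
  have hε62 : ε ^ 6 ≤ ε ^ 2 := pow_le_pow_of_le_one hε.le hε1 (by norm_num)
  have key : ∀ {z : ℝ}, z ^ 2 ≤ (2 / ε ^ 3) ^ 2 → z ∈ Set.Icc (-(2 / ε ^ 3)) (2 / ε ^ 3) := by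
    intro z hz
    have := abs_le_of_sq_le_sq' hz (by positivity)
    exact this
  have e1 : (2 : ℝ) ≤ 4 / ε ^ 6 := by rw [le_div_iff₀ (by positivity)]; linarith
  refine ⟨key (e0 ▸ h1.trans e1), key (e0 ▸ h2.trans e1), key (e0 ▸ h3.trans ?_), key (e0 ▸ h4.trans ?_)⟩
  · rw [div_le_div_iff₀ (by positivity) (by positivity)]; nlinarith [sq_nonneg ε]
  · rw [div_le_div_iff₀ (by positivity) (by positivity)]; nlinarith [show 0 < ε ^ 6 by positivity]

/-- generic points -/
def Gen (ε : ℝ) : Set R4 := {x | x.1 - ε ≠ 0 ∧ qA x - qB x ≠ 0 ∧ qA x + qB x ≠ 0 ∧ qC x - qA x ≠ 0 ∧ 1 - qD x ≠ 0}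

lemma Gen_open (ε : ℝ) : IsOpen (Gen ε) := by
  unfold Gen qD qA qB qC
  simp only [Set.ofPred_and]
  refine IsOpen.inter ?_ (IsOpen.inter ?_ (IsOpen.inter ?_ (IsOpen.inter ?_ ?_))) <;>
    exact isOpen_ne_fun (by fun_prop) continuous_const

lemma ae_R4 {p : R4 → Prop} (hp : MeasurableSet {x | p x}) (h : ∀ᵐ a : ℝ, ∀ᵐ b : ℝ, ∀ c : ℝ, ∀ᵐ d : ℝ, p (a, b, c, d)) :
    ∀ᵐ x : R4, p x := by
  rw [Measure.volume_eq_prod, Measure.ae_prod_iff_ae_ae hp]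
  filter_upwards [h] with a ha
  have hp2 : MeasurableSet {x : ℝ × ℝ × ℝ | p (a, x)} := (measurable_const.prodMk measurable_id) hp
  rw [Measure.volume_eq_prod, Measure.ae_prod_iff_ae_ae hp2]
  filter_upwards [ha] with b hb
  have hp3 : MeasurableSet {x : ℝ × ℝ | p (a, b, x)} := (measurable_const.prodMk measurable_id) hp2
  rw [Measure.volume_eq_prod, Measure.ae_prod_iff_ae_ae hp3]
  exact Eventually.of_forall hb

lemma ae_quad {k l m : ℝ} (h : k ≠ 0 ∨ l ≠ 0) : ∀ᵐ d : ℝ, k * d ^ 2 + l * d + m ≠ 0 := by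
  have hfin : {d : ℝ | ¬ (k * d ^ 2 + l * d + m ≠ 0)}.Finite := by
    let P : Polynomial ℝ := Polynomial.C k * Polynomial.X ^ 2 + Polynomial.C l * Polynomial.X + Polynomial.C m
    have hP : P ≠ 0 := by
      intro h0
      have c2 : P.coeff 2 = k := by simp [P, Polynomial.coeff_X, Polynomial.coeff_C]
      have c1 : P.coeff 1 = l := by simp [P, Polynomial.coeff_X, Polynomial.coeff_C]
      rw [h0] at c1 c2
      simp at c1 c2
      rcases h with h | h
      · exact h c2.symm
      · exact h c1.symm
    refine (P.roots.toFinset.finite_toSet).subset ?_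
    intro d hd
    simp only [Set.mem_ofPred_eq, not_not] at hd
    simp only [Finset.mem_coe, Multiset.mem_toFinset, Polynomial.mem_roots hP, Polynomial.IsRoot]
    simpa [P] using hd
  exact hfin.measure_zero volume

lemma ae_ne (k : ℝ) : ∀ᵐ d : ℝ, d ≠ k := by
  have := ae_quad (k := 0) (l := 1) (m := -k) (Or.inr one_ne_zero)
  filter_upwards [this] with d hd h
  apply hd; rw [h]; ring

lemma Gen_ae (ε : ℝ) : ∀ᵐ x : R4, x ∈ Gen ε := by
  refine ae_R4 (p := fun x => x ∈ Gen ε) (Gen_open ε).measurableSet ?_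
  filter_upwards [ae_ne 0, ae_ne ε] with a ha haε
  filter_upwards [ae_ne 0] with b hb
  intro c
  filter_upwards [ae_quad (k := 0) (l := a) (m := b ^ 2 - a * c - b * c) (Or.inr ha),
    ae_quad (k := 0) (l := -a) (m := b ^ 2 - a * c + b * c) (Or.inr (neg_ne_zero.2 ha)),
    ae_quad (k := 0) (l := -b) (m := c ^ 2 - (b ^ 2 - a * c)) (Or.inr (neg_ne_zero.2 hb)),
    ae_quad (k := a ^ 2) (l := 4 * (b ^ 2 - a * c) * b - 2 * a * b * c) (m := 1 - 4 * (b ^ 2 - a * c) * c ^ 2 + (b * c) ^ 2)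
      (Or.inl (pow_ne_zero 2 ha))] with d h1 h2 h3 h4
  refine ⟨sub_ne_zero.2 haε, ?_, ?_, ?_, ?_⟩
  · intro h; apply h1; unfold qA qB at h; simp only at h; linear_combination h
  · intro h; apply h2; unfold qA qB at h; simp only at h; linear_combination h
  · intro h; apply h3; unfold qA qC at h; simp only at h; linear_combination h
  · intro h; apply h4; unfold qD qA qB qC at h; simp only at h; linear_combination h

lemma pos_loc {g : R4 → ℝ} (hg : Continuous g) {x : R4} (hx : g x ≠ 0) : ∀ᶠ y in nhds x, (0 < g y ↔ 0 < g x) := by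
  rcases lt_or_gt_of_ne hx with h | h
  · filter_upwards [hg.continuousAt.eventually_lt continuousAt_const h] with y hy
    exact ⟨fun k => absurd k (not_lt.2 hy.le), fun k => absurd k (not_lt.2 h.le)⟩
  · filter_upwards [continuousAt_const.eventually_lt hg.continuousAt h] with y hy
    exact ⟨fun _ => h, fun _ => hy⟩

lemma RgO_iff {ε : ℝ} {x : R4} : x ∈ RgO ε ↔ 0 < x.1 - ε ∧ 0 < qA x - qB x ∧ 0 < qA x + qB x ∧ 0 < qC x - qA x ∧ 0 < 1 - qD x := by
  unfold RgO
  rw [Set.mem_ofPred_eq, abs_lt]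
  constructor
  · rintro ⟨h1, ⟨h2, h3⟩, h4, h5⟩; refine ⟨?_, ?_, ?_, ?_, ?_⟩ <;> linarith
  · rintro ⟨h1, h2, h3, h4, h5⟩; refine ⟨?_, ⟨?_, ?_⟩, ?_, ?_⟩ <;> linarith

lemma RgO_loc {ε : ℝ} {x : R4} (hx : x ∈ Gen ε) : ∀ᶠ y in nhds x, (y ∈ RgO ε ↔ x ∈ RgO ε) := by
  obtain ⟨h1, h2, h3, h4, h5⟩ := hx
  filter_upwards [pos_loc (g := fun x => x.1 - ε) (by fun_prop) h1,
    pos_loc (g := fun x => qA x - qB x) (by unfold qA qB; fun_prop) h2,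
    pos_loc (g := fun x => qA x + qB x) (by unfold qA qB; fun_prop) h3,
    pos_loc (g := fun x => qC x - qA x) (by unfold qA qC; fun_prop) h4,
    pos_loc (g := fun x => 1 - qD x) (by unfold qD qA qB qC; fun_prop) h5] with y k1 k2 k3 k4 k5
  rw [RgO_iff, RgO_iff, k1, k2, k3, k4, k5]

lemma RgC_iff {ε : ℝ} {x : R4} (hx : x ∈ Gen ε) : x ∈ RgC ε ↔ x ∈ RgO ε := by
  refine ⟨fun h => ?_, fun h => RgO_sub ε h⟩
  obtain ⟨h1, h2, h3, h4, h5⟩ := hx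
  obtain ⟨k1, k2, k3, k4, k5⟩ := h
  rw [abs_le] at k2
  rw [RgO_iff]
  refine ⟨by linarith, lt_of_le_of_ne (by linarith) h2.symm, lt_of_le_of_ne (by linarith) h3.symm, lt_of_le_of_ne (by linarith) h4.symm, by linarith⟩

lemma RgC_loc {ε : ℝ} {x : R4} (hx : x ∈ Gen ε) : ∀ᶠ y in nhds x, (y ∈ RgC ε ↔ x ∈ RgC ε) := by
  filter_upwards [RgO_loc hx, (Gen_open ε).mem_nhds hx] with y h1 h2
  rw [RgC_iff hx, RgC_iff h2, h1]

lemma vol_RgC (ε : ℝ) : volume (RgC ε) = volume (RgO ε) := by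
  refine measure_congr ?_
  filter_upwards [Gen_ae ε] with x hx
  exact propext (RgC_iff hx)

/-- volume of the truncated region -/
noncomputable def vv (ε : ℝ) : ℝ := (volume (RgO ε)).toReal

lemma vol_RgO0 : volume (RgO 0) = ENNReal.ofReal (Real.pi ^ 2 / 12) := by
  rw [← vol_f0, I4_eq M4_f0, ← lintegral_indicator_one (RgO_meas 0)]
  refine lintegral_congr fun x => ?_
  rw [Set.indicator_apply]
  unfold f0
  exact if_congr Iff.rfl rfl rfl

lemma vv_le {ε : ℝ} (hε : 0 < ε) : vv ε ≤ Real.pi ^ 2 / 12 := by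
  unfold vv
  refine ENNReal.toReal_le_of_le_ofReal (by positivity) ?_
  rw [← vol_RgO0]
  exact measure_mono fun x hx => ⟨hε.trans hx.1, hx.2⟩

lemma vv_lim {η : ℝ} (hη : 0 < η) : ∃ ε0 > 0, ∀ ε, 0 < ε → ε ≤ ε0 → |vv ε - Real.pi ^ 2 / 12| < η := by
  have h1 : Tendsto (fun n : ℕ => volume (RgO (1 / ((n : ℝ) + 1)))) atTop (nhds (volume (⋃ n : ℕ, RgO (1 / ((n : ℝ) + 1))))) := by
    refine tendsto_measure_iUnion_atTop ?_
    intro n m hnm x hx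
    refine ⟨lt_of_le_of_lt ?_ hx.1, hx.2⟩
    have : (n : ℝ) ≤ m := by exact_mod_cast hnm
    exact one_div_le_one_div_of_le (by positivity) (by linarith)
  have h2 : (⋃ n : ℕ, RgO (1 / ((n : ℝ) + 1))) = RgO 0 := by
    ext x
    rw [Set.mem_iUnion]
    constructor
    · rintro ⟨n, hn⟩; exact ⟨lt_trans (by positivity) hn.1, hn.2⟩
    · rintro ⟨h, h'⟩
      obtain ⟨n, hn⟩ := exists_nat_one_div_lt h
      exact ⟨n, hn, h'⟩
  rw [h2, vol_RgO0] at h1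
  have h3 := (ENNReal.tendsto_toReal ENNReal.ofReal_ne_top).comp h1
  rw [ENNReal.toReal_ofReal (by positivity)] at h3
  obtain ⟨n, hn⟩ := ((tendsto_order.1 h3).1 (Real.pi ^ 2 / 12 - η) (by linarith)).exists
  refine ⟨1 / ((n : ℝ) + 1), by positivity, fun ε hε hε' => ?_⟩
  have h4 := vv_le hε
  have h5 : vv (1 / ((n : ℝ) + 1)) ≤ vv ε := by
    unfold vv
    refine ENNReal.toReal_mono ?_ (measure_mono fun x hx => ⟨lt_of_le_of_lt hε' hx.1, hx.2⟩)
    refine ne_top_of_le_ne_top (b := volume (RgO 0)) ?_ (measure_mono fun x hx => ⟨hε.trans hx.1, hx.2⟩)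
    rw [vol_RgO0]; exact ENNReal.ofReal_ne_top
  simp only [Function.comp] at hn
  change _ < vv _ at hn
  rw [abs_lt]
  constructor <;> linarith

theorem count_RgO {ε : ℝ} (hε : 0 < ε) (hε1 : ε ≤ 1) {q : ℕ} (hq : 0 < q) (S : Finset (ZMod q × ZMod q × ZMod q × ZMod q)) :
    Tendsto (fun T : ℝ => ({F : Z4 | rdq q F ∈ S ∧ scl T F ∈ RgO ε}.ncard : ℝ) * (q / T) ^ 4) atTop (nhds (S.card * vv ε)) :=
  lattice_count_set hq S ((RgO_sub ε).trans (RgC_bx hε hε1)) (RgO_meas ε)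
    (by filter_upwards [Gen_ae ε] with x hx using RgO_loc hx)

theorem count_RgC {ε : ℝ} (hε : 0 < ε) (hε1 : ε ≤ 1) {q : ℕ} (hq : 0 < q) (S : Finset (ZMod q × ZMod q × ZMod q × ZMod q)) :
    Tendsto (fun T : ℝ => ({F : Z4 | rdq q F ∈ S ∧ scl T F ∈ RgC ε}.ncard : ℝ) * (q / T) ^ 4) atTop (nhds (S.card * vv ε)) := by
  have := lattice_count_set hq S (RgC_bx hε hε1) (RgC_meas ε)
    (by filter_upwards [Gen_ae ε] with x hx using RgC_loc hx)
  rwa [vol_RgC] at this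
end NH

namespace NH

lemma ncard_fiber_le {α β : Type*} [DecidableEq β] {S : Set α} (hS : S.Finite) (f : α → β) (I : Finset β) (hf : ∀ x ∈ S, f x ∈ I)
    (g : β → ℝ) (h : ∀ i ∈ I, ({x | x ∈ S ∧ f x = i}.ncard : ℝ) ≤ g i) : (S.ncard : ℝ) ≤ ∑ i ∈ I, g i := by
  classical
  rw [Set.ncard_eq_toFinset_card _ hS,
    Finset.card_eq_sum_card_fiberwise (f := f) (s := hS.toFinset) (t := I) (by intro x hx; exact hf x (hS.mem_toFinset.1 hx))]
  push_cast
  refine Finset.sum_le_sum fun i hi => ?_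
  refine le_trans (le_of_eq ?_) (h i hi)
  rw [← Set.ncard_coe_finset]
  congr 2
  ext x
  simp [hS.mem_toFinset]

lemma ap_count {s : Finset ℤ} {m : ℕ} (hm : 0 < m) {lo hi : ℝ} (hlh : lo ≤ hi) (h1 : ∀ x ∈ s, ∀ y ∈ s, (m : ℤ) ∣ x - y)
    (h2 : ∀ x ∈ s, lo ≤ (x : ℝ) ∧ (x : ℝ) ≤ hi) : (s.card : ℝ) ≤ (hi - lo) / m + 1 := by
  have hm' : (0 : ℝ) < m := by exact_mod_cast hm
  rcases s.eq_empty_or_nonempty with rfl | hne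
  · have : 0 ≤ (hi - lo) / m := div_nonneg (by linarith) hm'.le
    simp; linarith
  · set x0 := s.min' hne with hx0
    have hx0s : x0 ∈ s := s.min'_mem hne
    have hc : s.card ≤ (Finset.range (⌊(hi - lo) / m⌋₊ + 1)).card := by
      refine Finset.card_le_card_of_injOn (fun x => ((x - x0) / m).toNat) ?_ ?_
      · intro x hx
        simp only [Finset.coe_range, Set.mem_Iio]
        have hxl : x0 ≤ x := s.min'_le x hx
        obtain ⟨k, hk⟩ := h1 x hx x0 hx0s
        rw [hk, Int.mul_ediv_cancel_left _ (by positivity)]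
        have hk0 : 0 ≤ k := by
          by_contra hh
          have : (0 : ℤ) < m := by exact_mod_cast hm
          nlinarith
        rw [Nat.lt_add_one_iff]
        refine Nat.le_floor ?_
        rw [le_div_iff₀ hm']
        have e1 : ((k.toNat : ℕ) : ℝ) = (k : ℝ) := by
          have : ((k.toNat : ℕ) : ℤ) = k := Int.toNat_of_nonneg hk0
          exact_mod_cast this
        have e2 : (x : ℝ) - x0 = m * k := by exact_mod_cast hk
        rw [e1]
        linarith [(h2 x hx).2, (h2 x0 hx0s).1]
      · intro x hx y hy hxy
        simp only at hxy
        obtain ⟨k, hk⟩ := h1 x hx x0 hx0s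
        obtain ⟨l, hl⟩ := h1 y hy x0 hx0s
        have hmz : (0 : ℤ) < m := by exact_mod_cast hm
        have hxl : x0 ≤ x := s.min'_le x hx
        have hyl : x0 ≤ y := s.min'_le y hy
        rw [hk, hl, Int.mul_ediv_cancel_left _ (by positivity), Int.mul_ediv_cancel_left _ (by positivity)] at hxy
        have hk0 : 0 ≤ k := by by_contra hh; nlinarith
        have hl0 : 0 ≤ l := by by_contra hh; nlinarith
        have : k = l := by omega
        subst this
        linarith
    rw [Finset.card_range] at hc
    have h3 : (s.card : ℝ) ≤ (⌊(hi - lo) / m⌋₊ : ℝ) + 1 := by exact_mod_cast hc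
    have h4 := Nat.floor_le (div_nonneg (sub_nonneg.2 hlh) hm'.le)
    linarith

/-- fibre data determine the form -/
lemma fib_alg {a b c d b' c' d' : ℤ} (ha : 0 < a) (hr : b % a = b' % a)
    (hA : qA (a, b, c, d) = qA (a, b', c', d')) :
    (a ^ 2 ∣ qU (a, b, c, d) - qU (a, b', c', d')) ∧
    (qU (a, b, c, d) = qU (a, b', c', d') → |qB (a, b, c, d)| ≤ qA (a, b, c, d) → |qB (a, b', c', d')| ≤ qA (a, b, c, d) →
      0 < qA (a, b, c, d) → (b / a) % 2 = (b' / a) % 2 → ((a, b, c, d) : Z4) = (a, b', c', d')) := by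
  have hb := Int.emod_add_mul_ediv b a
  have hb' := Int.emod_add_mul_ediv b' a
  rw [← hr] at hb'
  generalize b % a = r at *
  generalize b / a = k at *
  generalize b' / a = k' at *
  obtain ⟨c0, hc0⟩ : ∃ c0, c = c0 + 2 * k * r + k ^ 2 * a := ⟨c - 2 * k * r - k ^ 2 * a, by ring⟩
  obtain ⟨c0', hc0'⟩ : ∃ c0, c' = c0 + 2 * k' * r + k' ^ 2 * a := ⟨c' - 2 * k' * r - k' ^ 2 * a, by ring⟩
  obtain ⟨d0, hd0⟩ : ∃ d0, d = d0 + 3 * k * c0 + 3 * k ^ 2 * r + k ^ 3 * a := ⟨d - 3 * k * c0 - 3 * k ^ 2 * r - k ^ 3 * a, by ring⟩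
  obtain ⟨d0', hd0'⟩ : ∃ d0, d' = d0 + 3 * k' * c0' + 3 * k' ^ 2 * r + k' ^ 3 * a :=
    ⟨d' - 3 * k' * c0' - 3 * k' ^ 2 * r - k' ^ 3 * a, by ring⟩
  subst hb hb' hc0 hc0' hd0 hd0'
  have hcc : c0 = c0' := by
    unfold qA at hA
    simp only at hA
    have : a * (c0 - c0') = 0 := by linarith
    rcases mul_eq_zero.1 this with h | h
    · omega
    · omega
  subst hcc
  have eU : ∀ k d0 : ℤ, qU (a, r + a * k, c0 + 2 * k * r + k ^ 2 * a, d0 + 3 * k * c0 + 3 * k ^ 2 * r + k ^ 3 * a) =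
      a ^ 2 * d0 - 3 * a * r * c0 + 2 * r ^ 3 := by
    intro k d0; unfold qU qA qB; simp only; ring
  have eA : ∀ k d0 : ℤ, qA (a, r + a * k, c0 + 2 * k * r + k ^ 2 * a, d0 + 3 * k * c0 + 3 * k ^ 2 * r + k ^ 3 * a) =
      r ^ 2 - a * c0 := by
    intro k d0; unfold qA; simp only; ring
  have eB : ∀ k d0 : ℤ, qB (a, r + a * k, c0 + 2 * k * r + k ^ 2 * a, d0 + 3 * k * c0 + 3 * k ^ 2 * r + k ^ 3 * a) =
      r * c0 - a * d0 + 2 * k * (r ^ 2 - a * c0) := by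
    intro k d0; unfold qB; simp only; ring
  rw [eU, eU, eA, eB, eB]
  refine ⟨⟨d0 - d0', by ring⟩, ?_⟩
  intro hU h1 h2 h3 hk
  have hd : d0 = d0' := by
    have : a ^ 2 * (d0 - d0') = 0 := by linarith
    rcases mul_eq_zero.1 this with h | h
    · have := pow_eq_zero_iff (two_ne_zero) |>.1 h; omega
    · omega
  subst hd
  rw [abs_le] at h1 h2
  generalize r ^ 2 - a * c0 = A at *
  have : k - k' < 2 := by by_contra hh; nlinarith
  have : -2 < k - k' := by by_contra hh; nlinarith
  have : k = k' := by omega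
  subst this
  rfl

/-- forms with given leading coefficient -/
def Sa (a : ℕ) (T : ℝ) : Set Z4 := {F | Red F ∧ F.1 = a ∧ ((qD F : ℤ) : ℝ) < T ^ 4}

lemma redT_finite (T : ℝ) : {F : Z4 | Red F ∧ ((qD F : ℤ) : ℝ) < T ^ 4}.Finite := by
  refine (red_finite ⌈T ^ 4⌉).subset ?_
  rintro F ⟨h1, h2⟩
  refine ⟨h1, ?_⟩
  have := h2.le.trans (Int.le_ceil _)
  exact_mod_cast this

lemma Sa_finite (a : ℕ) (T : ℝ) : (Sa a T).Finite := (redT_finite T).subset fun _ h => ⟨h.1, h.2.2⟩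

/-- index of the fibre -/
def fidx (F : Z4) : ℕ × ℕ × ℕ × ℕ := ((F.2.1 % F.1).toNat, (qA F / F.1).toNat, (F.2.1 / F.1 % 2).toNat, if 0 ≤ qU F then 0 else 1)

lemma Sa_facts {a : ℕ} (ha : 0 < a) {T : ℝ} (hT : 1 ≤ T) {F : Z4} (hF : F ∈ Sa a T) :
    0 < qA F ∧ ((qA F : ℤ) : ℝ) < T ^ 2 ∧ (a : ℝ) ^ 2 ≤ 2 * ((qA F : ℤ) : ℝ) := by
  obtain ⟨h1, h2, h3⟩ := hF
  have hA := red_pos h1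
  obtain ⟨k1, k2, k3⟩ := red_bounds F h1.1 h1.2.1
  have hAC := h1.2.1
  refine ⟨hA, ?_, ?_⟩
  · have : 3 * (qA F) ^ 2 ≤ qD F := by nlinarith
    have : 3 * ((qA F : ℤ) : ℝ) ^ 2 ≤ ((qD F : ℤ) : ℝ) := by exact_mod_cast this
    have hA' : (0 : ℝ) < ((qA F : ℤ) : ℝ) := by exact_mod_cast hA
    nlinarith [sq_nonneg T]
  · have : F.1 ^ 2 * qA F ≤ 2 * qA F * qA F := by nlinarith [sq_nonneg F.1, mul_nonneg (sq_nonneg F.2.1) hA.le, mul_nonneg (sq_nonneg F.1) (sub_nonneg.2 hAC)]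
    have := le_of_mul_le_mul_right this hA
    rw [h2] at this
    exact_mod_cast this

lemma fidx_A {a : ℕ} (ha : 0 < a) {b c d b' c' d' : ℤ} (hAF : 0 < qA ((a : ℤ), b, c, d)) (hAG : 0 < qA ((a : ℤ), b', c', d'))
    (hr : b % (a : ℤ) = b' % (a : ℤ)) (e2 : (qA ((a : ℤ), b, c, d) / a).toNat = (qA ((a : ℤ), b', c', d') / a).toNat) :
    qA ((a : ℤ), b, c, d) = qA ((a : ℤ), b', c', d') := by
  have haz : (0 : ℤ) < a := by exact_mod_cast ha
  have n1 := Int.ediv_nonneg hAF.le haz.le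
  have n2 := Int.ediv_nonneg hAG.le haz.le
  have hj : qA ((a : ℤ), b, c, d) / a = qA ((a : ℤ), b', c', d') / a := by omega
  have hAm : ∀ b c d : ℤ, qA ((a : ℤ), b, c, d) % a = (b % a) ^ 2 % a := by
    intro b c d
    unfold qA
    simp only
    rw [Int.sub_mul_emod_self_left]
    exact ((Int.mod_modEq b a).pow 2).symm
  rw [← Int.emod_add_mul_ediv (qA ((a : ℤ), b, c, d)) a, ← Int.emod_add_mul_ediv (qA ((a : ℤ), b', c', d')) a, hj, hAm, hAm, hr]

lemma fidx_A' {a : ℕ} (ha : 0 < a) {T : ℝ} (hT : 1 ≤ T) {F G : Z4} (hF : F ∈ Sa a T) (hG : G ∈ Sa a T) (h : fidx F = fidx G) :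
    qA F = qA G := by
  have haz : (0 : ℤ) < a := by exact_mod_cast ha
  have hAF := (Sa_facts ha hT hF).1
  have hAG := (Sa_facts ha hT hG).1
  obtain ⟨x, b, c, d⟩ := F
  obtain ⟨y, b', c', d'⟩ := G
  obtain ⟨f1, f2, f3⟩ := hF
  obtain ⟨g1, g2, g3⟩ := hG
  simp only at f2 g2
  subst f2 g2
  unfold fidx at h
  simp only [Prod.mk.injEq] at h
  obtain ⟨e1, e2, e3, e4⟩ := h
  have m1 := Int.emod_nonneg b haz.ne'
  have m2 := Int.emod_nonneg b' haz.ne'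
  exact fidx_A ha hAF hAG (by omega) e2

lemma fib_count {a : ℕ} (ha : 0 < a) {T : ℝ} (hT : 1 ≤ T) (i : ℕ × ℕ × ℕ × ℕ) {lo hi : ℝ} (hlh : lo ≤ hi)
    (h : ∀ F ∈ Sa a T, fidx F = i → lo ≤ |(qU F : ℝ)| ∧ |(qU F : ℝ)| ≤ hi) :
    ({F | F ∈ Sa a T ∧ fidx F = i}.ncard : ℝ) ≤ (hi - lo) / a ^ 2 + 1 := by
  classical
  have haz : (0 : ℤ) < a := by exact_mod_cast ha
  have hfin : {F | F ∈ Sa a T ∧ fidx F = i}.Finite := (Sa_finite a T).subset fun _ h => h.1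
  have key : ∀ F ∈ hfin.toFinset, ∀ G ∈ hfin.toFinset, ((a : ℤ) ^ 2 ∣ |qU F| - |qU G|) ∧ (|qU F| = |qU G| → F = G) := by
    intro F hF G hG
    obtain ⟨hF, hFi⟩ := hfin.mem_toFinset.1 hF
    obtain ⟨hG, hGi⟩ := hfin.mem_toFinset.1 hG
    rw [← hGi] at hFi
    have hAF := (Sa_facts ha hT hF).1
    have hAG := (Sa_facts ha hT hG).1
    obtain ⟨x, b, c, d⟩ := F
    obtain ⟨y, b', c', d'⟩ := G
    obtain ⟨f1, f2, f3⟩ := hF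
    obtain ⟨g1, g2, g3⟩ := hG
    simp only at f2 g2
    subst f2 g2
    unfold fidx at hFi
    simp only [Prod.mk.injEq] at hFi
    obtain ⟨e1, e2, e3, e4⟩ := hFi
    have m1 := Int.emod_nonneg b haz.ne'
    have m2 := Int.emod_nonneg b' haz.ne'
    have hr : b % (a : ℤ) = b' % (a : ℤ) := by omega
    have hk : b / (a : ℤ) % 2 = b' / (a : ℤ) % 2 := by omega
    have hA := fidx_A ha hAF hAG hr e2
    obtain ⟨p1, p2⟩ := fib_alg haz hr hA
    have hB' := g1.1
    rw [← hA] at hB'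
    have p2' := fun hU => p2 hU f1.1 hB' hAF hk
    have hsg : (0 ≤ qU ((a : ℤ), b, c, d) ↔ 0 ≤ qU ((a : ℤ), b', c', d')) := by
      constructor <;> intro hh <;> by_contra h2 <;> simp [hh, h2] at e4
    by_cases h0 : 0 ≤ qU ((a : ℤ), b, c, d)
    · rw [abs_of_nonneg h0, abs_of_nonneg (hsg.1 h0)]
      exact ⟨p1, p2'⟩
    · rw [abs_of_neg (not_le.1 h0), abs_of_neg (not_le.1 (fun hh => h0 (hsg.2 hh)))]
      refine ⟨?_, fun hh => p2' (by linarith)⟩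
      rw [neg_sub_neg]
      exact (dvd_sub_comm).1 p1
  rw [Set.ncard_eq_toFinset_card _ hfin]
  have hinj : Set.InjOn (fun F => |qU F|) (hfin.toFinset : Set Z4) := fun F hF G hG hh => (key F hF G hG).2 hh
  rw [← Finset.card_image_of_injOn hinj]
  have := ap_count (s := hfin.toFinset.image (fun F => |qU F|)) (m := a ^ 2) (by positivity) hlh ?_ ?_
  · push_cast at this; exact this
  · intro x hx y hy
    obtain ⟨F, hF, rfl⟩ := Finset.mem_image.1 hx
    obtain ⟨G, hG, rfl⟩ := Finset.mem_image.1 hy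
    push_cast
    exact (key F hF G hG).1
  · intro x hx
    obtain ⟨F, hF, rfl⟩ := Finset.mem_image.1 hx
    obtain ⟨hF, hFi⟩ := hfin.mem_toFinset.1 hF
    push_cast
    exact h F hF hFi
end NH

namespace NH

lemma sum_inv_sqrt (N : ℕ) : ∑ a ∈ Finset.Icc 1 N, 1 / √(a : ℝ) ≤ 2 * √(N : ℝ) := by
  induction N with
  | zero => simp
  | succ n ih =>
    rw [Finset.sum_Icc_succ_top (by omega)]
    have h1 : 0 < √((n + 1 : ℕ) : ℝ) := Real.sqrt_pos.2 (by positivity)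
    have h2 : √((n + 1 : ℕ) : ℝ) ^ 2 = n + 1 := by rw [Real.sq_sqrt (by positivity)]; push_cast; ring
    have h3 : √(n : ℝ) ^ 2 = n := Real.sq_sqrt (by positivity)
    have h4 : 0 ≤ √(n : ℝ) := Real.sqrt_nonneg _
    have : 1 / √((n + 1 : ℕ) : ℝ) ≤ 2 * √((n + 1 : ℕ) : ℝ) - 2 * √(n : ℝ) := by
      rw [div_le_iff₀ h1]
      nlinarith [sq_nonneg (√((n + 1 : ℕ) : ℝ) - √(n : ℝ))]
    linarith

lemma sum_j {J : ℕ} (hJ : 0 < J) (N : ℕ) (hN : J ≤ N) : ∑ j ∈ Finset.Ico J N, 1 / ((j : ℝ) * √(j : ℝ)) ≤ 4 / √(J : ℝ) - 4 / √(N : ℝ) := by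
  induction N, hN using Nat.le_induction with
  | base => simp
  | succ n hn ih =>
    rw [Finset.sum_Ico_succ_top hn]
    have hn0 : 0 < n := by omega
    have hn1 : (1 : ℝ) ≤ n := by exact_mod_cast hn0
    have h0 : 0 < √(n : ℝ) := Real.sqrt_pos.2 (by positivity)
    have h1 : 0 < √((n + 1 : ℕ) : ℝ) := Real.sqrt_pos.2 (by positivity)
    have h2 : √((n + 1 : ℕ) : ℝ) ^ 2 = n + 1 := by rw [Real.sq_sqrt (by positivity)]; push_cast; ring
    have h3 : √(n : ℝ) ^ 2 = n := Real.sq_sqrt (by positivity)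
    generalize √((n + 1 : ℕ) : ℝ) = y at *
    generalize √(n : ℝ) = x at *
    have hyx : y ≤ 3 / 2 * x := by nlinarith
    have : 1 / ((n : ℝ) * x) ≤ 4 / x - 4 / y := by
      rw [← h3]
      have e : 4 / x - 4 / y - 1 / (x ^ 2 * x) = (4 * x ^ 2 * (y - x) - y) / (x ^ 3 * y) := by field_simp
      have h5 : y - x = 1 / (y + x) := by rw [eq_div_iff (by positivity)]; nlinarith
      have h6 : 0 ≤ 4 * x ^ 2 * (y - x) - y := by
        rw [h5, mul_one_div, sub_nonneg, le_div_iff₀ (by positivity)]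
        nlinarith
      have := div_nonneg h6 (show 0 ≤ x ^ 3 * y by positivity)
      linarith
    linarith

/-- bound for a fibre -/
noncomputable def fbd (a : ℕ) (T : ℝ) (j : ℕ) : ℝ :=
  1 + (if j < ⌈T⌉₊ then 2 * ((⌈T⌉₊ : ℝ) * √(⌈T⌉₊ : ℝ)) / √(a : ℝ) else T ^ 4 / (2 * (a * √(a : ℝ))) * (1 / ((j : ℝ) * √(j : ℝ))))

lemma fib_bound {a : ℕ} (ha : 0 < a) {T : ℝ} (hT : 1 ≤ T) (i : ℕ × ℕ × ℕ × ℕ) :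
    ({F | F ∈ Sa a T ∧ fidx F = i}.ncard : ℝ) ≤ fbd a T i.2.1 := by
  have ha' : (0 : ℝ) < a := by exact_mod_cast ha
  have hsa : 0 < √(a : ℝ) := Real.sqrt_pos.2 ha'
  have hsa2 : √(a : ℝ) ^ 2 = a := Real.sq_sqrt ha'.le
  have haz : (0 : ℤ) < a := by exact_mod_cast ha
  have hJ : 0 < ⌈T⌉₊ := Nat.ceil_pos.2 (by linarith)
  have hUA : ∀ F ∈ Sa a T, |(qU F : ℝ)| ≤ 2 * (((qA F : ℤ) : ℝ) * √((qA F : ℤ) : ℝ)) ∧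
      2 * (((qA F : ℤ) : ℝ) * √((qA F : ℤ) : ℝ)) - a ^ 2 * T ^ 4 / (2 * (((qA F : ℤ) : ℝ) * √((qA F : ℤ) : ℝ))) ≤ |(qU F : ℝ)| := by
    intro F hF
    have hA := (Sa_facts ha hT hF).1
    have hA' : (0 : ℝ) < ((qA F : ℤ) : ℝ) := by exact_mod_cast hA
    have hs := Real.sqrt_pos.2 hA'
    have hs2 := Real.sq_sqrt hA'.le
    have hU := qU_sq F
    rw [hF.2.1] at hU
    have hU : (qU F : ℝ) ^ 2 + ((qD F : ℤ) : ℝ) * a ^ 2 = 4 * ((qA F : ℤ) : ℝ) ^ 3 := by exact_mod_cast hU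
    have hD0 : (0 : ℝ) < ((qD F : ℤ) : ℝ) := by exact_mod_cast hF.1.2.2
    have hD := hF.2.2
    rw [← sq_abs] at hU
    have hu0 := abs_nonneg (qU F : ℝ)
    generalize |(qU F : ℝ)| = u at *
    generalize ((qA F : ℤ) : ℝ) = A at *
    generalize ((qD F : ℤ) : ℝ) = D at *
    generalize √A = s at *
    have hw : (2 * (A * s)) ^ 2 = 4 * A ^ 3 := by linear_combination (4 * A ^ 2) * hs2
    have hw0 : 0 < 2 * (A * s) := by positivity
    rw [← hw] at hU
    generalize 2 * (A * s) = w at *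
    have ha2 : (0 : ℝ) < (a : ℝ) ^ 2 := by positivity
    have h1 : u ≤ w := by
      by_contra h
      nlinarith [mul_pos hD0 ha2]
    refine ⟨h1, ?_⟩
    have : w - u ≤ a ^ 2 * T ^ 4 / w := by
      rw [le_div_iff₀ hw0]
      nlinarith [mul_le_mul_of_nonneg_right hD.le ha2.le, mul_nonneg hu0 (sub_nonneg.2 h1)]
    linarith
  have hjA : ∀ F ∈ Sa a T, fidx F = i → (a : ℝ) * i.2.1 ≤ ((qA F : ℤ) : ℝ) ∧ ((qA F : ℤ) : ℝ) ≤ a * (i.2.1 + 1) := by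
    intro F hF hi
    have hA := (Sa_facts ha hT hF).1
    have h1 : (qA F / F.1).toNat = i.2.1 := by rw [← hi]; rfl
    rw [hF.2.1] at h1
    have h2 : qA F / a = i.2.1 := by
      have := Int.ediv_nonneg hA.le haz.le
      omega
    have h3 := Int.mul_ediv_self_le (x := qA F) haz.ne'
    have h4 := Int.lt_mul_ediv_self_add (x := qA F) haz
    rw [h2] at h3 h4
    have h4 : qA F ≤ a * (i.2.1 + 1) := by linarith
    exact ⟨by exact_mod_cast h3, by exact_mod_cast h4⟩
  unfold fbd
  split_ifs with hj
  · have hJr : (i.2.1 : ℝ) + 1 ≤ ⌈T⌉₊ := by exact_mod_cast hj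
    have hJ0 : (0 : ℝ) < ⌈T⌉₊ := by exact_mod_cast hJ
    generalize (⌈T⌉₊ : ℝ) = J at *
    have := fib_count ha hT i (lo := 0) (hi := 2 * ((a * J) * √(a * J))) (by positivity) ?_
    · refine this.trans (le_of_eq ?_)
      rw [Real.sqrt_mul ha'.le, add_comm, sub_zero]
      congr 1
      rw [div_eq_div_iff (by positivity) (by positivity)]
      linear_combination (2 * a * J * √J) * hsa2
    · intro F hF hi
      refine ⟨abs_nonneg _, (hUA F hF).1.trans ?_⟩
      have h1 : ((qA F : ℤ) : ℝ) ≤ a * J := (hjA F hF hi).2.trans (by gcongr)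
      gcongr
  · rcases Set.eq_empty_or_nonempty {F | F ∈ Sa a T ∧ fidx F = i} with he | ⟨G, hG, hGi⟩
    · rw [he, Set.ncard_empty, Nat.cast_zero]; positivity
    · have hA := (Sa_facts ha hT hG).1
      have hA' : (0 : ℝ) < ((qA G : ℤ) : ℝ) := by exact_mod_cast hA
      have hj0 : (0 : ℝ) < i.2.1 := by
        have : 0 < i.2.1 := by omega
        exact_mod_cast this
      have hsA := Real.sqrt_pos.2 hA'
      have := fib_count ha hT i (hi := 2 * (((qA G : ℤ) : ℝ) * √((qA G : ℤ) : ℝ)))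
        (lo := 2 * (((qA G : ℤ) : ℝ) * √((qA G : ℤ) : ℝ)) - a ^ 2 * T ^ 4 / (2 * (((qA G : ℤ) : ℝ) * √((qA G : ℤ) : ℝ)))) ?_ ?_
      · refine this.trans ?_
        rw [add_comm, sub_sub_cancel]
        refine add_le_add le_rfl ?_
        have h1 := (hjA G hG hGi).1
        have h2 : (a : ℝ) * i.2.1 * √(a * i.2.1) ≤ ((qA G : ℤ) : ℝ) * √((qA G : ℤ) : ℝ) := by gcongr
        rw [Real.sqrt_mul ha'.le] at h2
        have hsj : 0 < √(i.2.1 : ℝ) := Real.sqrt_pos.2 hj0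
        calc (a : ℝ) ^ 2 * T ^ 4 / (2 * (((qA G : ℤ) : ℝ) * √((qA G : ℤ) : ℝ))) / a ^ 2
            = T ^ 4 / (2 * (((qA G : ℤ) : ℝ) * √((qA G : ℤ) : ℝ))) := by field_simp
          _ ≤ T ^ 4 / (2 * ((a : ℝ) * i.2.1 * (√a * √i.2.1))) := by gcongr
          _ = _ := by field_simp
      · have : 0 ≤ (a : ℝ) ^ 2 * T ^ 4 / (2 * (((qA G : ℤ) : ℝ) * √((qA G : ℤ) : ℝ))) := by positivity
        linarith
      · intro F hF hi
        have := fidx_A' ha hT hG hF (hGi.trans hi.symm)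
        rw [this]
        exact ⟨(hUA F hF).2, (hUA F hF).1⟩

lemma sum_fbd {a : ℕ} (ha : 0 < a) {T : ℝ} (hT : 1 ≤ T) (N : ℕ) :
    ∑ j ∈ Finset.range N, fbd a T j ≤ N + 2 * ((⌈T⌉₊ : ℝ) ^ 2 * √(⌈T⌉₊ : ℝ)) / √(a : ℝ) + T ^ 4 / (2 * (a * √(a : ℝ))) * (4 / √(⌈T⌉₊ : ℝ)) := by
  have hJ : 0 < ⌈T⌉₊ := Nat.ceil_pos.2 (by linarith)
  unfold fbd
  rw [Finset.sum_add_distrib, Finset.sum_const, Finset.card_range, nsmul_eq_mul, mul_one, add_assoc]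
  refine add_le_add le_rfl ?_
  generalize ⌈T⌉₊ = J at *
  have e : ∑ j ∈ Finset.range N, (if j < J then 2 * ((J : ℝ) * √(J : ℝ)) / √(a : ℝ) else T ^ 4 / (2 * (a * √(a : ℝ))) * (1 / ((j : ℝ) * √(j : ℝ)))) ≤
      ∑ j ∈ Finset.range (max J N), (if j < J then 2 * ((J : ℝ) * √(J : ℝ)) / √(a : ℝ) else T ^ 4 / (2 * (a * √(a : ℝ))) * (1 / ((j : ℝ) * √(j : ℝ)))) := by
    refine Finset.sum_le_sum_of_subset_of_nonneg (Finset.range_mono (le_max_right _ _)) fun j _ _ => ?_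
    split_ifs <;> positivity
  refine e.trans ?_
  have hJN := le_max_left J N
  generalize max J N = M at *
  rw [← Finset.sum_range_add_sum_Ico _ hJN]
  refine add_le_add ?_ ?_
  · rw [Finset.sum_congr rfl (g := fun _ => 2 * ((J : ℝ) * √(J : ℝ)) / √(a : ℝ))]
    · rw [Finset.sum_const, Finset.card_range, nsmul_eq_mul]
      apply le_of_eq; ring
    · intro j hj; rw [if_pos (Finset.mem_range.1 hj)]
  · rw [Finset.sum_congr rfl (g := fun j : ℕ => T ^ 4 / (2 * (a * √(a : ℝ))) * (1 / ((j : ℝ) * √(j : ℝ))))]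
    · rw [← Finset.mul_sum]
      refine mul_le_mul_of_nonneg_left ?_ (by positivity)
      have := sum_j hJ M hJN
      have : 0 ≤ 4 / √(M : ℝ) := by positivity
      linarith
    · intro j hj; rw [if_neg (not_lt.2 (Finset.mem_Ico.1 hj).1)]

theorem Sa_count {a : ℕ} (ha : 0 < a) {T : ℝ} (hT : 1 ≤ T) : ((Sa a T).ncard : ℝ) ≤ 200 * (T ^ 3 * √T) * (1 / √(a : ℝ)) := by
  have ha' : (0 : ℝ) < a := by exact_mod_cast ha
  have haz : (0 : ℤ) < a := by exact_mod_cast ha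
  have hsa : 0 < √(a : ℝ) := Real.sqrt_pos.2 ha'
  rcases Set.eq_empty_or_nonempty (Sa a T) with he | ⟨G, hG⟩
  · rw [he, Set.ncard_empty]; push_cast; positivity
  obtain ⟨g1, g2, g3⟩ := Sa_facts ha hT hG
  have haT : (a : ℝ) ^ 2 ≤ 2 * T ^ 2 := by linarith
  set N := ⌊T ^ 2 / a⌋₊ + 1 with hN
  have h1 := ncard_fiber_le (Sa_finite a T) fidx (Finset.range a ×ˢ Finset.range N ×ˢ Finset.range 2 ×ˢ Finset.range 2) ?_
    (fun i => fbd a T i.2.1) (fun i _ => fib_bound ha hT i)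
  · refine h1.trans ?_
    have e : ∑ i ∈ Finset.range a ×ˢ Finset.range N ×ˢ Finset.range 2 ×ˢ Finset.range 2, fbd a T i.2.1 = 4 * a * ∑ j ∈ Finset.range N, fbd a T j := by
      rw [Finset.sum_product]
      simp only [Finset.sum_product, Finset.sum_const, Finset.card_product, Finset.card_range, nsmul_eq_mul, ← Finset.mul_sum]
      push_cast; ring
    rw [e]
    have h2 := sum_fbd ha hT N
    have hNr : (N : ℝ) ≤ T ^ 2 / a + 1 := by
      rw [hN]; push_cast
      have := Nat.floor_le (show 0 ≤ T ^ 2 / a by positivity)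
      linarith
    have hJ1 : T ≤ ⌈T⌉₊ := Nat.le_ceil T
    have hJ2 : (⌈T⌉₊ : ℝ) ≤ 2 * T := by have := Nat.ceil_lt_add_one (show 0 ≤ T by linarith); linarith
    have hx0 : 1 ≤ √T := Real.one_le_sqrt.2 hT
    have hx2 : √T ^ 2 = T := Real.sq_sqrt (by linarith)
    have hy2 : √(a : ℝ) ^ 2 = a := Real.sq_sqrt ha'.le
    have hJs1 : √T ≤ √(⌈T⌉₊ : ℝ) := Real.sqrt_le_sqrt hJ1
    have hJs2 : √(⌈T⌉₊ : ℝ) ≤ 3 / 2 * √T := by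
      rw [Real.sqrt_le_left (by positivity)]
      rw [mul_pow, hx2]; linarith
    generalize (⌈T⌉₊ : ℝ) = J at *
    generalize √J = z at *
    generalize √T = x at *
    generalize √(a : ℝ) = y at *
    generalize (a : ℝ) = α at *
    generalize ∑ j ∈ Finset.range N, fbd a T j = S0 at *
    generalize (N : ℝ) = n at *
    subst hx2 hy2
    have hyx : y ≤ 3 / 2 * x := by
      by_contra hh
      have h5 : 9 / 4 * x ^ 2 < y ^ 2 := by nlinarith
      nlinarith [sq_nonneg x]
    have hz0 : 0 ≤ z := by linarith
    have hJ0 : 0 ≤ J := by linarith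
    have b1 : J ^ 2 * z ≤ (2 * x ^ 2) ^ 2 * (3 / 2 * x) := by gcongr
    have b2 : 4 / z ≤ 4 / x := by gcongr
    have h3 : S0 ≤ (x ^ 2) ^ 2 / y ^ 2 + 1 + 2 * ((2 * x ^ 2) ^ 2 * (3 / 2 * x)) / y + (x ^ 2) ^ 4 / (2 * (y ^ 2 * y)) * (4 / x) := by
      refine h2.trans ?_
      gcongr
    have h4 : 4 * y ^ 2 * S0 ≤ 4 * y ^ 2 * ((x ^ 2) ^ 2 / y ^ 2 + 1 + 2 * ((2 * x ^ 2) ^ 2 * (3 / 2 * x)) / y + (x ^ 2) ^ 4 / (2 * (y ^ 2 * y)) * (4 / x)) := by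
      gcongr
    refine h4.trans ?_
    have e2 : 4 * y ^ 2 * ((x ^ 2) ^ 2 / y ^ 2 + 1 + 2 * ((2 * x ^ 2) ^ 2 * (3 / 2 * x)) / y + (x ^ 2) ^ 4 / (2 * (y ^ 2 * y)) * (4 / x)) =
        (4 * (x ^ 4 * y) + 4 * y ^ 3 + 48 * (x ^ 5 * y ^ 2) + 8 * x ^ 7) / y := by field_simp; ring
    rw [e2, mul_one_div]
    gcongr
    have hx0' : 0 < x := by linarith
    have c1 : x ^ 4 * y ≤ 3 / 2 * x ^ 7 := by
      have : x ^ 5 ≤ x ^ 7 := pow_le_pow_right₀ hx0 (by norm_num)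
      have : x ^ 4 * y ≤ x ^ 4 * (3 / 2 * x) := by gcongr
      linarith
    have c2 : y ^ 3 ≤ 27 / 8 * x ^ 7 := by
      have : x ^ 3 ≤ x ^ 7 := pow_le_pow_right₀ hx0 (by norm_num)
      have : y ^ 3 ≤ (3 / 2 * x) ^ 3 := by gcongr
      linarith
    have c3 : x ^ 5 * y ^ 2 ≤ 9 / 4 * x ^ 7 := by
      have : x ^ 5 * y ^ 2 ≤ x ^ 5 * (3 / 2 * x) ^ 2 := by gcongr
      linarith
    have e3 : (x ^ 2) ^ 3 * x = x ^ 7 := by ring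
    rw [e3]
    have : 0 < x ^ 7 := by positivity
    linarith
  · intro F hF
    obtain ⟨k1, k2, k3⟩ := Sa_facts ha hT hF
    have hF1 := hF.2.1
    unfold fidx
    simp only [Finset.mem_product, Finset.mem_range]
    rw [hF1]
    refine ⟨?_, ?_, ?_, ?_⟩
    · have := Int.emod_lt_of_pos F.2.1 haz
      have := Int.emod_nonneg F.2.1 haz.ne'
      omega
    · rw [hN, Nat.lt_add_one_iff]
      refine Nat.le_floor ?_
      rw [le_div_iff₀ ha']
      have h5 := Int.ediv_nonneg k1.le haz.le
      have h6 : (((qA F / a).toNat : ℕ) : ℤ) = qA F / a := Int.toNat_of_nonneg h5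
      have h7 : (((qA F / a).toNat : ℕ) : ℤ) * a ≤ qA F := by
        rw [h6, mul_comm]; exact Int.mul_ediv_self_le haz.ne'
      have h7 : (((qA F / a).toNat : ℕ) : ℝ) * a ≤ ((qA F : ℤ) : ℝ) := by exact_mod_cast h7
      linarith
    · omega
    · split_ifs <;> norm_num

theorem cusp_count {T ε : ℝ} (hT : 1 ≤ T) (hε : 0 < ε) :
    ({F : Z4 | Red F ∧ 0 < F.1 ∧ (F.1 : ℝ) ≤ ε * T ∧ ((qD F : ℤ) : ℝ) < T ^ 4}.ncard : ℝ) ≤ 400 * √ε * T ^ 4 := by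
  have hfin : {F : Z4 | Red F ∧ 0 < F.1 ∧ (F.1 : ℝ) ≤ ε * T ∧ ((qD F : ℤ) : ℝ) < T ^ 4}.Finite :=
    (redT_finite T).subset fun _ h => ⟨h.1, h.2.2.2⟩
  have h := ncard_fiber_le hfin (fun F => F.1.toNat) (Finset.Icc 1 ⌊ε * T⌋₊) ?_ (fun a => 200 * (T ^ 3 * √T) * (1 / √(a : ℝ))) ?_
  · refine h.trans ?_
    rw [← Finset.mul_sum]
    have h1 := sum_inv_sqrt ⌊ε * T⌋₊
    have h2 : √(⌊ε * T⌋₊ : ℝ) ≤ √ε * √T := by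
      rw [← Real.sqrt_mul hε.le]
      exact Real.sqrt_le_sqrt (Nat.floor_le (by positivity))
    have hx2 : √T ^ 2 = T := Real.sq_sqrt (by linarith)
    calc 200 * (T ^ 3 * √T) * ∑ a ∈ Finset.Icc 1 ⌊ε * T⌋₊, 1 / √(a : ℝ) ≤ 200 * (T ^ 3 * √T) * (2 * (√ε * √T)) := by gcongr; linarith
      _ = 400 * √ε * T ^ 3 * √T ^ 2 := by ring
      _ = _ := by rw [hx2]; ring
  · rintro F ⟨h1, h2, h3, h4⟩
    rw [Finset.mem_Icc]
    refine ⟨by omega, Nat.le_floor ?_⟩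
    have : ((F.1.toNat : ℕ) : ℤ) = F.1 := Int.toNat_of_nonneg h2.le
    have : ((F.1.toNat : ℕ) : ℝ) = (F.1 : ℝ) := by exact_mod_cast this
    rwa [this]
  · intro a ha
    rw [Finset.mem_Icc] at ha
    refine le_trans ?_ (Sa_count ha.1 hT)
    have := Set.ncard_le_ncard (s := {x | x ∈ {F : Z4 | Red F ∧ 0 < F.1 ∧ (F.1 : ℝ) ≤ ε * T ∧ ((qD F : ℤ) : ℝ) < T ^ 4} ∧ x.1.toNat = a}) (t := Sa a T) ?_ (Sa_finite a T)
    · exact_mod_cast this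
    · rintro F ⟨⟨h1, h2, h3, h4⟩, h5⟩
      exact ⟨h1, by omega, h4⟩
end NH

namespace NH

lemma ncard_mono_real {α : Type*} {S T : Set α} (h : S ⊆ T) (hT : T.Finite) : (S.ncard : ℝ) ≤ T.ncard := by
  exact_mod_cast Set.ncard_le_ncard h hT

lemma qA_neg' (F : Z4) : qA (-F) = qA F ∧ qB (-F) = qB F ∧ qC (-F) = qC F ∧ qD (-F) = qD F := by
  refine ⟨?_, ?_, ?_, ?_⟩ <;> simp only [qD, qA, qB, qC, Prod.fst_neg, Prod.snd_neg] <;> ring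

lemma Red.neg {F : Z4} (h : Red F) : Red (-F) := by
  obtain ⟨h1, h2, h3, h4⟩ := qA_neg' F
  unfold Red; rw [h1, h2, h3, h4]; exact h

lemma red_A_lt {F : Z4} (h : Red F) {T : ℝ} (hT : 0 ≤ T) (hD : ((qD F : ℤ) : ℝ) < T ^ 4) :
    ((qA F : ℤ) : ℝ) < T ^ 2 ∧ (F.1 : ℝ) ^ 2 ≤ 2 * ((qA F : ℤ) : ℝ) := by
  have hA := red_pos h
  obtain ⟨h1, -, h3⟩ := red_bounds F h.1 h.2.1
  have hAC := h.2.1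
  have k1 : 3 * (qA F * qA F) ≤ qD F := by nlinarith
  have k2 : F.1 ^ 2 ≤ 2 * qA F := by
    have : F.1 ^ 2 * qA F ≤ 2 * qA F * qA F := by nlinarith [sq_nonneg F.1, sq_nonneg F.2.1]
    exact le_of_mul_le_mul_right this hA
  have k1 : 3 * (((qA F : ℤ) : ℝ) * ((qA F : ℤ) : ℝ)) ≤ ((qD F : ℤ) : ℝ) := by exact_mod_cast k1
  refine ⟨?_, by exact_mod_cast k2⟩
  by_contra hh
  push Not at hh
  nlinarith [sq_nonneg T]

lemma red_pos_count {T : ℝ} (hT : 1 ≤ T) : ({F : Z4 | Red F ∧ 0 < F.1 ∧ ((qD F : ℤ) : ℝ) < T ^ 4}.ncard : ℝ) ≤ 600 * T ^ 4 := by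
  have h := cusp_count hT (show (0 : ℝ) < 2 by norm_num)
  have e : {F : Z4 | Red F ∧ 0 < F.1 ∧ ((qD F : ℤ) : ℝ) < T ^ 4} ⊆ {F : Z4 | Red F ∧ 0 < F.1 ∧ (F.1 : ℝ) ≤ 2 * T ∧ ((qD F : ℤ) : ℝ) < T ^ 4} := by
    rintro F ⟨h1, h2, h3⟩
    refine ⟨h1, h2, ?_, h3⟩
    obtain ⟨k1, k2⟩ := red_A_lt h1 (by linarith) h3
    have : (0 : ℝ) < F.1 := by exact_mod_cast h2
    nlinarith
  have h2 := ncard_mono_real e ((redT_finite T).subset fun _ h => ⟨h.1, h.2.2.2⟩)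
  have h3 : √(2 : ℝ) ≤ 3 / 2 := by rw [Real.sqrt_le_left (by norm_num)]; norm_num
  have h4 : 400 * √(2 : ℝ) * T ^ 4 ≤ 600 * T ^ 4 := by
    have : 0 < T ^ 4 := by positivity
    nlinarith
  linarith

lemma red_zero_facts {F : Z4} (h : Red F) (h0 : F.1 = 0) {T : ℝ} (hT : 0 ≤ T) (hD : ((qD F : ℤ) : ℝ) < T ^ 4) :
    F.2.1 ≠ 0 ∧ |F.2.2.1| ≤ |F.2.1| ∧ |(F.2.1 : ℝ)| ≤ T ∧
    0 < F.2.1 ^ 2 * (3 * F.2.2.1 ^ 2 - 4 * F.2.1 * F.2.2.2) ∧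
    (F.2.1 : ℝ) ^ 2 * (3 * F.2.2.1 ^ 2 - 4 * F.2.1 * F.2.2.2) < T ^ 4 := by
  have hA := red_pos h
  obtain ⟨k1, -⟩ := red_A_lt h hT hD
  obtain ⟨r1, r2, r3⟩ := h
  obtain ⟨a, b, c, d⟩ := F
  simp only at h0
  subst h0
  have eA : qA ((0, b, c, d) : Z4) = b ^ 2 := by simp [qA]
  have eB : qB ((0, b, c, d) : Z4) = b * c := by simp [qB]
  have eD : qD ((0, b, c, d) : Z4) = b ^ 2 * (3 * c ^ 2 - 4 * b * d) := by simp [qD, qA, qB, qC]; ring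
  rw [eA] at hA k1
  rw [eA, eB] at r1
  rw [eD] at r3 hD
  push_cast at hD k1
  have hb : b ≠ 0 := by rintro rfl; simp at hA
  refine ⟨hb, ?_, ?_, r3, hD⟩
  · rw [abs_mul, ← sq_abs b, sq] at r1
    exact le_of_mul_le_mul_left r1 (abs_pos.2 hb)
  · exact abs_le_of_sq_le_sq k1.le hT

lemma red_zero_fib {T : ℝ} (hT : 1 ≤ T) (b c : ℤ) (hb : b ≠ 0) :
    ({F : Z4 | Red F ∧ F.1 = 0 ∧ ((qD F : ℤ) : ℝ) < T ^ 4 ∧ F.2.1 = b ∧ F.2.2.1 = c}.ncard : ℝ) ≤ T ^ 4 / (4 * |(b : ℝ)| ^ 3) + 1 := by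
  set S := {F : Z4 | Red F ∧ F.1 = 0 ∧ ((qD F : ℤ) : ℝ) < T ^ 4 ∧ F.2.1 = b ∧ F.2.2.1 = c} with hS
  have hfin : S.Finite := (redT_finite T).subset fun _ h => ⟨h.1, h.2.2.1⟩
  have hb' : (b : ℝ) ≠ 0 := by exact_mod_cast hb
  have hbp : 0 < |(b : ℝ)| := abs_pos.2 hb'
  have hinj : S.InjOn (fun F => F.2.2.2) := by
    rintro ⟨a, b1, c1, d⟩ ⟨-, h1, -, h2, h3⟩ ⟨a', b2, c2, d'⟩ ⟨-, h4, -, h5, h6⟩ h7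
    simp only at *
    subst h1 h2 h3 h4 h5 h6 h7; rfl
  have h1 : S.ncard = (hfin.toFinset.image (fun F => F.2.2.2)).card := by
    rw [Finset.card_image_of_injOn (by simpa using hinj), ← Set.ncard_eq_toFinset_card _ hfin]
  rw [h1]
  -- centre
  have key : ∀ F ∈ S, |(F.2.2.2 : ℝ) - (3 * c ^ 2 / (4 * b) - T ^ 4 / (8 * b ^ 3))| ≤ T ^ 4 / (8 * |(b : ℝ)| ^ 3) := by
    rintro F ⟨f1, f2, f3, f4, f5⟩
    obtain ⟨-, -, -, g4, g5⟩ := red_zero_facts f1 f2 (by linarith) f3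
    rw [f4, f5] at g4 g5
    have g4 : (0 : ℝ) < (b : ℝ) ^ 2 * (3 * c ^ 2 - 4 * b * F.2.2.2) := by exact_mod_cast g4
    generalize (F.2.2.2 : ℝ) = d at *
    have e : d - (3 * c ^ 2 / (4 * b) - T ^ 4 / (8 * b ^ 3)) = (T ^ 4 - 2 * ((b : ℝ) ^ 2 * (3 * c ^ 2 - 4 * b * d))) / (8 * b ^ 3) := by
      field_simp; ring
    rw [e, abs_div, abs_mul, abs_pow]
    rw [abs_of_pos (show (0 : ℝ) < 8 by norm_num)]
    gcongr
    rw [abs_le]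
    constructor <;> linarith
  have := ap_count (s := hfin.toFinset.image (fun F => F.2.2.2)) (m := 1) one_pos
    (lo := (3 * c ^ 2 / (4 * b) - T ^ 4 / (8 * b ^ 3)) - T ^ 4 / (8 * |(b : ℝ)| ^ 3))
    (hi := (3 * c ^ 2 / (4 * b) - T ^ 4 / (8 * b ^ 3)) + T ^ 4 / (8 * |(b : ℝ)| ^ 3)) ?_ ?_ ?_
  · refine this.trans (le_of_eq ?_)
    push_cast
    field_simp; ring
  · have : 0 ≤ T ^ 4 / (8 * |(b : ℝ)| ^ 3) := by positivity
    linarith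
  · intros; simp
  · intro x hx
    rw [Finset.mem_image] at hx
    obtain ⟨F, hF, rfl⟩ := hx
    have := abs_le.1 (key F (hfin.mem_toFinset.1 hF))
    constructor <;> linarith [this.1, this.2]

lemma red_zero_fib2 {T : ℝ} (hT : 1 ≤ T) (b : ℤ) (hb : b ≠ 0) :
    ({F : Z4 | Red F ∧ F.1 = 0 ∧ ((qD F : ℤ) : ℝ) < T ^ 4 ∧ F.2.1 = b}.ncard : ℝ) ≤ 3 * |(b : ℝ)| * (T ^ 4 / (4 * |(b : ℝ)| ^ 3) + 1) := by
  have hfin : {F : Z4 | Red F ∧ F.1 = 0 ∧ ((qD F : ℤ) : ℝ) < T ^ 4 ∧ F.2.1 = b}.Finite := (redT_finite T).subset fun _ h => ⟨h.1, h.2.2.1⟩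
  have h := ncard_fiber_le hfin (fun F => F.2.2.1) (Finset.Icc (-|b|) |b|) ?_ (fun _ => T ^ 4 / (4 * |(b : ℝ)| ^ 3) + 1) ?_
  · refine h.trans ?_
    rw [Finset.sum_const, nsmul_eq_mul, Int.card_Icc]
    have hb1 : 1 ≤ |b| := Int.one_le_abs hb
    have e : (((|b| + 1 - -|b|).toNat : ℕ) : ℤ) = 2 * |b| + 1 := by omega
    have e : (((|b| + 1 - -|b|).toNat : ℕ) : ℝ) = 2 * |(b : ℝ)| + 1 := by exact_mod_cast e
    rw [e]
    have : (1 : ℝ) ≤ |(b : ℝ)| := by exact_mod_cast hb1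
    gcongr
    linarith
  · rintro F ⟨h1, h2, h3, h4⟩
    obtain ⟨-, g2, -⟩ := red_zero_facts h1 h2 (by linarith) h3
    rw [h4] at g2
    rw [Finset.mem_Icc]
    exact abs_le.1 g2
  · intro c _
    refine le_trans (le_of_eq ?_) (red_zero_fib hT b c hb)
    congr 2
    ext F
    simp only [Set.mem_ofPred_eq]
    tauto

lemma red_zero_count {T : ℝ} (hT : 1 ≤ T) : ({F : Z4 | Red F ∧ F.1 = 0 ∧ ((qD F : ℤ) : ℝ) < T ^ 4}.ncard : ℝ) ≤ 10 * T ^ 4 := by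
  have hfin : {F : Z4 | Red F ∧ F.1 = 0 ∧ ((qD F : ℤ) : ℝ) < T ^ 4}.Finite := (redT_finite T).subset fun _ h => ⟨h.1, h.2.2⟩
  have h := ncard_fiber_le hfin (fun F => (decide (0 < F.2.1), F.2.1.natAbs)) (Finset.univ ×ˢ Finset.Ioo 0 (⌊T⌋₊ + 1)) ?_
    (fun i => 3 * T ^ 4 / 4 * ((i.2 : ℝ) ^ 2)⁻¹ + 3 * T) ?_
  · refine h.trans ?_
    rw [Finset.sum_product]
    simp only [Finset.sum_const, Finset.card_univ, Fintype.card_bool, Finset.sum_add_distrib, ← Finset.mul_sum, Nat.card_Ioo, nsmul_eq_mul]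
    have h1 := sum_Ioo_inv_sq_le (α := ℝ) 0 (⌊T⌋₊ + 1)
    have h2 := Nat.floor_le (show 0 ≤ T by linarith)
    have h3 : ((⌊T⌋₊ + 1 - 0 - 1 : ℕ) : ℝ) ≤ T := by simpa using h2
    have h4 : 3 * T ^ 4 / 4 * ∑ i ∈ Finset.Ioo 0 (⌊T⌋₊ + 1), ((i : ℝ) ^ 2)⁻¹ ≤ 3 * T ^ 4 / 4 * 2 := by
      gcongr
      simpa using h1
    have h5 : ((⌊T⌋₊ + 1 - 0 - 1 : ℕ) : ℝ) * (3 * T) ≤ T * (3 * T) := by gcongr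
    have h6 : T ^ 2 ≤ T ^ 4 := pow_le_pow_right₀ hT (by norm_num)
    push_cast at *
    nlinarith
  · rintro F ⟨h1, h2, h3⟩
    obtain ⟨g1, -, g3, -⟩ := red_zero_facts h1 h2 (by linarith) h3
    simp only [Finset.mem_product, Finset.mem_univ, true_and, Finset.mem_Ioo]
    refine ⟨Int.natAbs_pos.2 g1, Nat.lt_add_one_iff.2 (Nat.le_floor ?_)⟩
    rw [Nat.cast_natAbs]; push_cast; exact g3
  · rintro ⟨s, n⟩ hi
    simp only [Finset.mem_product, Finset.mem_univ, true_and, Finset.mem_Ioo] at hi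
    obtain ⟨hn0, hn1⟩ := hi
    have hnT : (n : ℝ) ≤ T := (Nat.le_floor_iff (by linarith)).1 (by omega)
    have hn' : (0 : ℝ) < n := by exact_mod_cast hn0
    obtain ⟨b, hb0, hbn, hb⟩ : ∃ b : ℤ, b ≠ 0 ∧ |b| = n ∧ ∀ x : ℤ, decide (0 < x) = s → x.natAbs = n → x = b := by
      cases s
      · refine ⟨-n, by omega, by rw [abs_neg]; simp, fun x hx hx2 => ?_⟩
        simp only [decide_eq_false_iff_not] at hx
        omega
      · refine ⟨n, by omega, by simp, fun x hx hx2 => ?_⟩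
        simp only [decide_eq_true_eq] at hx
        omega
    have hbn : |(b : ℝ)| = n := by exact_mod_cast hbn
    have h2 := red_zero_fib2 hT b hb0
    rw [hbn] at h2
    have h3 := ncard_mono_real (S := {x | x ∈ {F : Z4 | Red F ∧ F.1 = 0 ∧ ((qD F : ℤ) : ℝ) < T ^ 4} ∧ (decide (0 < x.2.1), x.2.1.natAbs) = (s, n)})
      (T := {F : Z4 | Red F ∧ F.1 = 0 ∧ ((qD F : ℤ) : ℝ) < T ^ 4 ∧ F.2.1 = b}) ?_ ((redT_finite T).subset fun _ h => ⟨h.1, h.2.2.1⟩)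
    · refine h3.trans (h2.trans ?_)
      have e : 3 * (n : ℝ) * (T ^ 4 / (4 * (n : ℝ) ^ 3) + 1) = 3 * T ^ 4 / 4 * ((n : ℝ) ^ 2)⁻¹ + 3 * n := by field_simp
      rw [e]
      simp only
      gcongr
    · rintro F ⟨⟨f1, f2, f3⟩, f4⟩
      rw [Prod.mk.injEq] at f4
      exact ⟨f1, f2, f3, hb _ f4.1 f4.2⟩

/-- total number of reduced forms -/
theorem red_count {T : ℝ} (hT : 1 ≤ T) : ({F : Z4 | Red F ∧ ((qD F : ℤ) : ℝ) < T ^ 4}.ncard : ℝ) ≤ 1210 * T ^ 4 := by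
  set P := {F : Z4 | Red F ∧ 0 < F.1 ∧ ((qD F : ℤ) : ℝ) < T ^ 4}
  set Z := {F : Z4 | Red F ∧ F.1 = 0 ∧ ((qD F : ℤ) : ℝ) < T ^ 4}
  have hP : P.Finite := (redT_finite T).subset fun _ h => ⟨h.1, h.2.2⟩
  have hZ : Z.Finite := (redT_finite T).subset fun _ h => ⟨h.1, h.2.2⟩
  have e : {F : Z4 | Red F ∧ ((qD F : ℤ) : ℝ) < T ^ 4} ⊆ P ∪ (Z ∪ (fun F => -F) '' P) := by
    rintro F ⟨h1, h2⟩
    rcases lt_trichotomy F.1 0 with h | h | h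
    · refine Or.inr (Or.inr ⟨-F, ⟨h1.neg, ?_, ?_⟩, neg_neg F⟩)
      · rw [Prod.fst_neg]; omega
      · rw [(qA_neg' F).2.2.2]; exact h2
    · exact Or.inr (Or.inl ⟨h1, h, h2⟩)
    · exact Or.inl ⟨h1, h, h2⟩
  have h1 := Set.ncard_le_ncard e (hP.union (hZ.union (hP.image _)))
  have h2 := Set.ncard_union_le P (Z ∪ (fun F => -F) '' P)
  have h3 := Set.ncard_union_le Z ((fun F => -F) '' P)
  have h4 := Set.ncard_image_le (f := fun F => -F) hP
  have h5 : {F : Z4 | Red F ∧ ((qD F : ℤ) : ℝ) < T ^ 4}.ncard ≤ P.ncard + (Z.ncard + P.ncard) := by omega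
  have h5 : ({F : Z4 | Red F ∧ ((qD F : ℤ) : ℝ) < T ^ 4}.ncard : ℝ) ≤ P.ncard + (Z.ncard + P.ncard) := by exact_mod_cast h5
  have h6 := red_pos_count hT
  have h7 := red_zero_count hT
  linarith
end NH

namespace NH

/-- substitution `F(xX + yY, zX + wY)` -/
def act (x y z w : ℤ) (F : Z4) : Z4 :=
  (F.1 * x ^ 3 + 3 * F.2.1 * x ^ 2 * z + 3 * F.2.2.1 * x * z ^ 2 + F.2.2.2 * z ^ 3,
   F.1 * x ^ 2 * y + F.2.1 * (x ^ 2 * w + 2 * x * y * z) + F.2.2.1 * (2 * x * z * w + y * z ^ 2) + F.2.2.2 * z ^ 2 * w,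
   F.1 * x * y ^ 2 + F.2.1 * (2 * x * y * w + y ^ 2 * z) + F.2.2.1 * (x * w ^ 2 + 2 * y * z * w) + F.2.2.2 * z * w ^ 2,
   F.1 * y ^ 3 + 3 * F.2.1 * y ^ 2 * w + 3 * F.2.2.1 * y * w ^ 2 + F.2.2.2 * w ^ 3)

lemma act_act (x y z w x' y' z' w' : ℤ) (F : Z4) :
    act x' y' z' w' (act x y z w F) = act (x * x' + y * z') (x * y' + y * w') (z * x' + w * z') (z * y' + w * w') F := by
  obtain ⟨a, b, c, d⟩ := F
  simp only [act, Prod.mk.injEq]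
  refine ⟨?_, ?_, ?_, ?_⟩ <;> ring

lemma act_one (F : Z4) : act 1 0 0 1 F = F := by
  obtain ⟨a, b, c, d⟩ := F
  simp only [act, Prod.mk.injEq]
  refine ⟨?_, ?_, ?_, ?_⟩ <;> ring

lemma act_inv {x y z w : ℤ} (h : x * w - y * z = 1) (F : Z4) : act w (-y) (-z) x (act x y z w F) = F := by
  rw [act_act]
  have e1 : x * w + y * -z = 1 := by linarith
  have e2 : x * -y + y * x = 0 := by ring
  have e3 : z * w + w * -z = 0 := by ring
  have e4 : z * -y + w * x = 1 := by linarith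
  rw [e1, e2, e3, e4, act_one]

lemma act_A (x y z w : ℤ) (F : Z4) : qA (act x y z w F) = (x * w - y * z) ^ 2 * (qA F * x ^ 2 + qB F * x * z + qC F * z ^ 2) := by
  simp only [qA, qB, qC, act]; ring

lemma act_B (x y z w : ℤ) (F : Z4) : qB (act x y z w F) = (x * w - y * z) ^ 2 * (2 * qA F * x * y + qB F * (x * w + y * z) + 2 * qC F * z * w) := by
  simp only [qA, qB, qC, act]; ring

lemma act_C (x y z w : ℤ) (F : Z4) : qC (act x y z w F) = (x * w - y * z) ^ 2 * (qA F * y ^ 2 + qB F * y * w + qC F * w ^ 2) := by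
  simp only [qA, qB, qC, act]; ring

lemma act_D {x y z w : ℤ} (h : x * w - y * z = 1) (F : Z4) : qD (act x y z w F) = qD F := by
  have h2 : qD (act x y z w F) = (x * w - y * z) ^ 6 * qD F := by
    rw [qD, act_A, act_B, act_C, qD]; ring
  rw [h2, h]; ring

lemma exists_red (n : ℕ) : ∀ F : Z4, 0 < qA F → 0 < qD F → qA F ≤ n → ∃ x y z w : ℤ, x * w - y * z = 1 ∧ Red (act x y z w F) := by
  induction n with
  | zero => intro F h1 _ h3; simp at h3; omega
  | succ n ih =>
    intro F hA hD hn
    set k : ℤ := -((qB F + qA F) / (2 * qA F)) with hk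
    have hdet : (1 : ℤ) * 1 - k * 0 = 1 := by ring
    have eA : qA (act 1 k 0 1 F) = qA F := by rw [act_A]; ring
    have eB : qB (act 1 k 0 1 F) = 2 * qA F * k + qB F := by rw [act_B]; ring
    have eD := act_D hdet F
    have hB : |qB (act 1 k 0 1 F)| ≤ qA F := by
      have h1 := Int.mul_ediv_self_le (x := qB F + qA F) (k := 2 * qA F) (by omega)
      have h2 := Int.lt_mul_ediv_self_add (x := qB F + qA F) (k := 2 * qA F) (by omega)
      rw [eB, abs_le]
      constructor <;> nlinarith
    set G := act 1 k 0 1 F with hG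
    rcases le_or_gt (qA G) (qC G) with hAC | hAC
    · exact ⟨1, k, 0, 1, hdet, by rw [eA]; exact hB, hAC, by rw [eD]; exact hD⟩
    · have hC : 0 < qC G := by
        have h4 : 0 < qD G := by rw [eD]; exact hD
        have h5 : 0 < qA G := by rw [eA]; exact hA
        unfold qD at h4
        by_contra hh
        nlinarith [sq_nonneg (qB G), mul_nonneg h5.le (sub_nonneg.2 (not_lt.1 hh))]
      have hdet2 : (0 : ℤ) * 0 - (-1) * 1 = 1 := by ring
      have eA2 : qA (act 0 (-1) 1 0 G) = qC G := by rw [act_A]; ring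
      have eD2 := act_D hdet2 G
      obtain ⟨x, y, z, w, h1, h2⟩ := ih (act 0 (-1) 1 0 G) (by rw [eA2]; exact hC) (by rw [eD2, eD]; exact hD) (by rw [eA2]; push_cast at hn; omega)
      rw [hG, act_act, act_act] at h2
      refine ⟨_, _, _, _, ?_, h2⟩
      linear_combination h1

lemma sred_aux {A B C x z A' : ℤ} (hB : |B| < A) (hC : A < C) (h : A' = A * x ^ 2 + B * x * z + C * z ^ 2) (hz : z ≠ 0) : A < A' := by
  have h1 : 1 ≤ z ^ 2 := by have := Int.one_le_abs hz; rw [← sq_abs]; nlinarith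
  have h2 : -(|B| * |x * z|) ≤ B * x * z := by
    rw [← abs_mul, mul_assoc]; exact neg_abs_le _
  have h3 : |x * z| * 2 ≤ x ^ 2 + z ^ 2 := by
    rw [abs_mul, ← sq_abs x, ← sq_abs z]; nlinarith [sq_nonneg (|x| - |z|)]
  have h4 : |B| * |x * z| ≤ A * |x * z| := mul_le_mul_of_nonneg_right hB.le (abs_nonneg _)
  have h6 : 0 < A := lt_of_le_of_lt (abs_nonneg _) hB
  have h5 : |x * z| + 1 ≤ x ^ 2 + z ^ 2 := by
    rcases eq_or_ne x 0 with rfl | hx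
    · simpa using h1
    · have : 1 ≤ |x * z| := Int.one_le_abs (mul_ne_zero hx hz)
      omega
  rw [h]
  nlinarith [mul_le_mul_of_nonneg_left h5 h6.le]

/-- strictly reduced forms are inequivalent -/
lemma sred_unique {F G : Z4} (hF : SRed F) (hG : SRed G) (hF1 : 0 < F.1) (hG1 : 0 < G.1) {x y z w : ℤ} (h : x * w - y * z = 1)
    (he : G = act x y z w F) : G = F := by
  have hA := act_A x y z w F
  have hB := act_B x y z w F
  rw [← he, h] at hA hB
  have hinv := act_inv h F
  rw [← he] at hinv
  have hA2 := act_A w (-y) (-z) x G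
  have hdet2 : w * x - (-y) * (-z) = 1 := by linarith
  rw [hinv, hdet2] at hA2
  have hz : z = 0 := by
    by_contra hz
    have h1 := sred_aux (x := x) (A' := qA G) hF.1 hF.2 (by rw [hA]; ring) hz
    have h2 := sred_aux (x := w) (A' := qA F) hG.1 hG.2 (by rw [hA2]; ring) (neg_ne_zero.2 hz)
    exact lt_asymm h1 h2
  subst hz
  have hxw : x * w = 1 := by linarith
  rcases Int.eq_one_or_neg_one_of_mul_eq_one' hxw with ⟨rfl, rfl⟩ | ⟨rfl, rfl⟩
  · have hA' : qA G = qA F := by rw [hA]; ring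
    have hB' : qB G = 2 * qA F * y + qB F := by rw [hB]; ring
    have hy : y = 0 := by
      have h1 := abs_lt.1 hF.1
      have h2 := abs_lt.1 hG.1
      rw [hA', hB'] at h2
      have hp : 0 < qA F := lt_of_le_of_lt (abs_nonneg _) hF.1
      by_contra hy
      rcases lt_or_gt_of_ne hy with h3 | h3 <;> nlinarith
    subst hy
    rw [he, act_one]
  · exfalso
    have : G.1 = -F.1 := by rw [he]; simp only [act]; ring
    omega

/-- the overform construction -/
lemma over_exists {p : ℕ} (hp : p.Prime) (hp2 : p ≠ 2) {F : Z4} (hA : 0 < qA F) (hD : 0 < qD F) (hpD : (p : ℤ) ^ 2 ∣ qD F)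
    (hprim : ¬ ((p : ℤ) ∣ qA F ∧ (p : ℤ) ∣ qB F ∧ (p : ℤ) ∣ qC F)) :
    ∃ (E : Z4) (x y z w a b c d x' y' z' w' : ℤ), x * w - y * z = 1 ∧ x' * w' - y' * z' = 1 ∧ Red E ∧ qD F = p ^ 2 * qD E ∧
      ¬ (p : ℤ) ∣ c ∧ act x y z w E = (a, b, c, p * d) ∧ F = act x' y' z' w' (p ^ 2 * a, p * b, c, d) := by
  have hpp : Prime (p : ℤ) := Nat.prime_iff_prime_int.1 hp
  have hp0 : (0 : ℤ) < p := by exact_mod_cast hp.pos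
  -- move the double root
  obtain ⟨x, y, z, w, hdet, hpA⟩ : ∃ x y z w : ℤ, x * w - y * z = 1 ∧ (p : ℤ) ∣ qA (act x y z w F) := by
    by_cases h : (p : ℤ) ∣ qA F
    · exact ⟨1, 0, 0, 1, by ring, by rw [act_one]; exact h⟩
    · have hc : IsCoprime (p : ℤ) (2 * qA F) := by
        rw [Prime.coprime_iff_not_dvd hpp]
        intro h2
        rcases hpp.dvd_or_dvd h2 with h3 | h3
        · have : p ∣ 2 := by exact_mod_cast h3
          exact hp2 ((Nat.prime_dvd_prime_iff_eq hp Nat.prime_two).1 this)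
        · exact h h3
      obtain ⟨u, v, huv⟩ := hc
      refine ⟨-(v * qB F), -1, 1, 0, by ring, ?_⟩
      have hc2 : IsCoprime (p : ℤ) (2 * (2 * qA F)) := by
        rw [Prime.coprime_iff_not_dvd hpp]
        intro h2
        rcases hpp.dvd_or_dvd h2 with h3 | h3
        · have : p ∣ 2 := by exact_mod_cast h3
          exact hp2 ((Nat.prime_dvd_prime_iff_eq hp Nat.prime_two).1 this)
        · rcases hpp.dvd_or_dvd h3 with h3 | h3
          · have : p ∣ 2 := by exact_mod_cast h3
            exact hp2 ((Nat.prime_dvd_prime_iff_eq hp Nat.prime_two).1 this)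
          · exact h h3
      refine hc2.dvd_of_dvd_mul_left ?_
      obtain ⟨e, he⟩ := dvd_trans (dvd_pow_self (p : ℤ) two_ne_zero) hpD
      rw [act_A]
      unfold qD at he
      refine ⟨p * (u * qB F) ^ 2 + e, ?_⟩
      have e1 : 2 * qA F * v = 1 - u * p := by linarith
      have e2 : 2 * (2 * qA F) * (((-(v * qB F)) * 0 - (-1) * 1) ^ 2 * (qA F * (-(v * qB F)) ^ 2 + qB F * (-(v * qB F)) * 1 + qC F * 1 ^ 2)) =
        (qB F - (2 * qA F * v) * qB F) ^ 2 + (4 * qA F * qC F - qB F ^ 2) := by ring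
      rw [e2, e1, he]; ring
  set G := act x y z w F with hG
  have hDG : qD G = qD F := act_D hdet F
  have hprimG : ¬ ((p : ℤ) ∣ qA G ∧ (p : ℤ) ∣ qB G ∧ (p : ℤ) ∣ qC G) := by
    rintro ⟨h1, h2, h3⟩
    apply hprim
    have hinv := act_inv hdet F
    rw [← hG] at hinv
    refine ⟨?_, ?_, ?_⟩ <;> rw [← hinv]
    · rw [act_A]; refine Dvd.dvd.mul_left ?_ _; exact dvd_add (dvd_add (h1.mul_right _) ((h2.mul_right _).mul_right _)) (h3.mul_right _)
    · rw [act_B]; refine Dvd.dvd.mul_left ?_ _; exact dvd_add (dvd_add (((h1.mul_left _).mul_right _).mul_right _) (h2.mul_right _)) (((h3.mul_left _).mul_right _).mul_right _)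
    · rw [act_C]; refine Dvd.dvd.mul_left ?_ _; exact dvd_add (dvd_add (h1.mul_right _) ((h2.mul_right _).mul_right _)) (h3.mul_right _)
  have hAG : 0 < qA G := by
    rw [hG, act_A, hdet]
    have : 0 < 4 * qA F * (qA F * x ^ 2 + qB F * x * z + qC F * z ^ 2) := by
      have e : 4 * qA F * (qA F * x ^ 2 + qB F * x * z + qC F * z ^ 2) = (2 * qA F * x + qB F * z) ^ 2 + qD F * z ^ 2 := by
        unfold qD; ring
      rw [e]
      rcases eq_or_ne z 0 with rfl | hz
      · have hx : x ≠ 0 := by rintro rfl; simp at hdet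
        have : 2 * qA F * x ≠ 0 := mul_ne_zero (by omega) hx
        have := sq_pos_of_ne_zero this
        simpa using this
      · have : 0 < qD F * z ^ 2 := by positivity
        nlinarith [sq_nonneg (2 * qA F * x + qB F * z)]
    nlinarith
  have hFG : F = act w (-y) (-z) x G := (act_inv hdet F).symm
  rw [← hDG] at hpD hD ⊢
  clear_value G
  obtain ⟨a, b, c, d⟩ := G
  have hpB : (p : ℤ) ∣ qB (a, b, c, d) := by
    have h1 : (p : ℤ) ∣ qD (a, b, c, d) := dvd_trans (dvd_pow_self (p : ℤ) two_ne_zero) hpD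
    unfold qD at h1
    have h2 : (p : ℤ) ∣ qB (a, b, c, d) ^ 2 := (Int.dvd_iff_dvd_of_dvd_sub h1).1 ((hpA.mul_left _).mul_right _)
    exact hpp.dvd_of_dvd_pow h2
  have hpC : ¬ (p : ℤ) ∣ qC (a, b, c, d) := fun h => hprimG ⟨hpA, hpB, h⟩
  -- a ≡ b ≡ 0
  have ha : (p : ℤ) ∣ a := by
    by_contra ha
    have h1 : (p : ℤ) ∣ a ^ 2 * qC (a, b, c, d) := by
      have e : a ^ 2 * qC (a, b, c, d) = qA (a, b, c, d) * (qA (a, b, c, d) - b ^ 2) + a * b * qB (a, b, c, d) := by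
        simp only [qA, qB, qC]; ring
      rw [e]
      exact dvd_add (hpA.mul_right _) (hpB.mul_left _)
    rcases hpp.dvd_or_dvd h1 with h | h
    · exact ha (hpp.dvd_of_dvd_pow h)
    · exact hpC h
  obtain ⟨a1, rfl⟩ := ha
  have hb : (p : ℤ) ∣ b := by
    have : (p : ℤ) ∣ b ^ 2 := by
      have := dvd_add hpA (show (p : ℤ) ∣ p * a1 * c from ⟨a1 * c, by ring⟩)
      simpa [qA] using this
    exact hpp.dvd_of_dvd_pow this
  obtain ⟨b1, rfl⟩ := hb
  have hc : ¬ (p : ℤ) ∣ c := by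
    intro h
    apply hpC
    obtain ⟨c1, rfl⟩ := h
    exact ⟨p * c1 ^ 2 - b1 * d, by simp only [qC]; ring⟩
  have ha1 : (p : ℤ) ∣ a1 := by
    obtain ⟨e, he⟩ := hpD
    have h1 : (p : ℤ) ∣ 2 * 2 * a1 * c ^ 3 := by
      have h2 : (p : ℤ) * (2 * 2 * a1 * c ^ 3) = p * (p * (4 * a1 * c * b1 * d + 4 * b1 ^ 2 * (c ^ 2 - p * b1 * d) - (b1 * c - a1 * d) ^ 2 - e)) := by
        have h3 : qD ((p : ℤ) * a1, (p : ℤ) * b1, c, d) = p ^ 2 * (4 * b1 ^ 2 * (c ^ 2 - p * b1 * d) + 4 * a1 * c * b1 * d - (b1 * c - a1 * d) ^ 2) - p * (4 * a1 * c ^ 3) := by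
          simp only [qD, qA, qB, qC]; ring
        rw [h3] at he
        linear_combination -he
      exact ⟨_, mul_left_cancel₀ hp0.ne' h2⟩
    have h2' : ¬ (p : ℤ) ∣ 2 := by
      intro h3
      have : p ∣ 2 := by exact_mod_cast h3
      exact hp2 ((Nat.prime_dvd_prime_iff_eq hp Nat.prime_two).1 this)
    rcases hpp.dvd_or_dvd h1 with h | h
    · rcases hpp.dvd_or_dvd h with h | h
      · rcases hpp.dvd_or_dvd h with h | h <;> exact absurd h h2'
      · exact h
    · exact absurd (hpp.dvd_of_dvd_pow h) hc
  obtain ⟨a2, rfl⟩ := ha1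
  -- the overform
  have eA : qA ((p : ℤ) * (p * a2), (p : ℤ) * b1, c, d) = p ^ 2 * qA (a2, b1, c, (p : ℤ) * d) := by simp only [qA]; ring
  have eD : qD ((p : ℤ) * (p * a2), (p : ℤ) * b1, c, d) = p ^ 2 * qD (a2, b1, c, (p : ℤ) * d) := by simp only [qD, qA, qB, qC]; ring
  have hA1 : 0 < qA (a2, b1, c, (p : ℤ) * d) := by
    rw [eA] at hAG
    exact pos_of_mul_pos_right hAG (by positivity)
  have hD1 : 0 < qD (a2, b1, c, (p : ℤ) * d) := by
    rw [eD] at hD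
    exact pos_of_mul_pos_right hD (by positivity)
  obtain ⟨x1, y1, z1, w1, hdet1, hred⟩ := exists_red (qA (a2, b1, c, (p : ℤ) * d)).toNat _ hA1 hD1 (by omega)
  refine ⟨_, w1, -y1, -z1, x1, a2, b1, c, d, w, -y, -z, x, by linarith, by linarith, hred, ?_, hc, act_inv hdet1 _, ?_⟩
  · rw [act_D hdet1, eD]
  · rw [hFG]; congr 2; ring

/-- uniqueness for the overform construction -/
lemma over_unique {p : ℕ} (hp : 0 < p) {E F F1 : Z4} (hF : SRed F) (hF1 : SRed F1) (h0 : 0 < F.1) (h01 : 0 < F1.1)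
    {x y z w a b c d x' y' z' w' : ℤ} (h : x * w - y * z = 1) (h' : x' * w' - y' * z' = 1)
    (hE : act x y z w E = (a, b, c, p * d)) (hE' : F = act x' y' z' w' (p ^ 2 * a, p * b, c, d))
    {x1 y1 z1 w1 a1 b1 c1 d1 x1' y1' z1' w1' : ℤ} (h1 : x1 * w1 - y1 * z1 = 1) (h1' : x1' * w1' - y1' * z1' = 1)
    (hE1 : act x1 y1 z1 w1 E = (a1, b1, c1, p * d1)) (hE1' : F1 = act x1' y1' z1' w1' (p ^ 2 * a1, p * b1, c1, d1))
    (hl : (p : ℤ) ∣ w * y1 - y * w1) : F1 = F := by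
  obtain ⟨t, ht⟩ := hl
  have hp0 : (p : ℤ) ≠ 0 := by exact_mod_cast hp.ne'
  have e1 : E = act w (-y) (-z) x (a, b, c, p * d) := by rw [← hE, act_inv h]
  rw [e1, act_act] at hE1
  have e2 : w * y1 + -y * w1 = p * t := by linarith
  rw [e2] at hE1
  set m1 := w * x1 + -y * z1
  set m3 := -z * x1 + x * z1
  set m4 := -z * y1 + x * w1
  have hdet : m1 * m4 - (p * t) * m3 = 1 := by
    rw [← e2]
    linear_combination (x1 * w1 - y1 * z1) * h + h1
  have key : (p ^ 2 * a1, p * b1, c1, d1) = act m1 t (p * m3) m4 ((p ^ 2 * a, p * b, c, d) : Z4) := by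
    simp only [act, Prod.mk.injEq] at hE1 ⊢
    obtain ⟨k1, k2, k3, k4⟩ := hE1
    refine ⟨?_, ?_, ?_, ?_⟩
    · rw [← k1]; ring
    · rw [← k2]; ring
    · rw [← k3]; ring
    · refine mul_left_cancel₀ hp0 ?_
      rw [← k4]; ring
  have hinv := act_inv h' (p ^ 2 * a, p * b, c, d)
  rw [← hE'] at hinv
  have : F1 = act x1' y1' z1' w1' (act m1 t (p * m3) m4 (act w' (-y') (-z') x' F)) := by
    rw [hinv, ← key, hE1']
  rw [act_act, act_act] at this
  refine sred_unique hF hF1 h0 h01 ?_ this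
  have hd2 : m1 * m4 - t * (p * m3) = 1 := by linarith
  calc _ = (w' * x' - (-y') * (-z')) * (m1 * m4 - t * (p * m3)) * (x1' * w1' - y1' * z1') := by ring
    _ = 1 := by rw [hd2, h1']; linarith
end NH

namespace NH

lemma cubic_roots_le {p : ℕ} [Fact p.Prime] (a b c d : ZMod p) (h : ¬ (a = 0 ∧ b = 0 ∧ c = 0 ∧ d = 0)) :
    (Finset.univ.filter fun t : ZMod p => a * t ^ 3 + b * t ^ 2 + c * t + d = 0).card ≤ 3 := by
  set P : Cubic (ZMod p) := ⟨a, b, c, d⟩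
  have hP : P.toPoly ≠ 0 := by
    intro h0
    have := (Cubic.toPoly_eq_zero_iff P).1 h0
    apply h
    exact ⟨congrArg Cubic.a this, congrArg Cubic.b this, congrArg Cubic.c this, congrArg Cubic.d this⟩
  refine le_trans (Finset.card_le_card ?_) (Cubic.card_roots_le (P := P))
  intro t ht
  rw [Multiset.mem_toFinset, Cubic.mem_roots_iff hP]
  exact (Finset.mem_filter.1 ht).2

lemma over_count {p : ℕ} (hp : p.Prime) (hp3 : 3 < p) {T : ℝ} (hT : 0 ≤ T) :
    ({F : Z4 | SRed F ∧ 0 < F.1 ∧ ((qD F : ℤ) : ℝ) < T ^ 4 ∧ (p : ℤ) ^ 2 ∣ qD F ∧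
      ¬ ((p : ℤ) ∣ qA F ∧ (p : ℤ) ∣ qB F ∧ (p : ℤ) ∣ qC F)}.ncard : ℝ) ≤ 4840 * T ^ 4 / (p : ℝ) ^ 2 := by
  classical
  have : Fact p.Prime := ⟨hp⟩
  set S := {F : Z4 | SRed F ∧ 0 < F.1 ∧ ((qD F : ℤ) : ℝ) < T ^ 4 ∧ (p : ℤ) ^ 2 ∣ qD F ∧
      ¬ ((p : ℤ) ∣ qA F ∧ (p : ℤ) ∣ qB F ∧ (p : ℤ) ∣ qC F)} with hS
  have hfin : S.Finite := (redT_finite T).subset fun _ h => ⟨h.1.red, h.2.2.1⟩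
  have hp0 : (0 : ℝ) < p := by exact_mod_cast hp.pos
  have hex : ∀ F ∈ S, ∃ (E : Z4) (x y z w a b c d x' y' z' w' : ℤ), x * w - y * z = 1 ∧ x' * w' - y' * z' = 1 ∧ Red E ∧ qD F = p ^ 2 * qD E ∧
      ¬ (p : ℤ) ∣ c ∧ act x y z w E = (a, b, c, p * d) ∧ F = act x' y' z' w' (p ^ 2 * a, p * b, c, d) := by
    rintro F ⟨h1, h2, h3, h4, h5⟩
    exact over_exists hp (by omega) (red_pos h1.red) h1.red.2.2 h4 h5
  choose! E x y z w a b c d x' y' z' w' g1 g2 g3 g4 g5 g6 g7 using hex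
  set T' := T / √(p : ℝ) with hT'
  have eT : T' ^ 4 = T ^ 4 / (p : ℝ) ^ 2 := by
    rw [hT', div_pow]
    congr 1
    rw [show (4 : ℕ) = 2 * 2 by norm_num, pow_mul, Real.sq_sqrt hp0.le]
  have hT'0 : 0 ≤ T' := by positivity
  have hDE : ∀ F ∈ S, ((qD (E F) : ℤ) : ℝ) < T' ^ 4 := by
    intro F hF
    have h1 := g4 F hF
    have h1 : ((qD F : ℤ) : ℝ) = p ^ 2 * ((qD (E F) : ℤ) : ℝ) := by exact_mod_cast h1
    have h2 := hF.2.2.1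
    rw [eT, lt_div_iff₀ (by positivity)]
    linarith
  rcases lt_or_ge T' 1 with hlt | hge
  · have : S = ∅ := by
      ext F
      simp only [Set.mem_empty_iff_false, iff_false]
      intro hF
      have h1 := hDE F hF
      have h2 := (g3 F hF).2.2
      have h2 : (1 : ℝ) ≤ ((qD (E F) : ℤ) : ℝ) := by exact_mod_cast h2
      have h3 : T' ^ 4 < 1 := pow_lt_one₀ hT'0 hlt (by norm_num)
      linarith
    rw [this, Set.ncard_empty, Nat.cast_zero]; positivity
  have hR := redT_finite T'
  have h := ncard_fiber_le hfin E hR.toFinset (fun F hF => hR.mem_toFinset.2 ⟨g3 F hF, hDE F hF⟩) (fun _ => 4) ?_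
  · refine h.trans ?_
    rw [Finset.sum_const, nsmul_eq_mul, ← Set.ncard_eq_toFinset_card _ hR]
    have := red_count hge
    rw [eT] at this
    rw [eT]
    have e : 4840 * T ^ 4 / (p : ℝ) ^ 2 = 1210 * (T ^ 4 / (p : ℝ) ^ 2) * 4 := by ring
    rw [e]
    gcongr
  · intro E0 _
    rcases Set.eq_empty_or_nonempty {F | F ∈ S ∧ E F = E0} with he | ⟨F0, hF0, hF0E⟩
    · rw [he, Set.ncard_empty, Nat.cast_zero]; norm_num
    -- E0 is nonzero mod p
    have hE0 : ¬ ((E0.1 : ZMod p) = 0 ∧ (3 * E0.2.1 : ZMod p) = 0 ∧ (3 * E0.2.2.1 : ZMod p) = 0 ∧ (E0.2.2.2 : ZMod p) = 0) := by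
      rintro ⟨k1, k2, k3, k4⟩
      have h3 : (3 : ZMod p) ≠ 0 := by
        intro h3
        have h3 : ((3 : ℕ) : ZMod p) = 0 := by exact_mod_cast h3
        rw [ZMod.natCast_eq_zero_iff] at h3
        have := Nat.le_of_dvd (by norm_num) h3
        omega
      have k2 := (mul_eq_zero.1 k2).resolve_left h3
      have k3 := (mul_eq_zero.1 k3).resolve_left h3
      rw [ZMod.intCast_zmod_eq_zero_iff_dvd] at k1 k2 k3 k4
      apply g5 F0 hF0
      have h6 := g6 F0 hF0
      rw [hF0E] at h6
      simp only [act, Prod.mk.injEq] at h6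
      rw [← h6.2.2.1]
      exact dvd_add (dvd_add (dvd_add ((k1.mul_right _).mul_right _) (k2.mul_right _)) (k3.mul_right _)) ((k4.mul_right _).mul_right _)
    set key : Z4 → Option (ZMod p) := fun F => if ((w F : ℤ) : ZMod p) = 0 then none else some ((y F : ZMod p) / (w F : ZMod p)) with hkey
    set R := Finset.insertNone (Finset.univ.filter fun t : ZMod p => (E0.1 : ZMod p) * t ^ 3 + (3 * E0.2.1 : ZMod p) * t ^ 2 + (3 * E0.2.2.1 : ZMod p) * t + (E0.2.2.2 : ZMod p) = 0)
    have hRc : R.card ≤ 4 := by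
      rw [Finset.card_insertNone]
      have := cubic_roots_le _ _ _ _ hE0
      omega
    have hc : {F | F ∈ S ∧ E F = E0}.ncard ≤ (R : Set (Option (ZMod p))).ncard := by
      refine Set.ncard_le_ncard_of_injOn key ?_ ?_ R.finite_toSet
      · rintro F ⟨hF, hFE⟩
        rw [Finset.mem_coe, Finset.mem_insertNone]
        intro t ht
        rw [hkey] at ht
        simp only at ht
        split_ifs at ht with hw
        · simp at ht
        · rw [Option.mem_some] at ht
          rw [Finset.mem_filter]
          refine ⟨Finset.mem_univ _, ?_⟩
          have h6 := g6 F hF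
          rw [hFE] at h6
          simp only [act, Prod.mk.injEq] at h6
          have h7 := congrArg (Int.cast : ℤ → ZMod p) h6.2.2.2
          push_cast at h7
          rw [CharP.cast_eq_zero, zero_mul] at h7
          rw [← ht]
          generalize ((w F : ℤ) : ZMod p) = W at *
          generalize ((y F : ℤ) : ZMod p) = Y at *
          field_simp
          linear_combination h7
      · rintro F ⟨hF, hFE⟩ F1 ⟨hF1, hFE1⟩ hk
        have hl : (p : ℤ) ∣ w F * y F1 - y F * w F1 := by
          rw [← ZMod.intCast_zmod_eq_zero_iff_dvd]
          push_cast
          rw [hkey] at hk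
          simp only at hk
          split_ifs at hk with q1 q2 q2
          · rw [q1, q2]; ring
          · rw [Option.some_inj, div_eq_div_iff q1 q2] at hk
            rw [hk]; ring
        have u1 := g6 F hF
        have u2 := g6 F1 hF1
        rw [hFE] at u1
        rw [hFE1] at u2
        exact (over_unique hp.pos hF.1 hF1.1 hF.2.1 hF1.2.1 (g1 F hF) (g2 F hF) u1 (g7 F hF) (g1 F1 hF1) (g2 F1 hF1) u2 (g7 F1 hF1) hl).symm
    rw [Set.ncard_coe_finset] at hc
    have : {F | F ∈ S ∧ E F = E0}.ncard ≤ 4 := hc.trans hRc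
    exact_mod_cast this
end NH

namespace NH

lemma scl_q {T : ℝ} (hT : 0 < T) (F : Z4) : qA (scl T F) = ((qA F : ℤ) : ℝ) / T ^ 2 ∧ qB (scl T F) = ((qB F : ℤ) : ℝ) / T ^ 2 ∧
    qC (scl T F) = ((qC F : ℤ) : ℝ) / T ^ 2 ∧ qD (scl T F) = ((qD F : ℤ) : ℝ) / T ^ 4 := by
  have h0 := hT.ne'
  refine ⟨?_, ?_, ?_, ?_⟩ <;> simp only [qD, qA, qB, qC, scl] <;> push_cast <;> field_simp

lemma mem_RgO_iff {T ε : ℝ} (hT : 0 < T) (F : Z4) : scl T F ∈ RgO ε ↔ ε * T < F.1 ∧ SRed F ∧ ((qD F : ℤ) : ℝ) < T ^ 4 := by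
  obtain ⟨h1, h2, h3, h4⟩ := scl_q hT F
  have hT2 : 0 < T ^ 2 := by positivity
  have hT4 : 0 < T ^ 4 := by positivity
  simp only [RgO, Set.mem_ofPred_eq, h1, h2, h3, h4, SRed, abs_div, abs_of_pos hT2]
  rw [div_lt_div_iff_of_pos_right hT2, div_lt_div_iff_of_pos_right hT2, div_lt_one hT4]
  have : ε < (scl T F).1 ↔ ε * T < F.1 := by simp only [scl]; rw [lt_div_iff₀ hT]
  rw [this]
  have e1 : |((qB F : ℤ) : ℝ)| < ((qA F : ℤ) : ℝ) ↔ |qB F| < qA F := by exact_mod_cast Iff.rfl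
  have e2 : ((qA F : ℤ) : ℝ) < ((qC F : ℤ) : ℝ) ↔ qA F < qC F := by exact_mod_cast Iff.rfl
  rw [e1, e2]
  tauto

lemma mem_RgC_iff {T ε : ℝ} (hT : 0 < T) (F : Z4) : scl T F ∈ RgC ε ↔ ε * T < F.1 ∧ Red F ∧ ((qD F : ℤ) : ℝ) < T ^ 4 := by
  obtain ⟨h1, h2, h3, h4⟩ := scl_q hT F
  have hT2 : 0 < T ^ 2 := by positivity
  have hT4 : 0 < T ^ 4 := by positivity
  simp only [RgC, Set.mem_ofPred_eq, h1, h2, h3, h4, Red, abs_div, abs_of_pos hT2]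
  rw [div_le_div_iff_of_pos_right hT2, div_le_div_iff_of_pos_right hT2, div_lt_one hT4, div_pos_iff_of_pos_right hT4]
  have : ε < (scl T F).1 ↔ ε * T < F.1 := by simp only [scl]; rw [lt_div_iff₀ hT]
  rw [this]
  have e1 : |((qB F : ℤ) : ℝ)| ≤ ((qA F : ℤ) : ℝ) ↔ |qB F| ≤ qA F := by exact_mod_cast Iff.rfl
  have e2 : ((qA F : ℤ) : ℝ) ≤ ((qC F : ℤ) : ℝ) ↔ qA F ≤ qC F := by exact_mod_cast Iff.rfl
  have e3 : 0 < ((qD F : ℤ) : ℝ) ↔ 0 < qD F := by exact_mod_cast Iff.rfl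
  rw [e1, e2, e3]
  tauto

/-- integers in an interval in a residue class -/
noncomputable def sL (L : ℝ) (p : ℕ) (t : ZMod p) : Finset ℤ := (Finset.Icc ⌈-L⌉ ⌊L⌋).filter (fun x => (x : ZMod p) = t)

lemma mem_sL {L : ℝ} {p : ℕ} {t : ZMod p} {x : ℤ} : x ∈ sL L p t ↔ |(x : ℝ)| ≤ L ∧ (x : ZMod p) = t := by
  rw [sL, Finset.mem_filter, Finset.mem_Icc, Int.ceil_le, Int.le_floor, abs_le]

lemma sL_card {L : ℝ} (hL : 0 ≤ L) {p : ℕ} (hp : 0 < p) (t : ZMod p) : ((sL L p t).card : ℝ) ≤ 2 * L / p + 1 := by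
  refine (ap_count hp (lo := -L) (hi := L) (by linarith) ?_ ?_).trans (le_of_eq (by ring))
  · intro x hx y hy
    rw [← ZMod.intCast_zmod_eq_zero_iff_dvd]
    push_cast
    rw [(mem_sL.1 hx).2, (mem_sL.1 hy).2, sub_self]
  · intro x hx
    exact abs_le.1 (mem_sL.1 hx).1

/-- box -/
def Bd (L : ℝ) : Set Z4 := {F | |(F.1 : ℝ)| ≤ L ∧ |(F.2.1 : ℝ)| ≤ L ∧ |(F.2.2.1 : ℝ)| ≤ L ∧ |(F.2.2.2 : ℝ)| ≤ L}

lemma Bd_res (L : ℝ) (p : ℕ) (r : ZMod p × ZMod p × ZMod p × ZMod p) :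
    {F | F ∈ Bd L ∧ rdq p F = r} = ↑(sL L p r.1 ×ˢ sL L p r.2.1 ×ˢ sL L p r.2.2.1 ×ˢ sL L p r.2.2.2) := by
  ext F
  obtain ⟨a, b, c, d⟩ := F
  obtain ⟨r1, r2, r3, r4⟩ := r
  simp only [Finset.coe_product, Set.mem_prod, Finset.mem_coe, mem_sL, Bd, rdq, Set.mem_ofPred_eq, Prod.mk.injEq]
  tauto

lemma Bd_finite (L : ℝ) : (Bd L).Finite := by
  have : Bd L = {F | F ∈ Bd L ∧ rdq 1 F = (0, 0, 0, 0)} := by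
    ext F
    simp only [Set.mem_ofPred_eq]
    constructor
    · intro h; exact ⟨h, Subsingleton.elim _ _⟩
    · exact fun h => h.1
  rw [this, Bd_res]
  exact Finset.finite_toSet _

lemma Bd_res_card {L : ℝ} (hL : 0 ≤ L) {p : ℕ} (hp : 0 < p) (r : ZMod p × ZMod p × ZMod p × ZMod p) :
    ({F | F ∈ Bd L ∧ rdq p F = r}.ncard : ℝ) ≤ (2 * L / p + 1) ^ 4 := by
  rw [Bd_res, Set.ncard_coe_finset, Finset.card_product, Finset.card_product, Finset.card_product]
  push_cast
  have h := fun t => sL_card hL hp t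
  calc _ ≤ (2 * L / p + 1) * ((2 * L / p + 1) * ((2 * L / p + 1) * (2 * L / p + 1))) := by
        gcongr <;> exact h _
    _ = _ := by ring

lemma H0_card (p : ℕ) [Fact p.Prime] :
    (Finset.univ.filter fun F : ZMod p × ZMod p × ZMod p × ZMod p => qA F = 0 ∧ qB F = 0 ∧ qC F = 0).card ≤ p ^ 2 := by
  classical
  have : (Finset.univ : Finset (ZMod p × ZMod p)).card = p ^ 2 := by
    rw [Finset.card_univ, Fintype.card_prod, ZMod.card, sq]
  rw [← this]
  refine Finset.card_le_card_of_injOn (fun F => if F.1 = 0 then (0, F.2.2.2) else (F.1, F.2.1)) (fun _ _ => Finset.mem_univ _) ?_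
  rintro ⟨a, b, c, d⟩ h ⟨a', b', c', d'⟩ h' he
  have h := (Finset.mem_filter.1 (Finset.mem_coe.1 h)).2
  have h' := (Finset.mem_filter.1 (Finset.mem_coe.1 h')).2
  simp only [qA, qB, qC] at h h' he
  obtain ⟨h1, h2, h3⟩ := h
  obtain ⟨h1', h2', h3'⟩ := h'
  have key : ∀ b c d : ZMod p, b ^ 2 - 0 * c = 0 → c ^ 2 - b * d = 0 → b = 0 ∧ c = 0 := by
    intro b c d h1 h3
    have hb : b = 0 := by rw [zero_mul, sub_zero] at h1; exact pow_eq_zero_iff two_ne_zero |>.1 h1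
    subst hb
    rw [zero_mul, sub_zero] at h3
    exact ⟨rfl, pow_eq_zero_iff two_ne_zero |>.1 h3⟩
  split_ifs at he with q1 q2 q2
  · subst q1 q2
    obtain ⟨rfl, rfl⟩ := key _ _ _ h1 h3
    obtain ⟨rfl, rfl⟩ := key _ _ _ h1' h3'
    rw [Prod.mk.injEq] at he
    rw [he.2]
  · rw [Prod.mk.injEq] at he
    exact absurd he.1.symm q2
  · rw [Prod.mk.injEq] at he
    exact absurd he.1 q1
  · rw [Prod.mk.injEq] at he
    obtain ⟨rfl, rfl⟩ := he
    have hc : c = c' := mul_left_cancel₀ q1 (by linear_combination h1' - h1)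
    subst hc
    have hd : d = d' := mul_left_cancel₀ q1 (by linear_combination h2' - h2)
    rw [hd]

lemma small_count {L : ℝ} {p : ℕ} (hp : p.Prime) (hpL : (p : ℝ) ≤ L) :
    ({F : Z4 | F ∈ Bd L ∧ (p : ℤ) ∣ qA F ∧ (p : ℤ) ∣ qB F ∧ (p : ℤ) ∣ qC F}.ncard : ℝ) ≤ 81 * L ^ 4 / (p : ℝ) ^ 2 := by
  classical
  have : Fact p.Prime := ⟨hp⟩
  have hp0 : (0 : ℝ) < p := by exact_mod_cast hp.pos
  have hL : 0 ≤ L := by linarith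
  have hfin : {F : Z4 | F ∈ Bd L ∧ (p : ℤ) ∣ qA F ∧ (p : ℤ) ∣ qB F ∧ (p : ℤ) ∣ qC F}.Finite := (Bd_finite L).subset fun _ h => h.1
  have h := ncard_fiber_le hfin (rdq p) (Finset.univ.filter fun F : ZMod p × ZMod p × ZMod p × ZMod p => qA F = 0 ∧ qB F = 0 ∧ qC F = 0) ?_
    (fun _ => (2 * L / p + 1) ^ 4) ?_
  · refine h.trans ?_
    rw [Finset.sum_const, nsmul_eq_mul]
    have h1 : ((Finset.univ.filter fun F : ZMod p × ZMod p × ZMod p × ZMod p => qA F = 0 ∧ qB F = 0 ∧ qC F = 0).card : ℝ) ≤ (p : ℝ) ^ 2 := by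
      exact_mod_cast H0_card p
    have h2 : 2 * L / p + 1 ≤ 3 * L / p := by
      have : 1 ≤ L / p := by rwa [one_le_div hp0]
      have e : 3 * L / p = 2 * L / p + L / p := by ring
      linarith
    calc _ ≤ (p : ℝ) ^ 2 * (3 * L / p) ^ 4 := by gcongr
      _ = _ := by field_simp; ring
  · rintro F ⟨-, h1, h2, h3⟩
    rw [Finset.mem_filter]
    rw [← ZMod.intCast_zmod_eq_zero_iff_dvd] at h1 h2 h3
    simp only [qA, qB, qC, rdq] at *
    push_cast at *
    exact ⟨Finset.mem_univ _, h1, h2, h3⟩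
  · intro r _
    refine (ncard_mono_real ?_ ?_).trans (Bd_res_card hL hp.pos r)
    · rintro F ⟨h1, h2⟩; exact ⟨h1.1, h2⟩
    · exact (Bd_finite L).subset fun _ h => h.1

lemma large_count {L : ℝ} (hL : 0 ≤ L) :
    ({F : Z4 | F ∈ Bd L ∧ 0 < F.1 ∧ 0 < qA F ∧ ((qA F : ℤ) : ℝ) ≤ L ^ 2 ∧ ∃ p : ℕ, p.Prime ∧ L < p ∧ (p : ℤ) ∣ qA F ∧ (p : ℤ) ∣ qB F}.ncard : ℝ) ≤
      3 * (2 * L + 1) ^ 3 := by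
  classical
  set S := {F : Z4 | F ∈ Bd L ∧ 0 < F.1 ∧ 0 < qA F ∧ ((qA F : ℤ) : ℝ) ≤ L ^ 2 ∧ ∃ p : ℕ, p.Prime ∧ L < p ∧ (p : ℤ) ∣ qA F ∧ (p : ℤ) ∣ qB F} with hS
  have hfin : S.Finite := (Bd_finite L).subset fun _ h => h.1
  have h := ncard_fiber_le hfin (fun F => (F.1, F.2.1, F.2.2.1)) (sL L 1 0 ×ˢ sL L 1 0 ×ˢ sL L 1 0) ?_ (fun _ => 3) ?_
  · refine h.trans ?_
    have h1 := sL_card hL one_pos (p := 1) 0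
    rw [Finset.sum_const, nsmul_eq_mul, Finset.card_product, Finset.card_product]
    push_cast at *
    rw [div_one] at h1
    calc _ ≤ (2 * L + 1) * ((2 * L + 1) * (2 * L + 1)) * 3 := by gcongr
      _ = _ := by ring
  · rintro F ⟨⟨h1, h2, h3, -⟩, -⟩
    simp only [Finset.mem_product, mem_sL]
    exact ⟨⟨h1, Subsingleton.elim _ _⟩, ⟨h2, Subsingleton.elim _ _⟩, h3, Subsingleton.elim _ _⟩
  · rintro ⟨a, b, c⟩ -
    rcases Set.eq_empty_or_nonempty {F | F ∈ S ∧ (F.1, F.2.1, F.2.2.1) = (a, b, c)} with he | ⟨⟨a0, b0, c0, d0⟩, ⟨hB, ha, hA, hAL, p, hp, hpL, hpA, hpB⟩, hF⟩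
    · rw [he, Set.ncard_empty, Nat.cast_zero]; norm_num
    simp only [Prod.mk.injEq] at hF
    obtain ⟨rfl, rfl, rfl⟩ := hF
    have hp0 : (0 : ℝ) < p := by exact_mod_cast hp.pos
    have hpp : Prime (p : ℤ) := Nat.prime_iff_prime_int.1 hp
    have hsub : {F : Z4 | F ∈ S ∧ (F.1, F.2.1, F.2.2.1) = (a0, b0, c0)} ⊆ (fun d => (a0, b0, c0, d)) '' (sL L p (d0 : ZMod p) : Set ℤ) := by
      rintro ⟨a1, b1, c1, d1⟩ ⟨⟨hB', -, -, -, p', hp', hpL', hpA', hpB'⟩, hF⟩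
      simp only [Prod.mk.injEq] at hF
      obtain ⟨rfl, rfl, rfl⟩ := hF
      have hpp' : p' = p := by
        by_contra hne
        have hc : Nat.Coprime p' p := (Nat.coprime_primes hp' hp).2 hne
        have hd : ((p' : ℤ) * p) ∣ qA (a1, b1, c1, d0) := by
          refine IsCoprime.mul_dvd (by exact_mod_cast hc) ?_ hpA
          simpa [qA] using hpA'
        have h1 := Int.le_of_dvd hA hd
        have h1 : (p' : ℝ) * p ≤ ((qA (a1, b1, c1, d0) : ℤ) : ℝ) := by exact_mod_cast h1
        nlinarith
      subst hpp'
      refine ⟨d1, ?_, rfl⟩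
      rw [Finset.mem_coe, mem_sL]
      refine ⟨hB'.2.2.2, ?_⟩
      have hna : ¬ (p' : ℤ) ∣ a1 := by
        intro hd
        have h1 := Int.le_of_dvd ha hd
        have h1 : (p' : ℝ) ≤ (a1 : ℝ) := by exact_mod_cast h1
        have := (abs_le.1 hB.1).2
        simp only at this
        linarith
      have hd2 : (p' : ℤ) ∣ a1 * (d1 - d0) := by
        have := dvd_sub hpB hpB'
        simp only [qB] at this
        have e : b1 * c1 - a1 * d0 - (b1 * c1 - a1 * d1) = a1 * (d1 - d0) := by ring
        rw [← e]; exact this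
      have hd3 := (hpp.dvd_or_dvd hd2).resolve_left hna
      rw [← ZMod.intCast_zmod_eq_zero_iff_dvd] at hd3
      push_cast at hd3
      exact sub_eq_zero.1 hd3
    have h1 := ncard_mono_real hsub ((Finset.finite_toSet _).image _)
    have h2 := Set.ncard_image_le (f := fun d => ((a0, b0, c0, d) : Z4)) (Finset.finite_toSet (sL L p (d0 : ZMod p)))
    rw [Set.ncard_coe_finset] at h2
    have h2 : (((fun d => ((a0, b0, c0, d) : Z4)) '' (sL L p (d0 : ZMod p) : Set ℤ)).ncard : ℝ) ≤ (sL L p (d0 : ZMod p)).card := by exact_mod_cast h2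
    have h3 := sL_card hL hp.pos (d0 : ZMod p)
    have h4 : 2 * L / p ≤ 2 := by rw [div_le_iff₀ hp0]; linarith
    linarith

theorem tail_count {ε : ℝ} (hε : 0 < ε) (hε1 : ε ≤ 1) : ∃ C : ℝ, 0 < C ∧ ∀ M : ℕ, 3 ≤ M → ∀ T : ℝ, 1 ≤ T →
    ({F : Z4 | scl T F ∈ RgO ε ∧ ∃ p : ℕ, p.Prime ∧ M < p ∧ (p : ℤ) ^ 2 ∣ qD F}.ncard : ℝ) ≤ C * (T ^ 4 / M + T ^ 3) := by
  classical
  set K := 2 / ε ^ 3 with hK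
  have hK1 : 1 ≤ K := by
    have h1 : ε ^ 3 ≤ 1 := pow_le_one₀ hε.le hε1
    rw [hK, one_le_div (by positivity)]; linarith
  refine ⟨4840 + 81 * K ^ 4 + 3 * (3 * K) ^ 3, by positivity, ?_⟩
  intro M hM T hT
  have hT0 : 0 < T := by linarith
  set L := K * T with hL
  have hTL : T ≤ L := by nlinarith
  have hM0 : (0 : ℝ) < M := by exact_mod_cast (show 0 < M by omega)
  set S := {F : Z4 | scl T F ∈ RgO ε ∧ ∃ p : ℕ, p.Prime ∧ M < p ∧ (p : ℤ) ^ 2 ∣ qD F} with hS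
  set La := {F : Z4 | F ∈ Bd L ∧ 0 < F.1 ∧ 0 < qA F ∧ ((qA F : ℤ) : ℝ) ≤ L ^ 2 ∧ ∃ p : ℕ, p.Prime ∧ L < p ∧ (p : ℤ) ∣ qA F ∧ (p : ℤ) ∣ qB F} with hLa
  have hLaf : La.Finite := (Bd_finite L).subset fun _ h => h.1
  have hSBd : ∀ F ∈ S, F ∈ Bd L := by
    rintro F ⟨h1, -⟩
    have h2 := RgC_bx hε hε1 (RgO_sub _ h1)
    simp only [bx, Set.mem_prod, scl, Set.mem_Icc] at h2
    have key : ∀ x : ℝ, -K ≤ x / T ∧ x / T ≤ K → |x| ≤ L := by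
      intro x hx
      rw [← abs_le, abs_div, abs_of_pos hT0, div_le_iff₀ hT0] at hx
      exact hx
    exact ⟨key _ h2.1, key _ h2.2.1, key _ h2.2.2.1, key _ h2.2.2.2⟩
  have hSf : S.Finite := (Bd_finite L).subset hSBd
  have hW : (S \ La).Finite := hSf.subset Set.sdiff_subset
  have hch : ∀ F ∈ S, ∃ p : ℕ, p.Prime ∧ M < p ∧ (p : ℤ) ^ 2 ∣ qD F := fun F h => h.2
  choose! P hP1 hP2 hP3 using hch
  have hfac : ∀ F ∈ S, SRed F ∧ 0 < F.1 ∧ ((qD F : ℤ) : ℝ) < T ^ 4 := by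
    rintro F ⟨h1, -⟩
    obtain ⟨k1, k2, k3⟩ := (mem_RgO_iff hT0 F).1 h1
    refine ⟨k2, ?_, k3⟩
    have : (0 : ℝ) < F.1 := lt_trans (by positivity) k1
    exact_mod_cast this
  have h := ncard_fiber_le hW P (Finset.Ioc M ⌊T ^ 2⌋₊) ?_ (fun n => (4840 * T ^ 4 + 81 * L ^ 4) * ((n : ℝ) ^ 2)⁻¹) ?_
  · rw [← Finset.mul_sum] at h
    have h1 : ∑ n ∈ Finset.Ioc M ⌊T ^ 2⌋₊, ((n : ℝ) ^ 2)⁻¹ ≤ 1 / M := by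
      rcases le_or_gt M ⌊T ^ 2⌋₊ with hle | hgt
      · refine (sum_Ioc_inv_sq_le_sub (α := ℝ) (by omega) hle).trans ?_
        rw [one_div, sub_le_self_iff]; positivity
      · rw [Finset.Ioc_eq_empty (by omega), Finset.sum_empty]; positivity
    have h2 : (S.ncard : ℝ) ≤ ((S \ La).ncard : ℝ) + La.ncard := by
      have e := ncard_mono_real (S := S) (T := (S \ La) ∪ La) (by intro F hF; by_cases h : F ∈ La; exacts [Or.inr h, Or.inl ⟨hF, h⟩]) (hW.union hLaf)
      have e2 := Set.ncard_union_le (S \ La) La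
      have e2 : (((S \ La) ∪ La).ncard : ℝ) ≤ ((S \ La).ncard : ℝ) + La.ncard := by exact_mod_cast e2
      linarith
    have h3 := large_count (L := L) (by positivity)
    have h4 : (4840 * T ^ 4 + 81 * L ^ 4) * ∑ n ∈ Finset.Ioc M ⌊T ^ 2⌋₊, ((n : ℝ) ^ 2)⁻¹ ≤ (4840 * T ^ 4 + 81 * L ^ 4) * (1 / M) := by gcongr
    have h5 : 3 * (2 * L + 1) ^ 3 ≤ 3 * (3 * K) ^ 3 * T ^ 3 := by
      have : 2 * L + 1 ≤ 3 * K * T := by rw [mul_assoc, ← hL]; linarith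
      calc 3 * (2 * L + 1) ^ 3 ≤ 3 * (3 * K * T) ^ 3 := by gcongr
        _ = _ := by ring
    have h6 : (4840 * T ^ 4 + 81 * L ^ 4) * (1 / M) = (4840 + 81 * K ^ 4) * (T ^ 4 / M) := by rw [hL]; ring
    have h7 : 0 ≤ 3 * (3 * K) ^ 3 * (T ^ 4 / M) := by positivity
    have h8 : 0 ≤ (4840 + 81 * K ^ 4) * T ^ 3 := by positivity
    calc (S.ncard : ℝ) ≤ (4840 + 81 * K ^ 4) * (T ^ 4 / M) + 3 * (3 * K) ^ 3 * T ^ 3 := by linarith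
      _ ≤ _ := by linarith
  · rintro F ⟨hF, -⟩
    rw [Finset.mem_Ioc]
    refine ⟨hP2 F hF, Nat.le_floor ?_⟩
    obtain ⟨k1, k2, k3⟩ := hfac F hF
    have h1 := Int.le_of_dvd k1.red.2.2 (hP3 F hF)
    have h1 : (P F : ℝ) ^ 2 ≤ ((qD F : ℤ) : ℝ) := by exact_mod_cast h1
    refine (abs_le_of_sq_le_sq' ?_ (by positivity)).2
    rw [← pow_mul]; norm_num
    linarith
  · intro p hp
    rw [Finset.mem_Ioc] at hp
    by_cases hpp : p.Prime
    · set O := {F : Z4 | SRed F ∧ 0 < F.1 ∧ ((qD F : ℤ) : ℝ) < T ^ 4 ∧ (p : ℤ) ^ 2 ∣ qD F ∧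
        ¬ ((p : ℤ) ∣ qA F ∧ (p : ℤ) ∣ qB F ∧ (p : ℤ) ∣ qC F)} with hO
      set I := {F : Z4 | F ∈ Bd L ∧ (p : ℤ) ∣ qA F ∧ (p : ℤ) ∣ qB F ∧ (p : ℤ) ∣ qC F} with hI
      have hOf : O.Finite := (redT_finite T).subset fun _ h => ⟨h.1.red, h.2.2.1⟩
      have hIf : I.Finite := (Bd_finite L).subset fun _ h => h.1
      have o1 := over_count hpp (by omega) hT0.le
      rw [← hO] at o1
      have hp0 : (0 : ℝ) < p := by exact_mod_cast hpp.pos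
      have e : (4840 * T ^ 4 + 81 * L ^ 4) * ((p : ℝ) ^ 2)⁻¹ = 4840 * T ^ 4 / (p : ℝ) ^ 2 + 81 * L ^ 4 / (p : ℝ) ^ 2 := by ring
      rw [e]
      rcases le_or_gt (p : ℝ) L with hpL | hpL
      · have i1 := small_count hpp hpL
        rw [← hI] at i1
        have e1 := ncard_mono_real (S := {x | x ∈ S \ La ∧ P x = p}) (T := O ∪ I) (by
          rintro F ⟨⟨hF, -⟩, rfl⟩
          obtain ⟨k1, k2, k3⟩ := hfac F hF
          by_cases hH : ((P F : ℕ) : ℤ) ∣ qA F ∧ ((P F : ℕ) : ℤ) ∣ qB F ∧ ((P F : ℕ) : ℤ) ∣ qC F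
          · exact Or.inr ⟨hSBd F hF, hH⟩
          · exact Or.inl ⟨k1, k2, k3, hP3 F hF, hH⟩) (hOf.union hIf)
        have e2 := Set.ncard_union_le O I
        have e2 : ((O ∪ I).ncard : ℝ) ≤ O.ncard + I.ncard := by exact_mod_cast e2
        linarith
      · have e1 := ncard_mono_real (S := {x | x ∈ S \ La ∧ P x = p}) (T := O) (by
          rintro F ⟨⟨hF, hn⟩, rfl⟩
          obtain ⟨k1, k2, k3⟩ := hfac F hF
          refine ⟨k1, k2, k3, hP3 F hF, fun hH => hn ?_⟩
          refine ⟨hSBd F hF, k2, red_pos k1.red, ?_, P F, hP1 F hF, hpL, hH.1, hH.2.1⟩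
          have := (red_A_lt k1.red hT0.le k3).1
          have : T ^ 2 ≤ L ^ 2 := by gcongr
          linarith) hOf
        have : 0 ≤ 81 * L ^ 4 / (p : ℝ) ^ 2 := by positivity
        linarith
    · have : {x | x ∈ S \ La ∧ P x = p} = ∅ := by
        ext F
        simp only [Set.mem_ofPred_eq, Set.mem_empty_iff_false, iff_false]
        rintro ⟨⟨hF, -⟩, rfl⟩
        exact hpp (hP1 F hF)
      rw [this, Set.ncard_empty, Nat.cast_zero]; positivity
end NH

namespace NH

/-- the modulus -/
def qq (M : ℕ) : ℕ := 32 * (M.factorial) ^ 2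

lemma qq_pos (M : ℕ) : 0 < qq M := by unfold qq; have := M.factorial_pos; positivity

lemma dvd_qq {N M : ℕ} (hN : 0 < N) (h : N ≤ M) : N ∣ qq M :=
  ((Nat.dvd_factorial hN h).trans (dvd_pow_self _ two_ne_zero)).trans (dvd_mul_left _ _)

lemma sq_dvd_qq {p M : ℕ} (hp : 0 < p) (h : p ≤ M) : p ^ 2 ∣ qq M :=
  (pow_dvd_pow_of_dvd (Nat.dvd_factorial hp h) 2).trans (dvd_mul_left _ _)

lemma prime_dvd_qq {p M : ℕ} (hM : 2 ≤ M) (hp : p.Prime) : p ∣ qq M ↔ p ≤ M := by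
  constructor
  · intro h
    rcases hp.dvd_mul.1 h with h | h
    · have : p ∣ 2 := hp.dvd_of_dvd_pow (show p ∣ 2 ^ 5 by norm_num; exact h)
      exact (Nat.le_of_dvd two_pos this).trans hM
    · exact (hp.dvd_factorial).1 (hp.dvd_of_dvd_pow h)
  · intro h; exact dvd_qq hp.pos h

lemma t32_dvd_qq (M : ℕ) : 32 ∣ qq M := dvd_mul_right _ _

/-- local condition -/
def Lc (m N q : ℕ) (D : ℤ) : Prop := LocF q D ∧ D ≡ (m : ℤ) [ZMOD (N : ℤ)]

lemma Lc_congr {m N q : ℕ} (hNq : N ∣ q) {D E : ℤ} (h : D ≡ E [ZMOD (q : ℤ)]) (hD : Lc m N q D) : Lc m N q E := by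
  obtain ⟨h1, h2⟩ := hD
  have hNq' : (N : ℤ) ∣ q := by exact_mod_cast hNq
  refine ⟨?_, (h.of_dvd hNq').symm.trans h2⟩
  intro p hp hpq
  obtain ⟨k1, k2⟩ := h1 p hp hpq
  constructor
  · intro hp2
    obtain ⟨k3, k4⟩ := k1 hp2
    refine ⟨k3, fun h5 => k4 ?_⟩
    have h6 : (p : ℤ) ^ 2 ∣ (q : ℤ) := by exact_mod_cast k3
    have h7 := (h.of_dvd h6)
    exact (Int.ModEq.dvd_iff h7).2 h5
  · intro hp2
    obtain ⟨k3, k4⟩ := k2 hp2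
    refine ⟨k3, ?_⟩
    have h6 : (32 : ℤ) ∣ (q : ℤ) := by exact_mod_cast k3
    have h7 := (h.of_dvd h6)
    unfold Int.ModEq at h7
    omega

lemma fund_sq {Δ : ℤ} (hf : IsFundamentalDiscriminant Δ) {p : ℕ} (hp : p.Prime) (hp2 : p ≠ 2) : ¬ (p : ℤ) ^ 2 ∣ Δ := by
  intro h
  have hpp : Prime (p : ℤ) := Nat.prime_iff_prime_int.1 hp
  obtain ⟨-, ⟨h1, -⟩ | ⟨m', rfl, h1, -⟩⟩ := hf
  · rw [sq] at h
    exact hpp.not_isUnit (h1 _ h)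
  · have hc : IsCoprime ((p : ℤ) ^ 2) (4 : ℤ) := by
      have : Nat.Coprime (p ^ 2) (2 ^ 2) := Nat.Coprime.pow _ _ ((Nat.coprime_primes hp Nat.prime_two).2 hp2)
      have := Nat.isCoprime_iff_coprime.2 this
      push_cast at this
      exact this
    have h3 := hc.dvd_of_dvd_mul_left h
    rw [sq] at h3
    exact hpp.not_isUnit (h1 _ h3)

lemma sqf_of {n : ℤ} (hn : n ≠ 0) (h : ∀ p : ℕ, p.Prime → ¬ (p : ℤ) ^ 2 ∣ n) : Squarefree n := by
  rw [← Int.squarefree_natAbs, Nat.squarefree_iff_prime_squarefree]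
  intro p hp hd
  apply h p hp
  rw [← sq] at hd
  have : ((p ^ 2 : ℕ) : ℤ) ∣ n := Int.natCast_dvd.2 hd
  exact_mod_cast this

lemma fund_iff {m N M : ℕ} (hM : 2 ≤ M) {Δ : ℤ} (hΔ : Δ < 0) :
    (IsFundamentalDiscriminant Δ ∧ Δ ≡ (m : ℤ) [ZMOD (N : ℤ)]) ↔
      Lc m N (qq M) Δ ∧ ∀ p : ℕ, p.Prime → M < p → ¬ (p : ℤ) ^ 2 ∣ Δ := by
  constructor
  · rintro ⟨hf, hm⟩
    refine ⟨⟨fun p hp hpq => ⟨fun h2 => ⟨sq_dvd_qq hp.pos ((prime_dvd_qq hM hp).1 hpq), fund_sq hf hp h2⟩, fun h2 => ⟨t32_dvd_qq M, ?_⟩⟩, hm⟩,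
      fun p hp hMp => fund_sq hf hp (by omega)⟩
    obtain ⟨-, ⟨-, h⟩ | ⟨m', rfl, -, h⟩⟩ := hf <;> omega
  · rintro ⟨⟨h1, h2⟩, h3⟩
    refine ⟨⟨by omega, ?_⟩, h2⟩
    have h4 : ∀ p : ℕ, p.Prime → p ≠ 2 → ¬ (p : ℤ) ^ 2 ∣ Δ := by
      intro p hp hp2
      rcases le_or_gt p M with h | h
      · exact ((h1 p hp ((prime_dvd_qq hM hp).2 h)).1 hp2).2
      · exact h3 p hp h
    obtain ⟨-, h5⟩ := (h1 2 Nat.prime_two ((prime_dvd_qq hM Nat.prime_two).2 hM)).2 rfl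
    by_cases h6 : Δ % 4 = 1
    · left
      refine ⟨sqf_of hΔ.ne fun p hp => ?_, h6⟩
      by_cases hp2 : p = 2
      · subst hp2; intro hd; norm_num at hd; omega
      · exact h4 p hp hp2
    · right
      refine ⟨Δ / 4, by omega, sqf_of (by omega) fun p hp => ?_, by omega⟩
      by_cases hp2 : p = 2
      · subst hp2; intro hd; norm_num at hd; omega
      · intro hd
        refine h4 p hp hp2 (hd.trans ⟨4, by omega⟩)

/-- the range of negative discriminants -/
noncomputable def dI (X : ℝ) : Finset ℤ := Finset.Ioc (-⌈X⌉) (-1)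

lemma mem_dI {X : ℝ} {D : ℤ} : D ∈ dI X ↔ -X < (D : ℝ) ∧ D < 0 := by
  rw [dI, Finset.mem_Ioc]
  have h1 : -⌈X⌉ < D ↔ -X < (D : ℝ) := by
    rw [neg_lt, Int.lt_ceil]; push_cast; exact neg_lt
  rw [h1]
  constructor <;> rintro ⟨h, h'⟩ <;> exact ⟨h, by omega⟩

lemma Nminus_eq (X : ℝ) (m N : ℕ) [DecidablePred fun D => D ∈ Nminus X m N] : Nminus X m N = ↑((dI X).filter (fun D => D ∈ Nminus X m N)) := by
  ext D
  rw [Finset.mem_coe, Finset.mem_filter, mem_dI]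
  exact ⟨fun h => ⟨⟨h.1, h.2.1⟩, h⟩, fun h => h.2⟩

lemma Nminus_finite (X : ℝ) (m N : ℕ) : (Nminus X m N).Finite := by
  classical
  rw [Nminus_eq]; exact Finset.finite_toSet _

lemma ap_asym {X : ℝ} (hX : 0 < X) {q : ℕ} (hq : 0 < q) (r : ℤ) :
    |(((dI X).filter fun D => D ≡ r [ZMOD (q : ℤ)]).card : ℝ) - X / q| ≤ 3 := by
  have hq' : (0 : ℤ) < q := by exact_mod_cast hq
  have hqr : (1 : ℝ) ≤ q := by exact_mod_cast hq
  have h := Int.Ioc_filter_modEq_card (-⌈X⌉) (-1) hq' r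
  have h0 : (0 : ℤ) < ⌈X⌉ := Int.ceil_pos.2 hX
  set u := ⌊(((-1 : ℤ) : ℚ) - r) / ((q : ℤ) : ℚ)⌋ with hu
  set v := ⌊(((-⌈X⌉ : ℤ) : ℚ) - r) / ((q : ℤ) : ℚ)⌋ with hv
  have hqq : (0 : ℚ) < ((q : ℤ) : ℚ) := by exact_mod_cast hq'
  have hvu : v ≤ u := by
    apply Int.floor_le_floor
    gcongr
    omega
  rw [max_eq_left (by omega)] at h
  have u1 := Int.floor_le ((((-1 : ℤ) : ℚ) - r) / ((q : ℤ) : ℚ))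
  have u2 := Int.lt_floor_add_one ((((-1 : ℤ) : ℚ) - r) / ((q : ℤ) : ℚ))
  have v1 := Int.floor_le ((((-⌈X⌉ : ℤ) : ℚ) - r) / ((q : ℤ) : ℚ))
  have v2 := Int.lt_floor_add_one ((((-⌈X⌉ : ℤ) : ℚ) - r) / ((q : ℤ) : ℚ))
  rw [← hu] at u1 u2
  rw [← hv] at v1 v2
  have e1 : ((u : ℝ)) ≤ (-1 - r) / q := by
    have := (Rat.cast_le (K := ℝ)).2 u1
    push_cast at this; exact this
  have e2 : (-1 - r) / q < (u : ℝ) + 1 := by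
    have := (Rat.cast_lt (K := ℝ)).2 u2
    push_cast at this; exact this
  have e3 : ((v : ℝ)) ≤ (-(⌈X⌉ : ℝ) - r) / q := by
    have := (Rat.cast_le (K := ℝ)).2 v1
    push_cast at this; exact this
  have e4 : (-(⌈X⌉ : ℝ) - r) / q < (v : ℝ) + 1 := by
    have := (Rat.cast_lt (K := ℝ)).2 v2
    push_cast at this; exact this
  have hc : (((dI X).filter fun D => D ≡ r [ZMOD (q : ℤ)]).card : ℝ) = (u : ℝ) - v := by
    have : ((((dI X).filter fun D => D ≡ r [ZMOD (q : ℤ)]).card : ℤ) : ℝ) = ((u - v : ℤ) : ℝ) := by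
      rw [← h]; rfl
    push_cast at this; exact this
  rw [hc]
  have c1 := Int.le_ceil X
  have c2 := Int.ceil_lt_add_one X
  have e5 : (-1 - (r : ℝ)) / q - (-(⌈X⌉ : ℝ) - r) / q = (⌈X⌉ - 1) / q := by ring
  have e6 : ((⌈X⌉ : ℝ) - 1) / q ≤ X / q := by gcongr; linarith
  have e7 : X / q - 1 ≤ ((⌈X⌉ : ℝ) - 1) / q := by
    have : X / q - 1 / q ≤ ((⌈X⌉ : ℝ) - 1) / q := by rw [← sub_div]; gcongr
    have : (1 : ℝ) / q ≤ 1 := by rw [div_le_one (by linarith)]; exact hqr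
    linarith
  rw [abs_le]; constructor <;> linarith
end NH

namespace NH
open Classical in
/-- allowed residues -/
noncomputable def TM (m N q : ℕ) : Finset ℕ := (Finset.range q).filter fun r => Lc m N q (r : ℤ)

open Classical in
/-- discriminants satisfying the local conditions -/
noncomputable def LX (m N q : ℕ) (X : ℝ) : Finset ℤ := (dI X).filter fun D => Lc m N q D

lemma toNat_emod_mem {m N q : ℕ} (hq : 0 < q) (hNq : N ∣ q) {D : ℤ} : (D % q).toNat ∈ TM m N q ↔ Lc m N q D := by
  classical
  have hq' : (0 : ℤ) < q := by exact_mod_cast hq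
  have h1 := Int.emod_nonneg D hq'.ne'
  have h2 := Int.emod_lt_of_pos D hq'
  have h3 : (((D % q).toNat : ℕ) : ℤ) = D % q := Int.toNat_of_nonneg h1
  have h4 : D % q ≡ D [ZMOD (q : ℤ)] := Int.mod_modEq _ _
  rw [TM, Finset.mem_filter, Finset.mem_range, h3]
  constructor
  · rintro ⟨-, h⟩; exact Lc_congr hNq h4 h
  · intro h
    refine ⟨by omega, Lc_congr hNq h4.symm h⟩

lemma LX_card {m N q : ℕ} (hq : 0 < q) (hNq : N ∣ q) {X : ℝ} (hX : 0 < X) :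
    |((LX m N q X).card : ℝ) - (TM m N q).card / q * X| ≤ 3 * q := by
  classical
  have hq' : (0 : ℤ) < q := by exact_mod_cast hq
  have h := Finset.card_eq_sum_card_fiberwise (f := fun D : ℤ => (D % q).toNat) (s := LX m N q X) (t := TM m N q)
    (by intro D hD; exact (toNat_emod_mem hq hNq).2 (Finset.mem_filter.1 hD).2)
  have h1 : ∀ r ∈ TM m N q, ((LX m N q X).filter fun D : ℤ => (D % q).toNat = r) = (dI X).filter fun D => D ≡ (r : ℤ) [ZMOD (q : ℤ)] := by
    intro r hr
    obtain ⟨hr1, hr2⟩ := Finset.mem_filter.1 hr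
    rw [Finset.mem_range] at hr1
    ext D
    have hm := Int.emod_nonneg D hq'.ne'
    have e : (D % q).toNat = r ↔ D ≡ (r : ℤ) [ZMOD (q : ℤ)] := by
      unfold Int.ModEq
      rw [Int.emod_eq_of_lt (a := (r : ℤ)) (by omega) (by omega)]
      omega
    rw [Finset.mem_filter, Finset.mem_filter, LX, Finset.mem_filter, e]
    constructor
    · rintro ⟨⟨h1, -⟩, h2⟩; exact ⟨h1, h2⟩
    · rintro ⟨h1, h2⟩; exact ⟨⟨h1, Lc_congr hNq h2.symm hr2⟩, h2⟩
  have h' : (LX m N q X).card = ∑ r ∈ TM m N q, ((dI X).filter fun D => D ≡ (r : ℤ) [ZMOD (q : ℤ)]).card :=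
    h.trans (Finset.sum_congr rfl fun r hr => by rw [h1 r hr])
  rw [h']
  push_cast
  have e : ((TM m N q).card : ℝ) / q * X = ∑ r ∈ TM m N q, X / q := by
    rw [Finset.sum_const, nsmul_eq_mul]; ring
  rw [e, ← Finset.sum_sub_distrib]
  refine (Finset.abs_sum_le_sum_abs _ _).trans ?_
  refine (Finset.sum_le_sum (g := fun _ => (3 : ℝ)) fun r _ => ap_asym hX hq ((r : ℕ) : ℤ)).trans ?_
  rw [Finset.sum_const, nsmul_eq_mul, mul_comm]
  have : (TM m N q).card ≤ q := (Finset.card_filter_le _ _).trans (by rw [Finset.card_range])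
  have : ((TM m N q).card : ℝ) ≤ q := by exact_mod_cast this
  linarith

lemma bad_card {M s : ℕ} (hM : 1 ≤ M) (hs : 0 < s) (r : ℤ) {X : ℝ} (hX : 0 < X) (B : Finset ℤ)
    (hB : ∀ D ∈ B, D ∈ dI X ∧ D ≡ r [ZMOD (s : ℤ)] ∧ ∃ p : ℕ, p.Prime ∧ M < p ∧ p.Coprime s ∧ (p : ℤ) ^ 2 ∣ D) :
    (B.card : ℝ) ≤ X / s * (1 / M) + √X := by
  classical
  have hs' : (0 : ℝ) < s := by exact_mod_cast hs
  set I := (Finset.Ioc M ⌊√X⌋₊).filter fun n => n.Coprime s with hI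
  have hsub : B ⊆ I.biUnion fun n => B.filter fun D => (n : ℤ) ^ 2 ∣ D := by
    intro D hD
    obtain ⟨h1, h2, p, hp, hMp, hc, hd⟩ := hB D hD
    rw [mem_dI] at h1
    rw [Finset.mem_biUnion]
    refine ⟨p, Finset.mem_filter.2 ⟨Finset.mem_Ioc.2 ⟨hMp, ?_⟩, hc⟩, Finset.mem_filter.2 ⟨hD, hd⟩⟩
    apply Nat.le_floor
    apply Real.le_sqrt_of_sq_le
    have := Int.le_of_dvd (by omega) ((dvd_neg).2 hd)
    have : (p : ℝ) ^ 2 ≤ -(D : ℝ) := by exact_mod_cast this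
    linarith
  have h1 : (B.card : ℝ) ≤ ∑ n ∈ I, ((B.filter fun D => (n : ℤ) ^ 2 ∣ D).card : ℝ) := by
    exact_mod_cast (Finset.card_le_card hsub).trans Finset.card_biUnion_le
  have h2 : ∀ n ∈ I, ((B.filter fun D => (n : ℤ) ^ 2 ∣ D).card : ℝ) ≤ X / s * ((n : ℝ) ^ 2)⁻¹ + 1 := by
    intro n hn
    obtain ⟨hn1, hn2⟩ := Finset.mem_filter.1 hn
    have hn0 : 0 < n := by have := (Finset.mem_Ioc.1 hn1).1; omega
    have := ap_count (s := B.filter fun D => (n : ℤ) ^ 2 ∣ D) (m := s * n ^ 2) (by positivity) (lo := -X) (hi := 0) (by linarith) ?_ ?_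
    · refine this.trans (le_of_eq ?_)
      push_cast
      field_simp
      ring
    · intro x hx y hy
      obtain ⟨hx1, hx2⟩ := Finset.mem_filter.1 hx
      obtain ⟨hy1, hy2⟩ := Finset.mem_filter.1 hy
      push_cast
      refine IsCoprime.mul_dvd ?_ ?_ (dvd_sub hx2 hy2)
      · have := Nat.isCoprime_iff_coprime.2 (Nat.Coprime.pow_right 2 hn2.symm)
        push_cast at this; exact this
      · exact ((hB y hy1).2.1.trans (hB x hx1).2.1.symm).dvd
    · intro x hx
      obtain ⟨hx1, hx2⟩ := Finset.mem_filter.1 hx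
      have := mem_dI.1 (hB x hx1).1
      exact ⟨this.1.le, by exact_mod_cast this.2.le⟩
  have h3 := h1.trans (Finset.sum_le_sum h2)
  rw [Finset.sum_add_distrib, ← Finset.mul_sum] at h3
  have h4 : ∑ n ∈ I, ((n : ℝ) ^ 2)⁻¹ ≤ 1 / M := by
    refine (Finset.sum_le_sum_of_subset_of_nonneg (Finset.filter_subset _ _) (fun _ _ _ => by positivity)).trans ?_
    rcases le_or_gt M ⌊√X⌋₊ with hle | hgt
    · refine (sum_Ioc_inv_sq_le_sub (α := ℝ) (by omega) hle).trans ?_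
      rw [one_div, sub_le_self_iff]; positivity
    · rw [Finset.Ioc_eq_empty (by omega), Finset.sum_empty]; positivity
  have h5 : ∑ n ∈ I, (1 : ℝ) ≤ √X := by
    rw [Finset.sum_const, nsmul_eq_mul, mul_one]
    have : I.card ≤ ⌊√X⌋₊ := (Finset.card_filter_le _ _).trans (by rw [Nat.card_Ioc]; omega)
    exact (by exact_mod_cast this : (I.card : ℝ) ≤ (⌊√X⌋₊ : ℝ)).trans (Nat.floor_le (Real.sqrt_nonneg _))
  have h6 : X / s * ∑ n ∈ I, ((n : ℝ) ^ 2)⁻¹ ≤ X / s * (1 / M) := by gcongr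
  linarith

/-- finset version of `Nminus` -/
noncomputable def NF (X : ℝ) (m N : ℕ) : Finset ℤ := (Nminus_finite X m N).toFinset

lemma mem_NF {X : ℝ} {m N : ℕ} {D : ℤ} : D ∈ NF X m N ↔ D ∈ Nminus X m N := Set.Finite.mem_toFinset _

lemma mem_NF_iff {X : ℝ} {m N M : ℕ} (hM : 2 ≤ M) {D : ℤ} : D ∈ NF X m N ↔
    D ∈ dI X ∧ Lc m N (qq M) D ∧ ∀ p : ℕ, p.Prime → M < p → ¬ (p : ℤ) ^ 2 ∣ D := by
  rw [mem_NF, mem_dI]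
  constructor
  · rintro ⟨h1, h2, h3⟩
    exact ⟨⟨h1, h2⟩, (fund_iff hM h2).1 h3⟩
  · rintro ⟨⟨h1, h2⟩, h3⟩
    exact ⟨h1, h2, (fund_iff hM h2).2 h3⟩

lemma NF_le {m N M : ℕ} (hM : 2 ≤ M) (X : ℝ) : (NF X m N).card ≤ (LX m N (qq M) X).card := by
  classical
  refine Finset.card_le_card fun D hD => ?_
  rw [mem_NF_iff hM] at hD
  exact Finset.mem_filter.2 ⟨hD.1, hD.2.1⟩

lemma NF_ge {m N M : ℕ} (hM : 2 ≤ M) {X : ℝ} (hX : 0 < X) :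
    ((LX m N (qq M) X).card : ℝ) ≤ (NF X m N).card + (X / M + √X) := by
  classical
  have h := bad_card (M := M) (s := 1) (by omega) one_pos 0 hX (LX m N (qq M) X \ NF X m N) ?_
  · have h2 := Finset.card_le_card (show LX m N (qq M) X ⊆ NF X m N ∪ (LX m N (qq M) X \ NF X m N) by
      intro D hD; by_cases h : D ∈ NF X m N <;> simp [h, hD])
    have h3 := h2.trans (Finset.card_union_le _ _)
    have h3 : ((LX m N (qq M) X).card : ℝ) ≤ (NF X m N).card + ((LX m N (qq M) X \ NF X m N).card : ℝ) := by exact_mod_cast h3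
    have e : X / (1 : ℕ) * (1 / M) = X / M := by push_cast; ring
    rw [e] at h
    linarith
  · intro D hD
    obtain ⟨h1, h2⟩ := Finset.mem_sdiff.1 hD
    obtain ⟨h3, h4⟩ := Finset.mem_filter.1 h1
    refine ⟨h3, by simp [Int.modEq_one], ?_⟩
    rw [mem_NF_iff hM] at h2
    push Not at h2
    obtain ⟨p, hp, hMp, hd⟩ := h2 h3 h4
    exact ⟨p, hp, hMp, Nat.coprime_one_right p, hd⟩

lemma exists_Lc {m N M : ℕ} (hM : 2 ≤ M) (hN : 0 < N) (hss : CondStarStar m N) : ∃ r : ℤ, Lc m N (qq M) r := by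
  set Q := ∏ p ∈ (Finset.range (M + 1)).filter (fun p => p.Prime ∧ ¬ p ∣ N), p ^ 2 with hQ
  have hc : Nat.Coprime N Q := by
    refine Nat.Coprime.prod_right fun p hp => ?_
    obtain ⟨-, hp1, hp2⟩ := Finset.mem_filter.1 hp
    exact Nat.Coprime.pow_right 2 ((hp1.coprime_iff_not_dvd).2 hp2).symm
  obtain ⟨k, k1, k2⟩ := Nat.chineseRemainder hc m 1
  have k1 : (k : ℤ) ≡ m [ZMOD N] := Int.natCast_modEq_iff.2 k1
  have k2 : (k : ℤ) ≡ 1 [ZMOD Q] := by exact_mod_cast Int.natCast_modEq_iff.2 k2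
  refine ⟨k, ?_, k1⟩
  have hdQ : ∀ p : ℕ, p.Prime → p ≤ M → ¬ p ∣ N → (p : ℤ) ^ 2 ∣ (Q : ℤ) := by
    intro p hp hpM hpN
    have : p ^ 2 ∣ Q := Finset.dvd_prod_of_mem _ (Finset.mem_filter.2 ⟨Finset.mem_range.2 (by omega), hp, hpN⟩)
    exact_mod_cast this
  intro p hp hpq
  have hpM := (prime_dvd_qq hM hp).1 hpq
  constructor
  · intro hp2
    refine ⟨sq_dvd_qq hp.pos hpM, fun hd => ?_⟩
    have hpk : (p : ℤ) ∣ k := (dvd_pow_self _ two_ne_zero).trans hd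
    by_cases hpN : p ∣ N
    · have hpN' : (p : ℤ) ∣ N := by exact_mod_cast hpN
      have hpm : (p : ℤ) ∣ m := (Int.ModEq.dvd_iff (k1.of_dvd hpN')).1 hpk
      obtain ⟨s1, s2⟩ := hss.1 p hp (hp.odd_of_ne_two hp2) (by exact_mod_cast hpm) hpN
      have s1 : (p : ℤ) ^ 2 ∣ N := by exact_mod_cast s1
      have : (p : ℤ) ^ 2 ∣ m := (Int.ModEq.dvd_iff (k1.of_dvd s1)).1 hd
      exact s2 (by exact_mod_cast this)
    · have h1 := (Int.ModEq.dvd_iff (k2.of_dvd (hdQ p hp hpM hpN))).1 hd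
      have h2 : (p : ℤ) ∣ 1 := (dvd_pow_self _ two_ne_zero).trans h1
      have h3 : p ∣ 1 := by exact_mod_cast h2
      exact hp.one_lt.ne' (Nat.dvd_one.1 h3)
  · rintro rfl
    refine ⟨t32_dvd_qq M, ?_⟩
    by_cases hpN : 2 ∣ N
    · rcases hss.2 hpN with ⟨h1, h2⟩ | ⟨h1, h2⟩
      · have h1 : (4 : ℤ) ∣ N := by exact_mod_cast h1
        have := k1.of_dvd h1
        unfold Int.ModEq at this
        omega
      · have h1 : (16 : ℤ) ∣ N := by exact_mod_cast h1
        have := k1.of_dvd h1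
        unfold Int.ModEq at this
        omega
    · have := k2.of_dvd (hdQ 2 hp hpM hpN)
      unfold Int.ModEq at this
      norm_num at this
      omega

lemma NF_lower {m N : ℕ} (hN : 0 < N) (hss : CondStarStar m N) : ∃ c : ℝ, 0 < c ∧ ∀ᶠ X : ℝ in atTop, c * X ≤ (NF X m N).card := by
  classical
  set M := N + 2 with hM
  have hM2 : 2 ≤ M := by omega
  obtain ⟨r, hr⟩ := exists_Lc hM2 hN hss
  have hq : 0 < qq M := qq_pos M
  have hq' : (0 : ℝ) < qq M := by exact_mod_cast hq
  have hNq : N ∣ qq M := dvd_qq hN (by omega)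
  refine ⟨1 / (4 * qq M), by positivity, ?_⟩
  have hlim : ∀ᶠ X : ℝ in atTop, 1 ≤ X ∧ (4 * qq M) * (4 : ℝ) ≤ √X := by
    refine (eventually_ge_atTop 1).and ?_
    exact (Real.tendsto_sqrt_atTop).eventually (eventually_ge_atTop _)
  filter_upwards [hlim] with X ⟨hX1, hX⟩
  have hX0 : 0 < X := by linarith
  set A := (dI X).filter fun D => D ≡ r [ZMOD (qq M : ℤ)] with hA
  have h1 := (abs_le.1 (ap_asym hX0 hq r)).1
  have h := bad_card (M := M) (s := qq M) (by omega) hq r hX0 (A \ NF X m N) ?_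
  · have h2 := Finset.card_le_card (show A ⊆ NF X m N ∪ (A \ NF X m N) by
      intro D hD; by_cases h : D ∈ NF X m N <;> simp [h, hD])
    have h3 := h2.trans (Finset.card_union_le _ _)
    have h3 : (A.card : ℝ) ≤ (NF X m N).card + ((A \ NF X m N).card : ℝ) := by exact_mod_cast h3
    have h4 : X / qq M * (1 / M) ≤ X / qq M * (1 / 2) := by
      gcongr
      exact_mod_cast hM2
    have hs : √X * √X = X := Real.mul_self_sqrt hX0.le
    have h5 : 4 * √X ≤ X / (4 * qq M) := by
      rw [le_div_iff₀ (by positivity)]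
      nlinarith [Real.sqrt_nonneg X]
    have h6 : 1 ≤ √X := Real.one_le_sqrt.2 hX1
    have e1 : X / qq M = 4 * (X / (4 * qq M)) := by field_simp
    have e2 : 1 / (4 * (qq M : ℝ)) * X = X / (4 * qq M) := by ring
    rw [← hA] at h1
    rw [e2]
    rw [e1] at h h1 h4
    linarith
  · intro D hD
    obtain ⟨h1, h2⟩ := Finset.mem_sdiff.1 hD
    obtain ⟨h3, h4⟩ := Finset.mem_filter.1 h1
    refine ⟨h3, h4, ?_⟩
    rw [mem_NF_iff hM2] at h2
    push Not at h2
    obtain ⟨p, hp, hMp, hd⟩ := h2 h3 (Lc_congr hNq h4.symm hr)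
    refine ⟨p, hp, hMp, (hp.coprime_iff_not_dvd).2 fun hd => ?_, hd⟩
    have := (prime_dvd_qq hM2 hp).1 hd
    omega
end NH

namespace NH

/-- residues of forms with allowed discriminant -/
noncomputable def SF (m N q : ℕ) [NeZero q] : Finset (ZMod q × ZMod q × ZMod q × ZMod q) :=
  Finset.univ.filter fun F => (dsc F.1 F.2.1 F.2.2.1 F.2.2.2).val ∈ TM m N q

lemma mem_SF {m N q : ℕ} [NeZero q] (hNq : N ∣ q) (F : Z4) : rdq q F ∈ SF m N q ↔ Lc m N q (-qD F) := by
  have hq : 0 < q := Nat.pos_of_ne_zero (NeZero.ne q)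
  rw [← toNat_emod_mem hq hNq, SF, Finset.mem_filter]
  have h1 : dsc (rdq q F).1 (rdq q F).2.1 (rdq q F).2.2.1 (rdq q F).2.2.2 = (((-qD F : ℤ)) : ZMod q) := by
    rw [← dsc_eq]
    exact (dsc_map (Int.castRingHom (ZMod q)) _ _ _ _).symm
  rw [h1]
  have h2 := ZMod.val_intCast (n := q) (-qD F)
  have h3 : ((-qD F : ℤ) : ZMod q).val = ((-qD F) % q).toNat := by
    rw [← h2, Int.toNat_natCast]
  rw [h3]
  simp

lemma SF_card {m N q : ℕ} [NeZero q] : ((SF m N q).card : ℝ) = (TM m N q).card * ((q : ℝ) ^ 3 * ∏ p ∈ q.primeFactors, wt p) := by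
  classical
  have hq : 0 < q := Nat.pos_of_ne_zero (NeZero.ne q)
  have h := Finset.card_eq_sum_card_fiberwise (f := fun F : ZMod q × ZMod q × ZMod q × ZMod q => (dsc F.1 F.2.1 F.2.2.1 F.2.2.2).val)
    (s := SF m N q) (t := TM m N q) (by intro D hD; exact (Finset.mem_filter.1 hD).2)
  rw [h]
  push_cast
  rw [← nsmul_eq_mul, ← Finset.sum_const]
  refine Finset.sum_congr rfl fun r hr => ?_
  obtain ⟨hr1, hr2⟩ := Finset.mem_filter.1 hr
  rw [Finset.mem_range] at hr1
  rw [← cnt_eq hq hr2.1, cnt, Nat.card_eq_fintype_card, Fintype.card_subtype]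
  congr 2
  ext F
  rw [Finset.mem_filter, Finset.mem_filter, SF, Finset.mem_filter]
  have e : (dsc F.1 F.2.1 F.2.2.1 F.2.2.2).val = r ↔ dsc F.1 F.2.1 F.2.2.1 F.2.2.2 = (((r : ℕ) : ℤ) : ZMod q) := by
    constructor
    · rintro rfl; simp
    · intro h; rw [h]; simp [ZMod.val_natCast, Nat.mod_eq_of_lt hr1]
  rw [← e]
  constructor
  · rintro ⟨⟨h1, -⟩, h2⟩; exact ⟨h1, h2⟩
  · rintro ⟨h1, h2⟩; exact ⟨⟨h1, by rw [h2]; exact hr⟩, h2⟩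

lemma fiber_sum {S : Set Z4} (hS : S.Finite) (I : Finset ℤ) (hI : ∀ F ∈ S, -qD F ∈ I) :
    S.ncard = ∑ Δ ∈ I, {F | F ∈ S ∧ qD F = -Δ}.ncard := by
  classical
  rw [Set.ncard_eq_toFinset_card _ hS, Finset.card_eq_sum_card_fiberwise (f := fun F => -qD F) (t := I) (by
    intro F hF; exact hI F (hS.mem_toFinset.1 hF))]
  refine Finset.sum_congr rfl fun Δ _ => ?_
  rw [← Set.ncard_coe_finset]
  congr 1
  ext F
  simp only [Finset.coe_filter, Set.Finite.mem_toFinset, Set.mem_ofPred_eq, neg_eq_iff_eq_neg]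

lemma NF_lt {T : ℝ} {m N : ℕ} {F : Z4} (h : -qD F ∈ NF (T ^ 4) m N) : ((qD F : ℤ) : ℝ) < T ^ 4 := by
  have := (mem_NF.1 h).1
  push_cast at this
  linarith

lemma sum_upper {m N M : ℕ} [NeZero (qq M)] (hM : 2 ≤ M) (hNq : N ∣ qq M) {ε T : ℝ} (hε : 0 < ε) (hT : 1 ≤ T) (hε1 : ε ≤ 1) :
    (∑ Δ ∈ NF (T ^ 4) m N, (h3 Δ : ℝ)) ≤ (NF (T ^ 4) m N).card + 400 * √ε * T ^ 4 +
      {F : Z4 | rdq (qq M) F ∈ SF m N (qq M) ∧ scl T F ∈ RgC ε}.ncard := by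
  classical
  have hT0 : 0 < T := by linarith
  set R := {F : Z4 | (Red F ∧ 0 < F.1) ∧ -qD F ∈ NF (T ^ 4) m N} with hR
  have hRf : R.Finite := (redT_finite T).subset fun F h => ⟨h.1.1, NF_lt h.2⟩
  have h1 := fiber_sum hRf (NF (T ^ 4) m N) fun F h => h.2
  have h2 : (∑ Δ ∈ NF (T ^ 4) m N, h3 Δ) ≤ R.ncard + (NF (T ^ 4) m N).card := by
    rw [h1, Finset.card_eq_sum_ones, ← Finset.sum_add_distrib]
    refine Finset.sum_le_sum fun Δ hΔ => ?_
    have hN := mem_NF.1 hΔ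
    have h3 := h3_le hN.2.1 hN.2.2.1
    refine h3.trans (Nat.add_le_add_right (le_of_eq ?_) 1)
    congr 1
    ext F
    simp only [Set.mem_ofPred_eq, hR]
    constructor
    · rintro ⟨a, b, c⟩; exact ⟨⟨⟨a, b⟩, by rw [c, neg_neg]; exact hΔ⟩, c⟩
    · rintro ⟨⟨⟨a, b⟩, -⟩, c⟩; exact ⟨a, b, c⟩
  have h2 : (∑ Δ ∈ NF (T ^ 4) m N, (h3 Δ : ℝ)) ≤ R.ncard + (NF (T ^ 4) m N).card := by exact_mod_cast h2
  have h4 := cusp_count hT hε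
  set Cu := {F : Z4 | Red F ∧ 0 < F.1 ∧ (F.1 : ℝ) ≤ ε * T ∧ ((qD F : ℤ) : ℝ) < T ^ 4} with hCu
  have hCuf : Cu.Finite := (redT_finite T).subset fun F h => ⟨h.1, h.2.2.2⟩
  set G := {F : Z4 | rdq (qq M) F ∈ SF m N (qq M) ∧ scl T F ∈ RgC ε} with hG
  have hGf : G.Finite := (redT_finite T).subset fun F h => by
    have := (mem_RgC_iff hT0 F).1 h.2
    exact ⟨this.2.1, this.2.2⟩
  have h5 := ncard_mono_real (S := R) (T := Cu ∪ G) (by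
    rintro F ⟨⟨k1, k2⟩, k3⟩
    have k4 := NF_lt k3
    rcases le_or_gt (F.1 : ℝ) (ε * T) with h | h
    · exact Or.inl ⟨k1, k2, h, k4⟩
    · refine Or.inr ⟨(mem_SF hNq F).2 ((mem_NF_iff hM).1 k3).2.1, (mem_RgC_iff hT0 F).2 ⟨?_, k1, k4⟩⟩
      exact h) (hCuf.union hGf)
  have h6 := Set.ncard_union_le Cu G
  have h6 : ((Cu ∪ G).ncard : ℝ) ≤ Cu.ncard + G.ncard := by exact_mod_cast h6
  linarith

lemma sum_lower {ε : ℝ} (hε : 0 < ε) (hε1 : ε ≤ 1) : ∃ C : ℝ, 0 < C ∧ ∀ (m N M : ℕ) [NeZero (qq M)], 3 ≤ M → N ∣ qq M → ∀ T : ℝ, 1 ≤ T →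
    ({F : Z4 | rdq (qq M) F ∈ SF m N (qq M) ∧ scl T F ∈ RgO ε}.ncard : ℝ) + (NF (T ^ 4) m N).card ≤
      (∑ Δ ∈ NF (T ^ 4) m N, (h3 Δ : ℝ)) + C * (T ^ 4 / M + T ^ 3) := by
  classical
  obtain ⟨C, hC, htail⟩ := tail_count hε hε1
  set g : ℤ → ℕ := fun Δ => {F | SRed F ∧ 0 < F.1 ∧ qD F = -Δ}.ncard + 1 with hg
  set K : ℕ := ∑ Δ ∈ Finset.Ico (-4) 0, g Δ with hK
  refine ⟨C + K, by positivity, ?_⟩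
  intro m N M _ hM hNq T hT
  have hT0 : 0 < T := by linarith
  set R := {F : Z4 | (SRed F ∧ 0 < F.1) ∧ -qD F ∈ NF (T ^ 4) m N} with hR
  have hRf : R.Finite := (redT_finite T).subset fun F h => ⟨h.1.1.red, NF_lt h.2⟩
  have h1 := fiber_sum hRf (NF (T ^ 4) m N) fun F h => h.2
  have h2 : R.ncard + (NF (T ^ 4) m N).card ≤ (∑ Δ ∈ NF (T ^ 4) m N, h3 Δ) + K := by
    rw [h1, Finset.card_eq_sum_ones, ← Finset.sum_add_distrib]
    have e : ∀ Δ ∈ NF (T ^ 4) m N, {F | F ∈ R ∧ qD F = -Δ}.ncard + 1 ≤ h3 Δ + if Δ ∈ Finset.Ico (-4 : ℤ) 0 then g Δ else 0 := by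
      intro Δ hΔ
      have hN := mem_NF.1 hΔ
      have e1 : {F | F ∈ R ∧ qD F = -Δ} = {F | SRed F ∧ 0 < F.1 ∧ qD F = -Δ} := by
        ext F
        simp only [Set.mem_ofPred_eq, hR]
        constructor
        · rintro ⟨⟨⟨a, b⟩, -⟩, c⟩; exact ⟨a, b, c⟩
        · rintro ⟨a, b, c⟩; exact ⟨⟨⟨a, b⟩, by rw [c, neg_neg]; exact hΔ⟩, c⟩
      rw [e1]
      split_ifs with hi
      · exact Nat.le_add_left _ _
      · rw [Finset.mem_Ico] at hi
        exact h3_ge (by have := hN.2.1; omega) hN.2.2.1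
    refine (Finset.sum_le_sum e).trans ?_
    rw [Finset.sum_add_distrib, ← Finset.sum_filter]
    refine Nat.add_le_add_left (Finset.sum_le_sum_of_subset ?_) _
    intro Δ h; exact (Finset.mem_filter.1 h).2
  have h2 : (R.ncard : ℝ) + (NF (T ^ 4) m N).card ≤ (∑ Δ ∈ NF (T ^ 4) m N, (h3 Δ : ℝ)) + K := by exact_mod_cast h2
  have h4 := htail M hM T hT
  set Ta := {F : Z4 | scl T F ∈ RgO ε ∧ ∃ p : ℕ, p.Prime ∧ M < p ∧ (p : ℤ) ^ 2 ∣ qD F} with hTa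
  have hTaf : Ta.Finite := (redT_finite T).subset fun F h => by
    have := (mem_RgO_iff hT0 F).1 h.1
    exact ⟨this.2.1.red, this.2.2⟩
  have h5 := ncard_mono_real (S := {F : Z4 | rdq (qq M) F ∈ SF m N (qq M) ∧ scl T F ∈ RgO ε}) (T := Ta ∪ R) (by
    rintro F ⟨k1, k2⟩
    obtain ⟨k3, k4, k5⟩ := (mem_RgO_iff hT0 F).1 k2
    by_cases h : ∃ p : ℕ, p.Prime ∧ M < p ∧ (p : ℤ) ^ 2 ∣ qD F
    · exact Or.inl ⟨k2, h⟩
    · have k6 : (0 : ℝ) < F.1 := lt_trans (by positivity) k3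
      refine Or.inr ⟨⟨k4, by exact_mod_cast k6⟩, (mem_NF_iff (by omega)).2 ⟨mem_dI.2 ⟨?_, ?_⟩, (mem_SF hNq F).1 k1, ?_⟩⟩
      · push_cast; linarith
      · have := k4.red.2.2; omega
      · intro p hp hMp hd
        exact h ⟨p, hp, hMp, (dvd_neg).1 hd⟩) (hTaf.union hRf)
  have h6 := Set.ncard_union_le Ta R
  have h6 : ((Ta ∪ R).ncard : ℝ) ≤ Ta.ncard + R.ncard := by exact_mod_cast h6
  have h7 : (K : ℝ) ≤ K * (T ^ 4 / M + T ^ 3) := by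
    have : 1 ≤ T ^ 3 := one_le_pow₀ hT
    have : 0 ≤ T ^ 4 / M := by positivity
    nlinarith [Nat.cast_nonneg (α := ℝ) K]
  linarith
end NH

namespace NH

lemma qq_primeFactors {M : ℕ} (hM : 2 ≤ M) : (qq M).primeFactors = (M + 1).primesBelow := by
  ext p
  rw [Nat.mem_primeFactors, Nat.mem_primesBelow]
  constructor
  · rintro ⟨h1, h2, -⟩
    exact ⟨by have := (prime_dvd_qq hM h1).1 h2; omega, h1⟩
  · rintro ⟨h1, h2⟩
    exact ⟨h2, (prime_dvd_qq hM h2).2 (by omega), (qq_pos M).ne'⟩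

lemma prod_wt {M : ℕ} (hM : 2 ≤ M) : ∏ p ∈ (qq M).primeFactors, wt p = 2 * ∏ p ∈ (M + 1).primesBelow, (1 - 1 / (p : ℝ) ^ 2) := by
  rw [qq_primeFactors hM]
  have h2 : 2 ∈ (M + 1).primesBelow := Nat.mem_primesBelow.2 ⟨by omega, Nat.prime_two⟩
  rw [← Finset.mul_prod_erase _ _ h2, ← Finset.mul_prod_erase _ (fun p : ℕ => (1 - 1 / (p : ℝ) ^ 2)) h2, ← mul_assoc]
  congr 1
  · rw [wt, if_pos rfl]; norm_num
  · refine Finset.prod_congr rfl fun p hp => ?_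
    rw [wt, if_neg (Finset.ne_of_mem_erase hp)]

lemma euler_lim : Tendsto (fun n : ℕ => ∏ p ∈ n.primesBelow, (1 - 1 / (p : ℝ) ^ 2)) atTop (nhds (6 / Real.pi ^ 2)) := by
  have h := riemannZeta_eulerProduct (s := 2) (by norm_num)
  rw [riemannZeta_two] at h
  have e : ((Real.pi : ℂ) ^ 2 / 6) = ((Real.pi ^ 2 / 6 : ℝ) : ℂ) := by push_cast; rfl
  have e2 : (fun n : ℕ => ∏ p ∈ n.primesBelow, (1 - (p : ℂ) ^ (-2 : ℂ))⁻¹) =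
      fun n : ℕ => ((∏ p ∈ n.primesBelow, (1 - 1 / (p : ℝ) ^ 2)⁻¹ : ℝ) : ℂ) := by
    funext n
    push_cast
    refine Finset.prod_congr rfl fun p _ => ?_
    rw [Complex.cpow_neg, one_div]
    norm_num
  rw [e, e2, tendsto_ofReal_iff] at h
  have h2 := h.inv₀ (by positivity)
  have e3 : (Real.pi ^ 2 / 6)⁻¹ = 6 / Real.pi ^ 2 := by rw [inv_div]
  rw [e3] at h2
  refine h2.congr fun n => ?_
  rw [Finset.prod_inv_distrib, inv_inv]

lemma W_lim : Tendsto (fun M : ℕ => ∏ p ∈ (qq M).primeFactors, wt p) atTop (nhds (12 / Real.pi ^ 2)) := by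
  have h := ((tendsto_add_atTop_iff_nat 1).2 euler_lim).const_mul 2
  have e : 2 * (6 / Real.pi ^ 2) = 12 / Real.pi ^ 2 := by ring
  rw [e] at h
  refine h.congr' ?_
  filter_upwards [eventually_ge_atTop 2] with M hM
  rw [prod_wt hM]

lemma scale_lim {f : ℝ → ℝ} {q : ℕ} (hq : 0 < q) {L : ℝ} (h : Tendsto (fun T => f T * ((q : ℝ) / T) ^ 4) atTop (nhds L)) {δ : ℝ} (hδ : 0 < δ) :
    ∀ᶠ T : ℝ in atTop, |f T - L / (q : ℝ) ^ 4 * T ^ 4| ≤ δ * T ^ 4 := by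
  have hq' : (0 : ℝ) < q := by exact_mod_cast hq
  have h1 := (Metric.tendsto_nhds.1 h) (δ * (q : ℝ) ^ 4) (by positivity)
  filter_upwards [h1, eventually_gt_atTop 0] with T hT hT0
  rw [Real.dist_eq] at hT
  have e : f T - L / (q : ℝ) ^ 4 * T ^ 4 = (f T * ((q : ℝ) / T) ^ 4 - L) * (T ^ 4 / (q : ℝ) ^ 4) := by
    field_simp
  rw [e, abs_mul, abs_of_pos (show 0 < T ^ 4 / (q : ℝ) ^ 4 by positivity)]
  calc _ ≤ δ * (q : ℝ) ^ 4 * (T ^ 4 / (q : ℝ) ^ 4) := by gcongr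
    _ = _ := by field_simp

theorem main_est {m N : ℕ} (hN : 0 < N) {η : ℝ} (hη : 0 < η) :
    ∀ᶠ T : ℝ in atTop, |(∑ Δ ∈ NF (T ^ 4) m N, (h3 Δ : ℝ)) - 2 * (NF (T ^ 4) m N).card| ≤ η * T ^ 4 := by
  classical
  set δ := min 1 (η / 9) with hδ
  have hδ0 : 0 < δ := lt_min one_pos (by positivity)
  have hδ1 : δ ≤ 1 := min_le_left _ _
  have hδη : 9 * δ ≤ η := by have : δ ≤ η / 9 := min_le_right _ _; linarith
  have hpi : (9 : ℝ) < Real.pi ^ 2 := by nlinarith [Real.pi_gt_three]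
  have hpi2 : Real.pi ^ 2 < 12 := by nlinarith [Real.pi_gt_three, Real.pi_lt_d2]
  -- choice of `ε`
  obtain ⟨ε0, hε0, hvv⟩ := vv_lim hδ0
  set ε := min (min 1 ε0) ((δ / 400) ^ 2) with hε
  have hεp : 0 < ε := lt_min (lt_min one_pos hε0) (by positivity)
  have hε1 : ε ≤ 1 := (min_le_left _ _).trans (min_le_left _ _)
  have hv := hvv ε hεp ((min_le_left _ _).trans (min_le_right _ _))
  have hsq : 400 * √ε ≤ δ := by
    have : √ε ≤ δ / 400 := Real.sqrt_le_iff.2 ⟨by positivity, min_le_right _ _⟩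
    linarith
  obtain ⟨C, hC, hlow⟩ := sum_lower hεp hε1
  -- choice of `M`
  have hMev : ∀ᶠ M : ℕ in atTop, |(∏ p ∈ (qq M).primeFactors, wt p) - 12 / Real.pi ^ 2| < δ ∧ (1 / (M : ℝ) < δ ∧ C / (M : ℝ) < δ) ∧ 3 ≤ M ∧ N ≤ M := by
    refine ((Metric.tendsto_nhds.1 W_lim) δ hδ0).and ((Eventually.and ?_ ?_).and ((eventually_ge_atTop 3).and (eventually_ge_atTop N)))
    · exact (tendsto_const_div_atTop_nhds_zero_nat (1 : ℝ)).eventually (gt_mem_nhds hδ0)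
    · exact (tendsto_const_div_atTop_nhds_zero_nat C).eventually (gt_mem_nhds hδ0)
  obtain ⟨M, hW, ⟨hM1, hMC⟩, hM3, hMN⟩ := hMev.exists
  set W := ∏ p ∈ (qq M).primeFactors, wt p with hWdef
  have hq := qq_pos M
  have hq' : (0 : ℝ) < qq M := by exact_mod_cast hq
  haveI : NeZero (qq M) := ⟨hq.ne'⟩
  have hNq : N ∣ qq M := dvd_qq hN hMN
  set s : ℝ := (TM m N (qq M)).card / qq M with hs
  have hs0 : 0 ≤ s := by positivity
  have hs1 : s ≤ 1 := by
    have : (TM m N (qq M)).card ≤ qq M := (Finset.card_filter_le _ _).trans (by rw [Finset.card_range])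
    rw [hs, div_le_one hq']
    exact_mod_cast this
  have hWv : |W * vv ε - 1| ≤ 4 * δ := by
    have e : W * vv ε - 1 = W * (vv ε - Real.pi ^ 2 / 12) + Real.pi ^ 2 / 12 * (W - 12 / Real.pi ^ 2) := by
      field_simp; ring
    have h12 : 12 / Real.pi ^ 2 ≤ 2 := by rw [div_le_iff₀ (by positivity)]; linarith
    have h12p : 0 < 12 / Real.pi ^ 2 := by positivity
    have hWa : |W| ≤ 3 := by
      obtain ⟨w1, w2⟩ := abs_lt.1 hW
      rw [abs_le]; constructor <;> linarith
    rw [e]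
    refine (abs_add_le _ _).trans ?_
    rw [abs_mul, abs_mul, abs_of_pos (show 0 < Real.pi ^ 2 / 12 by positivity)]
    have a1 : |W| * |vv ε - Real.pi ^ 2 / 12| ≤ 3 * δ := by gcongr
    have a2 : Real.pi ^ 2 / 12 * |W - 12 / Real.pi ^ 2| ≤ 1 * δ := by
      gcongr
      linarith
    linarith
  have hLval : ((SF m N (qq M)).card : ℝ) * vv ε / (qq M : ℝ) ^ 4 = s * (W * vv ε) := by
    rw [SF_card, hs, ← hWdef]
    field_simp
  have hO := scale_lim hq (count_RgO hεp hε1 hq (SF m N (qq M))) hδ0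
  have hCl := scale_lim hq (count_RgC hεp hε1 hq (SF m N (qq M))) hδ0
  have e1 : ∀ᶠ T : ℝ in atTop, 1 ≤ T := eventually_ge_atTop 1
  have e2 : ∀ᶠ T : ℝ in atTop, (3 * qq M + 1 + C) / δ ≤ T := eventually_ge_atTop _
  filter_upwards [hO, hCl, e1, e2] with T hO hCl hT1 hT2
  rw [hLval] at hO hCl
  rw [div_le_iff₀ hδ0] at hT2
  have hT0 : 0 < T := by linarith
  have hX0 : 0 < T ^ 4 := by positivity
  have hT3 : (3 * qq M + 1 + C) * T ^ 3 ≤ δ * T ^ 4 := by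
    have : (3 * qq M + 1 + C) * T ^ 3 ≤ T * δ * T ^ 3 := by gcongr
    linarith
  have p1 : 1 ≤ T ^ 3 := one_le_pow₀ hT1
  have p2 : T ^ 2 ≤ T ^ 3 := pow_le_pow_right₀ hT1 (by norm_num)
  have hup := sum_upper (m := m) (by omega) hNq hεp hT1 hε1
  have hlo := hlow m N M hM3 hNq T hT1
  have hL := abs_le.1 (LX_card (m := m) hq hNq hX0)
  rw [← hs] at hL
  have hN1 : ((NF (T ^ 4) m N).card : ℝ) ≤ (LX m N (qq M) (T ^ 4)).card := by exact_mod_cast NF_le (by omega) _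
  have hN2 := NF_ge (m := m) (N := N) (M := M) (by omega) hX0
  have hsqrt : √(T ^ 4) = T ^ 2 := by
    rw [show T ^ 4 = (T ^ 2) ^ 2 by ring]; exact Real.sqrt_sq (by positivity)
  rw [hsqrt] at hN2
  obtain ⟨o1, -⟩ := abs_le.1 hO
  obtain ⟨-, c2⟩ := abs_le.1 hCl
  have hsW : |s * (W * vv ε) * T ^ 4 - s * T ^ 4| ≤ 4 * δ * T ^ 4 := by
    have e : s * (W * vv ε) * T ^ 4 - s * T ^ 4 = s * (W * vv ε - 1) * T ^ 4 := by ring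
    rw [e, abs_mul, abs_mul, abs_of_nonneg hs0, abs_of_pos hX0]
    have : s * |W * vv ε - 1| ≤ 1 * (4 * δ) := by gcongr
    exact mul_le_mul_of_nonneg_right (by linarith) hX0.le
  obtain ⟨w1, w2⟩ := abs_le.1 hsW
  have r1 : 400 * √ε * T ^ 4 ≤ δ * T ^ 4 := by gcongr
  have r2 : T ^ 4 / M ≤ δ * T ^ 4 := by
    have : T ^ 4 / M = 1 / M * T ^ 4 := by ring
    rw [this]; gcongr
  have r3 : C * (T ^ 4 / M) ≤ δ * T ^ 4 := by
    have : C * (T ^ 4 / M) = C / M * T ^ 4 := by ring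
    rw [this]; gcongr
  have r4 : C * (T ^ 4 / M + T ^ 3) = C * (T ^ 4 / M) + C * T ^ 3 := by ring
  rw [r4] at hlo
  have r5 : 3 * (qq M : ℝ) ≤ 3 * qq M * T ^ 3 := by nlinarith
  have r6 : 0 ≤ C * T ^ 3 := by positivity
  have r7 : (3 * (qq M : ℝ) + 1 + C) * T ^ 3 = 3 * qq M * T ^ 3 + T ^ 3 + C * T ^ 3 := by ring
  rw [r7] at hT3
  have r8 : 9 * δ * T ^ 4 ≤ η * T ^ 4 := by gcongr
  rw [abs_le]
  constructor <;> linarith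

theorem final {m N : ℕ} (hN : 0 < N) (hss : CondStarStar m N) :
    Tendsto (fun X : ℝ =>
      (∑ᶠ Δ ∈ Nminus X m N, (h3 Δ : ℝ)) / (Nat.card (Nminus X m N) : ℝ))
      atTop (nhds 2) := by
  obtain ⟨c, hc, hlow⟩ := NF_lower hN hss
  rw [Metric.tendsto_nhds]
  intro η hη
  have h1 := main_est (m := m) hN (η := c * η / 2) (by positivity)
  have ht : Tendsto (fun X : ℝ => X ^ (1 / 4 : ℝ)) atTop atTop := tendsto_rpow_atTop (by norm_num)
  filter_upwards [ht.eventually h1, hlow, eventually_gt_atTop 0] with X hX hX2 hX0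
  have e : (X ^ (1 / 4 : ℝ)) ^ 4 = X := by
    rw [← Real.rpow_natCast, ← Real.rpow_mul hX0.le]; norm_num
  rw [e] at hX
  have e1 : (∑ᶠ Δ ∈ Nminus X m N, (h3 Δ : ℝ)) = ∑ Δ ∈ NF X m N, (h3 Δ : ℝ) :=
    finsum_mem_eq_finite_toFinset_sum _ (Nminus_finite X m N)
  have e2 : Nat.card (Nminus X m N) = (NF X m N).card :=
    Set.ncard_eq_toFinset_card _ (Nminus_finite X m N)
  rw [e1, e2, Real.dist_eq]
  have hpos : (0 : ℝ) < (NF X m N).card := lt_of_lt_of_le (by positivity) hX2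
  have e3 : (∑ Δ ∈ NF X m N, (h3 Δ : ℝ)) / (NF X m N).card - 2 =
      ((∑ Δ ∈ NF X m N, (h3 Δ : ℝ)) - 2 * (NF X m N).card) / (NF X m N).card := by
    field_simp
  rw [e3, abs_div, abs_of_pos hpos, div_lt_iff₀ hpos]
  have : 0 < c * X := by positivity
  nlinarith
end NH

/-- Theorem 1.3 (Nakagawa–Horie), negative discriminants: if `m, N` are positive integers
satisfying Condition (**), then the average of `h₃(Δ)` over fundamental discriminants
`Δ ∈ N⁻(X, m, N)` tends to `2` as `X → ∞`. -/
theorem nakagawa_horie_neg (m N : ℕ) (hm : 0 < m) (hN : 0 < N) (hss : CondStarStar m N) :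
    Tendsto (fun X : ℝ =>
      (∑ᶠ Δ ∈ Nminus X m N, (h3 Δ : ℝ)) / (Nat.card (Nminus X m N) : ℝ))
      atTop (nhds 2) := by
  exact NH.final hN hss
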